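/- Fix ∂ ⊂ {0,1}. Let R*_∂ be the set of pairs (f,g) of commuting elements of Diff*_∂[0,1], and let R^c_∂ ⊂ R*_∂ be the set of pairs (f,g) such that either f and g are both flow maps φ^s, φ^t of a single C^∞ vector field on [0,1] with complete flow, or f and g are both iterates h^q, h^p of a single element h of Diff*_∂[0,1]. Then R^c_∂ is path-connected and dense in R*_∂ for the C^∞ topology. -/

import Mathlib

set_option autoImplicit false

open Set

/-- `f : ℝ → ℝ` represents (a smooth extension of) an orientation-preserving `C^∞`
diffeomorphism of the interval `[0,1]`. -/
def SmoothDiffeoI (f : ℝ → ℝ) : Prop :=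
  ContDiff ℝ (⊤ : ℕ∞) f ∧ f 0 = 0 ∧ f 1 = 1 ∧ (∀ x ∈ Icc (0 : ℝ) 1, 0 < deriv f x) ∧
    MapsTo f (Icc (0 : ℝ) 1) (Icc (0 : ℝ) 1)

/-- `f` is infinitely tangent to the identity at `p`. -/
def ITIat (f : ℝ → ℝ) (p : ℝ) : Prop :=
  f p = p ∧ ∀ n : ℕ, 1 ≤ n → iteratedDeriv n (fun x => f x - x) p = 0

/-- `Diff*_∂[0,1]`: the identity, together with the orientation-preserving `C^∞`
diffeomorphisms of `[0,1]` which are infinitely tangent to the identity exactly at the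
points of `D` and nowhere else in `[0,1]`. -/
def DiffStar (D : Set ℝ) (f : ℝ → ℝ) : Prop :=
  SmoothDiffeoI f ∧
    ((∀ x ∈ Icc (0 : ℝ) 1, f x = x) ∨ ∀ p ∈ Icc (0 : ℝ) 1, (ITIat f p ↔ p ∈ D))

/-- `finv` is a two-sided inverse of `f` on the set `s`. -/
def IsInverseOn (finv f : ℝ → ℝ) (s : Set ℝ) : Prop :=
  (∀ x ∈ s, finv (f x) = x) ∧ ∀ x ∈ s, f (finv x) = x

/-- The `n`-th power (`n ∈ ℤ`) of the bijection `h` with inverse `hinv`. -/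
def zpowIter (h hinv : ℝ → ℝ) (n : ℤ) : ℝ → ℝ :=
  if 0 ≤ n then h^[n.toNat] else hinv^[(-n).toNat]

/-- `φ` is the (complete) flow of the vector field `ξ` on the interval `[a,b]`. -/
def IsFlowOn (ξ : ℝ → ℝ) (φ : ℝ → ℝ → ℝ) (a b : ℝ) : Prop :=
  (∀ x ∈ Icc a b, φ 0 x = x) ∧
    ∀ x ∈ Icc a b, ∀ t : ℝ, φ t x ∈ Icc a b ∧ HasDerivAt (fun s => φ s x) (ξ (φ t x)) t

/-- The space `R*_∂` of pairs of commuting elements of `Diff*_∂[0,1]`. -/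
def PairStar (D : Set ℝ) : Type :=
  {p : (ℝ → ℝ) × (ℝ → ℝ) //
    DiffStar D p.1 ∧ DiffStar D p.2 ∧ ∀ x ∈ Icc (0 : ℝ) 1, p.1 (p.2 x) = p.2 (p.1 x)}

/-- The `C^∞` topology on `R*_∂`. -/
noncomputable instance (D : Set ℝ) : TopologicalSpace (PairStar D) :=
  TopologicalSpace.induced
    (fun p : PairStar D => fun (i : Bool) (k : ℕ) =>
      ContinuousMap.mk
        (fun x : Icc (0 : ℝ) 1 => iteratedDeriv k (if i then p.1.1 else p.1.2) x)
        (by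
          cases i <;>
            exact ((by first | exact p.2.1.1.1 | exact p.2.2.1.1.1 :
                ContDiff ℝ (⊤ : ℕ∞) _).continuous_iteratedDeriv k
                (by exact_mod_cast le_top)).comp continuous_subtype_val))
    inferInstance

/-- `R^c_∂ ⊆ R*_∂`: the set of clean pairs, i.e. pairs whose coordinates are both flow
maps of a single `C^∞` vector field on `[0,1]` with complete flow, or both iterates of a
single element of `Diff*_∂[0,1]`. -/
def CleanPairs (D : Set ℝ) : Set (PairStar D) :=
  {p : PairStar D |
    (∃ ξ : ℝ → ℝ, ∃ φ : ℝ → ℝ → ℝ, ContDiff ℝ (⊤ : ℕ∞) ξ ∧ IsFlowOn ξ φ 0 1 ∧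
      ∃ s t : ℝ, (∀ x ∈ Icc (0 : ℝ) 1, p.1.1 x = φ s x) ∧
        ∀ x ∈ Icc (0 : ℝ) 1, p.1.2 x = φ t x) ∨
    (∃ h hinv : ℝ → ℝ, DiffStar D h ∧ IsInverseOn hinv h (Icc (0 : ℝ) 1) ∧
      ∃ q q' : ℤ, (∀ x ∈ Icc (0 : ℝ) 1, p.1.1 x = zpowIter h hinv q x) ∧
        ∀ x ∈ Icc (0 : ℝ) 1, p.1.2 x = zpowIter h hinv q' x)}

set_option linter.unusedVariables false
section Helpers
open Set Filter Topology NNReal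

section
open Set Filter Topology

/-- families of functions, jointly continuous with `k` derivatives in the variable -/
def CK {P : Type*} [TopologicalSpace P] : ℕ → (P → ℝ → ℝ) → Prop
  | 0, F => Continuous (fun z : P × ℝ => F z.1 z.2)
  | k + 1, F => Continuous (fun z : P × ℝ => F z.1 z.2) ∧
      ∃ F' : P → ℝ → ℝ, (∀ p x, HasDerivAt (F p) (F' p x) x) ∧ CK k F'

namespace CK
variable {P Q : Type*} [TopologicalSpace P] [TopologicalSpace Q]

theorem cont {k : ℕ} {F : P → ℝ → ℝ} (h : CK k F) :
    Continuous (fun z : P × ℝ => F z.1 z.2) := by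
  cases k with
  | zero => exact h
  | succ k => exact h.1

theorem of_succ {k : ℕ} : ∀ {F : P → ℝ → ℝ}, CK (k + 1) F → CK k F := by
  induction k with
  | zero => intro F h; exact h.1
  | succ k ih => rintro F ⟨h, F', h1, h2⟩; exact ⟨h, F', h1, ih h2⟩

theorem mono {k m : ℕ} (hkm : m ≤ k) {F : P → ℝ → ℝ} (h : CK k F) : CK m F := by
  induction k with
  | zero => obtain rfl : m = 0 := by omega
            exact h
  | succ k ih =>
    rcases Nat.lt_or_ge m (k + 1) with h' | h'
    · exact ih (by omega) h.of_succ
    · obtain rfl : m = k + 1 := by omega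
      exact h

theorem param {k : ℕ} : ∀ {F : P → ℝ → ℝ}, CK k F → ∀ {g : Q → P}, Continuous g →
    CK k (fun q => F (g q)) := by
  induction k with
  | zero =>
    intro F h g hg
    exact (show Continuous (fun z : P × ℝ => F z.1 z.2) from h).comp
      ((hg.comp continuous_fst).prodMk continuous_snd)
  | succ k ih =>
    rintro F ⟨h, F', h1, h2⟩ g hg
    exact ⟨h.comp ((hg.comp continuous_fst).prodMk continuous_snd), fun q => F' (g q),
      fun q x => h1 _ _, ih h2 hg⟩

theorem add {k : ℕ} : ∀ {F G : P → ℝ → ℝ}, CK k F → CK k G →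
    CK k (fun p x => F p x + G p x) := by
  induction k with
  | zero => intro F G hF hG; exact Continuous.add hF hG
  | succ k ih =>
    rintro F G ⟨h, F', h1, h2⟩ ⟨g, G', g1, g2⟩
    exact ⟨h.add g, _, fun p x => (h1 p x).add (g1 p x), ih h2 g2⟩

theorem mul {k : ℕ} : ∀ {F G : P → ℝ → ℝ}, CK k F → CK k G →
    CK k (fun p x => F p x * G p x) := by
  induction k with
  | zero => intro F G hF hG; exact Continuous.mul hF hG
  | succ k ih =>
    rintro F G hF hG
    obtain ⟨h, F', h1, h2⟩ := id hF
    obtain ⟨g, G', g1, g2⟩ := id hG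
    exact ⟨h.mul g, _, fun p x => (h1 p x).mul (g1 p x),
      (ih h2 hG.of_succ).add (ih hF.of_succ g2)⟩

theorem fn {k : ℕ} : ∀ {h : ℝ → ℝ}, ContDiff ℝ k h → CK k (fun (_ : P) => h) := by
  induction k with
  | zero => intro h hh; exact hh.continuous.comp continuous_snd
  | succ k ih =>
    intro h hh
    refine ⟨hh.continuous.comp continuous_snd, fun _ => deriv h, fun p x =>
      ((hh.differentiable (by simp)) x).hasDerivAt, ih ?_⟩
    have := (contDiff_succ_iff_deriv (n := k)).1 (by exact_mod_cast hh)
    exact this.2.2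

theorem pconst {k : ℕ} : ∀ {c : P → ℝ}, Continuous c → CK k (fun p _ => c p) := by
  induction k with
  | zero => intro h hh; exact hh.comp continuous_fst
  | succ k ih =>
    intro c hc
    exact ⟨hc.comp continuous_fst, fun _ _ => 0, fun p x => hasDerivAt_const _ _,
      ih continuous_const⟩

theorem comp {k : ℕ} : ∀ {E F : P → ℝ → ℝ}, CK k E → CK k F →
    CK k (fun p x => E p (F p x)) := by
  induction k with
  | zero =>
    intro E F hE hF
    exact (show Continuous (fun z : P × ℝ => E z.1 z.2) from hE).comp
      (continuous_fst.prodMk hF)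
  | succ k ih =>
    rintro E F ⟨h, E', h1, h2⟩ hF
    obtain ⟨g, F', g1, g2⟩ := id hF
    exact ⟨h.comp (continuous_fst.prodMk g), _, fun p x => (h1 p (F p x)).comp x (g1 p x),
      (ih h2 hF.of_succ).mul g2⟩

theorem sub {k : ℕ} {F G : P → ℝ → ℝ} (hF : CK k F) (hG : CK k G) :
    CK k (fun p x => F p x - G p x) := by
  have := hF.add ((pconst (k := k) (continuous_const (y := (-1:ℝ)))).mul hG)
  simpa [sub_eq_add_neg] using this

theorem contDiff {k : ℕ} : ∀ {F : P → ℝ → ℝ}, CK k F → ∀ p, ContDiff ℝ k (F p) := by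
  induction k with
  | zero =>
    intro F h p
    exact_mod_cast contDiff_zero.2
      ((show Continuous (fun z : P × ℝ => F z.1 z.2) from h).comp (continuous_const.prodMk continuous_id))
  | succ k ih =>
    rintro F ⟨h, F', h1, h2⟩ p
    have e : deriv (F p) = F' p := funext fun x => (h1 p x).deriv
    have := (contDiff_succ_iff_deriv (n := k) (f := F p) (𝕜 := ℝ)).2
      ⟨fun x => (h1 p x).differentiableAt, by simp, by rw [e]; exact ih h2 p⟩
    exact_mod_cast this

theorem cont_iteratedDeriv {k : ℕ} : ∀ {F : P → ℝ → ℝ}, CK k F → ∀ {j : ℕ}, j ≤ k →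
    Continuous (fun z : P × ℝ => iteratedDeriv j (F z.1) z.2) := by
  induction k with
  | zero =>
    intro F h j hj
    obtain rfl : j = 0 := by omega
    simpa using h.cont
  | succ k ih =>
    rintro F ⟨h, F', h1, h2⟩ j hj
    cases j with
    | zero => simpa using h
    | succ j =>
      have e : ∀ p, deriv (F p) = F' p := fun p => funext fun x => (h1 p x).deriv
      simp only [iteratedDeriv_succ', e]
      exact ih h2 (by omega)

theorem of_deriv {k : ℕ} {F F' : P → ℝ → ℝ} (hF : CK 0 F) (h : ∀ p x, HasDerivAt (F p) (F' p x) x)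
    (h' : CK k F') : CK (k+1) F := ⟨hF, F', h, h'⟩

theorem congr {k : ℕ} {F G : P → ℝ → ℝ} (hF : CK k F) (h : ∀ p x, F p x = G p x) : CK k G := by
  have : F = G := by funext p x; exact h p x
  rwa [← this]

/-- integral in a parameter -/
theorem integral {k : ℕ} : ∀ {F : P × ℝ → ℝ → ℝ}, CK k F →
    CK k (fun (p : P × ℝ) x => ∫ s in (0:ℝ)..p.2, F (p.1, s) x) := by
  induction k with
  | zero =>
    intro F h
    have h' : Continuous (fun z : (P × ℝ) × ℝ => F z.1 z.2) := h
    have h3 : Continuous (Function.uncurry fun (z : (P × ℝ) × ℝ) (s : ℝ) => F (z.1.1, s) z.2) := by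
      exact h'.comp (show Continuous (fun w : ((P × ℝ) × ℝ) × ℝ => (((w.1.1.1, w.2), w.1.2) : (P × ℝ) × ℝ)) by fun_prop)
    exact intervalIntegral.continuous_parametric_intervalIntegral_of_continuous (a₀ := 0) h3
      (continuous_snd.comp continuous_fst)
  | succ k ih =>
    intro F hF
    obtain ⟨h, F', h1, h2⟩ := id hF
    refine of_deriv (ih hF.of_succ).cont ?_ (ih h2)
    intro p x
    have hc := h2.cont
    have cF : ∀ y, Continuous (fun s => F (p.1, s) y) := fun y =>
      h.comp ((continuous_const.prodMk continuous_id).prodMk continuous_const)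
    have cF' : ∀ y, Continuous (fun s => F' (p.1, s) y) := fun y =>
      hc.comp ((continuous_const.prodMk continuous_id).prodMk continuous_const)
    have cj : Continuous (fun z : ℝ × ℝ => F' (p.1, z.1) z.2) := hc.comp (show Continuous (fun z : ℝ × ℝ => (((p.1, z.1), z.2) : (P × ℝ) × ℝ)) by fun_prop)
    obtain ⟨C, hC⟩ := (isCompact_uIcc (a := (0:ℝ)) (b := p.2)).prod (isCompact_closedBall x (1:ℝ))
      |>.exists_bound_of_continuousOn cj.continuousOn
    refine (intervalIntegral.hasDerivAt_integral_of_dominated_loc_of_deriv_le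
      (F := fun y s => F (p.1, s) y) (F' := fun y s => F' (p.1, s) y) (μ := MeasureTheory.volume)
      (bound := fun _ => C) (s := Metric.closedBall x 1) (Metric.closedBall_mem_nhds x one_pos) ?_ ?_ ?_ ?_ ?_ ?_).2
    · exact Eventually.of_forall fun y => (cF y).aestronglyMeasurable
    · exact (cF x).intervalIntegrable _ _
    · exact (cF' x).aestronglyMeasurable
    · refine Eventually.of_forall fun t ht y hy => ?_
      exact hC (t, y) ⟨uIoc_subset_uIcc ht, hy⟩
    · exact intervalIntegrable_const
    · exact Eventually.of_forall fun t ht y hy => h1 _ _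

end CK
end

section
/-- global flow -/
def Fl (ξ : ℝ → ℝ) (φ : ℝ → ℝ → ℝ) : Prop :=
  (∀ x, φ 0 x = x) ∧ ∀ t x, HasDerivAt (fun s => φ s x) (ξ (φ t x)) t

theorem Fl.exists_of_lipschitz {ξ : ℝ → ℝ} {K L : ℝ≥0} (hK : LipschitzWith K ξ)
    (hL : ∀ x, |ξ x| ≤ L) : ∃ φ, Fl ξ φ := by
  have h1 : ∀ (n : ℕ) (x : ℝ), ∃ α : ℝ → ℝ, α 0 = x ∧
      ∀ t ∈ Ioo (-(n:ℝ)-1) (n+1), HasDerivAt α (ξ (α t)) t := by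
    intro n x
    have h0 : (0:ℝ) ∈ Icc (-(n:ℝ)-1) (n+1) := by constructor <;> (have := n.cast_nonneg (α := ℝ); linarith)
    have hP : IsPicardLindelof (fun _ => ξ) (⟨0, h0⟩ : Icc (-(n:ℝ)-1) (n+1)) x
        (L * (n + 1)) 0 L K := by
      apply IsPicardLindelof.of_time_independent
      · intro y _; exact hL y
      · exact hK.lipschitzOnWith
      · simp only [sub_zero, zero_sub]
        push_cast
        rw [show -(-(n:ℝ) - 1) = n + 1 by ring, max_self]
        simp
    obtain ⟨α, ha, hb⟩ := hP.exists_eq_forall_mem_Icc_hasDerivWithinAt₀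
    refine ⟨α, ha, fun t ht => (hb t (Ioo_subset_Icc_self ht)).hasDerivAt (Icc_mem_nhds ht.1 ht.2)⟩
  choose α ha hb using h1
  have huniq : ∀ n m : ℕ, n ≤ m → ∀ x, ∀ t ∈ Ioo (-(n:ℝ)-1) (n+1), α n x t = α m x t := by
    intro n m hnm x t ht
    have hnm' : (n:ℝ) ≤ m := by exact_mod_cast hnm
    refine ODE_solution_unique_of_mem_Ioo (v := fun _ => ξ) (s := fun _ => univ) (K := K)
      (t₀ := 0) (a := -(n:ℝ)-1) (b := n+1)
      (fun _ _ => hK.lipschitzOnWith) ?_ (fun t ht => ⟨hb n x t ht, trivial⟩)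
      (fun t ht => ⟨hb m x t ⟨by linarith [ht.1], by linarith [ht.2]⟩, trivial⟩) ?_ ht
    · constructor <;> (have := n.cast_nonneg (α := ℝ); linarith)
    · rw [ha, ha]
  refine ⟨fun t x => α ⌈|t|⌉₊ x t, fun x => by simp [ha], fun t x => ?_⟩
  have ht : t ∈ Ioo (-((⌈|t|⌉₊:ℕ):ℝ)-1) ((⌈|t|⌉₊:ℕ)+1) := by
    have := Nat.le_ceil |t|
    constructor <;> linarith [neg_abs_le t, le_abs_self t]
  refine (hb ⌈|t|⌉₊ x t ht).congr_of_eventuallyEq ?_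
  filter_upwards [isOpen_Ioo.mem_nhds ht] with s hs
  have hs' : s ∈ Ioo (-((⌈|s|⌉₊:ℕ):ℝ)-1) ((⌈|s|⌉₊:ℕ)+1) := by
    have := Nat.le_ceil |s|
    constructor <;> linarith [neg_abs_le s, le_abs_self s]
  rcases le_total ⌈|s|⌉₊ ⌈|t|⌉₊ with h | h
  · exact huniq _ _ h x s hs'
  · exact (huniq _ _ h x s hs).symm

/-- nice compactly supported family members -/
def Sup12 (ξ : ℝ → ℝ) : Prop := ∀ x, x ∉ Icc (-1:ℝ) 2 → ξ x = 0

theorem Sup12.lip {ξ : ℝ → ℝ} (hs : Sup12 ξ) (h : ContDiff ℝ 1 ξ) :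
    ∃ K L : ℝ≥0, LipschitzWith K ξ ∧ ∀ x, |ξ x| ≤ L := by
  have hc : HasCompactSupport ξ := HasCompactSupport.intro isCompact_Icc (fun x hx => hs x hx)
  obtain ⟨K, hK⟩ := h.lipschitzWith_of_hasCompactSupport hc (by simp)
  obtain ⟨C, hC⟩ := hc.exists_bound_of_continuous h.continuous
  refine ⟨K, C.toNNReal, hK, fun x => ?_⟩
  have := hC x
  rw [Real.norm_eq_abs] at this
  exact this.trans (Real.le_coe_toNNReal C)

theorem Fl.exists {ξ : ℝ → ℝ} (hs : Sup12 ξ) (h : ContDiff ℝ 1 ξ) : ∃ φ, Fl ξ φ := by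
  obtain ⟨K, L, h1, h2⟩ := hs.lip h
  exact Fl.exists_of_lipschitz h1 h2

theorem Fl.unique {ξ : ℝ → ℝ} {φ : ℝ → ℝ → ℝ} (h : Fl ξ φ) {K : ℝ≥0} (hK : LipschitzWith K ξ)
    {α : ℝ → ℝ} (ha : ∀ t, HasDerivAt α (ξ (α t)) t) (t : ℝ) : α t = φ t (α 0) := by
  have := ODE_solution_unique_univ (v := fun _ => ξ) (s := fun _ => univ) (K := K) (t₀ := 0)
      (f := α) (g := fun t => φ t (α 0)) (fun _ => hK.lipschitzOnWith) (fun t => ⟨ha t, trivial⟩)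
      (fun t => ⟨h.2 t _, trivial⟩) (by simp [h.1])
  exact congrFun this t

theorem Fl.neg {ξ : ℝ → ℝ} {φ : ℝ → ℝ → ℝ} (h : Fl ξ φ) :
    Fl (fun x => - ξ x) (fun t x => φ (-t) x) := by
  refine ⟨fun x => by simp [h.1], fun t x => ?_⟩
  have := HasDerivAt.scomp t (h.2 (-t) x) (hasDerivAt_neg t)
  simpa [Function.comp_def] using this

theorem Fl.add {ξ : ℝ → ℝ} {φ : ℝ → ℝ → ℝ} (h : Fl ξ φ) {K : ℝ≥0} (hK : LipschitzWith K ξ)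
    (s t x : ℝ) : φ (t + s) x = φ t (φ s x) := by
  have h1 : ∀ t, HasDerivAt (fun t => φ (t + s) x) (ξ (φ (t + s) x)) t := by
    intro t
    exact (h.2 (t + s) x).comp_add_const t s
  have := h.unique hK (α := fun t => φ (t + s) x) h1 t
  simpa using this

/-- Gronwall comparison -/
theorem Fl.gronwall_pos {ξ η : ℝ → ℝ} {φ ψ : ℝ → ℝ → ℝ} (h : Fl ξ φ) (h' : Fl η ψ) {K : ℝ≥0}
    (hK : LipschitzWith K ξ) {ε : ℝ} (hε : ∀ x, |η x - ξ x| ≤ ε) (x y t : ℝ) (ht : 0 ≤ t) :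
    |ψ t y - φ t x| ≤ gronwallBound |y - x| K ε t := by
  have := dist_le_of_approx_trajectories_ODE (v := fun _ => ξ) (K := K) (f := fun t => ψ t y)
    (g := fun t => φ t x) (f' := fun t => η (ψ t y)) (g' := fun t => ξ (φ t x)) (a := 0) (b := t)
    (εf := ε) (εg := 0) (δ := |y - x|) (fun _ => hK)
    (fun s _ => (h'.2 s y).continuousAt.continuousWithinAt)
    (fun s _ => (h'.2 s y).hasDerivWithinAt)
    (fun s _ => by rw [Real.dist_eq]; exact hε _)
    (fun s _ => (h.2 s x).continuousAt.continuousWithinAt)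
    (fun s _ => (h.2 s x).hasDerivWithinAt)
    (fun s _ => by simp) (by rw [Real.dist_eq, h.1, h'.1]) t ⟨ht, le_rfl⟩
  rw [Real.dist_eq] at this
  simpa using this

theorem Fl.gronwall {ξ η : ℝ → ℝ} {φ ψ : ℝ → ℝ → ℝ} (h : Fl ξ φ) (h' : Fl η ψ) {K : ℝ≥0}
    (hK : LipschitzWith K ξ) {ε : ℝ} (hε : ∀ x, |η x - ξ x| ≤ ε) (x y t : ℝ) :
    |ψ t y - φ t x| ≤ gronwallBound |y - x| K ε |t| := by
  rcases le_total 0 t with ht | ht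
  · rw [abs_of_nonneg ht]; exact h.gronwall_pos h' hK hε x y t ht
  · rw [abs_of_nonpos ht]
    have := h.neg.gronwall_pos h'.neg (K := K) (ε := ε) hK.neg
      (fun x => by rw [neg_sub_neg, abs_sub_comm]; exact hε x) x y (-t) (by linarith)
    simpa using this

section family
variable {Λ : Type*} [TopologicalSpace Λ]

theorem flow_continuous {ξ : Λ → ℝ → ℝ} (hξ : CK 1 ξ) (hs : ∀ l, Sup12 (ξ l))
    {φ : Λ → ℝ → ℝ → ℝ} (hφ : ∀ l, Fl (ξ l) (φ l)) :
    CK 0 (fun (p : Λ × ℝ) x => φ p.1 p.2 x) := by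
  show Continuous (fun z : (Λ × ℝ) × ℝ => φ z.1.1 z.1.2 z.2)
  rw [continuous_iff_continuousAt]
  rintro ⟨⟨l, t⟩, x⟩
  obtain ⟨K', L, hK', hL⟩ := (hs l).lip (by exact_mod_cast hξ.contDiff l)
  set K : ℝ≥0 := K' + 1
  have hK : LipschitzWith K (ξ l) := hK'.weaken (by simp [K])
  have hK0 : (K : ℝ) ≠ 0 := by positivity
  rw [ContinuousAt, Metric.tendsto_nhds]
  intro ε hε
  -- choose δ
  set B := Real.exp (K * (|t| + 1)) with hB
  have hB1 : 1 ≤ B := Real.one_le_exp (by positivity)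
  have hKpos : 0 < (K:ℝ) := by positivity
  have hK1 : 1 ≤ (K:ℝ) := by simp [K]
  set δ := ε / (4 * B) with hδ
  have hδ0 : 0 < δ := by positivity
  have e1 : ∀ᶠ l' in 𝓝 l, ∀ y ∈ Icc (-1:ℝ) 2, |ξ l' y - ξ l y| < δ := by
    apply isCompact_Icc.eventually_forall_of_forall_eventually
    intro y _
    have hc := hξ.cont
    have c2 : Continuous (fun z : Λ × ℝ => |ξ z.1 z.2 - ξ l z.2|) :=
      (hc.sub (hc.comp (continuous_const.prodMk continuous_snd))).abs
    have := c2.continuousAt (x := (l, y))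
    exact this.eventually_lt continuousAt_const (by simpa using hδ0)
  have e1' : ∀ᶠ z : (Λ × ℝ) × ℝ in 𝓝 ((l, t), x), ∀ y ∈ Icc (-1:ℝ) 2, |ξ z.1.1 y - ξ l y| < δ :=
    (Continuous.tendsto' (show Continuous (fun z : (Λ × ℝ) × ℝ => z.1.1) by fun_prop)
      ((l, t), x) l rfl).eventually e1
  have e2 : ∀ᶠ z : (Λ × ℝ) × ℝ in 𝓝 ((l, t), x), |z.2 - x| < δ := by
    have : ContinuousAt (fun z : (Λ × ℝ) × ℝ => |z.2 - x|) ((l, t), x) := by fun_prop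
    exact this.eventually_lt continuousAt_const (by simpa using hδ0)
  have e3 : ∀ᶠ z : (Λ × ℝ) × ℝ in 𝓝 ((l, t), x), |z.1.2| < |t| + 1 := by
    have : ContinuousAt (fun z : (Λ × ℝ) × ℝ => |z.1.2|) ((l, t), x) := by fun_prop
    exact this.eventually_lt continuousAt_const (by simp)
  have e4 : ∀ᶠ z : (Λ × ℝ) × ℝ in 𝓝 ((l, t), x), |φ l z.1.2 x - φ l t x| < ε / 4 := by
    have : ContinuousAt (fun z : (Λ × ℝ) × ℝ => |φ l z.1.2 x - φ l t x|) ((l, t), x) := by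
      have h1 : ContinuousAt (fun z : (Λ × ℝ) × ℝ => φ l z.1.2 x) ((l, t), x) :=
        ContinuousAt.comp (g := fun s => φ l s x) (f := fun z : (Λ × ℝ) × ℝ => z.1.2)
          ((hφ l).2 t x).continuousAt (by fun_prop)
      exact (h1.sub continuousAt_const).abs
    exact this.eventually_lt continuousAt_const (by simp; linarith)
  filter_upwards [e1', e2, e3, e4] with z z1 z2 z3 z4
  have hb : ∀ y, |ξ z.1.1 y - ξ l y| ≤ δ := by
    intro y
    by_cases hy : y ∈ Icc (-1:ℝ) 2
    · exact (z1 y hy).le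
    · rw [hs l y hy, hs _ y hy]; simpa using hδ0.le
  have g := (hφ l).gronwall (hφ z.1.1) hK hb x z.2 z.1.2
  rw [gronwallBound_of_K_ne_0 hK0] at g
  have hexp : Real.exp (K * |z.1.2|) ≤ B := Real.exp_le_exp.2 (by gcongr)
  have hg : |z.2 - x| * Real.exp (K * |z.1.2|) + δ / K * (Real.exp (K * |z.1.2|) - 1) ≤ ε / 2 := by
    have a1 : |z.2 - x| * Real.exp (K * |z.1.2|) ≤ δ * B := by gcongr
    have a2 : δ / K * (Real.exp (K * |z.1.2|) - 1) ≤ δ * B := by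
      have : δ / K ≤ δ := div_le_self hδ0.le hK1
      have h3 : 0 ≤ Real.exp (K * |z.1.2|) - 1 := by
        have := Real.one_le_exp (x := K * |z.1.2|) (by positivity)
        linarith
      calc _ ≤ δ * (Real.exp (K * |z.1.2|) - 1) := by gcongr
        _ ≤ δ * B := by gcongr; linarith
    have a3 : δ * B = ε / 4 := by rw [hδ]; field_simp
    linarith
  rw [Real.dist_eq]
  have : φ z.1.1 z.1.2 z.2 - φ l t x = (φ z.1.1 z.1.2 z.2 - φ l z.1.2 x) + (φ l z.1.2 x - φ l t x) := by ring
  rw [this]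
  exact (abs_add_le _ _).trans_lt (by linarith)

/-- difference quotient kernel -/
noncomputable def dq (ξ : ℝ → ℝ) (a b : ℝ) : ℝ := ∫ θ in (0:ℝ)..1, deriv ξ (b + θ * (a - b))

theorem dq_cont {ξ : ℝ → ℝ} (h : ContDiff ℝ 1 ξ) : Continuous (fun z : ℝ × ℝ => dq ξ z.1 z.2) := by
  have hc : Continuous (deriv ξ) := h.continuous_deriv le_rfl
  unfold dq
  apply intervalIntegral.continuous_parametric_intervalIntegral_of_continuous'
  exact hc.comp (by fun_prop)

theorem dq_self {ξ : ℝ → ℝ} (a : ℝ) : dq ξ a a = deriv ξ a := by simp [dq]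

theorem dq_spec {ξ : ℝ → ℝ} (h : ContDiff ℝ 1 ξ) (a b : ℝ) : ξ a - ξ b = dq ξ a b * (a - b) := by
  have hc : Continuous (deriv ξ) := h.continuous_deriv le_rfl
  have h1 : ∀ θ ∈ uIcc (0:ℝ) 1, HasDerivAt (fun θ => ξ (b + θ * (a - b)))
      (deriv ξ (b + θ * (a - b)) * (a - b)) θ := by
    intro θ _
    have h2 : HasDerivAt (fun θ : ℝ => b + θ * (a - b)) (a - b) θ := by
      simpa using ((hasDerivAt_id θ).mul_const (a - b)).const_add b
    exact ((h.differentiable (by simp)) (b + θ * (a - b))).hasDerivAt.comp θ h2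
  have := intervalIntegral.integral_eq_sub_of_hasDerivAt h1
    ((show Continuous _ from (hc.comp (by fun_prop)).mul continuous_const).intervalIntegrable _ _)
  rw [intervalIntegral.integral_mul_const] at this
  rw [dq, this]; simp

theorem lin_ode {D q : ℝ → ℝ} (hq : Continuous q) (hD : ∀ t, HasDerivAt D (q t * D t) t) (t : ℝ) :
    D t = D 0 * Real.exp (∫ s in (0:ℝ)..t, q s) := by
  have hI : ∀ t, HasDerivAt (fun t => ∫ s in (0:ℝ)..t, q s) (q t) t := fun t =>
    intervalIntegral.integral_hasDerivAt_right (hq.intervalIntegrable _ _)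
      (hq.stronglyMeasurableAtFilter _ _) hq.continuousAt
  have h1 : ∀ t, HasDerivAt (fun t => D t * Real.exp (-∫ s in (0:ℝ)..t, q s)) 0 t := by
    intro t
    have := (hD t).mul (hI t).neg.exp
    refine this.congr_deriv ?_
    simp only [Pi.neg_apply]
    ring
  have h2 := is_const_of_deriv_eq_zero (fun t => (h1 t).differentiableAt) (fun t => (h1 t).deriv) t 0
  simp only [intervalIntegral.integral_same, neg_zero, Real.exp_zero, mul_one] at h2
  rw [← h2, mul_assoc, ← Real.exp_add]; simp

theorem Fl.diff {ξ : ℝ → ℝ} {φ : ℝ → ℝ → ℝ} (h : Fl ξ φ) (hξ : ContDiff ℝ 1 ξ) (x y t : ℝ) :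
    φ t y - φ t x = (y - x) * Real.exp (∫ s in (0:ℝ)..t, dq ξ (φ s y) (φ s x)) := by
  have hc : ∀ z, Continuous (fun s => φ s z) := fun z =>
    continuous_iff_continuousAt.2 fun s => (h.2 s z).continuousAt
  have := lin_ode (D := fun t => φ t y - φ t x) (q := fun s => dq ξ (φ s y) (φ s x))
    ((dq_cont hξ).comp ((hc y).prodMk (hc x))) (fun t => by
      have := (h.2 t y).sub (h.2 t x)
      rw [dq_spec hξ] at this
      exact this) t
  simpa [h.1] using this

theorem Fl.hasDerivAt {ξ : ℝ → ℝ} {φ : ℝ → ℝ → ℝ} (h : Fl ξ φ) (hξ : ContDiff ℝ 1 ξ)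
    (hcont : Continuous (fun z : ℝ × ℝ => φ z.1 z.2)) (t x : ℝ) :
    HasDerivAt (φ t) (Real.exp (∫ s in (0:ℝ)..t, deriv ξ (φ s x))) x := by
  rw [hasDerivAt_iff_tendsto_slope]
  have h1 : Continuous (fun y => Real.exp (∫ s in (0:ℝ)..t, dq ξ (φ s y) (φ s x))) := by
    apply Real.continuous_exp.comp
    apply intervalIntegral.continuous_parametric_intervalIntegral_of_continuous'
    exact (dq_cont hξ).comp ((hcont.comp (by fun_prop : Continuous fun z : ℝ × ℝ => (z.2, z.1))).prodMk
      (hcont.comp (by fun_prop : Continuous fun z : ℝ × ℝ => (z.2, x))))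
  have h2 := h1.tendsto x
  simp only [dq_self] at h2
  refine (h2.mono_left nhdsWithin_le_nhds).congr' ?_
  filter_upwards [self_mem_nhdsWithin] with y hy
  rw [slope_def_field, h.diff hξ x y t]
  have : y - x ≠ 0 := sub_ne_zero.2 hy
  field_simp

theorem flow_CK {k : ℕ} {ξ : Λ → ℝ → ℝ} (hξ : CK (k+1) ξ) (hs : ∀ l, Sup12 (ξ l))
    {φ : Λ → ℝ → ℝ → ℝ} (hφ : ∀ l, Fl (ξ l) (φ l)) :
    CK (k+1) (fun (p : Λ × ℝ) x => φ p.1 p.2 x) := by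
  have h0 := flow_continuous (hξ.mono (by omega)) hs hφ
  obtain ⟨-, ξ', hd, hξ'⟩ := id hξ
  have hder : ∀ (p : Λ × ℝ) x, HasDerivAt (fun x => φ p.1 p.2 x)
      (Real.exp (∫ s in (0:ℝ)..p.2, ξ' p.1 (φ p.1 s x))) x := by
    intro p x
    have := (hφ p.1).hasDerivAt (by exact_mod_cast (hξ.mono (by omega : 1 ≤ k + 1)).contDiff p.1)
      ((show Continuous (fun z : (Λ × ℝ) × ℝ => φ z.1.1 z.1.2 z.2) from h0).comp
        (by fun_prop : Continuous (fun z : ℝ × ℝ => (((p.1, z.1), z.2) : (Λ × ℝ) × ℝ)))) p.2 x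
    have e : deriv (ξ p.1) = ξ' p.1 := funext fun x => (hd p.1 x).deriv
    rw [e] at this
    exact this
  have key : ∀ j ≤ k + 1, CK j (fun (p : Λ × ℝ) x => φ p.1 p.2 x) := by
    intro j
    induction j with
    | zero => intro _; exact h0
    | succ j ih =>
      intro hj
      refine CK.of_deriv h0 hder ?_
      have a1 : CK j (fun (p : Λ × ℝ) => ξ' p.1) := (hξ'.mono (by omega)).param continuous_fst
      have a2 := a1.comp (ih (by omega))
      have a3 := CK.integral a2
      have a4 : CK j (fun (_ : Λ × ℝ) => Real.exp) := CK.fn Real.contDiff_exp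
      exact a4.comp a3
  exact key _ le_rfl

end family
end

section
set_option linter.style.haveILetI false

/-- smooth functions -/
abbrev Sm (f : ℝ → ℝ) : Prop := ContDiff ℝ (⊤ : ℕ∞) f

theorem sm_iff_CK {f : ℝ → ℝ} : Sm f ↔ ∀ k : ℕ, CK k (fun _ : Unit => f) := by
  constructor
  · intro h k; exact CK.fn (h.of_le (by exact_mod_cast le_top))
  · intro h
    exact contDiff_infty.2 fun n => (h n).contDiff ()

theorem Sm.deriv {f : ℝ → ℝ} (h : Sm f) : Sm (deriv f) :=
  (contDiff_infty_iff_deriv.1 h).2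

theorem Sm.diff {f : ℝ → ℝ} (h : Sm f) : Differentiable ℝ f := (contDiff_infty_iff_deriv.1 h).1

theorem Sm.has {f : ℝ → ℝ} (h : Sm f) (x : ℝ) : HasDerivAt f (_root_.deriv f x) x := (h.diff x).hasDerivAt

theorem Sm.one {f : ℝ → ℝ} (h : Sm f) : ContDiff ℝ 1 f := h.of_le (by exact_mod_cast le_top)

theorem Sm.ck {P : Type*} [TopologicalSpace P] {f : ℝ → ℝ} (h : Sm f) (k : ℕ) :
    CK k (fun _ : P => f) := CK.fn (h.of_le (by exact_mod_cast le_top))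

theorem dq_smooth {v a b : ℝ → ℝ} (hv : Sm v) (ha : Sm a) (hb : Sm b) :
    Sm (fun x => dq v (a x) (b x)) := by
  refine contDiff_infty.2 fun k => ?_
  have h1 : CK k (fun (p : Unit × ℝ) x => b x + p.2 * (a x - b x)) :=
    (hb.ck k).add ((CK.pconst continuous_snd).mul ((ha.ck k).sub (hb.ck k)))
  have h2 : CK k (fun (p : Unit × ℝ) x => deriv v (b x + p.2 * (a x - b x))) :=
    (hv.deriv.ck k).comp h1
  exact h2.integral.contDiff ((), 1)

theorem hadamard {v : ℝ → ℝ} (hv : Sm v) {p : ℝ} (h0 : v p = 0) :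
    ∃ w, Sm w ∧ ∀ x, v x = (x - p) * w x := by
  refine ⟨fun x => dq v x p, dq_smooth hv contDiff_id contDiff_const, fun x => ?_⟩
  have := dq_spec hv.one x p
  rw [h0] at this; linarith

theorem factor {v : ℝ → ℝ} (hv : Sm v) (p : ℝ) (N : ℕ) :
    (∃ m < N, ∃ w, Sm w ∧ w p ≠ 0 ∧ ∀ x, v x = (x - p) ^ m * w x) ∨
    ∃ w, Sm w ∧ ∀ x, v x = (x - p) ^ N * w x := by
  induction N with
  | zero => exact Or.inr ⟨v, hv, fun x => by simp⟩
  | succ N ih =>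
    rcases ih with ⟨m, hm, w, h⟩ | ⟨w, hw, h⟩
    · exact Or.inl ⟨m, by omega, w, h⟩
    · by_cases h0 : w p = 0
      · obtain ⟨w', hw', h'⟩ := hadamard hw h0
        exact Or.inr ⟨w', hw', fun x => by rw [h, h']; ring⟩
      · exact Or.inl ⟨N, by omega, w, hw, h0, h⟩

/-- all derivatives vanish -/
def Flat (v : ℝ → ℝ) (p : ℝ) : Prop := ∀ n, iteratedDeriv n v p = 0

theorem iter_factor (p : ℝ) (n j : ℕ) : ∀ {w : ℝ → ℝ}, Sm w → ∃ w', Sm w' ∧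
    (w p ≠ 0 → w' p ≠ 0) ∧
    iteratedDeriv n (fun x => (x - p) ^ (n + j) * w x) = fun x => (x - p) ^ j * w' x := by
  induction n with
  | zero => intro w hw; exact ⟨w, hw, id, by simp⟩
  | succ n ih =>
    intro w hw
    have hd : deriv (fun x => (x - p) ^ (n + 1 + j) * w x) =
        fun x => (x - p) ^ (n + j) * (((n + 1 + j : ℕ) : ℝ) * w x + (x - p) * deriv w x) := by
      funext x
      have h1 : HasDerivAt (fun x : ℝ => (x - p) ^ (n + 1 + j)) (((n + 1 + j : ℕ) : ℝ) * (x - p) ^ (n + j)) x := by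
        have := ((hasDerivAt_id x).sub_const p).pow (n + 1 + j)
        refine this.congr_deriv ?_
        simp only [id, mul_one]
        congr 2
        omega
      rw [(h1.fun_mul (hw.has x)).deriv]
      rw [show n + 1 + j = (n + j) + 1 by ring, pow_succ]; ring
    have hs : Sm (fun x => ((n + 1 + j : ℕ) : ℝ) * w x + (x - p) * deriv w x) :=
      (contDiff_const.mul hw).add ((contDiff_id.sub contDiff_const).mul hw.deriv)
    obtain ⟨w', h1, h2, h3⟩ := ih hs
    refine ⟨w', h1, fun h => h2 ?_, ?_⟩
    · simp only [sub_self, zero_mul, add_zero]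
      exact mul_ne_zero (by positivity) h
    · rw [iteratedDeriv_succ', hd, h3]

theorem Flat.factor {v : ℝ → ℝ} (hv : Sm v) {p : ℝ} (h : Flat v p) (N : ℕ) :
    ∃ w, Sm w ∧ ∀ x, v x = (x - p) ^ N * w x := by
  rcases _root_.factor hv p N with ⟨m, hm, w, hw, h0, he⟩ | h'
  · exfalso
    obtain ⟨w', a, b, c⟩ := iter_factor p m 0 hw
    have e : v = fun x => (x - p) ^ (m + 0) * w x := by funext x; simpa using he x
    have := h m
    rw [e, c] at this
    simp only [pow_zero, one_mul] at this
    exact b h0 this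
  · exact h'

theorem flat_of_factor {v : ℝ → ℝ} {p : ℝ}
    (h : ∀ N : ℕ, ∃ w, Sm w ∧ ∀ x, v x = (x - p) ^ N * w x) : Flat v p := by
  intro n
  obtain ⟨w, hw, e⟩ := h (n + 1)
  obtain ⟨w', a, b, c⟩ := iter_factor p n 1 hw
  have e : v = fun x => (x - p) ^ (n + 1) * w x := by funext x; simpa using e x
  rw [e, c]; simp

theorem not_flat_iff {v : ℝ → ℝ} (hv : Sm v) {p : ℝ} : ¬ Flat v p ↔
    ∃ m, ∃ w, Sm w ∧ w p ≠ 0 ∧ ∀ x, v x = (x - p) ^ m * w x := by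
  constructor
  · intro h
    by_contra h'
    push Not at h'
    apply h
    apply flat_of_factor
    intro N
    rcases _root_.factor hv p N with ⟨m, hm, w, hw, h0, he⟩ | h''
    · obtain ⟨x, hx⟩ := h' m w hw h0
      exact (hx (he x)).elim
    · exact h''
  · rintro ⟨m, w, hw, h0, he⟩ h
    obtain ⟨w', a, b, c⟩ := iter_factor p m 0 hw
    have e : v = fun x => (x - p) ^ (m + 0) * w x := by funext x; simpa using he x
    have := h m
    rw [e, c] at this
    simp only [pow_zero, one_mul] at this
    exact b h0 this

theorem nhds_I_neBot {p : ℝ} (hp : p ∈ Icc (0:ℝ) 1) : (𝓝[Icc (0:ℝ) 1 \ {p}] p).NeBot := by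
  rcases lt_or_ge p 1 with h | h
  · have := left_nhdsWithin_Ioo_neBot h
    refine this.mono (nhdsWithin_mono _ fun x hx => ⟨⟨hp.1.trans hx.1.le, hx.2.le⟩, ?_⟩)
    simpa using hx.1.ne'
  · have hp1 : p = 1 := le_antisymm hp.2 h
    have := right_nhdsWithin_Ioo_neBot (show (0:ℝ) < p by linarith)
    refine this.mono (nhdsWithin_mono _ fun x hx => ⟨⟨hx.1.le, hx.2.le.trans hp.2⟩, ?_⟩)
    simpa using hx.2.ne

theorem flat_of_bound {v₁ v₂ : ℝ → ℝ} (h1 : Sm v₁) (h2 : Sm v₂) {p C : ℝ} (hp : p ∈ Icc (0:ℝ) 1)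
    (hC : ∀ x ∈ Icc (0:ℝ) 1, |v₁ x| ≤ C * |v₂ x|) (h : Flat v₂ p) : Flat v₁ p := by
  by_contra hn
  obtain ⟨m, w, hw, hw0, he⟩ := (not_flat_iff h1).1 hn
  obtain ⟨w₂, hw₂, he₂⟩ := h.factor h2 (m + 1)
  have := nhds_I_neBot hp
  have t1 : Tendsto (fun x => |w x|) (𝓝[Icc (0:ℝ) 1 \ {p}] p) (𝓝 |w p|) :=
    (hw.continuous.abs.tendsto p).mono_left nhdsWithin_le_nhds
  have t2 : Tendsto (fun x => C * (|x - p| * |w₂ x|)) (𝓝[Icc (0:ℝ) 1 \ {p}] p) (𝓝 (C * (|p - p| * |w₂ p|))) :=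
    ((continuous_const.mul (((continuous_id.sub continuous_const).abs).mul hw₂.continuous.abs)).tendsto p).mono_left
      nhdsWithin_le_nhds
  have := le_of_tendsto_of_tendsto t1 t2 (by
    filter_upwards [self_mem_nhdsWithin] with x hx
    have hxp : 0 < |x - p| ^ m := by
      have : x - p ≠ 0 := sub_ne_zero.2 hx.2
      positivity
    have := hC x hx.1
    rw [he, he₂, abs_mul, abs_mul, abs_pow, abs_pow, pow_succ] at this
    have h3 : |x - p| ^ m * |w x| ≤ |x - p| ^ m * (C * (|x - p| * |w₂ x|)) := by linarith
    exact le_of_mul_le_mul_left h3 hxp)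
  simp at this
  exact hw0 this

theorem ITI_iff {f : ℝ → ℝ} (hf : Sm f) (p : ℝ) : ITIat f p ↔ Flat (fun x => f x - x) p := by
  constructor
  · rintro ⟨h, h'⟩ n
    rcases Nat.eq_zero_or_pos n with rfl | hn
    · simp [h]
    · exact h' n hn
  · intro h
    refine ⟨?_, fun n _ => h n⟩
    have := h 0
    simp at this
    linarith

theorem iteratedDeriv_eq_of_eqOn {f g : ℝ → ℝ} (hf : Sm f) (hg : Sm g)
    (h : ∀ x ∈ Icc (0:ℝ) 1, f x = g x) (k : ℕ) {x : ℝ} (hx : x ∈ Icc (0:ℝ) 1) :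
    iteratedDeriv k f x = iteratedDeriv k g x := by
  have cf : Continuous (iteratedDeriv k f) := hf.continuous_iteratedDeriv k (by exact_mod_cast le_top)
  have cg : Continuous (iteratedDeriv k g) := hg.continuous_iteratedDeriv k (by exact_mod_cast le_top)
  have h1 : EqOn (iteratedDeriv k f) (iteratedDeriv k g) (Ioo 0 1) := by
    intro y hy
    apply Filter.EventuallyEq.iteratedDeriv_eq
    filter_upwards [isOpen_Ioo.mem_nhds hy] with z hz using h z (Ioo_subset_Icc_self hz)
  have h2 := h1.closure cf cg
  rw [closure_Ioo (by norm_num)] at h2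
  exact h2 hx

theorem ITI_congr {f g : ℝ → ℝ} (hf : Sm f) (hg : Sm g)
    (h : ∀ x ∈ Icc (0:ℝ) 1, f x = g x) {p : ℝ} (hp : p ∈ Icc (0:ℝ) 1) : ITIat f p ↔ ITIat g p := by
  rw [ITI_iff hf, ITI_iff hg]
  have : ∀ n, iteratedDeriv n (fun x => f x - x) p = iteratedDeriv n (fun x => g x - x) p := fun n =>
    iteratedDeriv_eq_of_eqOn (hf.sub contDiff_id) (hg.sub contDiff_id) (fun x hx => by rw [h x hx]) n hp
  simp only [Flat, this]

theorem SmoothDiffeoI.congr {f g : ℝ → ℝ} (hf : SmoothDiffeoI f) (hg : Sm g)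
    (h : ∀ x ∈ Icc (0:ℝ) 1, f x = g x) : SmoothDiffeoI g := by
  obtain ⟨a, b, c, d, e⟩ := hf
  refine ⟨hg, by rw [← h 0 (by simp), b], by rw [← h 1 (by simp), c], fun x hx => ?_, fun x hx => ?_⟩
  · have := iteratedDeriv_eq_of_eqOn a hg h 1 hx
    simp only [iteratedDeriv_one] at this
    rw [← this]; exact d x hx
  · rw [← h x hx]; exact e hx

theorem DiffStar.congr {D : Set ℝ} {f g : ℝ → ℝ} (hf : DiffStar D f) (hg : Sm g)
    (h : ∀ x ∈ Icc (0:ℝ) 1, f x = g x) : DiffStar D g := by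
  refine ⟨hf.1.congr hg h, ?_⟩
  rcases hf.2 with h' | h'
  · left; intro x hx; rw [← h x hx, h' x hx]
  · right; intro p hp; rw [← ITI_congr hf.1.1 hg h hp, h' p hp]
end

section
/-- global diffeomorphisms of the line fixing `0` and `1`, with inverse -/
structure GDiff (F G : ℝ → ℝ) : Prop where
  sm : Sm F
  smi : Sm G
  left : ∀ x, G (F x) = x
  right : ∀ x, F (G x) = x
  pos : ∀ x, 0 < deriv F x
  zero : F 0 = 0
  one : F 1 = 1

namespace GDiff
variable {F G : ℝ → ℝ}

theorem mono (h : GDiff F G) : StrictMono F := strictMono_of_deriv_pos h.pos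

theorem symm (h : GDiff F G) : GDiff G F := by
  refine ⟨h.smi, h.sm, h.right, h.left, fun x => ?_, ?_, ?_⟩
  · have h1 : HasDerivAt (fun x => F (G x)) (deriv F (G x) * deriv G x) x :=
      (h.sm.has (G x)).comp x (h.smi.has x)
    have h2 : HasDerivAt (fun x => F (G x)) 1 x := by
      simp only [h.right]; exact hasDerivAt_id x
    have h3 := h1.unique h2
    have := h.pos (G x)
    by_contra h4
    push Not at h4
    nlinarith
  · rw [← h.zero, h.left, h.zero]
  · rw [← h.one, h.left, h.one]

theorem mapsTo (h : GDiff F G) : MapsTo F (Icc (0:ℝ) 1) (Icc (0:ℝ) 1) := by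
  intro x hx
  constructor
  · rw [← h.zero]; exact h.mono.monotone hx.1
  · rw [← h.one]; exact h.mono.monotone hx.2

theorem sdi (h : GDiff F G) : SmoothDiffeoI F :=
  ⟨h.sm, h.zero, h.one, fun x _ => h.pos x, h.mapsTo⟩

theorem comp {F' G' : ℝ → ℝ} (h : GDiff F G) (h' : GDiff F' G') :
    GDiff (fun x => F (F' x)) (fun x => G' (G x)) := by
  refine ⟨h.sm.comp h'.sm, h'.smi.comp h.smi, fun x => by rw [h.left, h'.left], fun x => by rw [h'.right, h.right],
    fun x => ?_, by rw [h'.zero, h.zero], by rw [h'.one, h.one]⟩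
  have h1 : HasDerivAt (fun x => F (F' x)) (deriv F (F' x) * deriv F' x) x :=
      (h.sm.has (F' x)).comp x (h'.sm.has x)
  rw [h1.deriv]
  exact mul_pos (h.pos _) (h'.pos _)

theorem refl : GDiff (fun x => x) (fun x => x) :=
  ⟨contDiff_id, contDiff_id, fun _ => rfl, fun _ => rfl, fun x => by simp, rfl, rfl⟩

/-- the permutation of the line -/
def perm (h : GDiff F G) : Equiv.Perm ℝ := ⟨F, G, h.left, h.right⟩

theorem zpow (h : GDiff F G) (n : ℤ) : GDiff (⇑(h.perm ^ n)) (⇑((h.perm ^ n)⁻¹)) := by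
  have key : ∀ n : ℕ, GDiff (⇑(h.perm ^ n)) (⇑((h.perm ^ n)⁻¹)) := by
    intro n
    induction n with
    | zero => exact refl
    | succ n ih =>
      have := h.comp ih
      have e1 : (fun x => F ((h.perm ^ n) x)) = ⇑(h.perm ^ (n + 1)) := by
        rw [pow_succ']; rfl
      have e2 : (fun x => (h.perm ^ n)⁻¹ (G x)) = ⇑((h.perm ^ (n + 1))⁻¹) := by
        rw [pow_succ', mul_inv_rev]; rfl
      rwa [e1, e2] at this
  rcases n with n | n
  · simpa using key n
  · simpa using (key (n + 1)).symm

theorem zpowIter_eq (h : GDiff F G) (n : ℤ) : zpowIter F G n = ⇑(h.perm ^ n) := by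
  unfold zpowIter
  have e1 : ∀ n : ℕ, F^[n] = ⇑(h.perm ^ n) := fun n => by
    rw [Equiv.Perm.coe_pow]; rfl
  have e2 : ∀ n : ℕ, G^[n] = ⇑((h.perm ^ n)⁻¹) := fun n => by
    rw [← inv_pow, Equiv.Perm.coe_pow]; rfl
  rcases n with n | n
  · simp [e1]
  · rw [if_neg (by omega)]
    rw [e2]
    simp [Int.neg_negSucc]

end GDiff

theorem zpowIter_congr {h hinv F G : ℝ → ℝ} (hF : GDiff F G) (e : ∀ x ∈ Icc (0:ℝ) 1, h x = F x)
    (hi : IsInverseOn hinv h (Icc (0:ℝ) 1)) (hm : MapsTo h (Icc (0:ℝ) 1) (Icc (0:ℝ) 1)) (n : ℤ) :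
    ∀ x ∈ Icc (0:ℝ) 1, zpowIter h hinv n x = zpowIter F G n x := by
  have ei : ∀ x ∈ Icc (0:ℝ) 1, hinv x = G x := by
    intro x hx
    have hg := hF.symm.mapsTo hx
    have : h (G x) = x := by rw [e _ hg, hF.right]
    conv_lhs => rw [← this]
    exact hi.1 _ hg
  have aux : ∀ (a b : ℝ → ℝ), (∀ x ∈ Icc (0:ℝ) 1, a x = b x) → MapsTo b (Icc (0:ℝ) 1) (Icc (0:ℝ) 1) →
      ∀ n : ℕ, ∀ x ∈ Icc (0:ℝ) 1, a^[n] x = b^[n] x := by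
    intro a b hab hb n
    induction n with
    | zero => intro x hx; rfl
    | succ n ih =>
      intro x hx
      rw [Function.iterate_succ_apply, Function.iterate_succ_apply, hab x hx]
      exact ih _ (hb hx)
  intro x hx
  unfold zpowIter
  split_ifs
  · exact aux h F e hF.mapsTo _ x hx
  · exact aux hinv G ei hF.symm.mapsTo _ x hx

/-- smooth bump equal to one on the unit interval, supported near it -/
theorem exists_bump {r : ℝ} (hr : 0 < r) : ∃ χ : ℝ → ℝ, Sm χ ∧ (∀ x ∈ Icc (0:ℝ) 1, χ x = 1) ∧
    (∀ x, x ∉ Ioo (-r) (1 + r) → χ x = 0) ∧ ∀ x, χ x ∈ Icc (0:ℝ) 1 := by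
  let b : ContDiffBump (1/2 : ℝ) := ⟨1/2, 1/2 + r, by norm_num, by linarith⟩
  refine ⟨b, b.contDiff, fun x hx => ?_, fun x hx => ?_, fun x => ⟨b.nonneg, b.le_one⟩⟩
  · apply b.one_of_mem_closedBall
    rw [Metric.mem_closedBall, Real.dist_eq, abs_le]
    constructor <;> linarith [hx.1, hx.2]
  · apply b.zero_of_le_dist
    rw [Real.dist_eq]
    simp only [mem_Ioo, not_and_or, not_lt] at hx
    show 1/2 + r ≤ _
    rcases hx with hx | hx
    · rw [abs_sub_comm]; exact le_trans (by linarith) (le_abs_self _)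
    · exact le_trans (by linarith) (le_abs_self _)

theorem gdiff_of {F : ℝ → ℝ} (hF : Sm F) {c : ℝ} (hc : 0 < c) (h : ∀ x, c ≤ deriv F x)
    (h0 : F 0 = 0) (h1 : F 1 = 1) : ∃ G, GDiff F G := by
  have pos : ∀ x, 0 < deriv F x := fun x => hc.trans_le (h x)
  have hm : StrictMono F := strictMono_of_deriv_pos pos
  have hg : Monotone (fun x => F x - c * x) := by
    apply monotone_of_deriv_nonneg
    · exact hF.diff.sub (differentiable_id.const_mul c)
    · intro x
      have : HasDerivAt (fun x => F x - c * x) (deriv F x - c * 1) x := (hF.has x).sub ((hasDerivAt_id x).const_mul c)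
      rw [this.deriv]; linarith [h x]
  have hs : Function.Surjective F := by
    intro y
    have hcont : Continuous F := hF.continuous
    have a1 : F (-|y|/c) ≤ y := by
      have := hg (show -|y|/c ≤ 0 by rw [neg_div]; have : 0 ≤ |y|/c := by positivity
                                     linarith)
      simp only [h0, mul_zero, sub_zero] at this
      have e : c * (-|y|/c) = -|y| := by field_simp
      linarith [neg_abs_le y]
    have a2 : y ≤ F (|y|/c) := by
      have := hg (show 0 ≤ |y|/c by positivity)
      simp only [h0, mul_zero, sub_zero] at this
      have e : c * (|y|/c) = |y| := by field_simp
      linarith [le_abs_self y]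
    exact mem_range_of_exists_le_of_exists_ge hcont ⟨_, a1⟩ ⟨_, a2⟩
  let e := (hm.orderIsoOfSurjective F hs).toHomeomorph
  have he : ∀ x, e x = F x := fun x => rfl
  refine ⟨e.symm, hF, ?_, fun x => e.symm_apply_apply x, fun x => e.apply_symm_apply x, pos, h0, h1⟩
  exact e.contDiff_symm_deriv (f' := deriv F) (fun x => (pos x).ne') (fun x => hF.has x) hF

theorem exists_ext {f : ℝ → ℝ} (hf : SmoothDiffeoI f) : ∃ F G, GDiff F G ∧
    (∀ x ∈ Icc (0:ℝ) 1, f x = F x) ∧ ∃ c > 0, ∀ x, c ≤ deriv F x := by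
  obtain ⟨a', b, c, d, e⟩ := hf
  have a : Sm f := a'
  have hcd : Continuous (deriv f) := a.deriv.continuous
  obtain ⟨r, hr, hr1⟩ : ∃ r > 0, ∀ x ∈ Icc (-r) (1 + r), 0 < deriv f x := by
    have hop : IsOpen {x | 0 < deriv f x} := isOpen_lt continuous_const hcd
    obtain ⟨r, hr, h⟩ := (isCompact_Icc (a := (0:ℝ)) (b := 1)).exists_cthickening_subset_open hop d
    refine ⟨r, hr, fun x hx => h ?_⟩
    rw [isCompact_Icc.cthickening_eq_biUnion_closedBall hr.le]
    simp only [mem_iUnion]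
    rcases lt_or_ge x 0 with h0 | h0
    · exact ⟨0, by simp, by rw [Metric.mem_closedBall, Real.dist_eq, abs_le]; constructor <;> linarith [hx.1]⟩
    · rcases lt_or_ge 1 x with h1 | h1
      · exact ⟨1, by simp, by rw [Metric.mem_closedBall, Real.dist_eq, abs_le]; constructor <;> linarith [hx.2]⟩
      · exact ⟨x, ⟨h0, h1⟩, Metric.mem_closedBall_self hr.le⟩
  obtain ⟨χ, c1, c2, c3, c4⟩ := exists_bump hr
  obtain ⟨m, hm, hmm⟩ : ∃ m > 0, ∀ x ∈ Icc (-r) (1 + r), m ≤ deriv f x := by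
    obtain ⟨y, hy, hmin⟩ := isCompact_Icc.exists_isMinOn (nonempty_Icc.2 (by linarith : -r ≤ 1 + r)) hcd.continuousOn
    exact ⟨deriv f y, hr1 y hy, fun x hx => hmin hx⟩
  set g : ℝ → ℝ := fun x => χ x * deriv f x + (1 - χ x) with hg
  have hgs : Sm g := (c1.mul a.deriv).add (contDiff_const.sub c1)
  set F : ℝ → ℝ := fun x => ∫ s in (0:ℝ)..x, g s with hFd
  have hFder : ∀ x, HasDerivAt F (g x) x := fun x =>
    intervalIntegral.integral_hasDerivAt_right (hgs.continuous.intervalIntegrable _ _)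
      (hgs.continuous.stronglyMeasurableAtFilter _ _) hgs.continuous.continuousAt
  have hde : deriv F = g := funext fun x => (hFder x).deriv
  have hFs : Sm F := contDiff_infty_iff_deriv.2 ⟨fun x => (hFder x).differentiableAt, by rw [hde]; exact hgs⟩
  have heq : ∀ x ∈ Icc (0:ℝ) 1, f x = F x := by
    intro x hx
    have : ∫ s in (0:ℝ)..x, g s = ∫ s in (0:ℝ)..x, deriv f s := by
      apply intervalIntegral.integral_congr
      intro s hs
      rw [uIcc_of_le hx.1] at hs
      simp [hg, c2 s ⟨hs.1, hs.2.trans hx.2⟩]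
    rw [hFd]; simp only
    rw [this, intervalIntegral.integral_deriv_eq_sub (fun y _ => a.diff y) (hcd.intervalIntegrable _ _), b, sub_zero]
  have hlow : ∀ x, min m 1 ≤ deriv F x := by
    intro x
    rw [hde]
    simp only [hg]
    by_cases hx : x ∈ Ioo (-r) (1 + r)
    · have h1 := hmm x (Ioo_subset_Icc_self hx)
      have h2 := c4 x
      have h3 : min m 1 ≤ m := min_le_left _ _
      have h4 : min m 1 ≤ 1 := min_le_right _ _
      nlinarith [h2.1, h2.2]
    · rw [c3 x hx]; simp
  obtain ⟨G, hG⟩ := gdiff_of hFs (lt_min hm one_pos) hlow (by simp [hFd]) (by rw [← heq 1 (by simp), c])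
  exact ⟨F, G, hG, heq, _, lt_min hm one_pos, hlow⟩

/-- inverse families -/
theorem CK.inverse {P : Type*} [TopologicalSpace P] {H K : P → ℝ → ℝ} {c : ℝ} (hc : 0 < c)
    {k : ℕ} (hH : CK (k + 1) H) (hl : ∀ p x, c ≤ deriv (H p) x) (hK : ∀ p x, H p (K p x) = x)
    (hK' : ∀ p x, K p (H p x) = x) : CK (k + 1) K := by
  obtain ⟨hcont, H', hd, hH'⟩ := id hH
  have e : ∀ p x, deriv (H p) x = H' p x := fun p x => (hd p x).deriv
  have hdf : ∀ p, Differentiable ℝ (H p) := fun p x => (hd p x).differentiableAt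
  have hmono : ∀ p, Monotone (fun x => H p x - c * x) := by
    intro p
    apply monotone_of_deriv_nonneg
    · exact (hdf p).sub (differentiable_id.const_mul c)
    · intro x
      have : HasDerivAt (fun x => H p x - c * x) (H' p x - c * 1) x := (hd p x).sub ((hasDerivAt_id x).const_mul c)
      rw [this.deriv, ← e]; linarith [hl p x]
  have hlip : ∀ p x y, c * |x - y| ≤ |H p x - H p y| := by
    intro p x y
    rcases le_total x y with h | h
    · have := hmono p h
      simp only at this
      rw [abs_sub_comm, abs_sub_comm (H p x), abs_of_nonneg (by linarith : 0 ≤ y - x)]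
      exact le_trans (by linarith) (le_abs_self _)
    · have := hmono p h
      simp only at this
      rw [abs_of_nonneg (by linarith : 0 ≤ x - y)]
      exact le_trans (by linarith) (le_abs_self _)
  have h0 : CK 0 K := by
    show Continuous (fun z : P × ℝ => K z.1 z.2)
    rw [continuous_iff_continuousAt]
    rintro ⟨p, y⟩
    rw [ContinuousAt, tendsto_iff_dist_tendsto_zero]
    have hb : ∀ z : P × ℝ, dist (K z.1 z.2) (K p y) ≤ c⁻¹ * |z.2 - H z.1 (K p y)| := by
      intro z
      have := hlip z.1 (K z.1 z.2) (K p y)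
      rw [hK] at this
      rw [Real.dist_eq, inv_mul_eq_div, le_div_iff₀ hc]; linarith
    have hct : Continuous (fun z : P × ℝ => c⁻¹ * |z.2 - H z.1 (K p y)|) :=
      continuous_const.mul (continuous_snd.sub (hcont.comp (continuous_fst.prodMk continuous_const))).abs
    refine squeeze_zero (fun _ => dist_nonneg) hb ?_
    have := hct.tendsto (p, y)
    simpa [hK] using this
  have hder : ∀ p x, HasDerivAt (K p) (H' p (K p x))⁻¹ x := by
    intro p x
    have hck : Continuous (K p) := (show Continuous (fun z : P × ℝ => K z.1 z.2) from h0).comp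
      (continuous_const.prodMk continuous_id)
    exact HasDerivAt.of_local_left_inverse hck.continuousAt (hd p (K p x))
      (by rw [← e]; exact (hc.trans_le (hl _ _)).ne') (Eventually.of_forall fun y => hK p y)
  have key : ∀ j ≤ k + 1, CK j K := by
    intro j
    induction j with
    | zero => intro _; exact h0
    | succ j ih =>
      intro hj
      refine CK.of_deriv h0 hder ?_
      have a1 : CK j (fun p x => H' p (K p x)) := (hH'.mono (by omega)).comp (ih (by omega))
      have : ∀ j : ℕ, ∀ {A : P → ℝ → ℝ}, (∀ p x, A p x ≠ 0) → CK j A → CK j (fun p x => (A p x)⁻¹) := by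
        intro j
        induction j with
        | zero =>
          intro A hA h
          exact Continuous.inv₀ h fun z => hA _ _
        | succ j ih =>
          intro A hA h
          obtain ⟨g, A', g1, g2⟩ := id h
          have i1 := ih hA h.of_succ
          refine CK.of_deriv (g.inv₀ fun z => hA _ _)
            (F' := fun p x => (-1) * (A' p x * ((A p x)⁻¹ * (A p x)⁻¹))) ?_ ?_
          · intro p x
            refine ((g1 p x).fun_inv (hA p x)).congr_deriv ?_
            field_simp
          · exact (CK.pconst continuous_const).mul (g2.mul (i1.mul i1))
      exact this j (fun p x => by rw [← e]; exact (hc.trans_le (hl _ _)).ne') a1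
  exact key _ le_rfl
end

section
theorem Sm.lipI {v : ℝ → ℝ} (hv : Sm v) : ∃ L, 0 ≤ L ∧ ∀ x ∈ Icc (0:ℝ) 1, ∀ y ∈ Icc (0:ℝ) 1,
    |v x - v y| ≤ L * |x - y| := by
  obtain ⟨L, hL⟩ := (isCompact_Icc (a := (0:ℝ)) (b := 1)).exists_bound_of_continuousOn hv.deriv.continuous.continuousOn
  refine ⟨L, (norm_nonneg _).trans (hL 0 (by simp)), fun x hx y hy => ?_⟩
  exact (convex_Icc (0:ℝ) 1).norm_image_sub_le_of_norm_deriv_le (fun z _ => hv.diff z) hL hy hx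

/-- displacement comparison -/
def Cmp (F F' : ℝ → ℝ) : Prop := ∃ C, ∀ x ∈ Icc (0:ℝ) 1, |F x - x| ≤ C * |F' x - x|

theorem DiffStar.of_cmp {D : Set ℝ} {F F' G' : ℝ → ℝ} (h : DiffStar D F) (hF : GDiff F' G')
    (h1 : Cmp F F') (h2 : Cmp F' F) : DiffStar D F' := by
  refine ⟨hF.sdi, ?_⟩
  obtain ⟨C1, h1⟩ := h1
  obtain ⟨C2, h2⟩ := h2
  rcases h.2 with h' | h'
  · left
    intro x hx
    have := h2 x hx
    rw [h' x hx] at this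
    simp at this
    linarith
  · right
    intro p hp
    have hFs : Sm F := h.1.1
    rw [← h' p hp, ITI_iff hFs, ITI_iff hF.sm]
    exact ⟨flat_of_bound (hFs.sub contDiff_id) (hF.sm.sub contDiff_id) hp h1,
      flat_of_bound (hF.sm.sub contDiff_id) (hFs.sub contDiff_id) hp h2⟩

theorem DiffStar.id (D : Set ℝ) : DiffStar D (fun x => x) := ⟨GDiff.refl.sdi, Or.inl fun _ _ => rfl⟩

theorem GDiff.cmp_inv {F G : ℝ → ℝ} (h : GDiff F G) : Cmp F G := by
  obtain ⟨L, hL0, hL⟩ := h.sm.lipI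
  refine ⟨L, fun x hx => ?_⟩
  have := hL x hx (G x) (h.symm.mapsTo hx)
  rw [h.right] at this
  rw [abs_sub_comm (G x)]; exact this

theorem GDiff.pow_low {F G : ℝ → ℝ} (h : GDiff F G) (n : ℕ) (x : ℝ) :
    |F x - x| ≤ |(h.perm ^ (n + 1)) x - x| := by
  have key : ∀ n : ℕ, (x ≤ F x → F x ≤ (h.perm ^ (n + 1)) x) ∧ (F x ≤ x → (h.perm ^ (n + 1)) x ≤ F x) := by
    intro n
    induction n with
    | zero => simp [GDiff.perm]
    | succ n ih =>
      rw [pow_succ']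
      have e : (h.perm * h.perm ^ (n + 1)) x = F ((h.perm ^ (n + 1)) x) := rfl
      rw [e]
      exact ⟨fun hx => h.mono.monotone (hx.trans (ih.1 hx)), fun hx => h.mono.monotone ((ih.2 hx).trans hx)⟩
  rcases le_total x (F x) with hx | hx
  · rw [abs_of_nonneg (by linarith)]
    exact le_trans (by linarith [(key n).1 hx]) (le_abs_self _)
  · rw [abs_of_nonpos (by linarith)]
    exact le_trans (by linarith [(key n).2 hx]) (neg_le_abs _)

theorem GDiff.pow_up {F G : ℝ → ℝ} (h : GDiff F G) (n : ℕ) : Cmp (⇑(h.perm ^ n)) F := by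
  induction n with
  | zero => exact ⟨0, fun x _ => by simp⟩
  | succ n ih =>
    obtain ⟨C, hC⟩ := ih
    obtain ⟨L, hL0, hL⟩ := (h.zpow n).sm.lipI
    refine ⟨L + C, fun x hx => ?_⟩
    have e : (h.perm ^ (n + 1)) x = (h.perm ^ n) (F x) := by rw [pow_succ]; rfl
    have h1 := hL (F x) (h.mapsTo hx) x hx
    have h2 := hC x hx
    simp only [zpow_natCast] at h1
    rw [e]
    calc |(h.perm ^ n) (F x) - x| = |((h.perm ^ n) (F x) - (h.perm ^ n) x) + ((h.perm ^ n) x - x)| := by ring_nf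
      _ ≤ _ := abs_add_le _ _
      _ ≤ (L + C) * |F x - x| := by linarith

theorem DiffStar.zpow {D : Set ℝ} {F G : ℝ → ℝ} (hD : DiffStar D F) (h : GDiff F G) (n : ℤ) :
    DiffStar D (⇑(h.perm ^ n)) := by
  have key : ∀ n : ℕ, DiffStar D (⇑(h.perm ^ n)) := by
    intro n
    cases n with
    | zero => exact DiffStar.id D
    | succ n =>
      have hz := h.zpow ((n + 1 : ℕ) : ℤ)
      simp only [zpow_natCast] at hz
      exact hD.of_cmp hz ⟨1, fun x _ => by rw [one_mul]; exact h.pow_low n x⟩ (h.pow_up _)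
  rcases n with n | n
  · simpa using key n
  · have hz := h.zpow ((n + 1 : ℕ) : ℤ)
    rw [zpow_natCast] at hz
    rw [zpow_negSucc]
    exact (key (n + 1)).of_cmp hz.symm hz.cmp_inv hz.symm.cmp_inv

/-- identity pair -/
def idPair (D : Set ℝ) : PairStar D := ⟨(fun x => x, fun x => x), DiffStar.id D, DiffStar.id D, fun _ _ => rfl⟩

theorem id_clean (D : Set ℝ) : idPair D ∈ CleanPairs D := by
  right
  exact ⟨fun x => x, fun x => x, DiffStar.id D, ⟨fun _ _ => rfl, fun _ _ => rfl⟩, 0, 0,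
    fun x _ => by simp [idPair, zpowIter], fun x _ => by simp [idPair, zpowIter]⟩

theorem cont_pair {D : Set ℝ} {P : Type*} [TopologicalSpace P] {γ : P → PairStar D}
    {A B : P → ℝ → ℝ} (hA : ∀ k, CK k A) (hB : ∀ k, CK k B)
    (eA : ∀ r, ∀ x ∈ Icc (0:ℝ) 1, (γ r).1.1 x = A r x)
    (eB : ∀ r, ∀ x ∈ Icc (0:ℝ) 1, (γ r).1.2 x = B r x) : Continuous γ := by
  have sA : ∀ r, Sm (A r) := fun r => contDiff_infty.2 fun n => (hA n).contDiff r
  have sB : ∀ r, Sm (B r) := fun r => contDiff_infty.2 fun n => (hB n).contDiff r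
  rw [continuous_induced_rng]
  refine continuous_pi fun i => continuous_pi fun k => ?_
  apply ContinuousMap.continuous_of_continuous_uncurry
  have cA := (hA k).cont_iteratedDeriv le_rfl
  have cB := (hB k).cont_iteratedDeriv le_rfl
  have hsub : Continuous (fun z : P × Icc (0:ℝ) 1 => ((z.1, (z.2 : ℝ)) : P × ℝ)) := by fun_prop
  cases i
  · refine (cB.comp hsub).congr fun z => ?_
    have h2 : Sm (γ z.1).1.2 := (γ z.1).2.2.1.1.1
    exact (iteratedDeriv_eq_of_eqOn h2 (sB z.1) (eB z.1) k z.2.2).symm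
  · refine (cA.comp hsub).congr fun z => ?_
    have h2 : Sm (γ z.1).1.1 := (γ z.1).2.1.1.1
    exact (iteratedDeriv_eq_of_eqOn h2 (sA z.1) (eA z.1) k z.2.2).symm

theorem joined_of_family {D : Set ℝ} (p : PairStar D) {A B : unitInterval → ℝ → ℝ}
    (hA : ∀ k, CK k A) (hB : ∀ k, CK k B)
    (γ : unitInterval → PairStar D) (hγ : ∀ r, (γ r).1 = (A r, B r)) (hc : ∀ r, γ r ∈ CleanPairs D)
    (hp : p ∈ CleanPairs D)
    (h0A : ∀ x ∈ Icc (0:ℝ) 1, p.1.1 x = A 0 x) (h0B : ∀ x ∈ Icc (0:ℝ) 1, p.1.2 x = B 0 x)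
    (h1A : ∀ x ∈ Icc (0:ℝ) 1, A 1 x = x) (h1B : ∀ x ∈ Icc (0:ℝ) 1, B 1 x = x) :
    JoinedIn (CleanPairs D) p (idPair D) := by
  classical
  let γ' : unitInterval → PairStar D := fun r => if r = 0 then p else if r = 1 then idPair D else γ r
  have hcont : Continuous γ' := by
    refine cont_pair hA hB ?_ ?_
    · intro r x hx
      simp only [γ']
      split_ifs with h h'
      · rw [h]; exact h0A x hx
      · rw [h', h1A x hx]; rfl
      · rw [hγ]
    · intro r x hx
      simp only [γ']
      split_ifs with h h'
      · rw [h]; exact h0B x hx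
      · rw [h', h1B x hx]; rfl
      · rw [hγ]
  refine ⟨⟨⟨γ', hcont⟩, by simp [γ'], by simp [γ']⟩, fun r => ?_⟩
  show γ' r ∈ _
  simp only [γ']
  split_ifs
  · exact hp
  · exact id_clean D
  · exact hc r

theorem CK.zpowPerm {P : Type*} [TopologicalSpace P] {F G : P → ℝ → ℝ} (h : ∀ p, GDiff (F p) (G p)) {k : ℕ}
    (hF : CK k F) (hG : CK k G) (n : ℤ) : CK k (fun p => ⇑((h p).perm ^ n)) := by
  have key : ∀ n : ℕ, CK k (fun p => ⇑((h p).perm ^ n)) ∧ CK k (fun p => ⇑(((h p).perm ^ n)⁻¹)) := by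
    intro n
    induction n with
    | zero => exact ⟨Sm.ck contDiff_id k, Sm.ck contDiff_id k⟩
    | succ n ih =>
      constructor
      · refine (hF.comp ih.1).congr fun p x => ?_
        rw [pow_succ']; rfl
      · refine (ih.2.comp hG).congr fun p x => ?_
        rw [pow_succ', mul_inv_rev]; rfl
  rcases n with n | n
  · simpa using (key n).1
  · simpa using (key (n + 1)).2

theorem joined_iter {D : Set ℝ} (p : PairStar D) (hp : p ∈ CleanPairs D) {h hinv : ℝ → ℝ} (hD : DiffStar D h)
    (hi : IsInverseOn hinv h (Icc (0 : ℝ) 1)) (q q' : ℤ)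
    (h1 : ∀ x ∈ Icc (0 : ℝ) 1, p.1.1 x = zpowIter h hinv q x)
    (h2 : ∀ x ∈ Icc (0 : ℝ) 1, p.1.2 x = zpowIter h hinv q' x) :
    JoinedIn (CleanPairs D) p (idPair D) := by
  obtain ⟨F, G, hF, he, c, hc, hl⟩ := exists_ext hD.1
  have hDF : DiffStar D F := hD.congr hF.sm he
  set H : unitInterval → ℝ → ℝ := fun r x => (1 - (r:ℝ)) * F x + (r:ℝ) * x with hH
  have hHck : ∀ k, CK k H := fun k =>
    ((CK.pconst (by fun_prop)).mul (hF.sm.ck k)).add ((CK.pconst (by fun_prop)).mul (Sm.ck contDiff_id k))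
  have hder : ∀ r x, HasDerivAt (H r) ((1 - (r:ℝ)) * deriv F x + r * 1) x := fun r x =>
    ((hF.sm.has x).const_mul _).add ((hasDerivAt_id x).const_mul _)
  have hlow : ∀ r x, min c 1 ≤ deriv (H r) x := by
    intro r x
    rw [(hder r x).deriv]
    have a1 := r.2.1
    have a2 := r.2.2
    nlinarith [hl x, min_le_left c 1, min_le_right c 1]
  have hHs : ∀ r, Sm (H r) := fun r => contDiff_infty.2 fun n => (hHck n).contDiff r
  have hex : ∀ r, ∃ K, GDiff (H r) K := fun r =>
    gdiff_of (hHs r) (lt_min hc one_pos) (hlow r) (by simp [hH, hF.zero]) (by simp [hH, hF.one])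
  choose K hK using hex
  have hKck : ∀ k, CK k K := fun k =>
    ((CK.inverse (lt_min hc one_pos) (hHck (k + 1)) hlow (fun r => (hK r).right) (fun r => (hK r).left))).of_succ
  have hDH : ∀ r, DiffStar D (H r) := by
    intro r
    rcases eq_or_ne (r:ℝ) 1 with hr | hr
    · have : H r = fun x => x := by funext x; simp [hH, hr]
      rw [this]; exact DiffStar.id D
    · have hr' : 0 < 1 - (r:ℝ) := by have := r.2.2; have := lt_of_le_of_ne this hr; linarith
      have e : ∀ x, H r x - x = (1 - (r:ℝ)) * (F x - x) := fun x => by simp only [hH]; ring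
      refine hDF.of_cmp (hK r) ⟨(1 - (r:ℝ))⁻¹, fun x _ => ?_⟩ ⟨1 - (r:ℝ), fun x _ => ?_⟩
      · rw [e, abs_mul, abs_of_pos hr', ← mul_assoc, inv_mul_cancel₀ hr'.ne', one_mul]
      · rw [e, abs_mul, abs_of_pos hr']
  have hcomm : ∀ r (a b : ℤ) x, ((hK r).perm ^ a) (((hK r).perm ^ b) x) = ((hK r).perm ^ b) (((hK r).perm ^ a) x) := by
    intro r a b x
    rw [← Equiv.Perm.mul_apply, ← Equiv.Perm.mul_apply, ← zpow_add, ← zpow_add, add_comm]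
  let γ : unitInterval → PairStar D := fun r =>
    ⟨(⇑((hK r).perm ^ q), ⇑((hK r).perm ^ q')), (hDH r).zpow (hK r) q, (hDH r).zpow (hK r) q', fun x _ => hcomm r q q' x⟩
  have hH0 : ∀ x ∈ Icc (0:ℝ) 1, h x = H 0 x := fun x hx => by simp [hH, he x hx]
  refine joined_of_family p (fun k => CK.zpowPerm hK (hHck k) (hKck k) q) (fun k => CK.zpowPerm hK (hHck k) (hKck k) q')
    γ (fun r => rfl) (fun r => ?_) hp (fun x hx => ?_) (fun x hx => ?_) (fun x hx => ?_) (fun x hx => ?_)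
  · right
    exact ⟨H r, K r, hDH r, ⟨fun x _ => (hK r).left x, fun x _ => (hK r).right x⟩, q, q',
      fun x _ => by rw [(hK r).zpowIter_eq], fun x _ => by rw [(hK r).zpowIter_eq]⟩
  · rw [h1 x hx, zpowIter_congr (hK 0) hH0 hi hD.1.2.2.2.2 q x hx, (hK 0).zpowIter_eq]
  · rw [h2 x hx, zpowIter_congr (hK 0) hH0 hi hD.1.2.2.2.2 q' x hx, (hK 0).zpowIter_eq]
  all_goals
    have : (hK 1).perm = 1 := by
      ext y
      show H 1 y = y
      simp [hH]
    simp [this]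
end

section
theorem Fl.ck {ξ : ℝ → ℝ} {φ : ℝ → ℝ → ℝ} (h : Fl ξ φ) (hs : Sup12 ξ) {k : ℕ}
    (hξ : ContDiff ℝ (k + 1 : ℕ) ξ) : CK (k + 1) φ := by
  have := flow_CK (Λ := Unit) (ξ := fun _ => ξ) (φ := fun _ => φ) (CK.fn hξ) (fun _ => hs) (fun _ => h)
  exact this.param (g := fun t : ℝ => (((), t) : Unit × ℝ)) (by fun_prop)

theorem Fl.jc {ξ : ℝ → ℝ} {φ : ℝ → ℝ → ℝ} (h : Fl ξ φ) (hs : Sup12 ξ)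
    (hξ : ContDiff ℝ 1 ξ) : Continuous (fun z : ℝ × ℝ => φ z.1 z.2) :=
  (h.ck hs (k := 0) (by exact_mod_cast hξ)).cont

/-- time factor of the displacement -/
noncomputable def Jf (ξ : ℝ → ℝ) (φ : ℝ → ℝ → ℝ) (t x : ℝ) : ℝ :=
  ∫ s in (0:ℝ)..t, Real.exp (∫ r in (0:ℝ)..s, deriv ξ (φ r x))

section
variable {ξ : ℝ → ℝ} {φ : ℝ → ℝ → ℝ}

theorem Fl.field (h : Fl ξ φ) (hξ : ContDiff ℝ 1 ξ) (t x : ℝ) :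
    ξ (φ t x) = ξ x * Real.exp (∫ r in (0:ℝ)..t, deriv ξ (φ r x)) := by
  have hc : Continuous (fun s => φ s x) :=
    continuous_iff_continuousAt.2 fun s => (h.2 s x).continuousAt
  have := lin_ode (D := fun t => ξ (φ t x)) (q := fun s => deriv ξ (φ s x))
    ((hξ.continuous_deriv le_rfl).comp hc) (fun t =>
      ((hξ.differentiable (by simp)) (φ t x)).hasDerivAt.comp t (h.2 t x)) t
  simpa [h.1] using this

theorem Fl.inner_cont (h : Fl ξ φ) (hs : Sup12 ξ) (hξ : ContDiff ℝ 1 ξ) :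
    Continuous (fun z : ℝ × ℝ => Real.exp (∫ r in (0:ℝ)..z.1, deriv ξ (φ r z.2))) := by
  have hj := h.jc hs hξ
  apply Real.continuous_exp.comp
  refine intervalIntegral.continuous_parametric_intervalIntegral_of_continuous (a₀ := 0)
    (f := fun (z : ℝ × ℝ) r => deriv ξ (φ r z.2)) ?_ continuous_fst
  exact (hξ.continuous_deriv le_rfl).comp
    (hj.comp (show Continuous (fun w : (ℝ × ℝ) × ℝ => ((w.2, w.1.2) : ℝ × ℝ)) by fun_prop))

theorem Fl.disp (h : Fl ξ φ) (hs : Sup12 ξ) (hξ : ContDiff ℝ 1 ξ) (t x : ℝ) :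
    φ t x - x = ξ x * Jf ξ φ t x := by
  have hc : Continuous (fun s => ξ (φ s x)) :=
    hξ.continuous.comp (continuous_iff_continuousAt.2 fun s => (h.2 s x).continuousAt)
  have := intervalIntegral.integral_eq_sub_of_hasDerivAt (a := 0) (b := t) (fun s _ => h.2 s x)
    (hc.intervalIntegrable _ _)
  rw [h.1] at this
  rw [← this, Jf, ← intervalIntegral.integral_const_mul]
  exact intervalIntegral.integral_congr fun s _ => h.field hξ s x

theorem Jf_cont (h : Fl ξ φ) (hs : Sup12 ξ) (hξ : ContDiff ℝ 1 ξ) (t : ℝ) : Continuous (Jf ξ φ t) := by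
  unfold Jf
  apply intervalIntegral.continuous_parametric_intervalIntegral_of_continuous'
  exact (h.inner_cont hs hξ).comp (show Continuous (fun w : ℝ × ℝ => ((w.2, w.1) : ℝ × ℝ)) by fun_prop)

theorem Jf_strictMono (h : Fl ξ φ) (hs : Sup12 ξ) (hξ : ContDiff ℝ 1 ξ) (x : ℝ) :
    StrictMono (fun t => Jf ξ φ t x) := by
  have hc : Continuous (fun s => Real.exp (∫ r in (0:ℝ)..s, deriv ξ (φ r x))) :=
    (h.inner_cont hs hξ).comp (show Continuous (fun s : ℝ => ((s, x) : ℝ × ℝ)) by fun_prop)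
  apply strictMono_of_deriv_pos
  intro t
  have : HasDerivAt (fun t => Jf ξ φ t x) _ t := intervalIntegral.integral_hasDerivAt_right (hc.intervalIntegrable _ _)
      (hc.stronglyMeasurableAtFilter _ _) hc.continuousAt
  rw [this.deriv]
  exact Real.exp_pos _

theorem Jf_ne (h : Fl ξ φ) (hs : Sup12 ξ) (hξ : ContDiff ℝ 1 ξ) {t : ℝ} (ht : t ≠ 0) (x : ℝ) :
    Jf ξ φ t x ≠ 0 := by
  have h0 : Jf ξ φ 0 x = 0 := by simp [Jf]
  rw [← h0]
  exact fun e => ht ((Jf_strictMono h hs hξ x).injective e)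

theorem Fl.fix (h : Fl ξ φ) (hs : Sup12 ξ) (hξ : ContDiff ℝ 1 ξ) {x : ℝ} (hx : ξ x = 0) (t : ℝ) : φ t x = x := by
  have := h.disp hs hξ t x
  rw [hx, zero_mul] at this
  linarith

theorem Fl.sm (h : Fl ξ φ) (hs : Sup12 ξ) (hξ : Sm ξ) (t : ℝ) : Sm (φ t) :=
  contDiff_infty.2 fun n => ((h.ck hs (k := n) (hξ.of_le (by exact_mod_cast le_top))).of_succ).contDiff t

theorem Fl.inv (h : Fl ξ φ) (hs : Sup12 ξ) (hξ : ContDiff ℝ 1 ξ) (t x : ℝ) : φ (-t) (φ t x) = x := by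
  obtain ⟨K, L, hK, -⟩ := hs.lip hξ
  rw [← h.add hK]
  simp [h.1]

theorem Fl.gdiff (h : Fl ξ φ) (hs : Sup12 ξ) (hξ : Sm ξ) (h0 : ξ 0 = 0) (h1 : ξ 1 = 0) (t : ℝ) :
    GDiff (φ t) (φ (-t)) := by
  refine ⟨h.sm hs hξ t, h.sm hs hξ (-t), h.inv hs hξ.one t, fun x => ?_, fun x => ?_,
    h.fix hs hξ.one h0 t, h.fix hs hξ.one h1 t⟩
  · have := h.inv hs hξ.one (-t) x
    simpa using this
  · rw [(h.hasDerivAt hξ.one (h.jc hs hξ.one) t x).deriv]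
    exact Real.exp_pos _

theorem Fl.cmp1 (h : Fl ξ φ) (hs : Sup12 ξ) (hξ : ContDiff ℝ 1 ξ) (t : ℝ) :
    ∃ C, ∀ x ∈ Icc (0:ℝ) 1, |φ t x - x| ≤ C * |ξ x| := by
  obtain ⟨C, hC⟩ := (isCompact_Icc (a := (0:ℝ)) (b := 1)).exists_bound_of_continuousOn (Jf_cont h hs hξ t).continuousOn
  refine ⟨C, fun x hx => ?_⟩
  rw [h.disp hs hξ, abs_mul, mul_comm]
  exact mul_le_mul_of_nonneg_right (hC x hx) (abs_nonneg _)

theorem Fl.cmp2 (h : Fl ξ φ) (hs : Sup12 ξ) (hξ : ContDiff ℝ 1 ξ) {t : ℝ} (ht : t ≠ 0) :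
    ∃ C, ∀ x ∈ Icc (0:ℝ) 1, |ξ x| ≤ C * |φ t x - x| := by
  obtain ⟨C, hC⟩ := (isCompact_Icc (a := (0:ℝ)) (b := 1)).exists_bound_of_continuousOn
    ((Jf_cont h hs hξ t).inv₀ (fun x => Jf_ne h hs hξ ht x)).continuousOn
  refine ⟨C, fun x hx => ?_⟩
  have e : ξ x = (Jf ξ φ t x)⁻¹ * (φ t x - x) := by
    rw [h.disp hs hξ]
    have := Jf_ne h hs hξ ht x
    field_simp
  conv_lhs => rw [e]
  rw [abs_mul]
  exact mul_le_mul_of_nonneg_right (hC x hx) (abs_nonneg _)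

theorem Fl.flat_iff (h : Fl ξ φ) (hs : Sup12 ξ) (hξ : Sm ξ) {t : ℝ} (ht : t ≠ 0) {p : ℝ} (hp : p ∈ Icc (0:ℝ) 1) :
    ITIat (φ t) p ↔ Flat ξ p := by
  rw [ITI_iff (h.sm hs hξ t)]
  obtain ⟨C1, h1⟩ := h.cmp1 hs hξ.one t
  obtain ⟨C2, h2⟩ := h.cmp2 hs hξ.one ht
  exact ⟨flat_of_bound hξ ((h.sm hs hξ t).sub contDiff_id) hp h2,
    flat_of_bound ((h.sm hs hξ t).sub contDiff_id) hξ hp h1⟩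

/-- flows of fields flat exactly on `D` -/
theorem Fl.diffStar {D : Set ℝ} (h : Fl ξ φ) (hs : Sup12 ξ) (hξ : Sm ξ) (h0 : ξ 0 = 0) (h1 : ξ 1 = 0)
    (hD : ∀ p ∈ Icc (0:ℝ) 1, Flat ξ p ↔ p ∈ D) (t : ℝ) : DiffStar D (φ t) := by
  refine ⟨(h.gdiff hs hξ h0 h1 t).sdi, ?_⟩
  rcases eq_or_ne t 0 with rfl | ht
  · left; exact fun x _ => h.1 x
  · right; intro p hp
    rw [h.flat_iff hs hξ ht hp, hD p hp]

theorem Fl.comm (h : Fl ξ φ) (hs : Sup12 ξ) (hξ : Sm ξ) (s t x : ℝ) : φ s (φ t x) = φ t (φ s x) := by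
  obtain ⟨K, L, hK, -⟩ := hs.lip hξ.one
  rw [← h.add hK, ← h.add hK, add_comm]

theorem Fl.isFlowOn (h : Fl ξ φ) (hs : Sup12 ξ) (hξ : Sm ξ) (h0 : ξ 0 = 0) (h1 : ξ 1 = 0) : IsFlowOn ξ φ 0 1 :=
  ⟨fun x _ => h.1 x, fun x hx t => ⟨(h.gdiff hs hξ h0 h1 t).mapsTo hx, h.2 t x⟩⟩

end

theorem exists_cut : ∃ χ : ℝ → ℝ, Sm χ ∧ (∀ x ∈ Icc (0:ℝ) 1, χ x = 1) ∧ Sup12 χ := by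
  obtain ⟨χ, a, b, c, -⟩ := exists_bump (r := 1) one_pos
  refine ⟨χ, a, b, fun x hx => c x fun h => hx ⟨h.1.le, by linarith [h.2]⟩⟩

theorem exists_global_flow {ξ : ℝ → ℝ} {φ : ℝ → ℝ → ℝ} (hξ : Sm ξ) (h : IsFlowOn ξ φ 0 1) :
    ∃ ξ' φ', Sm ξ' ∧ Sup12 ξ' ∧ Fl ξ' φ' ∧ ξ' 0 = 0 ∧ ξ' 1 = 0 ∧
      ∀ t, ∀ x ∈ Icc (0:ℝ) 1, φ t x = φ' t x := by
  obtain ⟨χ, a, b, c⟩ := exists_cut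
  have hs : Sup12 (fun x => χ x * ξ x) := fun x hx => by simp [c x hx]
  have hsm : Sm (fun x => χ x * ξ x) := a.mul hξ
  obtain ⟨φ', hφ'⟩ := Fl.exists hs hsm.one
  have z : ∀ x ∈ Icc (0:ℝ) 1, (x = 0 ∨ x = 1) → ξ x = 0 := by
    intro x hx h01
    have hd := (h.2 x hx 0).2
    rw [h.1 x hx] at hd
    rcases h01 with rfl | rfl
    · refine IsLocalMin.hasDerivAt_eq_zero (f := fun s => φ s 0) (a := 0) ?_ hd
      refine Eventually.of_forall fun s => ?_
      simp only [h.1 0 hx]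
      exact (h.2 0 hx s).1.1
    · refine IsLocalMax.hasDerivAt_eq_zero (f := fun s => φ s 1) (a := 0) ?_ hd
      refine Eventually.of_forall fun s => ?_
      simp only [h.1 1 hx]
      exact (h.2 1 hx s).1.2
  refine ⟨_, φ', hsm, hs, hφ', by simp [z 0 (by simp) (Or.inl rfl)], by simp [z 1 (by simp) (Or.inr rfl)], fun t x hx => ?_⟩
  obtain ⟨K, L, hK, -⟩ := hs.lip hsm.one
  have := hφ'.unique hK (α := fun t => φ t x) (fun t => by
    have h2 := h.2 x hx t
    rw [b _ h2.1, one_mul]; exact h2.2) t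
  simpa [h.1 x hx] using this

theorem joined_flow {D : Set ℝ} (p : PairStar D) (hp : p ∈ CleanPairs D) {ξ : ℝ → ℝ} {φ : ℝ → ℝ → ℝ}
    (hξ : Sm ξ) (hφ : IsFlowOn ξ φ 0 1) (s t : ℝ)
    (h1 : ∀ x ∈ Icc (0 : ℝ) 1, p.1.1 x = φ s x) (h2 : ∀ x ∈ Icc (0 : ℝ) 1, p.1.2 x = φ t x) :
    JoinedIn (CleanPairs D) p (idPair D) := by
  obtain ⟨ξ', φ', a, b, c, d, e, f⟩ := exists_global_flow hξ hφ
  have hck : ∀ (s : ℝ) k, CK k (fun r : unitInterval => φ' ((1 - (r:ℝ)) * s)) := fun s k =>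
    ((c.ck b (k := k) (a.of_le (by exact_mod_cast le_top))).of_succ).param
      (g := fun r : unitInterval => (1 - (r:ℝ)) * s) (by fun_prop)
  have main : ∀ (s : ℝ) (P : ℝ → ℝ), DiffStar D P → (∀ x ∈ Icc (0:ℝ) 1, P x = φ s x) →
      ∀ r : unitInterval, DiffStar D (φ' ((1 - (r:ℝ)) * s)) := by
    intro s P hP hPe r
    have hPs : DiffStar D (φ' s) := hP.congr (c.sm b a s) (fun x hx => by rw [hPe x hx, f s x hx])
    rcases eq_or_ne ((1 - (r:ℝ)) * s) 0 with h0 | h0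
    · rw [h0]
      have : φ' 0 = fun x => x := funext c.1
      rw [this]; exact DiffStar.id D
    · have hs0 : s ≠ 0 := fun h => h0 (by simp [h])
      obtain ⟨C1, k1⟩ := c.cmp1 b a.one s
      obtain ⟨C2, k2⟩ := c.cmp2 b a.one hs0
      obtain ⟨C3, k3⟩ := c.cmp1 b a.one ((1 - (r:ℝ)) * s)
      obtain ⟨C4, k4⟩ := c.cmp2 b a.one h0
      refine hPs.of_cmp (c.gdiff b a d e _) ⟨|C1| * C4, fun x hx => ?_⟩ ⟨|C3| * C2, fun x hx => ?_⟩
      · calc _ ≤ C1 * |ξ' x| := k1 x hx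
          _ ≤ |C1| * |ξ' x| := by gcongr; exact le_abs_self _
          _ ≤ |C1| * (C4 * _) := by gcongr; exact k4 x hx
          _ = _ := by ring
      · calc _ ≤ C3 * |ξ' x| := k3 x hx
          _ ≤ |C3| * |ξ' x| := by gcongr; exact le_abs_self _
          _ ≤ |C3| * (C2 * _) := by gcongr; exact k2 x hx
          _ = _ := by ring
  let γ : unitInterval → PairStar D := fun r =>
    ⟨(φ' ((1 - (r:ℝ)) * s), φ' ((1 - (r:ℝ)) * t)), main s _ p.2.1 h1 r, main t _ p.2.2.1 h2 r,
      fun x _ => c.comm b a _ _ _⟩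
  refine joined_of_family p (hck s) (hck t) γ (fun r => rfl) (fun r => ?_) hp (fun x hx => ?_) (fun x hx => ?_)
    (fun x hx => ?_) (fun x hx => ?_)
  · left
    exact ⟨ξ', φ', a, c.isFlowOn b a d e, _, _, fun x _ => rfl, fun x _ => rfl⟩
  · rw [h1 x hx, f s x hx]; simp
  · rw [h2 x hx, f t x hx]; simp
  · simp [c.1]
  · simp [c.1]

theorem cleanPairs_pathConnected (D : Set ℝ) : IsPathConnected (CleanPairs D) := by
  refine ⟨idPair D, id_clean D, fun {p} hp => JoinedIn.symm ?_⟩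
  rcases id hp with ⟨ξ, φ, a, b, s, t, h1, h2⟩ | ⟨h, hinv, a, b, q, q', h1, h2⟩
  · exact joined_flow p hp a b s t h1 h2
  · exact joined_iter p hp a b q q' h1 h2
end

section
theorem CK.inv {P : Type*} [TopologicalSpace P] {k : ℕ} : ∀ {F : P → ℝ → ℝ}, CK k F → (∀ p x, F p x ≠ 0) →
    CK k (fun p x => (F p x)⁻¹) := by
  induction k with
  | zero => intro F hF h; exact Continuous.inv₀ hF (fun z => h z.1 z.2)
  | succ k ih =>
    intro F hF h
    have hi := ih hF.of_succ h
    obtain ⟨h0, F', h1, h2⟩ := id hF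
    refine ⟨h0.inv₀ (fun z => h z.1 z.2), fun p x => (0 - F' p x) * ((F p x)⁻¹ * (F p x)⁻¹), fun p x => ?_,
      ((CK.pconst continuous_const).sub h2).mul (hi.mul hi)⟩
    refine (HasDerivAt.fun_inv (h1 p x) (h p x)).congr_deriv ?_
    have := h p x
    field_simp
    ring

/-- log b - log a factor -/
theorem log_factor {a b : ℝ → ℝ} (ha : Sm a) (hb : Sm b) (pa : ∀ x, 0 < a x) (pb : ∀ x, 0 < b x) :
    ∃ l, Sm l ∧ ∀ x, Real.log (b x) - Real.log (a x) = (b x - a x) * l x := by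
  have hp : ∀ θ ∈ Icc (0:ℝ) 1, ∀ x, 0 < (1 - θ) * a x + θ * b x := by
    intro θ hθ x
    have := pa x; have := pb x
    rcases eq_or_lt_of_le hθ.1 with h | h
    · subst h; simpa using pa x
    · have := mul_pos h (pb x)
      have := mul_nonneg (sub_nonneg.2 hθ.2) (pa x).le
      linarith
  -- clamp θ
  let cl : ℝ → ℝ := fun θ => max 0 (min 1 θ)
  have hcl : Continuous cl := by fun_prop
  have hcl' : ∀ θ, cl θ ∈ Icc (0:ℝ) 1 := fun θ => ⟨le_max_left _ _, max_le zero_le_one (min_le_left _ _)⟩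
  have hcl2 : ∀ θ ∈ Icc (0:ℝ) 1, cl θ = θ := fun θ h => by
    simp only [cl, min_eq_right h.2, max_eq_right h.1]
  refine ⟨fun x => ∫ θ in (0:ℝ)..1, ((1 - cl θ) * a x + cl θ * b x)⁻¹, ?_, ?_⟩
  · rw [sm_iff_CK]
    intro k
    have h1 : CK k (fun (p : Unit × ℝ) x => ((1 - cl p.2) * a x + cl p.2 * b x)⁻¹) := by
      apply CK.inv
      · exact ((CK.pconst (by fun_prop)).mul (ha.ck k)).add ((CK.pconst (by fun_prop)).mul (hb.ck k))
      · intro p x; exact (hp _ (hcl' _) x).ne'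
    exact (CK.integral h1).param (Q := Unit) (g := fun u => (u, (1:ℝ))) (by fun_prop)
  · intro x
    have h1 : ∀ θ ∈ uIcc (0:ℝ) 1, HasDerivAt (fun θ => Real.log ((1 - θ) * a x + θ * b x))
        ((b x - a x) * ((1 - cl θ) * a x + cl θ * b x)⁻¹) θ := by
      intro θ hθ
      rw [uIcc_of_le zero_le_one] at hθ
      rw [hcl2 θ hθ]
      have h2 : HasDerivAt (fun θ => (1 - θ) * a x + θ * b x) (b x - a x) θ := by
        refine ((((hasDerivAt_id θ).const_sub 1).mul_const (a x)).add ((hasDerivAt_id θ).mul_const (b x))).congr_deriv ?_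
        ring
      refine (h2.log (hp θ hθ x).ne').congr_deriv ?_
      rw [div_eq_mul_inv]
    have hc : Continuous (fun θ => (b x - a x) * ((1 - cl θ) * a x + cl θ * b x)⁻¹) := by
      refine continuous_const.mul (Continuous.inv₀ (by fun_prop) ?_)
      intro θ; exact (hp _ (hcl' _) x).ne'
    have := intervalIntegral.integral_eq_sub_of_hasDerivAt h1 (hc.intervalIntegrable _ _)
    rw [intervalIntegral.integral_const_mul] at this
    rw [this]; simp

/-- Taylor -/
theorem taylor2 {f u : ℝ → ℝ} (hf : Sm f) (hu : Sm u) :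
    ∃ R, Sm R ∧ ∀ x, f (x + u x) - f x = deriv f x * u x + u x * u x * R x := by
  refine ⟨fun x => ∫ θ in (0:ℝ)..1, (1 - θ) * deriv (deriv f) (x + θ * u x), ?_, ?_⟩
  · rw [sm_iff_CK]
    intro k
    have h1 : CK k (fun (p : Unit × ℝ) x => (1 - p.2) * deriv (deriv f) (x + p.2 * u x)) := by
      refine (CK.pconst (by fun_prop)).mul ((hf.deriv.deriv.ck k).comp
        (F := fun (p : Unit × ℝ) x => x + p.2 * u x) ?_)
      exact (CK.fn contDiff_id).add ((CK.pconst (by fun_prop)).mul (hu.ck k))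
    exact (CK.integral h1).param (Q := Unit) (g := fun u => (u, (1:ℝ))) (by fun_prop)
  · intro x
    have h1 : ∀ θ ∈ uIcc (0:ℝ) 1, HasDerivAt (fun θ => (1 - θ) * (deriv f (x + θ * u x) * u x) + f (x + θ * u x))
        (u x * u x * ((1 - θ) * deriv (deriv f) (x + θ * u x))) θ := by
      intro θ _
      have h2 : HasDerivAt (fun θ => x + θ * u x) (u x) θ := by
        simpa using ((hasDerivAt_id θ).mul_const (u x)).const_add x
      have h3 := (hf.has (x + θ * u x)).comp θ h2
      have h4 := ((hf.deriv.has (x + θ * u x)).comp θ h2).mul_const (u x)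
      refine ((((hasDerivAt_id θ).const_sub 1).fun_mul h4).add h3).congr_deriv ?_
      simp only [Function.comp_apply, id]
      ring
    have hc : Continuous (fun θ => u x * u x * ((1 - θ) * deriv (deriv f) (x + θ * u x))) := by
      have := hf.deriv.deriv.continuous
      fun_prop
    have := intervalIntegral.integral_eq_sub_of_hasDerivAt h1 (hc.intervalIntegrable _ _)
    rw [intervalIntegral.integral_const_mul] at this
    rw [this]; simp; ring

structure GDE (F G : ℝ → ℝ) : Prop extends GDiff F G where
  m1 : F (-1) = -1
  two : F 2 = 2

theorem GDE.symm {F G : ℝ → ℝ} (h : GDE F G) : GDE G F :=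
  { h.toGDiff.symm with
    m1 := by have := h.left (-1); rwa [h.m1] at this
    two := by have := h.left 2; rwa [h.two] at this }

theorem GDE.mapsTo2 {F G : ℝ → ℝ} (h : GDE F G) : MapsTo F (Icc (-1:ℝ) 2) (Icc (-1:ℝ) 2) := by
  intro x hx
  have h1 := h.mono.monotone hx.1
  have h2 := h.mono.monotone hx.2
  rw [h.m1] at h1; rw [h.two] at h2
  exact ⟨h1, h2⟩

theorem GDiff.exists_GDE {F₀ G₀ : ℝ → ℝ} (h : GDiff F₀ G₀) : ∃ F G, GDE F G ∧ ∀ x ∈ Icc (0:ℝ) 1, F x = F₀ x := by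
  have hcd : Continuous (deriv F₀) := h.sm.deriv.continuous
  have hc := h.sm.continuous
  obtain ⟨r, hr, hr1, hr2, hr3⟩ : ∃ r > 0, r ≤ 1/2 ∧ F₀ (1 + r) < 2 ∧ -1 < F₀ (-r) := by
    have e1 : ∀ᶠ r in 𝓝[>] (0:ℝ), F₀ (1 + r) < 2 := nhdsWithin_le_nhds
      (ContinuousAt.eventually_lt (f := fun r => F₀ (1 + r)) (by fun_prop) continuousAt_const (by simp [h.one]))
    have e2 : ∀ᶠ r in 𝓝[>] (0:ℝ), -1 < F₀ (-r) := nhdsWithin_le_nhds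
      (ContinuousAt.eventually_lt (g := fun r => F₀ (-r)) continuousAt_const (by fun_prop) (by simp [h.zero]))
    have e3 : ∀ᶠ r in 𝓝[>] (0:ℝ), r ≤ 1/2 := nhdsWithin_le_nhds (eventually_le_nhds (by norm_num))
    obtain ⟨r, hr⟩ := ((e1.and e2).and (e3.and self_mem_nhdsWithin)).exists
    exact ⟨r, hr.2.2, hr.2.1, hr.1.1, hr.1.2⟩
  obtain ⟨χ, c1, c2, c3, c4⟩ := exists_bump hr
  have cc := c1.continuous
  have hintg : ∀ a b, IntervalIntegrable (fun x => χ x * deriv F₀ x) MeasureTheory.volume a b := fun a b =>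
    (cc.mul hcd).intervalIntegrable _ _
  have hintg' : ∀ a b, IntervalIntegrable (fun x => 1 - χ x) MeasureTheory.volume a b := fun a b =>
    (continuous_const.sub cc).intervalIntegrable _ _
  have part : ∀ a b, a ≤ b → (∀ x ∈ Icc a b, x ∉ Ioo (-r) (1+r)) → (∫ x in a..b, χ x * deriv F₀ x) = 0 ∧
      (∫ x in a..b, (1 - χ x)) = b - a := by
    intro a b hab hx
    constructor
    · rw [intervalIntegral.integral_congr (g := fun _ => (0:ℝ))]
      · simp
      · intro x hx'
        rw [uIcc_of_le hab] at hx'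
        simp [c3 x (hx x hx')]
    · rw [intervalIntegral.integral_congr (g := fun _ => (1:ℝ))]
      · simp
      · intro x hx'
        rw [uIcc_of_le hab] at hx'
        simp [c3 x (hx x hx')]
  have le : ∀ a b, a ≤ b → (∫ x in a..b, χ x * deriv F₀ x) ≤ F₀ b - F₀ a ∧ 0 ≤ ∫ x in a..b, (1 - χ x) := by
    intro a b hab
    constructor
    · rw [← intervalIntegral.integral_deriv_eq_sub (fun y _ => h.sm.diff y) (hcd.intervalIntegrable _ _)]
      apply intervalIntegral.integral_mono_on hab (hintg a b) (hcd.intervalIntegrable _ _)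
      intro x _
      have := (c4 x).2
      have := h.pos x
      nlinarith
    · apply intervalIntegral.integral_nonneg hab
      intro x _
      linarith [(c4 x).2]
  have solve : ∀ a b, (∫ x in a..b, χ x * deriv F₀ x) < 1 → 0 < (∫ x in a..b, (1 - χ x)) → ∃ c > 0,
      (∫ x in a..b, (χ x * deriv F₀ x + c * (1 - χ x))) = 1 := by
    intro a b h1 h2
    refine ⟨(1 - ∫ x in a..b, χ x * deriv F₀ x) / (∫ x in a..b, (1 - χ x)), div_pos (by linarith) h2, ?_⟩
    rw [intervalIntegral.integral_add (hintg a b) ((hintg' a b).const_mul _), intervalIntegral.integral_const_mul]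
    field_simp
    ring
  obtain ⟨cR, cR0, hR⟩ := solve 1 2 (by
      rw [← intervalIntegral.integral_add_adjacent_intervals (hintg 1 (1+r)) (hintg _ 2)]
      have := le 1 (1+r) (by linarith)
      have := part (1+r) 2 (by linarith) (fun x hx hx' => by linarith [hx.1, hx'.2])
      linarith [h.one]) (by
      rw [← intervalIntegral.integral_add_adjacent_intervals (hintg' 1 (1+r)) (hintg' _ 2)]
      have := le 1 (1+r) (by linarith)
      have := part (1+r) 2 (by linarith) (fun x hx hx' => by linarith [hx.1, hx'.2])
      linarith)
  obtain ⟨cL, cL0, hL⟩ := solve (-1) 0 (by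
      rw [← intervalIntegral.integral_add_adjacent_intervals (hintg (-1) (-r)) (hintg _ 0)]
      have := le (-r) 0 (by linarith)
      have := part (-1) (-r) (by linarith) (fun x hx hx' => by linarith [hx.2, hx'.1])
      linarith [h.zero]) (by
      rw [← intervalIntegral.integral_add_adjacent_intervals (hintg' (-1) (-r)) (hintg' _ 0)]
      have := le (-r) 0 (by linarith)
      have := part (-1) (-r) (by linarith) (fun x hx hx' => by linarith [hx.2, hx'.1])
      linarith)
  set st : ℝ → ℝ := Real.smoothTransition with hst
  have sts : Sm st := Real.smoothTransition.contDiff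
  set g : ℝ → ℝ := fun x => χ x * deriv F₀ x + (cL + (cR - cL) * st x) * (1 - χ x) with hg
  have hgs : Sm g := (c1.mul h.sm.deriv).add ((contDiff_const.add (contDiff_const.mul sts)).mul (contDiff_const.sub c1))
  set F : ℝ → ℝ := fun x => ∫ s in (0:ℝ)..x, g s with hFd
  have hFder : ∀ x, HasDerivAt F (g x) x := fun x =>
    intervalIntegral.integral_hasDerivAt_right (hgs.continuous.intervalIntegrable _ _)
      (hgs.continuous.stronglyMeasurableAtFilter _ _) hgs.continuous.continuousAt
  have hde : deriv F = g := funext fun x => (hFder x).deriv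
  have hFs : Sm F := contDiff_infty_iff_deriv.2 ⟨fun x => (hFder x).differentiableAt, by rw [hde]; exact hgs⟩
  have heq : ∀ x ∈ Icc (0:ℝ) 1, F x = F₀ x := by
    intro x hx
    have : ∫ s in (0:ℝ)..x, g s = ∫ s in (0:ℝ)..x, deriv F₀ s := by
      apply intervalIntegral.integral_congr
      intro s hs
      rw [uIcc_of_le hx.1] at hs
      simp [hg, c2 s ⟨hs.1, hs.2.trans hx.2⟩]
    rw [hFd]; simp only
    rw [this, intervalIntegral.integral_deriv_eq_sub (fun y _ => h.sm.diff y) (hcd.intervalIntegrable _ _), h.zero, sub_zero]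
  obtain ⟨m, hm, hmm⟩ : ∃ m > 0, ∀ x ∈ Icc (-r) (1 + r), m ≤ deriv F₀ x := by
    obtain ⟨y, hy, hmin⟩ := isCompact_Icc.exists_isMinOn (nonempty_Icc.2 (by linarith : -r ≤ 1 + r)) hcd.continuousOn
    exact ⟨deriv F₀ y, h.pos y, fun x hx => hmin hx⟩
  have hst1 : ∀ x, min cL cR ≤ cL + (cR - cL) * st x := by
    intro x
    have h0 := Real.smoothTransition.nonneg x
    have h1 := Real.smoothTransition.le_one x
    have : min cL cR ≤ cL := min_le_left _ _
    have : min cL cR ≤ cR := min_le_right _ _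
    simp only [hst]
    nlinarith
  have hlow : ∀ x, min m (min cL cR) ≤ deriv F x := by
    intro x
    rw [hde]
    simp only [hg]
    have h3 : min m (min cL cR) ≤ m := min_le_left _ _
    have h4 : min m (min cL cR) ≤ min cL cR := min_le_right _ _
    have h5 := hst1 x
    by_cases hx : x ∈ Ioo (-r) (1 + r)
    · have h1 := hmm x (Ioo_subset_Icc_self hx)
      have h2 := c4 x
      nlinarith [h2.1, h2.2]
    · rw [c3 x hx, zero_mul, zero_add, sub_zero, mul_one]; linarith
  have hF1 : F 1 = 1 := by rw [heq 1 (by simp), h.one]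
  obtain ⟨G, hG⟩ := gdiff_of hFs (lt_min hm (lt_min cL0 cR0)) hlow (by simp [hFd]) hF1
  have gint : ∀ a b, IntervalIntegrable g MeasureTheory.volume a b := fun a b => hgs.continuous.intervalIntegrable _ _
  refine ⟨F, G, { hG with m1 := ?_, two := ?_ }, heq⟩
  · have : ∫ s in (-1:ℝ)..0, g s = 1 := by
      refine Eq.trans ?_ hL
      apply intervalIntegral.integral_congr
      intro s hs
      rw [uIcc_of_le (by norm_num)] at hs
      simp [hg, hst, Real.smoothTransition.zero_of_nonpos hs.2]
    rw [hFd]; simp only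
    rw [intervalIntegral.integral_symm, this]
  · have : ∫ s in (1:ℝ)..2, g s = 1 := by
      refine Eq.trans ?_ hR
      apply intervalIntegral.integral_congr
      intro s hs
      rw [uIcc_of_le (by norm_num)] at hs
      simp [hg, hst, Real.smoothTransition.one_of_one_le hs.1]
    have h2 : F 2 = F 1 + ∫ s in (1:ℝ)..2, g s :=
      (intervalIntegral.integral_add_adjacent_intervals (gint 0 1) (gint 1 2)).symm
    rw [h2, this, hF1]; norm_num

structure Sz (F G R : ℝ → ℝ) : Prop where
  gd : GDE F G
  smR : Sm R
  eq : ∀ x, F (F x) - F x = deriv F x * (F x - x) * Real.exp ((F x - x) * R x)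

theorem dq_pos {F G : ℝ → ℝ} (h : GDiff F G) (a b : ℝ) : 0 < dq F a b := by
  have h1 := dq_spec h.sm.one a b
  rcases lt_trichotomy a b with hab | hab | hab
  · have := h.mono hab; nlinarith
  · subst hab; rw [dq_self]; exact h.pos a
  · have := h.mono hab; nlinarith

theorem Sz.exists {F G : ℝ → ℝ} (h : GDE F G) : ∃ R, Sz F G R := by
  have hu : Sm (fun x => F x - x) := h.sm.sub contDiff_id
  obtain ⟨R, hR, e⟩ := taylor2 h.sm hu
  have hq : Sm (fun x => dq F (F x) x) := dq_smooth h.sm h.sm contDiff_id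
  obtain ⟨l, hl, el⟩ := log_factor h.sm.deriv hq h.pos (fun x => dq_pos h.toGDiff _ _)
  refine ⟨fun x => R x * l x, h, hR.mul hl, fun x => ?_⟩
  have h1 := dq_spec h.sm.one (F x) x
  by_cases hx : F x - x = 0
  · have : F x = x := by linarith
    simp [this]
  have h2 : dq F (F x) x - deriv F x = (F x - x) * R x := by
    have := e x
    rw [show x + (F x - x) = F x by ring, h1] at this
    apply mul_left_cancel₀ hx; linarith
  have h3 := el x
  rw [h2] at h3
  rw [show (F x - x) * (R x * l x) = Real.log (dq F (F x) x) - Real.log (deriv F x) by rw [h3]; ring,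
    Real.exp_sub, Real.exp_log (dq_pos h.toGDiff _ _), Real.exp_log (h.pos x), h1]
  have := (h.pos x).ne'
  field_simp
end

section
section orbit
variable {F G R : ℝ → ℝ}

theorem GDE.orb_mem (h : GDE F G) {x : ℝ} (hx : x ∈ Icc (-1:ℝ) 2) (n : ℕ) : F^[n] x ∈ Icc (-1:ℝ) 2 :=
  (h.mapsTo2.iterate n) hx

theorem GDiff.iter_mono (h : GDiff F G) (n : ℕ) : StrictMono (F^[n]) := h.mono.iterate n

theorem GDiff.orb_part (h : GDiff F G) (x : ℝ) (n : ℕ) :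
    ∑ i ∈ Finset.range n, |F^[i+1] x - F^[i] x| = |F^[n] x - x| := by
  rcases le_total x (F x) with hx | hx
  · have hm : Monotone (fun n => F^[n] x) := h.mono.monotone.monotone_iterate_of_le_map hx
    have : ∀ i, |F^[i+1] x - F^[i] x| = F^[i+1] x - F^[i] x := fun i =>
      abs_of_nonneg (sub_nonneg.2 (hm (Nat.le_succ i)))
    simp_rw [this]
    rw [Finset.sum_range_sub (fun i => F^[i] x)]
    exact (abs_of_nonneg (sub_nonneg.2 (hm (Nat.zero_le n)))).symm
  · have hm : Antitone (fun n => F^[n] x) := h.mono.monotone.antitone_iterate_of_map_le hx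
    have : ∀ i, |F^[i+1] x - F^[i] x| = F^[i] x - F^[i+1] x := fun i => by
      rw [abs_sub_comm]; exact abs_of_nonneg (sub_nonneg.2 (hm (Nat.le_succ i)))
    simp_rw [this]
    rw [Finset.sum_range_sub' (fun i => F^[i] x)]
    rw [abs_sub_comm]
    exact (abs_of_nonneg (sub_nonneg.2 (hm (Nat.zero_le n)))).symm

theorem GDE.orb_summable (h : GDE F G) {x : ℝ} (hx : x ∈ Icc (-1:ℝ) 2) :
    Summable (fun n => |F^[n+1] x - F^[n] x|) ∧ ∑' n, |F^[n+1] x - F^[n] x| ≤ 3 := by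
  have hb : ∀ n, ∑ i ∈ Finset.range n, |F^[i+1] x - F^[i] x| ≤ 3 := by
    intro n
    rw [h.orb_part, abs_le]
    have := h.orb_mem hx n
    constructor <;> linarith [this.1, this.2, hx.1, hx.2]
  have hs := summable_of_sum_range_le (fun n => abs_nonneg _) hb
  exact ⟨hs, hs.tsum_le_of_sum_range_le hb⟩

/-- the sum over the forward orbit -/
noncomputable def So (F a : ℝ → ℝ) (x : ℝ) : ℝ := ∑' n, a (F^[n] x)

theorem So_summable (h : GDE F G) {a : ℝ → ℝ} {x C : ℝ} (hC : 0 ≤ C) (hx : x ∈ Icc (-1:ℝ) 2)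
    (ha : ∀ n, |a (F^[n] x)| ≤ C * |F^[n+1] x - F^[n] x|) :
    Summable (fun n => a (F^[n] x)) ∧ |So F a x| ≤ 3 * C := by
  obtain ⟨h1, h2⟩ := h.orb_summable hx
  have hs : Summable (fun n => |a (F^[n] x)|) :=
    Summable.of_nonneg_of_le (fun n => abs_nonneg _) ha (h1.mul_left C)
  refine ⟨hs.of_abs, ?_⟩
  have h3 : |So F a x| ≤ ∑' n, |a (F^[n] x)| := by
    have := norm_tsum_le_tsum_norm (f := fun n => a (F^[n] x)) (by simpa using hs)
    simpa [So] using this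
  have h4 := hs.tsum_le_tsum ha (h1.mul_left C)
  have h5 := h1.tsum_mul_left C
  rw [h5] at h4
  nlinarith

theorem So_step {a : ℝ → ℝ} {x : ℝ} (hs : Summable (fun n => a (F^[n] x))) :
    So F a x = a x + So F a (F x) := by
  have := hs.tsum_eq_zero_add
  simpa [So] using this

theorem So_tail (a : ℝ → ℝ) (x : ℝ) :
    Tendsto (fun n => So F a (F^[n] x)) atTop (𝓝 0) := by
  have := tendsto_sum_nat_add (fun n => a (F^[n] x))
  simpa only [So, Function.iterate_add_apply] using this

noncomputable def Lf (F R : ℝ → ℝ) (x : ℝ) : ℝ := So F (fun y => (F y - y) * R y) x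
noncomputable def xi (F R : ℝ → ℝ) (x : ℝ) : ℝ := (F x - x) * Real.exp (Lf F R x)

theorem bddI {v : ℝ → ℝ} (hv : Continuous v) : ∃ C, 0 ≤ C ∧ ∀ x ∈ Icc (-1:ℝ) 2, |v x| ≤ C := by
  obtain ⟨C, hC⟩ := isCompact_Icc.exists_bound_of_continuousOn (s := Icc (-1:ℝ) 2) hv.continuousOn
  exact ⟨C, (norm_nonneg _).trans (hC 0 (by norm_num)), fun x hx => hC x hx⟩

theorem Sz.L_bd (h : Sz F G R) : ∃ C, 0 ≤ C ∧ ∀ x ∈ Icc (-1:ℝ) 2,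
    Summable (fun n => (fun y => (F y - y) * R y) (F^[n] x)) ∧ |Lf F R x| ≤ C := by
  obtain ⟨C, hC0, hC⟩ := bddI h.smR.continuous
  refine ⟨3 * C, by positivity, fun x hx => ?_⟩
  refine So_summable (a := fun y => (F y - y) * R y) h.gd hC0 hx fun n => ?_
  show |(F (F^[n] x) - F^[n] x) * R (F^[n] x)| ≤ _
  rw [Function.iterate_succ_apply', abs_mul, mul_comm]
  exact mul_le_mul_of_nonneg_right (hC _ (h.gd.orb_mem hx n)) (abs_nonneg _)

theorem Sz.xi_F (h : Sz F G R) {x : ℝ} (hx : x ∈ Icc (-1:ℝ) 2) : xi F R (F x) = deriv F x * xi F R x := by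
  obtain ⟨C, -, hC⟩ := h.L_bd
  have h1 := So_step (F := F) (a := fun y => (F y - y) * R y) (hC x hx).1
  have h2 := h.eq x
  unfold xi Lf
  rw [h1, h2, Real.exp_add]
  ring

theorem Sz.xi_le (h : Sz F G R) : ∃ C, 0 < C ∧ ∀ x ∈ Icc (-1:ℝ) 2,
    |xi F R x| ≤ C * |F x - x| ∧ |F x - x| ≤ C * |xi F R x| := by
  obtain ⟨C, -, hC⟩ := h.L_bd
  refine ⟨Real.exp C, Real.exp_pos _, fun x hx => ?_⟩
  have h1 := (hC x hx).2
  rw [abs_le] at h1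
  have h2 : Real.exp (Lf F R x) ≤ Real.exp C := Real.exp_le_exp.2 h1.2
  have h3 : 1 ≤ Real.exp C * Real.exp (Lf F R x) := by
    rw [← Real.exp_add]; exact Real.one_le_exp (by linarith)
  unfold xi
  rw [abs_mul, abs_of_pos (Real.exp_pos _)]
  have := abs_nonneg (F x - x)
  constructor <;> nlinarith

theorem xi_ne {x : ℝ} (hx : F x ≠ x) : xi F R x ≠ 0 := by
  unfold xi; exact mul_ne_zero (sub_ne_zero.2 hx) (Real.exp_pos _).ne'

theorem GDiff.iter_ne (h : GDiff F G) {x : ℝ} (hx : F x ≠ x) (n : ℕ) : F (F^[n] x) ≠ F^[n] x := by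
  rw [← Function.iterate_succ_apply' F, Function.iterate_succ_apply]
  exact fun e => hx ((h.iter_mono n).injective e)

theorem Sz.iter_deriv (h : Sz F G R) {x : ℝ} (hx : x ∈ Icc (-1:ℝ) 2) (hx' : F x ≠ x) (n : ℕ) :
    HasDerivAt (F^[n]) (xi F R (F^[n] x) / xi F R x) x := by
  induction n with
  | zero =>
    have := xi_ne (R := R) hx'
    simpa [this] using hasDerivAt_id x
  | succ n ih =>
    have h1 := (h.gd.sm.has (F^[n] x)).comp x ih
    rw [← Function.iterate_succ'] at h1
    refine h1.congr_deriv ?_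
    rw [Function.iterate_succ_apply', h.xi_F (h.gd.orb_mem hx n)]; ring

theorem abs_sub_le_uIcc {a b x y : ℝ} (hx : x ∈ uIcc a b) (hy : y ∈ uIcc a b) : |x - y| ≤ |a - b| := by
  have := Set.abs_sub_le_of_uIcc_subset_uIcc (uIcc_subset_uIcc hx hy)
  rw [abs_sub_comm, abs_sub_comm a]; exact this

/-- differentiation of orbit sums -/
theorem Sz.So_deriv (h : Sz F G R) {V : Set ℝ} (hV : IsOpen V)
    (hsub : ∀ x ∈ V, x ∈ Ioo (-1:ℝ) 2 ∧ F x ≠ x) (hinv : ∀ x ∈ V, F x ∈ V) {a a' : ℝ → ℝ} {C : ℝ} (hC : 0 ≤ C)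
    (ha : ∀ x ∈ V, |a x| ≤ C * |F x - x|) (hd : ∀ x ∈ V, HasDerivAt a (a' x) x)
    (ha' : ∀ x ∈ V, |a' x| ≤ C) {x : ℝ} (hx : x ∈ V) :
    HasDerivAt (So F a) (So F (fun y => xi F R y * a' y) x / xi F R x) x := by
  obtain ⟨Cx, hCx0, hCx⟩ := h.xi_le
  have hxI := hsub x hx
  have hxx : x ∈ Icc (-1:ℝ) 2 := Ioo_subset_Icc_self hxI.1
  have hVn : ∀ y ∈ V, ∀ n, F^[n] y ∈ V := by
    intro y hy n
    induction n with
    | zero => exact hy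
    | succ n ih => rw [Function.iterate_succ_apply']; exact hinv _ ih
  -- a point β with x strictly between β and F β
  have hβ : ∃ β ∈ Icc (-1:ℝ) 2, uIoo β (F β) ∈ 𝓝 x := by
    rcases lt_or_gt_of_ne hxI.2 with hlt | hgt
    · obtain ⟨β, h1, h2⟩ : ∃ β, x < β ∧ β ≤ 2 ∧ F β < x := by
        have : ∀ᶠ β in 𝓝[>] x, F β < x :=
          nhdsWithin_le_nhds (h.gd.sm.continuous.continuousAt.eventually_lt continuousAt_const hlt)
        have h2 : ∀ᶠ β in 𝓝[>] x, β ≤ 2 := nhdsWithin_le_nhds ((eventually_le_nhds hxI.1.2))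
        obtain ⟨β, hb⟩ := (this.and (h2.and self_mem_nhdsWithin)).exists
        exact ⟨β, hb.2.2, hb.2.1, hb.1⟩
      refine ⟨β, ⟨by linarith [hxI.1.1], h2.1⟩, ?_⟩
      rw [uIoo_of_gt (by linarith)]
      exact Ioo_mem_nhds h2.2 h1
    · obtain ⟨β, h1, h2⟩ : ∃ β, β < x ∧ -1 ≤ β ∧ x < F β := by
        have : ∀ᶠ β in 𝓝[<] x, x < F β :=
          nhdsWithin_le_nhds (continuousAt_const.eventually_lt h.gd.sm.continuous.continuousAt hgt)
        have h2 : ∀ᶠ β in 𝓝[<] x, -1 ≤ β := nhdsWithin_le_nhds ((eventually_ge_nhds hxI.1.1))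
        obtain ⟨β, hb⟩ := (this.and (h2.and self_mem_nhdsWithin)).exists
        exact ⟨β, hb.2.2, hb.2.1, hb.1⟩
      refine ⟨β, ⟨h2.1, by linarith [hxI.1.2]⟩, ?_⟩
      rw [uIoo_of_lt (by linarith)]
      exact Ioo_mem_nhds h1 h2.2
  obtain ⟨β, hβI, hβ⟩ := hβ
  -- lower bound for the displacement near x
  have hux : 0 < |F x - x| := abs_pos.2 (sub_ne_zero.2 hxI.2)
  have hlow : ∀ᶠ y in 𝓝 x, |F x - x| / 2 < |F y - y| := by
    have : ContinuousAt (fun y => |F y - y|) x := by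
      have := h.gd.sm.continuous
      fun_prop
    exact continuousAt_const.eventually_lt this (half_lt_self hux)
  obtain ⟨r, hr, hball⟩ := Metric.eventually_nhds_iff_ball.1
    ((hlow.and hβ).and (hV.mem_nhds hx))
  set t := Metric.ball x r with ht
  have hxt : x ∈ t := Metric.mem_ball_self hr
  let d : ℕ → ℝ := fun n => |F^[n+1] β - F^[n] β|
  have hds : Summable d := (h.gd.orb_summable hβI).1
  have hstep : ∀ y ∈ t, ∀ n, |F^[n+1] y - F^[n] y| ≤ d (n+1) + d n := by
    intro y hy n
    have hy1 : y ∈ uIcc β (F β) := uIoo_subset_uIcc_self (hball y hy).1.2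
    have h1 : ∀ n, F^[n] y ∈ uIcc (F^[n] β) (F^[n+1] β) := by
      intro n
      rw [Function.iterate_succ_apply]
      exact (h.gd.iter_mono n).monotone.mapsTo_uIcc hy1
    have h2 := abs_sub_le_uIcc (h1 (n+1)) left_mem_uIcc
    have h3 := abs_sub_le_uIcc (h1 n) right_mem_uIcc
    have h4 : |F^[n+1] y - F^[n] y| ≤ |F^[n+1] y - F^[n+1] β| + |F^[n] y - F^[n+1] β| := by
      have := abs_sub_le (F^[n+1] y) (F^[n+1] β) (F^[n] y)
      rwa [abs_sub_comm (F^[n+1] β)] at this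
    simp only [d]
    rw [abs_sub_comm (F^[n+1+1] β), abs_sub_comm (F^[n+1] β) (F^[n] β)]
    linarith
  have key := hasDerivAt_tsum_of_isPreconnected (𝕜 := ℝ) (g := fun n y => a (F^[n] y))
    (g' := fun n y => a' (F^[n] y) * (xi F R (F^[n] y) / xi F R y))
    (u := fun n => (C * Cx * (2 * Cx / |F x - x|)) * (d (n+1) + d n)) (t := t)
    (((_root_.summable_nat_add_iff 1).2 hds |>.add hds).mul_left _) Metric.isOpen_ball
    (convex_ball x r).isPreconnected ?_ ?_ hxt ?_ hxt
  · refine key.congr_deriv ?_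
    unfold So
    rw [← tsum_div_const]
    congr 1; funext n; ring
  · intro n y hy
    have hyV := (hball y hy).2
    have hyI := hsub y hyV
    exact (hd _ (hVn y hyV n)).comp y (h.iter_deriv (Ioo_subset_Icc_self hyI.1) hyI.2 n)
  · intro n y hy
    have hyV := (hball y hy).2
    have hyI := hsub y hyV
    have h1 := ha' _ (hVn y hyV n)
    have h2 := (hCx _ (Ioo_subset_Icc_self (hsub _ (hVn y hyV n)).1)).1
    have h3 := (hCx y (Ioo_subset_Icc_self hyI.1)).2
    have h4 := (hball y hy).1.1
    have h5 := hstep y hy n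
    rw [← Function.iterate_succ_apply' F] at h2
    have hxi : |F x - x| / (2 * Cx) ≤ |xi F R y| := by
      rw [div_le_iff₀ (by positivity)]; nlinarith
    rw [Real.norm_eq_abs, abs_mul, abs_div]
    have h6 : |xi F R (F^[n] y)| / |xi F R y| ≤ Cx * (d (n+1) + d n) / (|F x - x| / (2 * Cx)) := by
      apply div_le_div₀ _ _ (by positivity) hxi
      · have : 0 ≤ d (n+1) + d n := by positivity
        positivity
      · exact h2.trans (mul_le_mul_of_nonneg_left h5 hCx0.le)
    calc _ ≤ C * (Cx * (d (n+1) + d n) / (|F x - x| / (2 * Cx))) :=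
          mul_le_mul h1 h6 (by positivity) hC
      _ = _ := by field_simp
  · refine (So_summable h.gd hC hxx fun n => ?_).1
    rw [Function.iterate_succ_apply']
    exact ha _ (hVn x hx n)

end orbit
end

section
section cls
variable {F G R : ℝ → ℝ} {P : ℝ → ℝ → Prop}

structure Dom (F : ℝ → ℝ) (P : ℝ → ℝ → Prop) : Prop where
  opn : ∀ e, IsOpen {x | P x e}
  sub : ∀ x e, P x e → x ∈ Ioo (-1:ℝ) 2 ∧ F x ≠ x
  inv : ∀ x e, P x e → P (F x) e
  e01 : ∀ x e, P x e → 0 < e ∧ e ≤ 1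

def Bc (ξ : ℝ → ℝ) (P : ℝ → ℝ → Prop) (s : ℕ) : ℕ → ℕ → (ℝ → ℝ) → Prop
  | 0, k, h => ∃ C, 0 ≤ C ∧ ∀ x e, P x e → |h x| ≤ C * e ^ k
  | j + 1, k, h => (∃ C, 0 ≤ C ∧ ∀ x e, P x e → |h x| ≤ C * e ^ k) ∧
      ∃ d : ℝ → ℝ, (∀ x e, P x e → HasDerivAt h (d x / ξ x) x) ∧ Bc ξ P s j (k + s) d

namespace Bc
variable {ξ : ℝ → ℝ} {s : ℕ}

theorem bd {j k : ℕ} {h : ℝ → ℝ} (H : Bc ξ P s j k h) : ∃ C, 0 ≤ C ∧ ∀ x e, P x e → |h x| ≤ C * e ^ k := by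
  cases j with
  | zero => exact H
  | succ j => exact H.1

theorem of_succ {j : ℕ} : ∀ {k : ℕ} {h : ℝ → ℝ}, Bc ξ P s (j+1) k h → Bc ξ P s j k h := by
  induction j with
  | zero => intro k h H; exact H.1
  | succ j ih => rintro k h ⟨H, d, hd, hB⟩; exact ⟨H, d, hd, ih hB⟩

theorem add {j : ℕ} : ∀ {k : ℕ} {h g : ℝ → ℝ}, Bc ξ P s j k h → Bc ξ P s j k g →
    Bc ξ P s j k (fun x => h x + g x) := by
  have b : ∀ {k : ℕ} {h g : ℝ → ℝ}, (∃ C, 0 ≤ C ∧ ∀ x e, P x e → |h x| ≤ C * e ^ k) →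
      (∃ C, 0 ≤ C ∧ ∀ x e, P x e → |g x| ≤ C * e ^ k) →
      (∃ C, 0 ≤ C ∧ ∀ x e, P x e → |h x + g x| ≤ C * e ^ k) := by
    rintro k h g ⟨C, hC, h1⟩ ⟨C', hC', h2⟩
    refine ⟨C + C', by positivity, fun x e hP => (abs_add_le _ _).trans ?_⟩
    rw [add_mul]; exact add_le_add (h1 x e hP) (h2 x e hP)
  induction j with
  | zero => intro k h g; exact b
  | succ j ih =>
    rintro k h g ⟨H, d, hd, hB⟩ ⟨H', d', hd', hB'⟩
    refine ⟨b H H', _, fun x e hP => ?_, ih hB hB'⟩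
    exact ((hd x e hP).fun_add (hd' x e hP)).congr_deriv (add_div _ _ _).symm

theorem mul {j : ℕ} : ∀ {k l : ℕ} {h g : ℝ → ℝ}, Bc ξ P s j k h → Bc ξ P s j l g →
    Bc ξ P s j (k + l) (fun x => h x * g x) := by
  have b : ∀ {k l : ℕ} {h g : ℝ → ℝ}, (∃ C, 0 ≤ C ∧ ∀ x e, P x e → |h x| ≤ C * e ^ k) →
      (∃ C, 0 ≤ C ∧ ∀ x e, P x e → |g x| ≤ C * e ^ l) →
      (∃ C, 0 ≤ C ∧ ∀ x e, P x e → |h x * g x| ≤ C * e ^ (k + l)) := by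
    rintro k l h g ⟨C, hC, h1⟩ ⟨C', hC', h2⟩
    refine ⟨C * C', by positivity, fun x e hP => ?_⟩
    have h3 := mul_le_mul (h1 x e hP) (h2 x e hP) (abs_nonneg _) ((abs_nonneg _).trans (h1 x e hP))
    rw [abs_mul]; refine h3.trans (le_of_eq ?_); rw [pow_add]; ring
  induction j with
  | zero => intro k l h g; exact b
  | succ j ih =>
    rintro k l h g H₁ H₂
    obtain ⟨H, d, hd, hB⟩ := id H₁
    obtain ⟨H', d', hd', hB'⟩ := id H₂
    refine ⟨b H H', fun x => d x * g x + h x * d' x, fun x e hP => ?_, ?_⟩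
    · refine ((hd x e hP).fun_mul (hd' x e hP)).congr_deriv ?_
      ring
    · have h1 := ih hB H₂.of_succ
      have h2 := ih H₁.of_succ hB'
      rw [show k + s + l = k + l + s by ring] at h1
      rw [← add_assoc] at h2
      exact h1.add h2

theorem const {j : ℕ} : ∀ {k : ℕ} {c : ℝ}, (∃ C, 0 ≤ C ∧ ∀ x e, P x e → |c| ≤ C * e ^ k) →
    (∀ x e, P x e → 0 ≤ e) → Bc ξ P s j k (fun _ => c) := by
  induction j with
  | zero => intro k c h _; exact h
  | succ j ih =>
    intro k c h h'
    refine ⟨h, fun _ => 0, fun x e _ => by simpa using hasDerivAt_const x c, ih ⟨0, le_rfl, ?_⟩ h'⟩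
    intro x e hP; simp

theorem exp {j : ℕ} : ∀ {h : ℝ → ℝ}, Bc ξ P s j 0 h → Bc ξ P s j 0 (fun x => Real.exp (h x)) := by
  have b : ∀ {h : ℝ → ℝ}, (∃ C, 0 ≤ C ∧ ∀ x e, P x e → |h x| ≤ C * e ^ 0) →
      (∃ C, 0 ≤ C ∧ ∀ x e, P x e → |Real.exp (h x)| ≤ C * e ^ 0) := by
    rintro h ⟨C, hC, h1⟩
    refine ⟨Real.exp C, (Real.exp_pos _).le, fun x e hP => ?_⟩
    have := h1 x e hP
    simp only [pow_zero, mul_one] at *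
    rw [abs_of_pos (Real.exp_pos _)]; exact Real.exp_le_exp.2 ((le_abs_self _).trans this)
  induction j with
  | zero => intro h; exact b
  | succ j ih =>
    rintro h H
    obtain ⟨H0, d, hd, hB⟩ := id H
    refine ⟨b H0, fun x => Real.exp (h x) * d x, fun x e hP => ?_, ?_⟩
    · exact (hd x e hP).exp.congr_deriv (by ring)
    · have := (ih H.of_succ).mul hB
      rwa [Nat.zero_add] at this

end Bc

noncomputable def v0 (F R : ℝ → ℝ) (x : ℝ) : ℝ :=
  deriv (fun y => F y - y) x * Real.exp (Lf F R x) +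
    So F (fun y => xi F R y * deriv (fun y => (F y - y) * R y) y) x

theorem Sz.smu (h : Sz F G R) : Sm (fun y => F y - y) := h.gd.sm.sub contDiff_id
theorem Sz.smr (h : Sz F G R) : Sm (fun y => (F y - y) * R y) := h.smu.mul h.smR

theorem Sz.L_deriv (h : Sz F G R) {x : ℝ} (hx : x ∈ Ioo (-1:ℝ) 2) (hx' : F x ≠ x) :
    HasDerivAt (Lf F R) (So F (fun y => xi F R y * deriv (fun y => (F y - y) * R y) y) x / xi F R x) x := by
  obtain ⟨C, hC0, hC⟩ := bddI h.smR.continuous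
  obtain ⟨C', hC0', hC'⟩ := bddI h.smr.deriv.continuous
  refine h.So_deriv (V := {x | x ∈ Ioo (-1:ℝ) 2 ∧ F x ≠ x}) ?_ (fun _ h => h) ?_ (C := max C C')
    (hC0.trans (le_max_left _ _)) ?_ (fun x _ => h.smr.has x) ?_ ⟨hx, hx'⟩
  · exact isOpen_Ioo.inter (isOpen_ne_fun h.gd.sm.continuous continuous_id)
  · rintro y ⟨hy, hy'⟩
    refine ⟨⟨?_, ?_⟩, fun e => hy' (h.gd.mono.injective e)⟩
    · rw [← h.gd.m1]; exact h.gd.mono hy.1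
    · rw [← h.gd.two]; exact h.gd.mono hy.2
  · rintro y ⟨hy, -⟩
    rw [abs_mul, mul_comm]
    exact mul_le_mul_of_nonneg_right ((hC y (Ioo_subset_Icc_self hy)).trans (le_max_left _ _)) (abs_nonneg _)
  · rintro y ⟨hy, -⟩
    exact (hC' y (Ioo_subset_Icc_self hy)).trans (le_max_right _ _)

theorem Sz.xi_deriv (h : Sz F G R) {x : ℝ} (hx : x ∈ Ioo (-1:ℝ) 2) (hx' : F x ≠ x) :
    HasDerivAt (xi F R) (v0 F R x) x := by
  have h1 := (h.smu.has x).fun_mul (h.L_deriv hx hx').exp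
  refine h1.congr_deriv ?_
  have := xi_ne (R := R) hx'
  unfold v0
  unfold xi at this ⊢
  field_simp

variable {s : ℕ}

/-- smooth functions are in the class -/
theorem Bc.smooth (h : Sz F G R) (hP : Dom F P) (hξ : Bc (xi F R) P s 0 1 (xi F R)) {N k : ℕ} {a : ℝ → ℝ} (ha : Sm a)
    (hb : ∀ i ≤ N, ∃ C, 0 ≤ C ∧ ∀ x e, P x e → e ^ i * |iteratedDeriv i a x| ≤ C * e ^ (k + s * i)) :
    ∀ j, (∀ j' < j, Bc (xi F R) P s j' s (v0 F R)) → ∀ i, i + j ≤ N →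
      Bc (xi F R) P s j (k + s * i) (fun x => xi F R x ^ i * iteratedDeriv i a x) := by
  obtain ⟨C1, hC1, h1⟩ := hξ
  have b : ∀ i ≤ N, ∃ C, 0 ≤ C ∧ ∀ x e, P x e → |xi F R x ^ i * iteratedDeriv i a x| ≤ C * e ^ (k + s * i) := by
    intro i hi
    obtain ⟨C, hC, h2⟩ := hb i hi
    refine ⟨C1 ^ i * C, by positivity, fun x e he => ?_⟩
    have h3 := h1 x e he
    have h4 := h2 x e he
    have e0 := (hP.e01 x e he).1
    rw [pow_one] at h3
    rw [abs_mul, abs_pow]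
    calc _ ≤ (C1 * e) ^ i * |iteratedDeriv i a x| := by gcongr
      _ = C1 ^ i * (e ^ i * |iteratedDeriv i a x|) := by rw [mul_pow]; ring
      _ ≤ C1 ^ i * (C * e ^ (k + s * i)) := by gcongr
      _ = _ := by ring
  intro j
  induction j with
  | zero => intro _ i hi; exact b i (by omega)
  | succ j ih =>
    intro hv i hi
    refine ⟨b i (by omega), fun x => (i * v0 F R x) * (xi F R x ^ i * iteratedDeriv i a x) +
      xi F R x ^ (i+1) * iteratedDeriv (i+1) a x, fun x e he => ?_, ?_⟩
    · obtain ⟨hx, hx'⟩ := hP.sub x e he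
      have h3 : HasDerivAt (iteratedDeriv i a) (iteratedDeriv (i+1) a x) x := by
        rw [iteratedDeriv_succ]
        exact ((ha.differentiable_iteratedDeriv i (by exact_mod_cast WithTop.coe_lt_top _)) x).hasDerivAt
      have h4 := ((h.xi_deriv hx hx').fun_pow i).fun_mul h3
      refine h4.congr_deriv ?_
      have hne := xi_ne (R := R) hx'
      cases i with
      | zero => simp; field_simp
      | succ i =>
        simp only [Nat.add_sub_cancel]
        field_simp
        ring
    · have h5 := ih (fun j' hj' => hv j' (by omega)) i (by omega)
      have h6 := ih (fun j' hj' => hv j' (by omega)) (i+1) (by omega)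
      have h7 : Bc (xi F R) P s j s (fun x => i * v0 F R x) := by
        have := (Bc.const (ξ := xi F R) (s := s) (j := j) (k := 0) (c := (i:ℝ)) (P := P)
          ⟨|(i:ℝ)|, abs_nonneg _, fun x e _ => by simp⟩ (fun x e he => (hP.e01 x e he).1.le)).mul (hv j (by omega))
        simpa using this
      have h8 := h7.mul h5
      rw [show s + (k + s * i) = k + s * i + s by ring] at h8
      rw [show k + s * (i + 1) = k + s * i + s by ring] at h6
      exact h8.add h6

theorem Bc.sum (h : Sz F G R) (hP : Dom F P) : ∀ {j k : ℕ} {a : ℝ → ℝ},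
    (∀ j' < j, Bc (xi F R) P s j' s (v0 F R)) → Bc (xi F R) P s j k a →
    Bc (xi F R) P s j k (So F (fun y => xi F R y * a y)) := by
  obtain ⟨Cx, hCx0, hCx⟩ := h.xi_le
  have hit : ∀ x e, P x e → ∀ n, P (F^[n] x) e := by
    intro x e hx n
    induction n with
    | zero => exact hx
    | succ n ih => rw [Function.iterate_succ_apply']; exact hP.inv _ _ ih
  have b : ∀ {k : ℕ} {a : ℝ → ℝ}, (∃ C, 0 ≤ C ∧ ∀ x e, P x e → |a x| ≤ C * e ^ k) →
      ∃ C, 0 ≤ C ∧ ∀ x e, P x e → |So F (fun y => xi F R y * a y) x| ≤ C * e ^ k := by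
    rintro k a ⟨C, hC, h1⟩
    refine ⟨3 * (Cx * C), by positivity, fun x e he => ?_⟩
    have e0 := (hP.e01 x e he).1
    have hxI := Ioo_subset_Icc_self (hP.sub x e he).1
    rw [mul_assoc]
    refine (So_summable h.gd (a := fun y => xi F R y * a y) (by positivity) hxI fun n => ?_).2
    show |xi F R (F^[n] x) * a (F^[n] x)| ≤ _
    rw [abs_mul, Function.iterate_succ_apply']
    have h2 := (hCx _ (h.gd.orb_mem hxI n)).1
    have h3 := h1 _ e (hit x e he n)
    calc _ ≤ (Cx * |F (F^[n] x) - F^[n] x|) * (C * e ^ k) := by gcongr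
      _ = _ := by ring
  intro j
  induction j with
  | zero => intro k a _ ha; exact b ha
  | succ j ih =>
    intro k a hv ha
    obtain ⟨ha0, d, hd, hB⟩ := id ha
    have hB2 : Bc (xi F R) P s j (k + s) (fun x => v0 F R x * a x + d x) := by
      have := (hv j (by omega)).mul ha.of_succ
      rw [add_comm] at this
      exact this.add hB
    refine ⟨b ha0, _, fun x e he => ?_, ih (fun j' hj' => hv j' (by omega)) hB2⟩
    obtain ⟨C, hC, hC'⟩ := ha0
    obtain ⟨C2, hC2, hC2'⟩ := hB2.bd
    have e0 := (hP.e01 x e he).1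
    refine h.So_deriv (V := {x | P x e}) (a' := fun x => v0 F R x * a x + d x) (C := max (Cx * (C * e ^ k)) (C2 * e ^ (k+s)))
      (hP.opn e) (fun x he => hP.sub x e he) (fun x he => hP.inv x e he) ?_ ?_ ?_ ?_ he
    · exact le_max_of_le_left (by positivity)
    · intro y hy
      have h1 := (hCx y (Ioo_subset_Icc_self (hP.sub y e hy).1)).1
      have h2 := hC' y e hy
      rw [abs_mul]
      calc _ ≤ (Cx * |F y - y|) * (C * e ^ k) := by gcongr
        _ = (Cx * (C * e ^ k)) * |F y - y| := by ring
        _ ≤ _ := by gcongr; exact le_max_left _ _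
    · intro y hy
      obtain ⟨h1, h2⟩ := hP.sub y e hy
      refine ((h.xi_deriv h1 h2).fun_mul (hd y e hy)).congr_deriv ?_
      have := xi_ne (R := R) h2
      field_simp
    · intro y hy
      exact (hC2' y e hy).trans (le_max_right _ _)

theorem Bc.v0 (h : Sz F G R) (hP : Dom F P) (hξ : Bc (xi F R) P s 0 1 (xi F R)) {N : ℕ}
    (hb1 : ∀ i ≤ N, ∃ C, 0 ≤ C ∧ ∀ x e, P x e →
      e ^ i * |iteratedDeriv i (deriv (fun y => F y - y)) x| ≤ C * e ^ (s + s * i))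
    (hb2 : ∀ i ≤ N, ∃ C, 0 ≤ C ∧ ∀ x e, P x e →
      e ^ i * |iteratedDeriv i (deriv (fun y => (F y - y) * R y)) x| ≤ C * e ^ (s + s * i)) :
    ∀ j ≤ N, Bc (xi F R) P s j s (v0 F R) := by
  intro j
  induction j using Nat.strong_induction_on with
  | _ j ih =>
    intro hj
    have hv : ∀ j' < j, Bc (xi F R) P s j' s (_root_.v0 F R) := fun j' h' => ih j' h' (by omega)
    have h1 : Bc (xi F R) P s j s (deriv (fun y => F y - y)) := by
      simpa using Bc.smooth h hP hξ h.smu.deriv hb1 j hv 0 (by omega)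
    have h2 : Bc (xi F R) P s j s (deriv (fun y => (F y - y) * R y)) := by
      simpa using Bc.smooth h hP hξ h.smr.deriv hb2 j hv 0 (by omega)
    have h3 := Bc.sum h hP hv h2
    have h4 : Bc (xi F R) P s j 0 (Lf F R) := by
      obtain ⟨C, hC0, hC⟩ := h.L_bd
      have b : ∃ C, 0 ≤ C ∧ ∀ x e, P x e → |Lf F R x| ≤ C * e ^ 0 :=
        ⟨C, hC0, fun x e he => by simpa using (hC x (Ioo_subset_Icc_self (hP.sub x e he).1)).2⟩
      cases j with
      | zero => exact b
      | succ j =>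
        refine ⟨b, _, fun x e he => h.L_deriv (hP.sub x e he).1 (hP.sub x e he).2, ?_⟩
        simpa using h3.of_succ
    have h5 := (h1.mul h4.exp).add h3
    exact h5

theorem Bc.chain (h : Sz F G R) (hP : Dom F P) : ∀ {j i k : ℕ} {w : ℝ → ℝ},
    (∀ j' < j, Bc (xi F R) P s j' s (_root_.v0 F R)) → Bc (xi F R) P s j k w →
    ∃ c : ℕ → ℝ → ℝ, c 0 = (fun x => w x / xi F R x ^ i) ∧
      (∀ l < j, ∀ x e, P x e → HasDerivAt (c l) (c (l+1) x) x) ∧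
      ∀ l ≤ j, ∃ C, 0 ≤ C ∧ ∀ x e, P x e → |xi F R x ^ (i + l) * c l x| ≤ C * e ^ (k + s * l) := by
  intro j
  induction j with
  | zero =>
    intro i k w _ hw
    refine ⟨fun _ x => w x / xi F R x ^ i, rfl, fun l hl => by omega, fun l hl => ?_⟩
    obtain rfl : l = 0 := by omega
    obtain ⟨C, hC, h1⟩ := hw
    refine ⟨C, hC, fun x e he => ?_⟩
    have := xi_ne (R := R) (hP.sub x e he).2
    have h2 := h1 x e he
    simpa [mul_div_cancel₀, this] using h2
  | succ j ih =>
    intro i k w hv hw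
    obtain ⟨hw0, d, hd, hB⟩ := id hw
    have h7 : Bc (xi F R) P s j s (fun x => (-(i:ℝ)) * _root_.v0 F R x) := by
      have := (Bc.const (ξ := xi F R) (s := s) (j := j) (k := 0) (c := -(i:ℝ)) (P := P)
        ⟨|-(i:ℝ)|, abs_nonneg _, fun x e _ => by simp⟩ (fun x e he => (hP.e01 x e he).1.le)).mul (hv j (by omega))
      simpa using this
    have h8 := h7.mul hw.of_succ
    rw [add_comm s k] at h8
    obtain ⟨c, c0, c1, c2⟩ := ih (i := i + 1) (fun j' hj' => hv j' (by omega)) (hB.add h8)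
    refine ⟨fun l => Nat.casesOn l (fun x => w x / xi F R x ^ i) c, rfl, ?_, ?_⟩
    · intro l hl x e he
      cases l with
      | zero =>
        show HasDerivAt (fun x => w x / xi F R x ^ i) (c 0 x) x
        obtain ⟨hx, hx'⟩ := hP.sub x e he
        have hne := xi_ne (R := R) hx'
        rw [c0]
        refine ((hd x e he).fun_div ((h.xi_deriv hx hx').fun_pow i) (pow_ne_zero _ hne)).congr_deriv ?_
        cases i with
        | zero => simp
        | succ i =>
          simp only [Nat.add_sub_cancel]
          field_simp
          ring
      | succ l => exact c1 l (by omega) x e he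
    · intro l hl
      cases l with
      | zero =>
        obtain ⟨C, hC, h1⟩ := hw0
        refine ⟨C, hC, fun x e he => ?_⟩
        have := xi_ne (R := R) (hP.sub x e he).2
        have h2 := h1 x e he
        simpa [mul_div_cancel₀, this] using h2
      | succ l =>
        obtain ⟨C, hC, h1⟩ := c2 l (by omega)
        refine ⟨C, hC, fun x e he => ?_⟩
        have h2 := h1 x e he
        rw [show i + 1 + l = i + (l+1) by ring, show k + s + s * l = k + s * (l+1) by ring] at h2
        exact h2

end cls
end

section
noncomputable def tt (ξ : ℝ → ℝ) (x y : ℝ) : ℝ := ∫ t in x..y, (ξ t)⁻¹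

/-- a component of the complement of the fixed points -/
structure Cpt (F : ℝ → ℝ) (a b : ℝ) : Prop where
  lt : a < b
  fa : F a = a
  fb : F b = b
  ne : ∀ x ∈ Ioo a b, F x ≠ x

structure Fd (F ξ : ℝ → ℝ) (a b : ℝ) : Prop where
  cp : Cpt F a b
  fc : Continuous F
  cont : ContinuousOn ξ (Ioo a b)
  pos : ∀ x ∈ Ioo a b, 0 < ξ x * (F x - x)

structure Ivr (h k ξ : ℝ → ℝ) (a b : ℝ) : Prop where
  gd : GDiff h k
  ha : h a = a
  hb : h b = b
  der : ∀ x ∈ Ioo a b, ξ (h x) = deriv h x * ξ x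

theorem Cpt.exists {F : ℝ → ℝ} (hF : Continuous F) {α β x : ℝ} (hα : F α = α) (hβ : F β = β) (hx : x ∈ Icc α β)
    (hne : F x ≠ x) : ∃ a b, α ≤ a ∧ b ≤ β ∧ x ∈ Ioo a b ∧ Cpt F a b := by
  have hcl : IsClosed {y | F y = y} := isClosed_eq hF continuous_id
  have c1 : IsCompact ({y | F y = y} ∩ Icc α x) := (isCompact_Icc).inter_left hcl
  have c2 : IsCompact ({y | F y = y} ∩ Icc x β) := (isCompact_Icc).inter_left hcl
  obtain ⟨a, ha, ha'⟩ := c1.exists_isGreatest ⟨α, hα, le_rfl, hx.1⟩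
  obtain ⟨b, hb, hb'⟩ := c2.exists_isLeast ⟨β, hβ, hx.2, le_rfl⟩
  have hax : a < x := lt_of_le_of_ne ha.2.2 fun e => hne (e ▸ ha.1)
  have hbx : x < b := lt_of_le_of_ne hb.2.1 fun e => hne (e ▸ hb.1)
  refine ⟨a, b, ha.2.1, hb.2.2, ⟨hax, hbx⟩, hax.trans hbx, ha.1, hb.1, fun y hy e => ?_⟩
  rcases le_total y x with h | h
  · exact absurd (ha' ⟨e, ha.2.1.trans hy.1.le, h⟩) (not_le.2 hy.1)
  · exact absurd (hb' ⟨e, h, hy.2.le.trans hb.2.2⟩) (not_le.2 hy.2)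

theorem Cpt.sgn {F : ℝ → ℝ} (hF : Continuous F) {a b : ℝ} (h : Cpt F a b) :
    (∀ x ∈ Ioo a b, 0 < F x - x) ∨ (∀ x ∈ Ioo a b, F x - x < 0) := by
  by_contra! hc
  obtain ⟨⟨x, hx, h1⟩, y, hy, h2⟩ := hc
  have := isPreconnected_Ioo.intermediate_value (a := x) (b := y) hx hy (f := fun x => F x - x)
    (hF.sub continuous_id).continuousOn
  obtain ⟨z, hz, e⟩ := this ⟨h1, h2⟩
  exact h.ne z hz (by simpa [sub_eq_zero] using e)

section
variable {F ξ : ℝ → ℝ} {a b : ℝ}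

theorem Fd.ne (h : Fd F ξ a b) {x : ℝ} (hx : x ∈ Ioo a b) : ξ x ≠ 0 := fun e => by
  have := h.pos x hx; simp [e] at this

theorem Fd.sgn (h : Fd F ξ a b) : ((∀ x ∈ Ioo a b, 0 < F x - x) ∧ ∀ x ∈ Ioo a b, 0 < ξ x) ∨
    ((∀ x ∈ Ioo a b, F x - x < 0) ∧ ∀ x ∈ Ioo a b, ξ x < 0) := by
  rcases h.cp.sgn h.fc with h1 | h1
  · exact Or.inl ⟨h1, fun x hx => (pos_iff_pos_of_mul_pos (h.pos x hx)).2 (h1 x hx)⟩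
  · refine Or.inr ⟨h1, fun x hx => ?_⟩
    have := h.pos x hx
    have := h1 x hx
    by_contra h2; push Not at h2; nlinarith

theorem uIcc_sub_Ioo {x y : ℝ} (hx : x ∈ Ioo a b) (hy : y ∈ Ioo a b) : uIcc x y ⊆ Ioo a b :=
  ordConnected_Ioo.uIcc_subset hx hy

theorem Fd.ii (h : Fd F ξ a b) {x y : ℝ} (hx : x ∈ Ioo a b) (hy : y ∈ Ioo a b) :
    IntervalIntegrable (fun t => (ξ t)⁻¹) MeasureTheory.volume x y :=
  ((h.cont.inv₀ fun x hx => h.ne hx).mono (uIcc_sub_Ioo hx hy)).intervalIntegrable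

theorem Fd.tt_add (h : Fd F ξ a b) {x y z : ℝ} (hx : x ∈ Ioo a b) (hy : y ∈ Ioo a b) (hz : z ∈ Ioo a b) :
    tt ξ x y + tt ξ y z = tt ξ x z :=
  intervalIntegral.integral_add_adjacent_intervals (h.ii hx hy) (h.ii hy hz)

theorem tt_symm (ξ : ℝ → ℝ) (x y : ℝ) : tt ξ y x = - tt ξ x y := intervalIntegral.integral_symm _ _

theorem Fd.tt_pos_of (h : Fd F ξ a b) {x y : ℝ} (hx : x ∈ Ioo a b) (hy : y ∈ Ioo a b)
    (hp : 0 < (y - x) * (F x - x)) : 0 < tt ξ x y := by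
  rcases h.sgn with ⟨h1, h2⟩ | ⟨h1, h2⟩
  · have : x < y := by have := h1 x hx; by_contra h3; push Not at h3; nlinarith
    refine intervalIntegral.intervalIntegral_pos_of_pos_on (h.ii hx hy) (fun t ht => ?_) this
    exact inv_pos.2 (h2 t (uIcc_sub_Ioo hx hy (Icc_subset_uIcc (Ioo_subset_Icc_self ht))))
  · have : y < x := by have := h1 x hx; by_contra h3; push Not at h3; nlinarith
    rw [← neg_neg (tt ξ x y), ← tt_symm]
    unfold tt
    rw [← intervalIntegral.integral_neg]
    refine intervalIntegral.intervalIntegral_pos_of_pos_on (h.ii hy hx).neg (fun t ht => ?_) this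
    exact neg_pos.2 (inv_lt_zero.2 (h2 t (uIcc_sub_Ioo hy hx (Icc_subset_uIcc (Ioo_subset_Icc_self ht)))))

theorem Fd.tt_pos (h : Fd F ξ a b) {x y : ℝ} (hx : x ∈ Ioo a b) (hy : y ∈ Ioo a b) :
    0 < tt ξ x y ↔ 0 < (y - x) * (F x - x) := by
  refine ⟨fun h0 => ?_, h.tt_pos_of hx hy⟩
  by_contra hc
  push Not at hc
  rcases hc.lt_or_eq with hc | hc
  · have : 0 < tt ξ y x := by
      apply h.tt_pos_of hy hx
      rcases h.sgn with ⟨h1, h2⟩ | ⟨h1, h2⟩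
      · have := h1 x hx; have := h1 y hy
        have : y < x := by by_contra h3; push Not at h3; nlinarith
        nlinarith
      · have := h1 x hx; have := h1 y hy
        have : x < y := by by_contra h3; push Not at h3; nlinarith
        nlinarith
    rw [tt_symm] at this; linarith
  · rcases mul_eq_zero.1 hc with e | e
    · rw [sub_eq_zero.1 e] at h0; simp [tt] at h0
    · exact h.cp.ne x hx (sub_eq_zero.1 e)

theorem Fd.tt_inj (h : Fd F ξ a b) {x y : ℝ} (hx : x ∈ Ioo a b) (hy : y ∈ Ioo a b) (h0 : tt ξ x y = 0) : x = y := by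
  by_contra hne
  have hF : F x - x ≠ 0 := sub_ne_zero.2 (h.cp.ne x hx)
  rcases lt_or_gt_of_ne (mul_ne_zero (sub_ne_zero.2 (Ne.symm hne)) hF) with h1 | h1
  · have h3 := (h.tt_pos hy hx).2
    rcases h.sgn with ⟨h4, -⟩ | ⟨h4, -⟩
    · have := h4 x hx; have := h4 y hy
      have : y < x := by by_contra h3; push Not at h3; nlinarith
      have := h3 (by nlinarith)
      rw [tt_symm] at this; linarith
    · have := h4 x hx; have := h4 y hy
      have : x < y := by by_contra h3; push Not at h3; nlinarith
      have := h3 (by nlinarith)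
      rw [tt_symm] at this; linarith
  · have := (h.tt_pos hx hy).2 h1; linarith

variable {p q : ℝ → ℝ}

theorem Ivr.mem (hi : Ivr p q ξ a b) {x : ℝ} (hx : x ∈ Ioo a b) : p x ∈ Ioo a b :=
  ⟨by rw [← hi.ha]; exact hi.gd.mono hx.1, by rw [← hi.hb]; exact hi.gd.mono hx.2⟩

theorem Ivr.symm (hi : Ivr p q ξ a b) : Ivr q p ξ a b := by
  have ha : q a = a := by have := hi.gd.left a; rwa [hi.ha] at this
  have hb : q b = b := by have := hi.gd.left b; rwa [hi.hb] at this
  refine ⟨hi.gd.symm, ha, hb, fun x hx => ?_⟩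
  have hq : q x ∈ Ioo a b := ⟨by rw [← ha]; exact hi.gd.symm.mono hx.1, by rw [← hb]; exact hi.gd.symm.mono hx.2⟩
  have h1 := hi.der _ hq
  rw [hi.gd.right] at h1
  have h2 : HasDerivAt (fun x => p (q x)) (deriv p (q x) * deriv q x) x :=
      (hi.gd.sm.has (q x)).comp x (hi.gd.smi.has x)
  have h3 : HasDerivAt (fun x => p (q x)) 1 x := by
      simp only [hi.gd.right]; exact hasDerivAt_id x
  have h4 := h2.unique h3
  rw [h1, ← mul_assoc, mul_comm (deriv q x), h4, one_mul]

theorem Fd.hasDeriv (h : Fd F ξ a b) {x₀ x : ℝ} (hx₀ : x₀ ∈ Ioo a b) (hx : x ∈ Ioo a b) :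
    HasDerivAt (fun y => tt ξ x₀ y) (ξ x)⁻¹ x := by
  have hc := h.cont.inv₀ fun x hx => h.ne hx
  refine intervalIntegral.integral_hasDerivAt_right (h.ii hx₀ hx) ?_ (hc.continuousAt (isOpen_Ioo.mem_nhds hx))
  exact hc.stronglyMeasurableAtFilter isOpen_Ioo x hx

theorem Fd.const (h : Fd F ξ a b) (hi : Ivr p q ξ a b) {x y : ℝ} (hx : x ∈ Ioo a b) (hy : y ∈ Ioo a b) :
    tt ξ x (p x) = tt ξ y (p y) := by
  have key : ∀ z ∈ Ioo a b, HasDerivAt (fun z => tt ξ x (p z) - tt ξ x z) 0 z := by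
    intro z hz
    have h1 := (h.hasDeriv hx (hi.mem hz)).comp z (hi.gd.sm.has z)
    have h2 := h1.sub (h.hasDeriv hx hz)
    refine h2.congr_deriv ?_
    rw [hi.der z hz]
    have := h.ne hz
    have := (hi.gd.pos z).ne'
    field_simp
    ring
  have e := isOpen_Ioo.is_const_of_deriv_eq_zero (𝕜 := ℝ) isPreconnected_Ioo (f := fun z => tt ξ x (p z) - tt ξ x z)
    (fun z hz => (key z hz).differentiableAt.differentiableWithinAt) (fun z hz => (key z hz).deriv) hx hy
  have h3 := h.tt_add hx hy (hi.mem hy)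
  have h4 : tt ξ x x = 0 := by simp [tt]
  linarith

theorem Ivr.zpow_mem (hi : Ivr p q ξ a b) (n : ℤ) {x : ℝ} (hx : x ∈ Ioo a b) : (hi.gd.perm ^ n) x ∈ Ioo a b := by
  induction n using Int.induction_on generalizing x with
  | zero => simpa using hx
  | succ n ih => rw [zpow_add, zpow_one]; exact ih (hi.mem hx)
  | pred n ih => rw [zpow_sub, zpow_one]; exact ih (hi.symm.mem hx)

theorem Fd.zpow (h : Fd F ξ a b) (hi : Ivr p q ξ a b) (n : ℤ) {x : ℝ} (hx : x ∈ Ioo a b) :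
    tt ξ x ((hi.gd.perm ^ n) x) = n * tt ξ x (p x) := by
  induction n using Int.induction_on generalizing x with
  | zero => simp [tt]
  | succ n ih =>
    rw [zpow_add, zpow_one]
    show tt ξ x ((hi.gd.perm ^ (n:ℤ)) (p x)) = _
    rw [← h.tt_add hx (hi.mem hx) (hi.zpow_mem _ (hi.mem hx)), ih (hi.mem hx), h.const hi (hi.mem hx) hx]
    push_cast; ring
  | pred n ih =>
    rw [zpow_sub, zpow_one]
    show tt ξ x ((hi.gd.perm ^ (-(n:ℤ))) (q x)) = _
    have hq := hi.symm.mem hx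
    rw [← h.tt_add hx hq (hi.zpow_mem _ hq), ih hq, tt_symm]
    have := h.const hi hq hx
    rw [hi.gd.right] at this
    rw [hi.gd.right, this]
    push_cast; ring

/-- times of words -/
theorem Fd.word (h : Fd F ξ a b) (hi : Ivr p q ξ a b) {f g : ℝ → ℝ} (hj : Ivr f g ξ a b) (m n : ℤ) {x y : ℝ}
    (hx : x ∈ Ioo a b) (hy : y ∈ Ioo a b) :
    tt ξ x ((hi.gd.perm ^ m) ((hj.gd.perm ^ n) x)) = m * tt ξ y (p y) + n * tt ξ y (f y) := by
  have := hj.zpow_mem n hx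
  rw [← h.tt_add hx this (hi.zpow_mem _ this), h.zpow hi m this, h.zpow hj n hx, h.const hi this hy, h.const hj hx hy]
  ring
end
end

section
section
variable {F G R p q : ℝ → ℝ}

theorem GDiff.orb_conv (h : GDE F G) {x : ℝ} (hx : x ∈ Icc (-1:ℝ) 2) :
    ∃ z, Tendsto (fun n => F^[n] x) atTop (𝓝 z) := by
  have h1 : Bornology.IsBounded (range fun n => F^[n] x) :=
    (Metric.isBounded_Icc (-1:ℝ) 2).subset (by rintro _ ⟨n, rfl⟩; exact h.orb_mem hx n)
  rcases le_total x (F x) with hx | hx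
  · have hm : Monotone (fun n => F^[n] x) := h.mono.monotone.monotone_iterate_of_le_map hx
    exact ⟨_, tendsto_atTop_ciSup hm h1.bddAbove⟩
  · have hm : Antitone (fun n => F^[n] x) := h.mono.monotone.antitone_iterate_of_map_le hx
    exact ⟨_, tendsto_atTop_ciInf hm h1.bddBelow⟩

theorem kopell (h : Sz F G R) (gd : GDiff p q) (comm : ∀ x ∈ Icc (0:ℝ) 1, F (p x) = p (F x)) {x : ℝ}
    (hx : x ∈ Icc (0:ℝ) 1) : xi F R (p x) = deriv p x * xi F R x := by
  by_cases hFx : F x = x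
  · have : F (p x) = p x := by rw [comm x hx, hFx]
    simp [xi, hFx, this]
  have I2 : Icc (0:ℝ) 1 ⊆ Icc (-1:ℝ) 2 := Icc_subset_Icc (by norm_num) (by norm_num)
  have hm : ∀ n, F^[n] x ∈ Icc (0:ℝ) 1 := fun n => (h.gd.mapsTo.iterate n) hx
  have hc : ∀ n, p (F^[n] x) = F^[n] (p x) := by
    intro n
    induction n with
    | zero => rfl
    | succ n ih => rw [Function.iterate_succ_apply', Function.iterate_succ_apply', ← comm _ (hm n), ih]
  -- one step invariance
  have one : ∀ y ∈ Icc (0:ℝ) 1, F y ≠ y → xi F R (p (F y)) / (deriv p (F y) * xi F R (F y)) =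
      xi F R (p y) / (deriv p y * xi F R y) := by
    intro y hy hne
    have hy' : y ∈ Ioo (0:ℝ) 1 := by
      refine ⟨lt_of_le_of_ne hy.1 ?_, lt_of_le_of_ne hy.2 ?_⟩
      · rintro rfl; exact hne h.gd.zero
      · rintro rfl; exact hne h.gd.one
    have d1 : HasDerivAt (fun x => F (p x)) (deriv F (p y) * deriv p y) y := (h.gd.sm.has (p y)).comp y (gd.sm.has y)
    have d2 : HasDerivAt (fun x => p (F x)) (deriv p (F y) * deriv F y) y := (gd.sm.has (F y)).comp y (h.gd.sm.has y)
    have d3 : HasDerivAt (fun x => F (p x)) (deriv p (F y) * deriv F y) y := by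
      refine d2.congr_of_eventuallyEq ?_
      filter_upwards [isOpen_Ioo.mem_nhds hy'] with z hz
      exact comm z (Ioo_subset_Icc_self hz)
    have d4 := d1.unique d3
    rw [← comm y hy, h.xi_F (I2 (gd.mapsTo hy)), h.xi_F (I2 hy)]
    have := xi_ne (R := R) hne
    have a1 := (h.gd.pos y).ne'
    have a2 := (gd.pos y).ne'
    have a3 := (gd.pos (F y)).ne'
    rw [div_eq_div_iff (by positivity) (by positivity)]
    linear_combination (xi F R (p y) * xi F R y) * d4
  have all : ∀ n, xi F R (p (F^[n] x)) / (deriv p (F^[n] x) * xi F R (F^[n] x)) =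
      xi F R (p x) / (deriv p x * xi F R x) := by
    intro n
    induction n with
    | zero => rfl
    | succ n ih => rw [Function.iterate_succ_apply', one _ (hm n) (h.gd.iter_ne hFx n), ih]
  obtain ⟨z, hz⟩ := GDiff.orb_conv h.gd (I2 hx)
  have hlim : Tendsto (fun n => xi F R (p (F^[n] x)) / (deriv p (F^[n] x) * xi F R (F^[n] x))) atTop (𝓝 1) := by
    have e : ∀ n, xi F R (p (F^[n] x)) / (deriv p (F^[n] x) * xi F R (F^[n] x)) =
        dq p (F^[n+1] x) (F^[n] x) / deriv p (F^[n] x) *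
          Real.exp (Lf F R (F^[n] (p x)) - Lf F R (F^[n] x)) := by
      intro n
      have h1 := dq_spec gd.sm.one (F^[n+1] x) (F^[n] x)
      have h2 : xi F R (p (F^[n] x)) = dq p (F^[n+1] x) (F^[n] x) * (F (F^[n] x) - F^[n] x) *
          Real.exp (Lf F R (F^[n] (p x))) := by
        unfold xi
        rw [comm _ (hm n), ← Function.iterate_succ_apply' F, h1, hc n]
      have h3 := sub_ne_zero.2 (h.gd.iter_ne hFx n)
      have a2 := (gd.pos (F^[n] x)).ne'
      rw [h2, Real.exp_sub]
      unfold xi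
      have := (Real.exp_pos (Lf F R (F^[n] x))).ne'
      field_simp
    simp_rw [e]
    have t1 : Tendsto (fun n => dq p (F^[n+1] x) (F^[n] x)) atTop (𝓝 (deriv p z)) := by
      have := ((dq_cont gd.sm.one).tendsto (z, z)).comp
        ((((tendsto_add_atTop_iff_nat 1).2 hz)).prodMk_nhds hz)
      simpa [dq_self, Function.comp_def] using this
    have t2 : Tendsto (fun n => deriv p (F^[n] x)) atTop (𝓝 (deriv p z)) :=
      (gd.sm.deriv.continuous.tendsto z).comp hz
    have t3 := t1.div t2 (gd.pos z).ne'
    have t4 := ((So_tail (F := F) (fun y => (F y - y) * R y) (p x)).sub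
      (So_tail (F := F) (fun y => (F y - y) * R y) x)).rexp
    have t5 := t3.mul t4
    simpa [div_self (gd.pos z).ne', Lf] using t5
  simp_rw [all] at hlim
  have := tendsto_nhds_unique tendsto_const_nhds hlim
  have a2 := (gd.pos x).ne'
  have a3 := xi_ne (R := R) hFx
  rw [div_eq_one_iff_eq (by positivity)] at this
  exact this

theorem Sz.xi_contAt (h : Sz F G R) {x : ℝ} (hx : x ∈ Ioo (-1:ℝ) 2) (hne : F x ≠ x) : ContinuousAt (xi F R) x :=
  (h.xi_deriv hx hne).continuousAt

theorem Sz.fd (h : Sz F G R) {a b : ℝ} (ha : -1 ≤ a) (hb : b ≤ 2) (hc : Cpt F a b) : Fd F (xi F R) a b := by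
  refine ⟨hc, h.gd.sm.continuous, fun x hx => ?_, fun x hx => ?_⟩
  · exact (h.xi_contAt ⟨ha.trans_lt hx.1, hx.2.trans_le hb⟩ (hc.ne x hx)).continuousWithinAt
  · have := sub_ne_zero.2 (hc.ne x hx)
    unfold xi
    have h1 := Real.exp_pos (Lf F R x)
    have : 0 < (F x - x)^2 := by positivity
    nlinarith [mul_pos this h1]

theorem GDE.disp_sign (h : GDE F G) {x : ℝ} (hx : F x ≠ x) : (G x - x) * (F x - x) < 0 := by
  rcases lt_or_gt_of_ne hx with h1 | h1
  · have h2 := h.symm.mono h1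
    rw [h.left] at h2
    nlinarith
  · have h2 := h.symm.mono h1
    rw [h.left] at h2
    nlinarith

theorem Sz.fd' (h : Sz G F R) {a b : ℝ} (ha : -1 ≤ a) (hb : b ≤ 2) (hc : Cpt F a b) :
    Fd F (fun x => - xi G R x) a b := by
  have hc' : Cpt G a b := by
    refine ⟨hc.lt, ?_, ?_, fun x hx e => hc.ne x hx ?_⟩
    · have := h.gd.right a; rwa [hc.fa] at this
    · have := h.gd.right b; rwa [hc.fb] at this
    · have := h.gd.left x; rwa [e] at this
  have := h.fd ha hb hc'
  refine ⟨hc, h.gd.symm.sm.continuous, this.cont.neg, fun x hx => ?_⟩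
  have h1 := this.pos x hx
  have h2 := h.gd.symm.disp_sign (hc.ne x hx)
  by_contra h3
  push Not at h3
  have h4 : 0 ≤ xi G R x * (F x - x) := by linarith
  have h5 : 0 ≤ (xi G R x * (F x - x)) * (xi G R x * (G x - x)) := mul_nonneg h4 h1.le
  have h6 : 0 < xi G R x ^ 2 := by have := this.ne hx; positivity
  nlinarith [mul_neg_of_pos_of_neg h6 h2]

theorem Sz.ivr (h : Sz F G R) {a b : ℝ} (ha : -1 ≤ a) (hb : b ≤ 2) (hc : Cpt F a b) : Ivr F G (xi F R) a b :=
  ⟨h.gd.toGDiff, hc.fa, hc.fb, fun x hx => h.xi_F ⟨ha.trans hx.1.le, hx.2.le.trans hb⟩⟩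

theorem Ivr.neg {ξ : ℝ → ℝ} {a b : ℝ} (h : Ivr p q ξ a b) : Ivr p q (fun x => - ξ x) a b :=
  ⟨h.gd, h.ha, h.hb, fun x hx => by rw [h.der x hx]; ring⟩

theorem Ivr.of_kopell (h : Sz F G R) (gd : GDiff p q) (comm : ∀ x ∈ Icc (0:ℝ) 1, F (p x) = p (F x))
    {a b : ℝ} (ha : 0 ≤ a) (hb : b ≤ 1) (pa : p a = a) (pb : p b = b) : Ivr p q (xi F R) a b :=
  ⟨gd, pa, pb, fun x hx => kopell h gd comm ⟨ha.trans hx.1.le, hx.2.le.trans hb⟩⟩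
end
end

section
structure CP (D : Set ℝ) (f f' g g' : ℝ → ℝ) : Prop where
  hD : D ⊆ ({0, 1} : Set ℝ)
  gf : GDE f f'
  gg : GDE g g'
  comm : ∀ x ∈ Icc (0:ℝ) 1, f (g x) = g (f x)
  flf : ∀ p ∈ Icc (0:ℝ) 1, Flat (fun x => f x - x) p ↔ p ∈ D

theorem flat_of_acc {v : ℝ → ℝ} (hv : Sm v) {s : ℕ → ℝ} {z : ℝ} (h0 : ∀ n, v (s n) = 0) (hne : ∀ n, s n ≠ z)
    (hz : Tendsto s atTop (𝓝 z)) : Flat v z := by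
  by_contra hf
  obtain ⟨m, w, hw, hwz, e⟩ := (not_flat_iff hv).1 hf
  have h1 : ∀ n, w (s n) = 0 := by
    intro n
    have := h0 n
    rw [e] at this
    exact (mul_eq_zero.1 this).resolve_left (pow_ne_zero _ (sub_ne_zero.2 (hne n)))
  have h2 := (hw.continuous.tendsto z).comp hz
  simp only [Function.comp_def, h1] at h2
  exact hwz (tendsto_nhds_unique h2 tendsto_const_nhds)

section
variable {D : Set ℝ} {f f' g g' : ℝ → ℝ}

theorem CP.flat_orb (h : CP D f f' g g') {k k' : ℝ → ℝ} (hk : GDE k k') (hc : ∀ x ∈ Icc (0:ℝ) 1, f (k x) = k (f x))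
    {a b p : ℝ} (hab : Cpt k a b) (ha : 0 ≤ a) (hb : b ≤ 1) (hp : p ∈ Ioo a b) (fp : f p = p) :
    (k p < p → a ∈ D) ∧ (p < k p → b ∈ D) := by
  have I2 : Icc (0:ℝ) 1 ⊆ Icc (-1:ℝ) 2 := Icc_subset_Icc (by norm_num) (by norm_num)
  have hp01 : p ∈ Icc (0:ℝ) 1 := ⟨ha.trans hp.1.le, hp.2.le.trans hb⟩
  have hm : ∀ n, k^[n] p ∈ Icc (0:ℝ) 1 := fun n => (hk.mapsTo.iterate n) hp01
  have hJ : ∀ n, k^[n] p ∈ Ioo a b := by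
    intro n
    induction n with
    | zero => exact hp
    | succ n ih =>
      rw [Function.iterate_succ_apply']
      exact ⟨by rw [← hab.fa]; exact hk.mono ih.1, by rw [← hab.fb]; exact hk.mono ih.2⟩
  have hf : ∀ n, f (k^[n] p) = k^[n] p := by
    intro n
    induction n with
    | zero => exact fp
    | succ n ih => rw [Function.iterate_succ_apply', hc _ (hm n), ih]
  obtain ⟨z, hz⟩ := GDiff.orb_conv hk (I2 hp01)
  have hzI : z ∈ Icc a b := isClosed_Icc.mem_of_tendsto hz (Eventually.of_forall fun n => Ioo_subset_Icc_self (hJ n))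
  have hkz : k z = z := by
    have h1 := (hk.sm.continuous.tendsto z).comp hz
    have h2 := (tendsto_add_atTop_iff_nat 1).2 hz
    simp only [Function.iterate_succ_apply'] at h2
    exact tendsto_nhds_unique h1 h2
  have hz' : z = a ∨ z = b := by
    by_contra! hn
    exact hab.ne z ⟨lt_of_le_of_ne hzI.1 (Ne.symm hn.1), lt_of_le_of_ne hzI.2 hn.2⟩ hkz
  have hD : z ∈ D := by
    rw [← h.flf z ⟨ha.trans hzI.1, hzI.2.trans hb⟩]
    refine flat_of_acc (s := fun n => k^[n] p) (h.gf.sm.sub contDiff_id) (fun n => ?_) (fun n => ?_) hz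
    · simp [hf n]
    · rcases hz' with e | e
      · rw [e]; exact (hJ n).1.ne'
      · rw [e]; exact (hJ n).2.ne
  constructor
  · intro hlt
    have hmn : Antitone (fun n => k^[n] p) := hk.mono.monotone.antitone_iterate_of_map_le hlt.le
    have := hmn.le_of_tendsto hz 0
    rcases hz' with e | e
    · rwa [← e]
    · exact absurd (e ▸ this) (not_le.2 hp.2)
  · intro hlt
    have hmn : Monotone (fun n => k^[n] p) := hk.mono.monotone.monotone_iterate_of_le_map hlt.le
    have := hmn.ge_of_tendsto hz 0
    rcases hz' with e | e
    · exact absurd (e ▸ this) (not_le.2 hp.1)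
    · rwa [← e]

theorem CP.fix (h : CP D f f' g g') {p : ℝ} (hp : p ∈ Icc (0:ℝ) 1) (fp : f p = p) : g p = p := by
  by_contra hg
  obtain ⟨a, b, ha, hb, hpab, hab⟩ := Cpt.exists h.gg.sm.continuous h.gg.zero h.gg.one hp hg
  have I1 : ∀ x ∈ Icc (0:ℝ) 1, f (g' x) = g' (f x) := by
    intro x hx
    have := h.comm (g' x) (h.gg.symm.mapsTo hx)
    rw [h.gg.right] at this
    rw [this, h.gg.left]
  have hab' : Cpt g' a b := by
    refine ⟨hab.lt, ?_, ?_, fun x hx e => hab.ne x hx ?_⟩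
    · have := h.gg.left a; rwa [hab.fa] at this
    · have := h.gg.left b; rwa [hab.fb] at this
    · have := h.gg.right x; rwa [e] at this
  have h1 := h.flat_orb h.gg h.comm hab ha hb hpab fp
  have h2 := h.flat_orb h.gg.symm I1 hab' ha hb hpab fp
  have hD : a ∈ D ∧ b ∈ D := by
    rcases lt_or_gt_of_ne hg with hlt | hlt
    · refine ⟨h1.1 hlt, h2.2 ?_⟩
      have := h.gg.symm.mono hlt; rwa [h.gg.left] at this
    · refine ⟨h2.1 ?_, h1.2 hlt⟩
      have := h.gg.symm.mono hlt; rwa [h.gg.left] at this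
  have ha0 : a = 0 := by
    rcases h.hD hD.1 with e | e
    · exact e
    · have := hab.lt; simp at e; linarith
  have hb1 : b = 1 := by
    rcases h.hD hD.2 with e | e
    · have := hab.lt; linarith
    · exact e
  subst ha0 hb1
  obtain ⟨R, hR⟩ := Sz.exists h.gg
  have hfd := hR.fd (by norm_num) (by norm_num) hab
  have hiv := Ivr.of_kopell hR h.gf.toGDiff (fun x hx => (h.comm x hx).symm) le_rfl le_rfl h.gf.zero h.gf.one
  have hid : ∀ x ∈ Ioo (0:ℝ) 1, f x = x := by
    intro x hx
    have h1 := hfd.const hiv hx hpab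
    rw [fp] at h1
    exact (hfd.tt_inj hx (hiv.mem hx) (by rw [h1]; simp [tt])).symm
  have hid' : ∀ x ∈ Icc (0:ℝ) 1, f x = x := by
    intro x hx
    rcases eq_or_lt_of_le hx.1 with e | e
    · rw [← e]; exact h.gf.zero
    rcases eq_or_lt_of_le hx.2 with e' | e'
    · rw [e']; exact h.gf.one
    exact hid x ⟨e, e'⟩
  have hfl : Flat (fun x => f x - x) (1/2) :=
    flat_of_bound (v₂ := fun _ => 0) (C := 0) (h.gf.sm.sub contDiff_id) contDiff_const (by norm_num)
      (fun x hx => by simp [hid' x hx]) (fun n => by simp)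
  have := h.hD ((h.flf _ (by norm_num)).1 hfl)
  norm_num at this
end
end

section
section
variable {F G R : ℝ → ℝ}

theorem So_le (h : GDE F G) {a : ℝ → ℝ} {x C B : ℝ} (hC : 0 ≤ C) (hx : x ∈ Icc (-1:ℝ) 2)
    (ha : ∀ n, |a (F^[n] x)| ≤ C * |F^[n+1] x - F^[n] x|) (hB : ∀ n, |F^[n] x - x| ≤ B) :
    |So F a x| ≤ C * B := by
  obtain ⟨h1, h2⟩ := h.orb_summable hx
  have hs : Summable (fun n => |a (F^[n] x)|) :=
    Summable.of_nonneg_of_le (fun n => abs_nonneg _) ha (h1.mul_left C)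
  have h3 : |So F a x| ≤ ∑' n, |a (F^[n] x)| := by
    have := norm_tsum_le_tsum_norm (f := fun n => a (F^[n] x)) (by simpa using hs)
    simpa [So] using this
  refine h3.trans ((hs.tsum_le_tsum ha (h1.mul_left C)).trans ?_)
  have h5 : ∑' n, C * |F^[n+1] x - F^[n] x| = C * ∑' n, |F^[n+1] x - F^[n] x| := h1.tsum_mul_left C
  rw [h5]
  refine mul_le_mul_of_nonneg_left ?_ hC
  exact h1.tsum_le_of_sum_range_le fun n => by rw [h.orb_part]; exact hB n

theorem GDiff.toward (h : GDiff F G) {p x : ℝ} (hp : F p = p) (hx : (F x - x) * (x - p) ≤ 0) (n : ℕ) :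
    |F^[n] x - x| ≤ |x - p| := by
  have hpn : F^[n] p = p := Function.iterate_fixed hp n
  rcases lt_trichotomy x p with h1 | h1 | h1
  · have h2 : x ≤ F x := by nlinarith
    have hm : Monotone (fun n => F^[n] x) := h.mono.monotone.monotone_iterate_of_le_map h2
    have h3 : x ≤ F^[n] x := hm (Nat.zero_le n)
    have h4 := (h.iter_mono n).monotone h1.le
    rw [hpn] at h4
    rw [abs_of_nonneg (by linarith), abs_of_neg (by linarith)]; linarith
  · subst h1; simp [hpn]
  · have h2 : F x ≤ x := by nlinarith
    have hm : Antitone (fun n => F^[n] x) := h.mono.monotone.antitone_iterate_of_map_le h2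
    have h3 : F^[n] x ≤ x := hm (Nat.zero_le n)
    have h4 := (h.iter_mono n).monotone h1.le
    rw [hpn] at h4
    rw [abs_of_nonpos (by linarith), abs_of_pos (by linarith)]; linarith

theorem Sz.L_small (h : Sz F G R) : ∃ C, 0 ≤ C ∧ ∀ x ∈ Icc (-1:ℝ) 2, ∀ p, F p = p → (F x - x) * (x - p) ≤ 0 →
    |Lf F R x| ≤ C * |x - p| := by
  obtain ⟨C, hC0, hC⟩ := bddI h.smR.continuous
  refine ⟨C, hC0, fun x hx p hp ht => ?_⟩
  refine So_le (a := fun y => (F y - y) * R y) h.gd hC0 hx (fun n => ?_) (h.gd.toward hp ht)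
  show |(F (F^[n] x) - F^[n] x) * R (F^[n] x)| ≤ _
  rw [Function.iterate_succ_apply', abs_mul, mul_comm]
  exact mul_le_mul_of_nonneg_right (hC _ (h.gd.orb_mem hx n)) (abs_nonneg _)

/-- the normalised field has ratio tending to one at the attracting end -/
theorem Sz.ratio (h : Sz F G R) {a b p : ℝ} (ha : -1 ≤ a) (hb : b ≤ 2) (hp : F p = p)
    (hc : ∀ x ∈ Ioo a b, F x ≠ x ∧ (F x - x) * (x - p) ≤ 0) :
    Tendsto (fun x => xi F R x / (F x - x)) (𝓝[Ioo a b] p) (𝓝 1) := by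
  obtain ⟨C, hC0, hC⟩ := h.L_small
  have h1 : Tendsto (fun x => Lf F R x) (𝓝[Ioo a b] p) (𝓝 0) := by
    have h2 : Tendsto (fun x => C * |x - p|) (𝓝[Ioo a b] p) (𝓝 0) := by
      have : Continuous fun x => C * |x - p| := by fun_prop
      have := this.tendsto p
      simp only [sub_self, abs_zero, mul_zero] at this
      exact this.mono_left nhdsWithin_le_nhds
    refine squeeze_zero_norm' ?_ h2
    filter_upwards [self_mem_nhdsWithin] with x hx
    exact hC x ⟨ha.trans hx.1.le, hx.2.le.trans hb⟩ p hp (hc x hx).2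
  have h3 := h1.rexp
  rw [Real.exp_zero] at h3
  refine h3.congr' ?_
  filter_upwards [self_mem_nhdsWithin] with x hx
  unfold xi
  rw [mul_div_cancel_left₀ _ (sub_ne_zero.2 (hc x hx).1)]

theorem Sz.ratio' (h : Sz G F R) {a b p : ℝ} (ha : -1 ≤ a) (hb : b ≤ 2) (hp : F p = p)
    (hc : ∀ x ∈ Ioo a b, F x ≠ x ∧ 0 ≤ (F x - x) * (x - p)) :
    Tendsto (fun x => - xi G R x / (F x - x)) (𝓝[Ioo a b] p) (𝓝 (deriv F p)⁻¹) := by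
  have hGp : G p = p := by have := h.gd.right p; rwa [hp] at this
  have h1 := h.ratio ha hb hGp (fun x hx => ⟨fun e => (hc x hx).1 (by have := h.gd.left x; rwa [e] at this), by
    have h2 := h.gd.symm.disp_sign (hc x hx).1
    have h3 := (hc x hx).2
    by_contra h4
    push Not at h4
    have h5 : 0 ≤ ((F x - x) * (x - p)) * ((G x - x) * (x - p)) := mul_nonneg h3 h4.le
    have h6 : 0 < (x - p)^2 := by
      have : x - p ≠ 0 := fun e => by simp [e] at h4
      positivity
    nlinarith [mul_neg_of_pos_of_neg h6 h2]⟩)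
  have h2 : Tendsto (fun x => (dq F x (G x))⁻¹) (𝓝[Ioo a b] p) (𝓝 (deriv F p)⁻¹) := by
    have hc1 : Continuous fun x => dq F x (G x) :=
      (dq_cont h.gd.symm.sm.one).comp (continuous_id.prodMk h.gd.sm.continuous)
    have := hc1.tendsto p
    rw [hGp, dq_self] at this
    exact (this.inv₀ (h.gd.symm.pos p).ne').mono_left nhdsWithin_le_nhds
  have h3 := h1.mul h2
  rw [one_mul] at h3
  refine h3.congr' ?_
  filter_upwards [self_mem_nhdsWithin] with x hx
  have h4 := dq_spec h.gd.symm.sm.one x (G x)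
  rw [h.gd.left] at h4
  have h5 : x - G x ≠ 0 := fun e => (hc x hx).1 (by rw [e, mul_zero] at h4; linarith)
  have h6 : dq F x (G x) ≠ 0 := (dq_pos h.gd.symm.toGDiff _ _).ne'
  have h7 : G x - x ≠ 0 := fun e => h5 (by linarith)
  rw [h4]
  have h8 : x - G x = - (G x - x) := by ring
  rw [h8]
  field_simp

noncomputable def kn (m : ℕ) (A B : ℝ → ℝ) (p : ℝ) : ℝ :=
  ∫ θ in (0:ℝ)..1, B p / (A p * (1 + θ * ((p - p) ^ m * B p)) ^ (m + 1))

theorem kn_lim {h k W A B : ℝ → ℝ} {a b p κ : ℝ} {m : ℕ} (gd : GDiff h k) (sA : Sm A) (sB : Sm B) (hA : A p ≠ 0)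
    (hh : ∀ x, h x - x = (x - p) ^ (m + 1) * B x) (hm : ∀ x ∈ Ioo a b, h x ∈ Ioo a b)
    (hp : p ∉ Ioo a b)
    (hAne : ∀ x ∈ Ioo a b, A x ≠ 0)
    (hWc : ContinuousOn W (Ioo a b)) (hW0 : ∀ x ∈ Ioo a b, W x ≠ 0) (hκ : κ ≠ 0)
    (hlim : Tendsto (fun x => W x / ((x - p) ^ (m + 1) * A x)) (𝓝[Ioo a b] p) (𝓝 κ)) :
    Tendsto (fun x => tt W x (h x)) (𝓝[Ioo a b] p) (𝓝 (kn m A B p / κ)) := by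
  set β : ℝ × ℝ → ℝ := fun z => B z.2 / (A (z.2 + z.1 * (h z.2 - z.2)) * (1 + z.1 * ((z.2 - p) ^ m * B z.2)) ^ (m + 1)) with hβ
  set ω : ℝ → ℝ := fun y => (y - p) ^ (m + 1) * A y / W y with hω
  have hhp : h p = p := by have := hh p; simp at this; linarith
  have hlim' : Tendsto ω (𝓝[Ioo a b] p) (𝓝 κ⁻¹) := by
    refine (hlim.inv₀ hκ).congr fun x => ?_
    rw [inv_div]
  -- nonvanishing
  have hnz : ∀ θ ∈ Icc (0:ℝ) 1, A (p + θ * (h p - p)) * (1 + θ * ((p - p) ^ m * B p)) ^ (m + 1) ≠ 0 := by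
    intro θ hθ
    refine mul_ne_zero (by simpa [hhp] using hA) (pow_ne_zero _ ?_)
    rcases Nat.eq_zero_or_pos m with rfl | hm0
    · have hd : HasDerivAt (fun x => x + (x - p) ^ (0 + 1) * B x) (1 + B p) p := by
        have h1 := (hasDerivAt_id p).add (((hasDerivAt_id p).sub_const p).fun_mul (sB.has p))
        refine (h1.congr_deriv (by simp)).congr_of_eventuallyEq ?_
        filter_upwards with x; simp
      have he : (fun x => x + (x - p) ^ (0 + 1) * B x) = h := by ext x; rw [← hh]; ring
      rw [he] at hd
      have h2 := gd.pos p
      rw [hd.deriv] at h2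
      simp only [pow_zero, one_mul]
      have : 0 < 1 + θ * B p := by
        rcases le_or_gt 0 (B p) with h3 | h3
        · have := mul_nonneg hθ.1 h3; linarith
        · have := hθ.2; nlinarith
      exact this.ne'
    · simp [hm0.ne']
  have hβc : ∀ θ ∈ Icc (0:ℝ) 1, ContinuousAt β (θ, p) := by
    intro θ hθ
    have c1 := sA.continuous; have c2 := sB.continuous; have c3 := gd.sm.continuous
    exact ContinuousAt.div (by fun_prop) (by fun_prop) (hnz θ hθ)
  have hβc' : ContinuousOn (fun θ => β (θ, p)) (Icc 0 1) := fun θ hθ =>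
    (ContinuousAt.comp (f := fun θ : ℝ => ((θ, p) : ℝ × ℝ)) (hβc θ hθ) (by fun_prop)).continuousWithinAt
  obtain ⟨C, hC⟩ := isCompact_Icc.exists_bound_of_continuousOn hβc'
  have hbd : ∀ᶠ x in 𝓝 p, ∀ θ ∈ Icc (0:ℝ) 1, |β (θ, x)| < C + 1 := by
    refine isCompact_Icc.eventually_forall_of_forall_eventually fun θ hθ => ?_
    have h0 : |β (θ, p)| < C + 1 := by
      have := hC θ hθ
      rw [Real.norm_eq_abs] at this
      linarith
    have h1 := (hβc θ hθ).abs.eventually (gt_mem_nhds h0)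
    exact ((continuous_swap.tendsto (p, θ)).eventually h1)
  have hωb : ∀ᶠ y in 𝓝[Ioo a b] p, |ω y| < |κ⁻¹| + 1 :=
    hlim'.abs.eventually (gt_mem_nhds (by linarith))
  -- intermediate points
  have hmem : ∀ x ∈ Ioo a b, ∀ θ ∈ Icc (0:ℝ) 1, x + θ * (h x - x) ∈ Ioo a b := by
    intro x hx θ hθ
    have := (convex_Ioo a b).add_smul_sub_mem hx (hm x hx) hθ
    simpa using this
  have hev : ∀ {Q : ℝ → Prop}, (∀ᶠ y in 𝓝[Ioo a b] p, Q y) →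
      ∀ᶠ x in 𝓝[Ioo a b] p, ∀ θ ∈ Icc (0:ℝ) 1, Q (x + θ * (h x - x)) := by
    intro Q hQ
    rw [eventually_nhdsWithin_iff, Metric.eventually_nhds_iff_ball] at hQ
    obtain ⟨ε, hε, hQ⟩ := hQ
    have h1 : ∀ᶠ x in 𝓝 p, h x ∈ Metric.ball p ε := by
      have := gd.sm.continuous.tendsto p
      rw [hhp] at this
      exact this (Metric.ball_mem_nhds p hε)
    filter_upwards [nhdsWithin_le_nhds h1, nhdsWithin_le_nhds (Metric.ball_mem_nhds p hε), self_mem_nhdsWithin]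
      with x h2 h3 h4 θ hθ
    refine hQ _ ?_ (hmem x h4 θ hθ)
    have := (convex_ball p ε).add_smul_sub_mem h3 h2 hθ
    simpa using this
  have hid : ∀ x ∈ Ioo a b, ∀ θ ∈ Icc (0:ℝ) 1,
      (h x - x) * (W (x + θ * (h x - x)))⁻¹ = β (θ, x) * ω (x + θ * (h x - x)) := by
    intro x hx θ hθ
    have hxp : x - p ≠ 0 := sub_ne_zero.2 fun e => hp (e ▸ hx)
    have hy := hmem x hx θ hθ
    have hyp : x + θ * (h x - x) - p ≠ 0 := sub_ne_zero.2 fun e => hp (e ▸ hy)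
    have e1 : x + θ * (h x - x) - p = (x - p) * (1 + θ * ((x - p) ^ m * B x)) := by rw [hh]; ring
    have hq : 1 + θ * ((x - p) ^ m * B x) ≠ 0 := fun e => hyp (by rw [e1, e, mul_zero])
    simp only [hβ, hω]
    have hAy := hAne _ hy
    have hWy := hW0 _ hy
    rw [e1, mul_pow]
    generalize A (x + θ * (h x - x)) = α at *
    generalize W (x + θ * (h x - x)) = γ at *
    generalize 1 + θ * ((x - p) ^ m * B x) = δ at *
    rw [hh x]
    field_simp
  have hintg : ∀ x, tt W x (h x) = ∫ θ in (0:ℝ)..1, (h x - x) * (W (x + θ * (h x - x)))⁻¹ := by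
    intro x
    have := intervalIntegral.smul_integral_comp_add_mul (a := 0) (b := 1) (fun t => (W t)⁻¹) (h x - x) x
    rw [intervalIntegral.integral_const_mul]
    unfold tt
    simp only [smul_eq_mul, mul_zero, add_zero, mul_one, add_sub_cancel] at this
    rw [← this]
    simp_rw [mul_comm (h x - x)]
  have hkn : kn m A B p / κ = ∫ θ in (0:ℝ)..1, β (θ, p) * κ⁻¹ := by
    rw [intervalIntegral.integral_mul_const, div_eq_mul_inv]
    simp [kn, hβ, hhp]
  rw [hkn]
  simp_rw [hintg]
  refine intervalIntegral.tendsto_integral_filter_of_dominated_convergence (fun _ => (C + 1) * (|κ⁻¹| + 1)) ?_ ?_ ?_ ?_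
  · filter_upwards [self_mem_nhdsWithin] with x hx
    refine (ContinuousOn.mul continuousOn_const (ContinuousOn.inv₀ (hWc.comp (by fun_prop)
      (s := Icc 0 1) fun θ hθ => hmem x hx θ hθ) fun θ hθ => hW0 _ (hmem x hx θ hθ))).mono
      (by rw [uIoc_of_le zero_le_one]; exact Ioc_subset_Icc_self) |>.aestronglyMeasurable measurableSet_uIoc
  · filter_upwards [self_mem_nhdsWithin, nhdsWithin_le_nhds hbd, hev hωb] with x hx h1 h2
    refine Eventually.of_forall fun θ hθ => ?_
    rw [uIoc_of_le zero_le_one] at hθ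
    have hθ' := Ioc_subset_Icc_self hθ
    rw [hid x hx θ hθ', Real.norm_eq_abs, abs_mul]
    exact mul_le_mul (h1 θ hθ').le (h2 θ hθ').le (abs_nonneg _) ((abs_nonneg _).trans (h1 θ hθ').le)
  · exact intervalIntegrable_const
  · refine Eventually.of_forall fun θ hθ => ?_
    rw [uIoc_of_le zero_le_one] at hθ
    have hθ' := Ioc_subset_Icc_self hθ
    have t1 : Tendsto (fun x => β (θ, x)) (𝓝[Ioo a b] p) (𝓝 (β (θ, p))) :=
      (ContinuousAt.comp (f := fun x : ℝ => ((θ, x) : ℝ × ℝ)) (hβc θ hθ') (by fun_prop)).tendsto.mono_left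
        nhdsWithin_le_nhds
    have t2 : Tendsto (fun x => ω (x + θ * (h x - x))) (𝓝[Ioo a b] p) (𝓝 κ⁻¹) := by
      refine tendsto_def.2 fun s hs => ?_
      have := hev (Q := fun y => ω y ∈ s) (hlim' hs)
      filter_upwards [this] with x hx using hx θ hθ'
    refine (t1.mul t2).congr' ?_
    filter_upwards [self_mem_nhdsWithin] with x hx
    exact (hid x hx θ hθ').symm
end
end

section
section
variable {D : Set ℝ} {f f' g g' : ℝ → ℝ}

/-- an invariant field on a component -/
structure FF (f f' g g' W : ℝ → ℝ) (a b : ℝ) : Prop where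
  fd : Fd f W a b
  iff : Ivr f f' W a b
  ivg : Ivr g g' W a b

/-- the rotation type relation -/
def RelT (P Q : Equiv.Perm ℝ) (τ x : ℝ) : Prop :=
  ∀ m n : ℤ, 0 < ((P ^ m) ((Q ^ n) x) - x) * (P x - x) ↔ 0 < m + n * τ

theorem RelT.unique {P Q : Equiv.Perm ℝ} {τ τ' x : ℝ} (h : RelT P Q τ x) (h' : RelT P Q τ' x) : τ = τ' := by
  have key : ∀ {τ τ' : ℝ}, RelT P Q τ x → RelT P Q τ' x → ¬ τ < τ' := by
    intro τ τ' h h' hl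
    obtain ⟨q, h1, h2⟩ := exists_rat_btwn hl
    have hq : (0:ℝ) < q.den := by exact_mod_cast q.den_pos
    have e : (q:ℝ) = q.num / q.den := Rat.cast_def q
    rw [e, lt_div_iff₀ hq] at h1
    rw [e, div_lt_iff₀ hq] at h2
    have h3 := (h' (-q.num) q.den).2 (by push_cast; linarith)
    have h4 := (h (-q.num) q.den).1 h3
    push_cast at h4
    linarith
  exact le_antisymm (not_lt.1 (key h' h)) (not_lt.1 (key h h'))

theorem FF.c_pos {W : ℝ → ℝ} {a b x : ℝ} (h : FF f f' g g' W a b) (hx : x ∈ Ioo a b) : 0 < tt W x (f x) :=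
  (h.fd.tt_pos hx (h.iff.mem hx)).2 (mul_self_pos.2 (sub_ne_zero.2 (h.fd.cp.ne x hx)))

theorem FF.rel {W : ℝ → ℝ} {a b x y : ℝ} (h : FF f f' g g' W a b) (hf : GDiff f f') (hg : GDiff g g')
    (hx : x ∈ Ioo a b) (hy : y ∈ Ioo a b) :
    RelT hf.perm hg.perm (tt W y (g y) / tt W y (f y)) x := by
  intro m n
  have h1 := h.fd.word h.iff h.ivg m n hx hy
  have h2 := h.fd.tt_pos hx (h.iff.zpow_mem m (h.ivg.zpow_mem n hx))
  rw [h1] at h2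
  refine h2.symm.trans ?_
  have h3 := h.c_pos hy
  have e : (m:ℝ) + n * (tt W y (g y) / tt W y (f y)) = (m * tt W y (f y) + n * tt W y (g y)) / tt W y (f y) := by
    field_simp
  rw [e, div_pos_iff_of_pos_right h3]

theorem CP.ff (h : CP D f f' g g') {R : ℝ → ℝ} (hR : Sz f f' R) {a b : ℝ} (ha : 0 ≤ a) (hb : b ≤ 1) (hc : Cpt f a b) :
    FF f f' g g' (xi f R) a b :=
  ⟨hR.fd (by linarith) (by linarith) hc, hR.ivr (by linarith) (by linarith) hc,
    Ivr.of_kopell hR h.gg.toGDiff h.comm ha hb (h.fix ⟨ha, hc.lt.le.trans hb⟩ hc.fa) (h.fix ⟨ha.trans hc.lt.le, hb⟩ hc.fb)⟩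

theorem CP.comm' (h : CP D f f' g g') : ∀ x ∈ Icc (0:ℝ) 1, f' (g x) = g (f' x) := by
  intro x hx
  have := h.comm (f' x) (h.gf.symm.mapsTo hx)
  rw [h.gf.right] at this
  rw [← this, h.gf.left]

theorem Cpt.inv (h : GDiff f f') {a b : ℝ} (hc : Cpt f a b) : Cpt f' a b := by
  refine ⟨hc.lt, ?_, ?_, fun x hx e => hc.ne x hx ?_⟩
  · have := h.left a; rwa [hc.fa] at this
  · have := h.left b; rwa [hc.fb] at this
  · have := h.right x; rwa [e] at this

theorem Ivr.inv {W : ℝ → ℝ} {a b : ℝ} (h : Ivr f f' W a b) : Ivr f' f W a b := h.symm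

theorem CP.ff' (h : CP D f f' g g') {R : ℝ → ℝ} (hR : Sz f' f R) {a b : ℝ} (ha : 0 ≤ a) (hb : b ≤ 1) (hc : Cpt f a b) :
    FF f f' g g' (fun x => - xi f' R x) a b :=
  ⟨hR.fd' (by linarith) (by linarith) hc, ((hR.ivr (by linarith) (by linarith) (hc.inv h.gf.toGDiff)).symm).neg,
    (Ivr.of_kopell hR h.gg.toGDiff h.comm' ha hb (h.fix ⟨ha, hc.lt.le.trans hb⟩ hc.fa)
      (h.fix ⟨ha.trans hc.lt.le, hb⟩ hc.fb)).neg⟩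

theorem CP.side (h : CP D f f' g g') {a b p : ℝ} (ha : 0 ≤ a) (hb : b ≤ 1) (hc : Cpt f a b) (hp : p = a ∨ p = b) :
    ∃ W κ, 0 < κ ∧ FF f f' g g' W a b ∧ Tendsto (fun x => W x / (f x - x)) (𝓝[Ioo a b] p) (𝓝 κ) := by
  have hfp : f p = p := by rcases hp with rfl | rfl; exacts [hc.fa, hc.fb]
  obtain ⟨R, hR⟩ := Sz.exists h.gf
  obtain ⟨R', hR'⟩ := Sz.exists h.gf.symm
  have key : (∀ x ∈ Ioo a b, (f x - x) * (x - p) ≤ 0) ∨ (∀ x ∈ Ioo a b, 0 ≤ (f x - x) * (x - p)) := by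
    rcases hp with rfl | rfl <;> rcases hc.sgn h.gf.sm.continuous with hs | hs
    · right; intro x hx; exact mul_nonneg (hs x hx).le (by linarith [hx.1])
    · left; intro x hx; exact mul_nonpos_of_nonpos_of_nonneg (hs x hx).le (by linarith [hx.1])
    · left; intro x hx; exact mul_nonpos_of_nonneg_of_nonpos (hs x hx).le (by linarith [hx.2])
    · right; intro x hx; exact mul_nonneg_of_nonpos_of_nonpos (hs x hx).le (by linarith [hx.2])
  rcases key with k | k
  · exact ⟨_, 1, one_pos, h.ff hR ha hb hc, hR.ratio (by linarith) (by linarith) hfp fun x hx => ⟨hc.ne x hx, k x hx⟩⟩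
  · exact ⟨_, _, inv_pos.2 (h.gf.pos p), h.ff' hR' ha hb hc,
      hR'.ratio' (by linarith) (by linarith) hfp fun x hx => ⟨hc.ne x hx, k x hx⟩⟩

theorem FF.bound {W : ℝ → ℝ} {a b : ℝ} (h : FF f f' g g' W a b) (hf : GDiff f f') (hg : GDiff g g')
    (ha : 0 ≤ a) (hb : b ≤ 1) : ∃ C, ∀ x ∈ Ioo a b, |g x - x| ≤ C * |f x - x| := by
  have hm : (a + b) / 2 ∈ Ioo a b := ⟨by linarith [h.fd.cp.lt], by linarith [h.fd.cp.lt]⟩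
  set τ := tt W ((a+b)/2) (g ((a+b)/2)) / tt W ((a+b)/2) (f ((a+b)/2)) with hτ
  obtain ⟨n, hn⟩ := exists_nat_gt |τ|
  obtain ⟨C1, hC1⟩ := hf.pow_up n
  obtain ⟨C2, hC2⟩ := hf.symm.pow_up n
  obtain ⟨C3, hC3⟩ := hf.symm.cmp_inv
  refine ⟨max C1 0 + max C2 0 * max C3 0, fun x hx => ?_⟩
  have hx01 : x ∈ Icc (0:ℝ) 1 := ⟨ha.trans hx.1.le, hx.2.le.trans hb⟩
  have r := h.rel hf hg hx hm
  rw [← hτ] at r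
  have r1 := r (-(n:ℤ)) 1
  have r2 := r (n:ℤ) 1
  simp only [zpow_one, zpow_natCast, zpow_neg, Int.cast_natCast, Int.cast_neg, Int.cast_one, one_mul] at r1 r2
  have hτ1 := abs_lt.1 hn
  have r1' := not_lt.1 (r1.not.2 (by linarith))
  have r2' := r2.2 (by linarith)
  have ef : hf.perm x = f x := rfl
  have eg : hg.perm x = g x := rfl
  rw [ef, eg] at r1' r2'
  have m1 : StrictMono (⇑(hf.perm ^ n)) := by simpa using (hf.zpow n).mono
  have e1 : (hf.perm ^ n) ((hf.perm ^ n)⁻¹ (g x)) = g x := Equiv.apply_symm_apply _ _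
  have e2 : (hf.perm ^ n) ((hf.symm.perm ^ n) x) = x := by
    have : hf.symm.perm = hf.perm⁻¹ := rfl
    rw [this, inv_pow]; exact Equiv.apply_symm_apply _ _
  have b1 := hC1 x hx01
  have b2 := hC2 x hx01
  have b3 := hC3 x hx01
  have key : |g x - x| ≤ |(hf.perm ^ n) x - x| + |(hf.symm.perm ^ n) x - x| := by
    have k1 := abs_nonneg ((hf.perm ^ n) x - x)
    have k2 := abs_nonneg ((hf.symm.perm ^ n) x - x)
    have k3 := le_abs_self ((hf.perm ^ n) x - x)
    have k4 := le_abs_self ((hf.symm.perm ^ n) x - x)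
    have k5 := neg_abs_le ((hf.perm ^ n) x - x)
    have k6 := neg_abs_le ((hf.symm.perm ^ n) x - x)
    rcases lt_or_gt_of_ne (h.fd.cp.ne x hx) with hs | hs
    · have l1 : x ≤ (hf.perm ^ n)⁻¹ (g x) := by by_contra hcon; push Not at hcon; nlinarith
      have l2 : (hf.perm ^ n) (g x) < x := by by_contra hcon; push Not at hcon; nlinarith
      have l3 := m1.monotone l1
      rw [e1] at l3
      have l4 : g x < (hf.symm.perm ^ n) x := by rw [← m1.lt_iff_lt, e2]; exact l2
      rw [abs_le]; constructor <;> linarith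
    · have l1 : (hf.perm ^ n)⁻¹ (g x) ≤ x := by by_contra hcon; push Not at hcon; nlinarith
      have l2 : x < (hf.perm ^ n) (g x) := by by_contra hcon; push Not at hcon; nlinarith
      have l3 := m1.monotone l1
      rw [e1] at l3
      have l4 : (hf.symm.perm ^ n) x < g x := by rw [← m1.lt_iff_lt, e2]; exact l2
      rw [abs_le]; constructor <;> linarith
  have q0 := abs_nonneg (f x - x)
  have q1 := abs_nonneg (f' x - x)
  have := mul_le_mul_of_nonneg_right (le_max_left C1 0) q0
  have w1 := mul_le_mul_of_nonneg_right (le_max_left C2 0) q1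
  have w2 := mul_le_mul_of_nonneg_right (le_max_left C3 0) q0
  have w3 := mul_le_mul_of_nonneg_left (b3.trans w2) (le_max_right C2 0)
  calc |g x - x| ≤ _ := key
    _ ≤ max C1 0 * |f x - x| + max C2 0 * (max C3 0 * |f x - x|) := by linarith
    _ = _ := by ring

/-- local data at a non flat fixed point -/
theorem CP.nonflat (h : CP D f f' g g') {p : ℝ} (hp : p ∈ Icc (0:ℝ) 1) (hpD : p ∉ D) (fp : f p = p) :
    ∃ m A, Sm A ∧ A p ≠ 0 ∧ ∀ x, f x - x = (x - p) ^ (m + 1) * A x := by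
  have hs : Sm (fun x => f x - x) := h.gf.sm.sub contDiff_id
  obtain ⟨m, w, hw, hwp, e⟩ := (not_flat_iff hs).1 (fun e => hpD ((h.flf p hp).1 e))
  rcases m with _ | m
  · exfalso
    have := e p
    simp only [fp, sub_self, pow_zero, one_mul] at this
    exact hwp this.symm
  · exact ⟨m, w, hw, hwp, e⟩

theorem CP.isol (h : CP D f f' g g') {p : ℝ} (hp : p ∈ Icc (0:ℝ) 1) (hpD : p ∉ D) (fp : f p = p) :
    ∃ δ > 0, ∀ x, |x - p| < δ → x ≠ p → f x ≠ x := by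
  obtain ⟨m, A, sA, hA, e⟩ := h.nonflat hp hpD fp
  have := sA.continuous.continuousAt.eventually_ne hA
  rw [Metric.eventually_nhds_iff] at this
  obtain ⟨δ, hδ, h1⟩ := this
  refine ⟨δ, hδ, fun x hx hne h2 => ?_⟩
  have h3 := e x
  rw [h2, sub_self] at h3
  exact mul_ne_zero (pow_ne_zero _ (sub_ne_zero.2 hne)) (h1 hx) h3.symm

/-- every point near a nonflat fixed point lies in an adjacent component -/
theorem CP.adj (h : CP D f f' g g') {p : ℝ} (hp : p ∈ Icc (0:ℝ) 1) (hpD : p ∉ D) (fp : f p = p) :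
    ∃ δ > 0, ∀ x ∈ Icc (0:ℝ) 1, |x - p| < δ → x ≠ p →
      ∃ a b, 0 ≤ a ∧ b ≤ 1 ∧ x ∈ Ioo a b ∧ Cpt f a b ∧ (p = a ∨ p = b) := by
  obtain ⟨δ, hδ, h1⟩ := h.isol hp hpD fp
  refine ⟨δ, hδ, fun x hx hxp hne => ?_⟩
  obtain ⟨a, b, ha, hb, hxab, hc⟩ := Cpt.exists h.gf.sm.continuous h.gf.zero h.gf.one hx (h1 x hxp hne)
  refine ⟨a, b, ha, hb, hxab, hc, ?_⟩
  have hpn : p ∉ Ioo a b := fun e => hc.ne p e fp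
  by_contra hcon
  push Not at hcon
  rw [abs_lt] at hxp
  rcases lt_or_gt_of_ne hne with hl | hl
  · have : b < p := by
      by_contra h2; push Not at h2
      exact hpn ⟨hxab.1.trans hl, lt_of_le_of_ne h2 hcon.2⟩
    exact h1 b (by rw [abs_lt]; constructor <;> linarith [hxab.2]) this.ne hc.fb
  · have : p < a := by
      by_contra h2; push Not at h2
      exact hpn ⟨lt_of_le_of_ne h2 (Ne.symm hcon.1), hl.trans hxab.2⟩
    exact h1 a (by rw [abs_lt]; constructor <;> linarith [hxab.1]) this.ne' hc.fa

theorem end_neBot {a b p : ℝ} (h : a < b) (hp : p = a ∨ p = b) : (𝓝[Ioo a b] p).NeBot := by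
  rw [← mem_closure_iff_nhdsWithin_neBot, closure_Ioo h.ne]
  rcases hp with rfl | rfl
  exacts [left_mem_Icc.2 h.le, right_mem_Icc.2 h.le]

theorem CP.kn_tt (h : CP D f f' g g') {a b p : ℝ} (hpp : p ∈ Icc (0:ℝ) 1) (ha : 0 ≤ a) (hb : b ≤ 1) (hc : Cpt f a b)
    (hp : p = a ∨ p = b) {m : ℕ} {A B : ℝ → ℝ} (sA : Sm A) (hA : A p ≠ 0) (eA : ∀ x, f x - x = (x - p) ^ (m + 1) * A x)
    (sB : Sm B) (eB : ∀ x, g x - x = (x - p) ^ (m + 1) * B x) :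
    ∃ W κ, 0 < κ ∧ FF f f' g g' W a b ∧ Tendsto (fun x => W x / (f x - x)) (𝓝[Ioo a b] p) (𝓝 κ) ∧
      ∀ x ∈ Ioo a b, tt W x (f x) = kn m A A p / κ ∧ tt W x (g x) = kn m A B p / κ := by
  obtain ⟨W, κ, hκ, hW, hl⟩ := h.side ha hb hc hp
  refine ⟨W, κ, hκ, hW, hl, fun x hx => ?_⟩
  have hpn : p ∉ Ioo a b := by rcases hp with rfl | rfl <;> simp
  have hAne : ∀ x ∈ Ioo a b, A x ≠ 0 := fun x hx e => hc.ne x hx (by have := eA x; rw [e, mul_zero] at this; linarith)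
  have hl' : Tendsto (fun x => W x / ((x - p) ^ (m + 1) * A x)) (𝓝[Ioo a b] p) (𝓝 κ) :=
    hl.congr fun x => by rw [eA]
  have l1 := kn_lim h.gf.toGDiff sA sA hA eA (fun x hx => hW.iff.mem hx) hpn hAne hW.fd.cont (fun x hx => hW.fd.ne hx) hκ.ne' hl'
  have l2 := kn_lim h.gg.toGDiff sA sB hA eB (fun x hx => hW.ivg.mem hx) hpn hAne hW.fd.cont (fun x hx => hW.fd.ne hx) hκ.ne' hl'
  have := end_neBot hc.lt hp
  constructor
  · refine tendsto_nhds_unique (tendsto_const_nhds.congr' ?_) l1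
    filter_upwards [self_mem_nhdsWithin] with y hy
    exact hW.fd.const hW.iff hx hy
  · refine tendsto_nhds_unique (tendsto_const_nhds.congr' ?_) l2
    filter_upwards [self_mem_nhdsWithin] with y hy
    exact hW.fd.const hW.ivg hx hy

theorem CP.factor_g (h : CP D f f' g g') {a b p : ℝ} (ha : 0 ≤ a) (hb : b ≤ 1) (hc : Cpt f a b)
    (hp : p = a ∨ p = b) {m : ℕ} {A : ℝ → ℝ} (sA : Sm A) (eA : ∀ x, f x - x = (x - p) ^ (m + 1) * A x) :
    ∃ B, Sm B ∧ ∀ x, g x - x = (x - p) ^ (m + 1) * B x := by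
  obtain ⟨W, κ, hκ, hW, hl⟩ := h.side ha hb hc hp
  obtain ⟨C, hC⟩ := hW.bound h.gf.toGDiff h.gg.toGDiff ha hb
  have hs : Sm (fun x => g x - x) := h.gg.sm.sub contDiff_id
  rcases factor hs p (m+1) with ⟨k, hk, w, hw, hwp, e⟩ | ⟨w, hw, e⟩
  · exfalso
    have := end_neBot hc.lt hp
    have hpn : p ∉ Ioo a b := by rcases hp with rfl | rfl <;> simp
    have l1 : Tendsto (fun x => |w x|) (𝓝[Ioo a b] p) (𝓝 |w p|) :=
      (hw.continuous.abs.tendsto p).mono_left nhdsWithin_le_nhds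
    have l2 : Tendsto (fun x => C * (|x - p| ^ (m + 1 - k) * |A x|)) (𝓝[Ioo a b] p) (𝓝 0) := by
      have cA := sA.continuous
      have : Continuous fun x => C * (|x - p| ^ (m + 1 - k) * |A x|) := by fun_prop
      have := this.tendsto p
      rw [sub_self, abs_zero, zero_pow (by omega), zero_mul, mul_zero] at this
      exact this.mono_left nhdsWithin_le_nhds
    have : |w p| ≤ 0 := by
      refine le_of_tendsto_of_tendsto l1 l2 ?_
      filter_upwards [self_mem_nhdsWithin] with x hx
      have h1 := hC x hx
      have h2 : 0 < |x - p| := abs_pos.2 (sub_ne_zero.2 fun e => hpn (e ▸ hx))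
      have e' := e x
      rw [e', eA, abs_mul, abs_mul, abs_pow, abs_pow] at h1
      have h3 : |x - p| ^ (m + 1) = |x - p| ^ k * |x - p| ^ (m + 1 - k) := by rw [← pow_add]; congr 1; omega
      rw [h3] at h1
      refine le_of_mul_le_mul_left (a := |x - p| ^ k) ?_ (by positivity)
      linarith
    exact hwp (abs_nonpos_iff.1 this)
  · exact ⟨w, hw, e⟩

theorem CP.tau_fix (h : CP D f f' g g') {p : ℝ} (hp : p ∈ Icc (0:ℝ) 1) (hpD : p ∉ D) (fp : f p = p) :
    ∃ τ, ∃ δ > 0, ∀ x ∈ Icc (0:ℝ) 1, |x - p| < δ → x ≠ p → RelT h.gf.perm h.gg.perm τ x := by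
  obtain ⟨δ, hδ, h1⟩ := h.adj hp hpD fp
  obtain ⟨m, A, sA, hA, eA⟩ := h.nonflat hp hpD fp
  by_cases hx0 : ∃ x0 ∈ Icc (0:ℝ) 1, |x0 - p| < δ ∧ x0 ≠ p
  swap
  · push Not at hx0
    exact ⟨0, δ, hδ, fun x hx hxp hne => absurd (hx0 x hx hxp) hne⟩
  obtain ⟨x0, hx0, hxp0, hne0⟩ := hx0
  obtain ⟨a, b, ha, hb, hx, hc, hpab⟩ := h1 x0 hx0 hxp0 hne0
  obtain ⟨B, sB, eB⟩ := h.factor_g ha hb hc hpab sA eA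
  refine ⟨kn m A B p / kn m A A p, δ, hδ, fun x hx hxp hne => ?_⟩
  obtain ⟨a, b, ha, hb, hx, hc, hpab⟩ := h1 x hx hxp hne
  obtain ⟨W, κ, hκ, hW, -, h2⟩ := h.kn_tt hp ha hb hc hpab sA hA eA sB eB
  have h3 := hW.rel h.gf.toGDiff h.gg.toGDiff hx hx
  rw [(h2 x hx).1, (h2 x hx).2] at h3
  rwa [div_div_div_cancel_right₀ hκ.ne'] at h3

theorem CP.tau (h : CP D f f' g g') : ∃ τ, ∀ x ∈ Icc (0:ℝ) 1, f x ≠ x → RelT h.gf.perm h.gg.perm τ x := by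
  have I2 : ∀ {x : ℝ}, x ∈ Ioo (0:ℝ) 1 → x ∉ D := by
    intro x hx hxD
    have := h.hD hxD
    simp only [mem_insert_iff, mem_singleton_iff] at this
    rcases this with rfl | rfl
    · exact lt_irrefl _ hx.1
    · exact lt_irrefl _ hx.2
  obtain ⟨R, hR⟩ := Sz.exists h.gf
  have hU : ∀ x ∈ Icc (0:ℝ) 1, f x ≠ x → ∃ τ, ∀ᶠ y in 𝓝 x, RelT h.gf.perm h.gg.perm τ y := by
    intro x hx hne
    obtain ⟨a, b, ha, hb, hxab, hc⟩ := Cpt.exists h.gf.sm.continuous h.gf.zero h.gf.one hx hne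
    refine ⟨tt (xi f R) x (g x) / tt (xi f R) x (f x), ?_⟩
    · filter_upwards [isOpen_Ioo.mem_nhds hxab] with y hy
      exact (h.ff hR ha hb hc).rel h.gf.toGDiff h.gg.toGDiff hy hxab
  have hL : ∀ x ∈ Ioo (0:ℝ) 1, ∃ τ, ∀ᶠ y in 𝓝[≠] x, RelT h.gf.perm h.gg.perm τ y := by
    intro x hx
    by_cases hne : f x = x
    · obtain ⟨τ, δ, hδ, h1⟩ := h.tau_fix (Ioo_subset_Icc_self hx) (I2 hx) hne
      refine ⟨τ, ?_⟩
      filter_upwards [nhdsWithin_le_nhds (isOpen_Ioo.mem_nhds hx), nhdsWithin_le_nhds (Metric.ball_mem_nhds x hδ),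
        self_mem_nhdsWithin] with y h2 h3 h4
      exact h1 y (Ioo_subset_Icc_self h2) h3 h4
    · obtain ⟨τ, h1⟩ := hU x (Ioo_subset_Icc_self hx) hne
      exact ⟨τ, nhdsWithin_le_nhds h1⟩
  choose! T hT using hL
  have hu : ∀ x ∈ Ioo (0:ℝ) 1, ∀ τ, (∀ᶠ y in 𝓝[≠] x, RelT h.gf.perm h.gg.perm τ y) → T x = τ := by
    intro x hx τ h1
    obtain ⟨y, h2, h3⟩ := ((hT x hx).and h1).exists
    exact h2.unique h3
  have hlc : ∀ x ∈ Ioo (0:ℝ) 1, ∀ᶠ y in 𝓝 x, T y = T x := by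
    intro x hx
    have h1 := hT x hx
    rw [← eventually_eventually_nhdsWithin, eventually_nhdsWithin_iff] at h1
    filter_upwards [h1, isOpen_Ioo.mem_nhds hx] with y h2 h3
    by_cases hy : y = x
    · rw [hy]
    · have h4 : ∀ᶠ z in 𝓝 y, z ∈ ({x}ᶜ : Set ℝ) := isOpen_compl_singleton.mem_nhds hy
      have h5 := h2 hy
      rw [eventually_nhdsWithin_iff] at h5
      refine hu y h3 _ ?_
      filter_upwards [nhdsWithin_le_nhds h4, nhdsWithin_le_nhds h5] with z h6 h7
      exact h7 h6
  have hd : ∀ x ∈ Ioo (0:ℝ) 1, HasDerivAt T 0 x := fun x hx =>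
    (hasDerivAt_const x (T x)).congr_of_eventuallyEq (hlc x hx)
  have hconst : ∀ x ∈ Ioo (0:ℝ) 1, T x = T (1/2) := fun x hx =>
    isOpen_Ioo.is_const_of_deriv_eq_zero isPreconnected_Ioo
      (fun y hy => (hd y hy).differentiableAt.differentiableWithinAt) (fun y hy => (hd y hy).deriv) hx (by norm_num)
  refine ⟨T (1/2), fun x hx hne => ?_⟩
  have hx' : x ∈ Ioo (0:ℝ) 1 := by
    refine ⟨lt_of_le_of_ne hx.1 ?_, lt_of_le_of_ne hx.2 ?_⟩
    · rintro rfl; exact hne h.gf.zero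
    · rintro rfl; exact hne h.gf.one
  obtain ⟨τ, h1⟩ := hU x hx hne
  rw [← hconst x hx', hu x hx' τ (nhdsWithin_le_nhds h1)]
  exact h1.self_of_nhds
end
end

section
section
variable {D : Set ℝ} {f f' g g' : ℝ → ℝ}

theorem GDiff.mem_iff (h : GDiff f f') (x : ℝ) : h.perm x ∈ Icc (0:ℝ) 1 ↔ x ∈ Icc (0:ℝ) 1 :=
  ⟨fun hx => by have := h.symm.mapsTo hx; rwa [show f' (h.perm x) = x from h.left x] at this, fun hx => h.mapsTo hx⟩

theorem CP.rational (h : CP D f f' g g') (hf : DiffStar D f) {τ : ℝ}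
    (hτ : ∀ x ∈ Icc (0:ℝ) 1, f x ≠ x → RelT h.gf.perm h.gg.perm τ x) (hi : ¬ Irrational τ) :
    ∃ k kinv : ℝ → ℝ, DiffStar D k ∧ IsInverseOn kinv k (Icc (0 : ℝ) 1) ∧
      ∃ q q' : ℤ, (∀ x ∈ Icc (0 : ℝ) 1, f x = zpowIter k kinv q x) ∧
        ∀ x ∈ Icc (0 : ℝ) 1, g x = zpowIter k kinv q' x := by
  unfold Irrational at hi
  push Not at hi
  obtain ⟨r, rfl⟩ := hi
  have hden : (0:ℝ) < r.den := by exact_mod_cast r.den_pos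
  have er : (r:ℝ) = r.num / r.den := Rat.cast_def r
  set P := h.gf.toGDiff.perm with hP
  set Q := h.gg.toGDiff.perm with hQ
  have hword : ∀ x ∈ Icc (0:ℝ) 1, (P ^ (-r.num)) ((Q ^ (r.den:ℤ)) x) = x := by
    intro x hx
    by_cases hne : f x = x
    · have hg := h.fix hx hne
      have e1 : (Q ^ (r.den:ℤ)) x = x := Function.IsFixedPt.perm_zpow (e := Q) hg _
      rw [e1]
      exact Function.IsFixedPt.perm_zpow (e := P) hne _
    · obtain ⟨a, b, ha, hb, hxab, hc⟩ := Cpt.exists h.gf.sm.continuous h.gf.zero h.gf.one hx hne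
      obtain ⟨R, hR⟩ := Sz.exists h.gf
      have hF := h.ff hR ha hb hc
      have h1 := (hF.rel h.gf.toGDiff h.gg.toGDiff hxab hxab).unique (hτ x hx hne)
      have h2 := hF.fd.word hF.iff hF.ivg (-r.num) r.den hxab hxab
      have h3 := hF.c_pos hxab
      rw [er, div_eq_div_iff h3.ne' hden.ne'] at h1
      refine (hF.fd.tt_inj hxab (hF.iff.zpow_mem _ (hF.ivg.zpow_mem _ hxab)) ?_).symm
      rw [h2]
      push_cast
      linarith
  set P' := P.subtypePerm (p := fun x => x ∈ Icc (0:ℝ) 1) h.gf.toGDiff.mem_iff with hP'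
  set Q' := Q.subtypePerm (p := fun x => x ∈ Icc (0:ℝ) 1) h.gg.toGDiff.mem_iff with hQ'
  have hcomm : Commute P' Q' := by
    ext x
    exact h.comm x.1 x.2
  have hPQ : P' ^ r.num = Q' ^ (r.den : ℤ) := by
    have : P' ^ (-r.num) * Q' ^ (r.den : ℤ) = 1 := by
      ext x
      rw [hP', hQ', Equiv.Perm.subtypePerm_zpow, Equiv.Perm.subtypePerm_zpow]
      exact hword x.1 x.2
    rw [zpow_neg] at this
    exact (inv_mul_eq_one.1 this)
  obtain ⟨v, u, huv⟩ : ∃ v u : ℤ, v * r.den + u * r.num = 1 := by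
    have : IsCoprime r.num (r.den:ℤ) := Int.isCoprime_iff_gcd_eq_one.2 (by simpa [Int.gcd] using r.reduced)
    obtain ⟨u, v, e⟩ := this
    exact ⟨v, u, by linarith⟩
  set K := h.gf.toGDiff.zpow v with hK
  have gk := (h.gf.toGDiff.zpow v).comp (h.gg.toGDiff.zpow u)
  set k : ℝ → ℝ := fun x => (P ^ v) ((Q ^ u) x) with hk
  set K' := gk.perm.subtypePerm (p := fun x => x ∈ Icc (0:ℝ) 1) gk.mem_iff with hK'
  have hKe : K' = P' ^ v * Q' ^ u := by
    ext x
    rw [hP', hQ', Equiv.Perm.subtypePerm_zpow, Equiv.Perm.subtypePerm_zpow]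
    rfl
  have e1 : K' ^ (r.den:ℤ) = P' := by
    rw [hKe, (hcomm.zpow_zpow v u).mul_zpow, ← zpow_mul, ← zpow_mul, mul_comm u, zpow_mul Q', ← hPQ, ← zpow_mul, ← zpow_add,
      mul_comm r.num, huv, zpow_one]
  have e2 : K' ^ r.num = Q' := by
    rw [hKe, (hcomm.zpow_zpow v u).mul_zpow, ← zpow_mul, ← zpow_mul, mul_comm v, zpow_mul P', hPQ, ← zpow_mul, ← zpow_add,
      mul_comm _ v, huv, zpow_one]
  have ef : ∀ x ∈ Icc (0:ℝ) 1, f x = (gk.perm ^ (r.den:ℤ)) x := by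
    intro x hx
    have := congrArg (fun e : Equiv.Perm _ => (e ⟨x, hx⟩).1) e1
    rw [hK', Equiv.Perm.subtypePerm_zpow] at this
    exact this.symm
  have eg : ∀ x ∈ Icc (0:ℝ) 1, g x = (gk.perm ^ r.num) x := by
    intro x hx
    have := congrArg (fun e : Equiv.Perm _ => (e ⟨x, hx⟩).1) e2
    rw [hK', Equiv.Perm.subtypePerm_zpow] at this
    exact this.symm
  refine ⟨k, _, hf.of_cmp gk ?_ ⟨1, fun x hx => ?_⟩, ⟨fun x _ => gk.left x, fun x _ => gk.right x⟩, r.den, r.num,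
    fun x hx => ?_, fun x hx => ?_⟩
  · obtain ⟨C, hC⟩ := gk.pow_up r.den
    refine ⟨C, fun x hx => ?_⟩
    rw [ef x hx]
    simpa using hC x hx
  · obtain ⟨n, hn⟩ := Nat.exists_eq_succ_of_ne_zero r.den_nz
    rw [ef x hx, hn, one_mul]
    have := gk.pow_low n x
    rw [zpow_natCast]
    exact this
  · rw [gk.zpowIter_eq]; exact ef x hx
  · rw [gk.zpowIter_eq]; exact eg x hx

theorem dense_word {τ : ℝ} (hi : Irrational τ) {s t : ℝ} (hst : s < t) : ∃ m n : ℤ, s < m + n * τ ∧ m + n * τ < t := by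
  have h := dense_addSubgroupClosure_pair_iff (a := τ) (b := 1)
  rw [div_one] at h
  obtain ⟨z, hz, hz'⟩ := (h.2 hi).exists_between hst
  rw [SetLike.mem_coe, AddSubgroup.mem_closure_pair] at hz
  obtain ⟨n, m, e⟩ := hz
  refine ⟨m, n, ?_⟩
  have : (m:ℝ) + n * τ = z := by rw [← e]; simp; ring
  rw [this]; exact hz'

theorem FF.zpow_ratio {W W' : ℝ → ℝ} {a b x : ℝ} {k k' : ℝ → ℝ} (hk : Ivr k k' W a b) (hk' : Ivr k k' W' a b)
    (hW' : ∀ x ∈ Ioo a b, W' x ≠ 0)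
    (n : ℤ) (hx : x ∈ Ioo a b) : W ((hk.gd.perm ^ n) x) / W' ((hk.gd.perm ^ n) x) = W x / W' x := by
  have base : ∀ x ∈ Ioo a b, W (k x) / W' (k x) = W x / W' x := by
    intro x hx
    rw [hk.der x hx, hk'.der x hx, mul_div_mul_left _ _ (hk.gd.pos x).ne']
  induction n using Int.induction_on generalizing x with
  | zero => simp
  | succ n ih =>
    rw [zpow_add, zpow_one]
    show W ((hk.gd.perm ^ (n:ℤ)) (k x)) / W' ((hk.gd.perm ^ (n:ℤ)) (k x)) = _
    rw [ih (hk.mem hx), base x hx]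
  | pred n ih =>
    rw [zpow_sub, zpow_one]
    show W ((hk.gd.perm ^ (-(n:ℤ))) (k' x)) / W' ((hk.gd.perm ^ (-(n:ℤ))) (k' x)) = _
    rw [ih (hk.symm.mem hx), ← base _ (hk.symm.mem hx), hk.gd.right]

theorem FF.unique {W W' : ℝ → ℝ} {a b τ : ℝ} (h : FF f f' g g' W a b) (h' : FF f f' g g' W' a b)
    (hf : GDiff f f') (hg : GDiff g g') (hi : Irrational τ) (hτ : ∀ x ∈ Ioo a b, RelT hf.perm hg.perm τ x)
    {x : ℝ} (hx : x ∈ Ioo a b) : tt W x (f x) * W x = tt W' x (f x) * W' x := by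
  have hc : ∀ y ∈ Ioo a b, W y / W' y = W x / W' x := by
    intro y hy
    by_contra hne
    have hcont : ContinuousAt (fun y => W y / W' y) y :=
      (h.fd.cont.continuousAt (isOpen_Ioo.mem_nhds hy)).div (h'.fd.cont.continuousAt (isOpen_Ioo.mem_nhds hy)) (h'.fd.ne hy)
    have h1 := (hcont.eventually_ne hne).and (isOpen_Ioo.mem_nhds hy)
    rw [Metric.eventually_nhds_iff] at h1
    obtain ⟨ε, hε, h1⟩ := h1
    have hy1 := (h1 (y := y - ε/2) (by rw [Real.dist_eq, sub_sub_cancel_left, abs_neg, abs_of_pos] <;> linarith)).2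
    have hy2 := (h1 (y := y + ε/2) (by rw [Real.dist_eq, add_sub_cancel_left, abs_of_pos] <;> linarith)).2
    have hcp := h.c_pos hx
    have hr : tt W x (g x) = τ * tt W x (f x) := by
      have := (h.rel hf hg hx hx).unique (hτ x hx)
      rw [← this]; field_simp
    -- a word between
    have key : ∀ y1 ∈ Ioo a b, ∀ y2 ∈ Ioo a b, 0 < (y2 - y1) * (f y1 - y1) → ∃ m n : ℤ,
        0 < ((hf.perm ^ m) ((hg.perm ^ n) x) - y1) * (f y1 - y1) ∧
        0 < (y2 - (hf.perm ^ m) ((hg.perm ^ n) x)) * (f ((hf.perm ^ m) ((hg.perm ^ n) x)) - ((hf.perm ^ m) ((hg.perm ^ n) x))) := by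
      intro y1 hy1 y2 hy2 h12
      have h2 := (h.fd.tt_pos hy1 hy2).2 h12
      have h3 := h.fd.tt_add hx hy1 hy2
      obtain ⟨m, n, h4, h5⟩ := dense_word hi (s := tt W x y1 / tt W x (f x)) (t := tt W x y2 / tt W x (f x))
        (by gcongr; linarith)
      have hw := h.iff.zpow_mem m (h.ivg.zpow_mem n hx)
      have h6 := h.fd.word h.iff h.ivg m n hx hx
      rw [hr] at h6
      rw [div_lt_iff₀ hcp] at h4
      rw [lt_div_iff₀ hcp] at h5
      refine ⟨m, n, (h.fd.tt_pos hy1 hw).1 ?_, (h.fd.tt_pos hw hy2).1 ?_⟩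
      · have := h.fd.tt_add hx hy1 hw
        change tt W x y1 + tt W y1 _ = _ at this
        linarith
      · have := h.fd.tt_add hx hw hy2
        linarith
    have key2 : ∃ m n : ℤ, |(hf.perm ^ m) ((hg.perm ^ n) x) - y| < ε := by
      rcases h.fd.sgn with ⟨hs, -⟩ | ⟨hs, -⟩
      · obtain ⟨m, n, k1, k2⟩ := key _ hy1 _ hy2 (mul_pos (by linarith) (hs _ hy1))
        have hw := h.iff.zpow_mem m (h.ivg.zpow_mem n hx)
        have k3 := (pos_iff_pos_of_mul_pos k1).2 (hs _ hy1)
        have k4 := (pos_iff_pos_of_mul_pos k2).2 (hs _ hw)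
        exact ⟨m, n, by rw [abs_lt]; constructor <;> linarith⟩
      · obtain ⟨m, n, k1, k2⟩ := key _ hy2 _ hy1 (mul_pos_of_neg_of_neg (by linarith) (hs _ hy2))
        have hw := h.iff.zpow_mem m (h.ivg.zpow_mem n hx)
        have k3 := neg_of_mul_pos_left k1 (hs _ hy2).le
        have k4 := neg_of_mul_pos_left k2 (hs _ hw).le
        exact ⟨m, n, by rw [abs_lt]; constructor <;> linarith⟩
    obtain ⟨m, n, hmn⟩ := key2
    refine (h1 (y := (hf.perm ^ m) ((hg.perm ^ n) x)) hmn).1 ?_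
    have e1 := FF.zpow_ratio h.iff h'.iff (fun x hx => h'.fd.ne hx) m (h.ivg.zpow_mem n hx)
    have e2 := FF.zpow_ratio h.ivg h'.ivg (fun x hx => h'.fd.ne hx) n hx
    exact e1.trans e2
  set κ := W x / W' x with hκ
  have hκ0 : κ ≠ 0 := div_ne_zero (h.fd.ne hx) (h'.fd.ne hx)
  have hW : ∀ y ∈ Ioo a b, W y = κ * W' y := fun y hy => by
    rw [← hc y hy, div_mul_cancel₀ _ (h'.fd.ne hy)]
  have ht : tt W x (f x) = κ⁻¹ * tt W' x (f x) := by
    unfold tt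
    rw [← intervalIntegral.integral_const_mul]
    refine intervalIntegral.integral_congr fun t ht => ?_
    show (W t)⁻¹ = κ⁻¹ * (W' t)⁻¹
    rw [hW t (uIcc_sub_Ioo hx (h.iff.mem hx) ht), mul_inv]
  rw [ht, hW x hx]
  field_simp
end
end

section
theorem chain_contDiff {S : Set ℝ} (hS : IsOpen S) : ∀ (J : ℕ) {c : ℕ → ℝ → ℝ},
    (∀ l < J + 1, ∀ x ∈ S, HasDerivAt (c l) (c (l+1) x) x) → ContDiffOn ℝ J (c 0) S := by
  intro J
  induction J with
  | zero =>
    intro c h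
    rw [Nat.cast_zero, contDiffOn_zero]
    exact fun x hx => (h 0 (by omega) x hx).continuousAt.continuousWithinAt
  | succ J ih =>
    intro c h
    push_cast
    rw [contDiffOn_succ_iff_deriv_of_isOpen hS]
    refine ⟨fun x hx => (h 0 (by omega) x hx).differentiableAt.differentiableWithinAt, by simp, ?_⟩
    refine (ih (c := fun l => c (l+1)) fun l hl x hx => h (l+1) (by omega) x hx).congr fun x hx => ?_
    exact (h 0 (by omega) x hx).deriv

/-- one sided derivative chain, with quadratic decay -/
def Ch (Λ : ℝ → ℝ) (p σ z : ℝ) (J : ℕ) : Prop :=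
  ∃ c : ℕ → ℝ → ℝ, c 0 = Λ ∧
    (∀ l < J, ∀ x, 0 < σ * (x - p) → σ * (x - p) < z → HasDerivAt (c l) (c (l+1) x) x) ∧
    ∀ l ≤ J, ∃ C, 0 ≤ C ∧ ∀ x, 0 < σ * (x - p) → σ * (x - p) < z → |c l x| ≤ C * (x - p) ^ 2

theorem Ch.mono {Λ : ℝ → ℝ} {p σ z z' : ℝ} {J : ℕ} (h : Ch Λ p σ z J) (hz : z' ≤ z) : Ch Λ p σ z' J := by
  obtain ⟨c, h0, h1, h2⟩ := h
  refine ⟨c, h0, fun l hl x a b => h1 l hl x a (b.trans_le hz), fun l hl => ?_⟩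
  obtain ⟨C, hC, h3⟩ := h2 l hl
  exact ⟨C, hC, fun x a b => h3 x a (b.trans_le hz)⟩

theorem Ch.neg {Λ : ℝ → ℝ} {p σ z : ℝ} {J : ℕ} (h : Ch Λ p σ z J) : Ch (fun x => - Λ x) p σ z J := by
  obtain ⟨c, h0, h1, h2⟩ := h
  refine ⟨fun l x => - c l x, by simp [h0], fun l hl x a b => (h1 l hl x a b).fun_neg, fun l hl => ?_⟩
  obtain ⟨C, hC, h3⟩ := h2 l hl
  exact ⟨C, hC, fun x a b => by rw [abs_neg]; exact h3 x a b⟩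

noncomputable def gl (p : ℝ) (a b : ℝ → ℝ) (x : ℝ) : ℝ := if p < x then a x else if x < p then b x else 0

theorem gl_pos {p x : ℝ} {a b : ℝ → ℝ} (h : p < x) : gl p a b x = a x := if_pos h
theorem gl_neg {p x : ℝ} {a b : ℝ → ℝ} (h : x < p) : gl p a b x = b x := by
  unfold gl; rw [if_neg (not_lt.2 h.le), if_pos h]
theorem gl_self {p : ℝ} {a b : ℝ → ℝ} : gl p a b p = 0 := by simp [gl]

theorem glue {a b : ℝ → ℝ} {p z : ℝ} {J : ℕ} (hz : 0 < z) (ha : Ch a p 1 z (J+1)) (hb : Ch b p (-1) z (J+1)) :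
    ContDiffOn ℝ J (gl p a b) (Metric.ball p z) := by
  obtain ⟨c, h0, h1, h2⟩ := ha
  obtain ⟨d, k0, k1, k2⟩ := hb
  rw [← h0, ← k0]
  refine chain_contDiff (c := fun l => gl p (c l) (d l)) Metric.isOpen_ball J fun l hl x hx => ?_
  rw [Metric.mem_ball, Real.dist_eq, abs_lt] at hx
  rcases lt_trichotomy x p with hxp | rfl | hxp
  · rw [gl_neg hxp]
    refine (k1 l hl x (by linarith) (by linarith)).congr_of_eventuallyEq ?_
    filter_upwards [gt_mem_nhds hxp] with y hy
    exact gl_neg hy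
  · rw [gl_self]
    obtain ⟨C, hC, h3⟩ := h2 l hl.le
    obtain ⟨C', hC', k3⟩ := k2 l hl.le
    have hO : gl x (c l) (d l) =O[𝓝 x] fun y => ‖y - x‖ ^ 2 := by
      refine Asymptotics.IsBigO.of_bound (C + C') ?_
      filter_upwards [Metric.ball_mem_nhds x hz] with y hy
      rw [Metric.mem_ball, Real.dist_eq, abs_lt] at hy
      rw [Real.norm_eq_abs, Real.norm_eq_abs, Real.norm_eq_abs, abs_pow, abs_abs, sq_abs]
      have hsq := sq_nonneg (y - x)
      rcases lt_trichotomy y x with hyx | rfl | hyx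
      · rw [gl_neg hyx]
        have := k3 y (by linarith) (by linarith)
        nlinarith
      · rw [gl_self]; simp
      · rw [gl_pos hyx]
        have := h3 y (by linarith) (by linarith)
        nlinarith
    have := hO.hasFDerivAt (𝕜 := ℝ) (by norm_num)
    exact hasFDerivAt_iff_hasDerivAt.1 this |>.congr_deriv (by simp)
  · rw [gl_pos hxp]
    refine (h1 l hl x (by linarith) (by linarith)).congr_of_eventuallyEq ?_
    filter_upwards [lt_mem_nhds hxp] with y hy
    exact gl_pos hy

section
variable {F G R A : ℝ → ℝ} {p : ℝ} {m : ℕ}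

theorem q_pos (gd : GDiff F G) (sA : Sm A) (eA : ∀ x, F x - x = (x - p) ^ (m + 1) * A x) :
    0 < 1 + (p - p) ^ m * A p := by
  rcases Nat.eq_zero_or_pos m with rfl | hm0
  · have hd : HasDerivAt (fun x => x + (x - p) ^ (0 + 1) * A x) (1 + A p) p := by
      have h1 := (hasDerivAt_id p).add (((hasDerivAt_id p).sub_const p).fun_mul (sA.has p))
      refine (h1.congr_deriv (by simp)).congr_of_eventuallyEq ?_
      filter_upwards with x; simp
    have he : (fun x => x + (x - p) ^ (0 + 1) * A x) = F := by ext x; rw [← eA]; ring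
    rw [he] at hd
    have h2 := gd.pos p
    rw [hd.deriv] at h2
    simpa using h2
  · simp [hm0.ne']

/-- cohomological equation to finite order -/
theorem coh (gd : GDiff F G) (sR : Sm R) (sA : Sm A) (hA : A p ≠ 0) (eA : ∀ x, F x - x = (x - p) ^ (m + 1) * A x)
    (n : ℕ) : ∃ ℓ w, Sm ℓ ∧ Sm w ∧ ℓ p = 0 ∧ ∀ x, (F x - x) * R x + ℓ (F x) - ℓ x = (x - p) ^ (m + 1 + n) * w x := by
  induction n with
  | zero => exact ⟨fun _ => 0, fun x => A x * R x, contDiff_const, sA.mul sR, rfl, fun x => by rw [eA]; ring⟩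
  | succ n ih =>
    obtain ⟨ℓ, w, sℓ, sw, hp, e⟩ := ih
    set T : ℝ → ℝ := fun x => A x * ∑ i ∈ Finset.range (n+1), (1 + (x - p) ^ m * A x) ^ i with hT
    have sx : Sm (fun x : ℝ => x - p) := contDiff_id.sub contDiff_const
    have sT : Sm T := by
      refine sA.mul (ContDiff.sum fun i _ => ContDiff.pow (contDiff_const.add ((sx.pow m).mul sA)) i)
    have hTp : T p ≠ 0 := by
      refine mul_ne_zero hA (ne_of_gt ?_)
      exact Finset.sum_pos (fun i _ => pow_pos (q_pos gd sA eA) i) ⟨0, by simp⟩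
    have hTe : ∀ x, (F x - p) ^ (n+1) - (x - p) ^ (n+1) = (x - p) ^ (m + 1 + n) * T x := by
      intro x
      have h1 : F x - p = (x - p) * (1 + (x - p) ^ m * A x) := by
        have := eA x; rw [pow_succ] at this; linear_combination this
      have h2 := geom_sum_mul (1 + (x - p) ^ m * A x) (n+1)
      rw [h1, mul_pow, hT]
      have h3 : (1 + (x - p) ^ m * A x) ^ (n+1) =
        1 + (∑ i ∈ Finset.range (n+1), (1 + (x - p) ^ m * A x) ^ i) * ((x - p) ^ m * A x) := by linear_combination -h2
      rw [h3]
      ring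
    obtain ⟨w', sw', e'⟩ := hadamard (v := fun x => w x - w p / T p * T x) (p := p) (sw.sub (contDiff_const.mul sT))
      (by simp [div_mul_cancel₀ _ hTp])
    refine ⟨fun x => ℓ x - w p / T p * (x - p) ^ (n+1), w', sℓ.sub (contDiff_const.mul (sx.pow _)), sw', by simp [hp], fun x => ?_⟩
    have h1 := e x
    have h2 := hTe x
    have h3 := e' x
    have h4 : (x - p) ^ (m + 1 + (n + 1)) = (x - p) ^ (m + 1 + n) * (x - p) := by rw [← pow_succ]; rfl
    rw [h4, mul_assoc, ← h3]
    linear_combination h1 - w p / T p * h2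
end
end

section
section
variable {F G R A : ℝ → ℝ} {p : ℝ} {m : ℕ}

theorem near_A (sA : Sm A) (hA : A p ≠ 0) : ∃ z > 0, ∀ x, |x - p| < z → |A p| / 2 ≤ |A x| := by
  have h1 : ∀ᶠ x in 𝓝 p, |A p| / 2 < |A x| :=
    (sA.continuous.abs.tendsto p).eventually (lt_mem_nhds (by have := abs_pos.2 hA; linarith))
  obtain ⟨z, hz, h2⟩ := Metric.eventually_nhds_iff.1 h1
  exact ⟨z, hz, fun x hx => (h2 (by rwa [Real.dist_eq])).le⟩

theorem So_ch (h : Sz F G R) (hp : p ∈ Icc (0:ℝ) 1) (sA : Sm A) (hA : A p ≠ 0)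
    (eA : ∀ x, F x - x = (x - p) ^ (m + 1) * A x) {σ z0 : ℝ} (hσ : σ = 1 ∨ σ = -1) (hz0 : 0 < z0)
    (ctr : ∀ x, 0 < σ * (x - p) → σ * (x - p) < z0 → (F x - x) * (x - p) < 0) {N J : ℕ} {r w : ℝ → ℝ} (sw : Sm w)
    (er : ∀ x, r x = (x - p) ^ N * w x) (hN : (m + 1) * (J + 1) + 3 ≤ N) : ∃ z > 0, z ≤ z0 ∧ z ≤ 1/2 ∧ Ch (So F r) p σ z J ∧
      ∀ x, 0 < σ * (x - p) → σ * (x - p) < z → So F r x = r x + So F r (F x) := by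
  have fp : F p = p := by have := eA p; simp at this; linarith
  have aσ : ∀ x, 0 < σ * (x - p) → |x - p| = σ * (x - p) := by
    intro x hx
    have : |σ * (x - p)| = σ * (x - p) := abs_of_pos hx
    rw [abs_mul] at this
    rcases hσ with rfl | rfl <;> simpa using this
  obtain ⟨z1, hz1, nA⟩ := near_A sA hA
  set z := min (min z0 z1) (1/2) with hzd
  have hz : 0 < z := by positivity
  have zz0 : z ≤ z0 := (min_le_left _ _).trans (min_le_left _ _)
  have zz1 : z ≤ z1 := (min_le_left _ _).trans (min_le_right _ _)
  have zz2 : z ≤ 1/2 := min_le_right _ _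
  have hkeep : ∀ x, 0 < σ * (x - p) → σ * (x - p) < z → 0 < σ * (F x - p) ∧ σ * (F x - p) < σ * (x - p) := by
    intro x h1 h2
    have h3 := ctr x h1 (h2.trans_le zz0)
    rcases hσ with rfl | rfl
    · have h4 : p < x := by linarith
      have h5 := h.gd.mono h4
      rw [fp] at h5
      exact ⟨by linarith, by nlinarith⟩
    · have h4 : x < p := by linarith
      have h5 := h.gd.mono h4
      rw [fp] at h5
      exact ⟨by linarith, by nlinarith⟩
  have hI : ∀ x, 0 < σ * (x - p) → σ * (x - p) < z → x ∈ Ioo (-1:ℝ) 2 := by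
    intro x h1 h2
    have h3 := aσ x h1
    have := abs_lt.1 (h3.trans_lt h2)
    constructor <;> linarith [hp.1, hp.2, this.1, this.2]
  set P : ℝ → ℝ → Prop := fun x e => 0 < σ * (x - p) ∧ σ * (x - p) < e ∧ e ≤ z with hPd
  have hP : Dom F P := by
    refine ⟨fun e => ?_, ?_, ?_, ?_⟩
    · have c1 : Continuous fun x => σ * (x - p) := by fun_prop
      exact (isOpen_lt continuous_const c1).inter ((isOpen_lt c1 continuous_const).inter isOpen_const)
    · rintro x e ⟨h1, h2, h3⟩
      refine ⟨hI x h1 (h2.trans_le h3), fun e' => ?_⟩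
      have := ctr x h1 (h2.trans_le (h3.trans zz0))
      rw [e'] at this; simp at this
    · rintro x e ⟨h1, h2, h3⟩
      have := hkeep x h1 (h2.trans_le h3)
      exact ⟨this.1, this.2.trans h2, h3⟩
    · rintro x e ⟨h1, h2, h3⟩
      exact ⟨h1.trans h2, by linarith⟩
  have hPI : ∀ x e, P x e → x ∈ Icc (-1:ℝ) 2 := fun x e he => Ioo_subset_Icc_self (hP.sub x e he).1
  obtain ⟨Cx, hCx0, hCx⟩ := h.xi_le
  have hξ : Bc (xi F R) P 0 0 1 (xi F R) := by
    refine ⟨Cx, hCx0.le, fun x e he => ((hCx x (hPI x e he)).1).trans ?_⟩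
    obtain ⟨h1, h2, h3⟩ := he
    have h4 := hkeep x h1 (h2.trans_le h3)
    rw [pow_one]
    refine mul_le_mul_of_nonneg_left ?_ hCx0.le
    rcases hσ with rfl | rfl <;> rw [abs_le] <;> constructor <;> linarith
  have bsm : ∀ a : ℝ → ℝ, Sm a → ∀ i ≤ J, ∃ C, 0 ≤ C ∧ ∀ x e, P x e →
      e ^ i * |iteratedDeriv i a x| ≤ C * e ^ (0 + 0 * i) := by
    intro a ha i _
    obtain ⟨C, hC, h1⟩ := bddI (ha.continuous_iteratedDeriv i (by exact_mod_cast le_top))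
    refine ⟨C, hC, fun x e he => ?_⟩
    have h2 := hP.e01 x e he
    have h3 : e ^ i ≤ 1 := pow_le_one₀ h2.1.le h2.2
    have h4 := h1 x (hPI x e he)
    simp only [zero_mul, add_zero, pow_zero, mul_one]
    nlinarith [abs_nonneg (iteratedDeriv i a x)]
  have hv : ∀ j ≤ J, Bc (xi F R) P 0 j 0 (v0 F R) :=
    Bc.v0 h hP hξ (bsm _ h.smu.deriv) (bsm _ h.smr.deriv)
  have sx : Sm (fun x : ℝ => x - p) := contDiff_id.sub contDiff_const
  have sr : Sm r := by
    have : r = fun x => (x - p) ^ N * w x := funext er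
    rw [this]; exact (sx.pow N).mul sw
  have hJ : J + 1 ≤ (m+1) * (J+1) := by nlinarith
  have hr' : Bc (xi F R) P 0 J (N - 1) (deriv r) := by
    have := Bc.smooth h hP hξ (N := J) (k := N - 1) sr.deriv ?_ J (fun j' hj' => hv j' hj'.le) 0 (by omega)
    · simpa using this
    · intro i hi
      obtain ⟨w', sw', -, e1⟩ := iter_factor p (i+1) (N - (i+1)) sw
      have e2 : iteratedDeriv i (deriv r) = fun x => (x - p) ^ (N - (i+1)) * w' x := by
        rw [← iteratedDeriv_succ', ← e1, show i + 1 + (N - (i+1)) = N by omega]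
        congr 1; exact funext er
      obtain ⟨C, hC, h1⟩ := bddI sw'.continuous
      refine ⟨C, hC, fun x e he => ?_⟩
      rw [e2]
      have h2 := h1 x (hPI x e he)
      have e0 := (hP.e01 x e he).1
      have h3 : |x - p| ≤ e := by rw [aσ x he.1]; exact he.2.1.le
      simp only [zero_mul, add_zero]
      rw [abs_mul, abs_pow]
      calc e ^ i * (|x - p| ^ (N - (i+1)) * |w' x|) ≤ e ^ i * (e ^ (N - (i+1)) * C) := by gcongr
        _ = C * (e ^ i * e ^ (N - (i+1))) := by ring
        _ = _ := by rw [← pow_add, show i + (N - (i+1)) = N - 1 by omega]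
  have hS := Bc.sum h hP (fun j' hj' => hv j' hj'.le) hr'
  obtain ⟨c, c0, c1, c2⟩ := Bc.chain h hP (i := 1) (fun j' hj' => hv j' hj'.le) hS
  obtain ⟨Cw, hCw0, hCw⟩ := bddI sw.continuous
  set a0 := |A p| / 2 with ha0
  have a0p : 0 < a0 := by have := abs_pos.2 hA; positivity
  have hlow : ∀ x, 0 < σ * (x - p) → σ * (x - p) < z → a0 * |x - p| ^ (m+1) ≤ |F x - x| := by
    intro x h1 h2
    rw [eA, abs_mul, abs_pow, mul_comm]
    refine mul_le_mul_of_nonneg_left (nA x ?_) (by positivity)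
    rw [aσ x h1]; linarith
  have hrb : ∀ x, 0 < σ * (x - p) → σ * (x - p) < z → |r x| ≤ (Cw / a0) * |x - p| * |F x - x| := by
    intro x h1 h2
    rw [er, abs_mul, abs_pow]
    have h3 := hCw x (Ioo_subset_Icc_self (hI x h1 h2))
    have h4 := hlow x h1 h2
    have h5 : |x - p| ≤ 1 := by rw [aσ x h1]; linarith
    calc |x - p| ^ N * |w x| ≤ |x - p| ^ (m + 2) * Cw := by
          refine mul_le_mul (pow_le_pow_of_le_one (abs_nonneg _) h5 (by nlinarith)) h3 (abs_nonneg _) (by positivity)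
      _ = (Cw / a0) * |x - p| * (a0 * |x - p| ^ (m+1)) := by field_simp; ring
      _ ≤ _ := by gcongr
  have hit0 : ∀ x, 0 < σ * (x - p) → σ * (x - p) < z →
      ∀ n, 0 < σ * (F^[n] x - p) ∧ σ * (F^[n] x - p) ≤ σ * (x - p) := by
    intro x h1 h2 n
    induction n with
    | zero => exact ⟨h1, le_rfl⟩
    | succ n ih =>
      rw [Function.iterate_succ_apply']
      have := hkeep _ ih.1 (by linarith [ih.2])
      exact ⟨this.1, this.2.le.trans ih.2⟩
  refine ⟨z / 2, by positivity, by linarith, by linarith, ⟨fun l => Nat.casesOn l (So F r) c, rfl, ?_, ?_⟩, ?_⟩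
  rotate_left 2
  · intro x h1 h2
    refine So_step (So_summable h.gd (C := Cw / a0) (by positivity) (Ioo_subset_Icc_self (hI x h1 (by linarith))) fun n => ?_).1
    have hn := hit0 x h1 (by linarith) n
    rw [Function.iterate_succ_apply']
    refine (hrb _ hn.1 (by linarith [hn.2])).trans (mul_le_mul_of_nonneg_right ?_ (abs_nonneg _))
    rw [aσ _ hn.1]
    have : 0 ≤ Cw / a0 := by positivity
    nlinarith [hn.2]
  · intro l hl x h1 h2
    have hPx : P x z := ⟨h1, by linarith, le_rfl⟩
    cases l with
    | zero =>
      show HasDerivAt (So F r) (c 0 x) x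
      rw [c0]
      simp only [pow_one]
      obtain ⟨Cr, hCr0, hCr⟩ := bddI sr.deriv.continuous
      refine h.So_deriv (V := {x | P x z}) (C := max Cr (Cw / a0)) (hP.opn z) (fun x hx => hP.sub x z hx)
        (fun x hx => hP.inv x z hx) (hCr0.trans (le_max_left _ _)) ?_ (fun x _ => sr.has x) ?_ hPx
      · intro y hy
        have h3 := hrb y hy.1 hy.2.1
        have h5 : |y - p| ≤ 1 := by rw [aσ y hy.1]; linarith [hy.2.1]
        refine h3.trans (mul_le_mul_of_nonneg_right ?_ (abs_nonneg _))
        refine le_trans ?_ (le_max_right _ _)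
        have : 0 ≤ Cw / a0 := by positivity
        nlinarith
      · intro y hy
        exact (hCr y (hPI y z hy)).trans (le_max_left _ _)
    | succ l => exact c1 l (by omega) x z hPx
  · intro l hl
    cases l with
    | zero =>
      refine ⟨Cw / a0, by positivity, fun x h1 h2 => ?_⟩
      show |So F r x| ≤ _
      have hit := hit0 x h1 (by linarith)
      have := So_le h.gd (a := r) (x := x) (C := Cw / a0 * |x - p|) (B := |x - p|) (by positivity)
        (Ioo_subset_Icc_self (hI x h1 (by linarith))) (fun n => ?_)
        (h.gd.toward fp (ctr x h1 (by linarith)).le)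
      · rw [← sq_abs]; linarith
      · rw [Function.iterate_succ_apply']
        refine (hrb _ (hit n).1 (by linarith [(hit n).2])).trans ?_
        rw [aσ _ (hit n).1, aσ _ h1]
        exact mul_le_mul_of_nonneg_right (mul_le_mul_of_nonneg_left (hit n).2 (by positivity)) (abs_nonneg _)
    | succ l =>
      obtain ⟨C, hC, h3⟩ := c2 l (by omega)
      refine ⟨C * 2 ^ (N-1) * (Cx / a0) ^ (l+1), by positivity, fun x h1 h2 => ?_⟩
      show |c l x| ≤ _
      have h4 := h3 x (2 * (σ * (x - p))) ⟨h1, by linarith, by linarith⟩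
      rw [← aσ x h1] at h4
      simp only [zero_mul, add_zero] at h4
      have h5 := (hCx x (Ioo_subset_Icc_self (hI x h1 (by linarith)))).2
      have h6 := hlow x h1 (by linarith)
      set d := |x - p| with hd
      have d0 : 0 < d := by rw [hd, aσ x h1]; exact h1
      have d1 : d ≤ 1 := by rw [hd, aσ x h1]; linarith
      have h7 : (a0 / Cx) * d ^ (m+1) ≤ |xi F R x| := by
        rw [div_mul_eq_mul_div, div_le_iff₀ hCx0]; linarith
      have h8 : ((a0 / Cx) * d ^ (m+1)) ^ (1+l) * |c l x| ≤ C * (2 * d) ^ (N-1) := by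
        refine le_trans ?_ h4
        rw [abs_mul, abs_pow]
        gcongr
      have h9 : d ^ (N-1) ≤ d ^ ((m+1)*(1+l)) * d ^ 2 := by
        rw [← pow_add]
        refine pow_le_pow_of_le_one d0.le d1 ?_
        have : (m+1)*(1+l) ≤ (m+1)*(J+1) := Nat.mul_le_mul_left _ (by omega)
        omega
      have h10 : 0 < ((a0 / Cx) * d ^ (m+1)) ^ (1+l) := by positivity
      rw [← sq_abs, ← hd]
      refine le_of_mul_le_mul_left (h8.trans ?_) h10
      calc C * (2 * d) ^ (N-1) = C * 2 ^ (N-1) * d ^ (N-1) := by rw [mul_pow]; ring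
        _ ≤ C * 2 ^ (N-1) * (d ^ ((m+1)*(1+l)) * d ^ 2) := by gcongr
        _ = C * 2 ^ (N-1) * (((a0 / Cx) * (Cx / a0)) ^ (1+l) * d ^ ((m+1)*(1+l)) * d ^ 2) := by
            rw [show a0 / Cx * (Cx / a0) = 1 by field_simp]; ring
        _ = _ := by rw [mul_pow, mul_pow, ← pow_mul, add_comm 1 l]; ring
end
end

section
theorem inv_lim {T T' Q : ℝ → ℝ} (gd : GDE T T') {p σ z κ a b : ℝ} (tp : T p = p) (hp : p ∈ Icc (0:ℝ) 1)
    (hσ : σ = 1 ∨ σ = -1) (hz : z ≤ 1)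
    (ctr : ∀ x, 0 < σ * (x - p) → σ * (x - p) < z → (T x - x) * (x - p) < 0) (hpab : p = a ∨ p = b)
    (hQ : ∀ y ∈ Ioo a b, 0 < σ * (y - p) → σ * (y - p) < z → Q (T y) = Q y)
    (hl : Tendsto Q (𝓝[Ioo a b] p) (𝓝 κ)) {x : ℝ} (hx : x ∈ Ioo a b) (h1 : 0 < σ * (x - p)) (h2 : σ * (x - p) < z) :
    Q x = κ := by
  have hkeep : ∀ y, 0 < σ * (y - p) → σ * (y - p) < z → 0 < σ * (T y - p) ∧ σ * (T y - p) < σ * (y - p) := by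
    intro y h1 h2
    have h3 := ctr y h1 h2
    rcases hσ with rfl | rfl
    · have h5 := gd.mono (show p < y by linarith)
      rw [tp] at h5
      exact ⟨by linarith, by nlinarith⟩
    · have h5 := gd.mono (show y < p by linarith)
      rw [tp] at h5
      exact ⟨by linarith, by nlinarith⟩
  have hit : ∀ n, 0 < σ * (T^[n] x - p) ∧ σ * (T^[n] x - p) ≤ σ * (x - p) := by
    intro n
    induction n with
    | zero => exact ⟨h1, le_rfl⟩
    | succ n ih =>
      rw [Function.iterate_succ_apply']
      have := hkeep _ ih.1 (by linarith [ih.2])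
      exact ⟨this.1, this.2.le.trans ih.2⟩
  have hin : ∀ n, T^[n] x ∈ Ioo a b := by
    intro n
    have := hit n
    obtain ⟨hxa, hxb⟩ := hx
    rcases hσ with rfl | rfl <;> rcases hpab with rfl | rfl <;> constructor <;> linarith
  have hc : ∀ n, Q (T^[n] x) = Q x := by
    intro n
    induction n with
    | zero => rfl
    | succ n ih => rw [Function.iterate_succ_apply', hQ _ (hin n) (hit n).1 (by linarith [(hit n).2]), ih]
  have hxI : x ∈ Icc (-1:ℝ) 2 := by
    obtain ⟨p0, p1⟩ := hp
    rcases hσ with rfl | rfl <;> constructor <;> linarith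
  obtain ⟨y, hy⟩ := GDiff.orb_conv gd hxI
  have hyp : y = p := by
    have hfy : T y = y := isFixedPt_of_tendsto_iterate hy gd.sm.continuous.continuousAt
    have c1 : Tendsto (fun n => σ * (T^[n] x - p)) atTop (𝓝 (σ * (y - p))) := (hy.sub_const p).const_mul σ
    have l1 := ge_of_tendsto' c1 fun n => (hit n).1.le
    have l2 := le_of_tendsto' c1 fun n => (hit n).2
    by_contra hne
    have l3 : 0 < σ * (y - p) := by
      refine lt_of_le_of_ne l1 (Ne.symm (mul_ne_zero ?_ (sub_ne_zero.2 hne)))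
      rcases hσ with rfl | rfl <;> norm_num
    have := ctr y l3 (by linarith)
    rw [hfy] at this; simp at this
  rw [hyp] at hy
  have h3 : Tendsto (fun n => T^[n] x) atTop (𝓝[Ioo a b] p) :=
    tendsto_nhdsWithin_iff.2 ⟨hy, Eventually.of_forall hin⟩
  have h4 := hl.comp h3
  refine tendsto_nhds_unique ?_ h4
  simp only [Function.comp_def, hc]
  exact tendsto_const_nhds

section
variable {F G R R' A : ℝ → ℝ} {p : ℝ} {m : ℕ}

/-- invariance hypothesis on a field near an end of a component -/
structure Fld (F W : ℝ → ℝ) (p κ a b : ℝ) : Prop where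
  cp : Cpt F a b
  e : p = a ∨ p = b
  inv : ∀ x ∈ Ioo a b, W (F x) = deriv F x * W x
  lim : Tendsto (fun x => W x / (F x - x)) (𝓝[Ioo a b] p) (𝓝 κ)

theorem mem_of_cpt {a b x : ℝ} (gd : GDiff F G) (hc : Cpt F a b) (hx : x ∈ Ioo a b) : F x ∈ Ioo a b := by
  have h1 := gd.mono hx.1
  have h2 := gd.mono hx.2
  rw [hc.fa] at h1; rw [hc.fb] at h2
  exact ⟨h1, h2⟩

theorem side_E (h : Sz F G R) (h' : Sz G F R') (hp : p ∈ Icc (0:ℝ) 1) (sA : Sm A) (hA : A p ≠ 0)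
    (eA : ∀ x, F x - x = (x - p) ^ (m + 1) * A x) {N J : ℕ} {r w ℓ : ℝ → ℝ} (sw : Sm w) (sℓ : Sm ℓ) (ℓp : ℓ p = 0)
    (er : ∀ x, r x = (x - p) ^ N * w x) (hN : (m + 1) * (J + 1) + 3 ≤ N)
    (eℓ : ∀ x, (F x - x) * R x + ℓ (F x) - ℓ x = r x) {σ : ℝ} (hσ : σ = 1 ∨ σ = -1) :
    ∃ Λ, ∃ z > 0, Ch Λ p σ z J ∧ ∀ a b W κ, Fld F W p κ a b → ∀ x ∈ Ioo a b, 0 < σ * (x - p) → σ * (x - p) < z →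
      W x = κ * ((F x - x) * Real.exp (ℓ x + Λ x)) := by
  have fp : F p = p := by have := eA p; simp at this; linarith
  have gp : G p = p := by have := h.gd.left p; rwa [fp] at this
  have σσ : σ * σ = 1 := by rcases hσ with rfl | rfl <;> norm_num
  -- sign of the displacement
  have key : ∃ z0 > 0, (∀ x, 0 < σ * (x - p) → σ * (x - p) < z0 → (F x - x) * (x - p) < 0) ∨
      (∀ x, 0 < σ * (x - p) → σ * (x - p) < z0 → 0 < (F x - x) * (x - p)) := by
    have hσA : σ ^ m * A p ≠ 0 := mul_ne_zero (pow_ne_zero _ (by rcases hσ with rfl | rfl <;> norm_num)) hA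
    have id1 : ∀ x, (F x - x) * (x - p) = (σ * (x - p)) ^ (m+2) * (σ ^ m * A x) := by
      intro x
      rw [eA, mul_pow, show σ ^ (m+2) = σ ^ m by rw [pow_add, sq, σσ, mul_one]]
      have : σ ^ m * σ ^ m = 1 := by rw [← mul_pow, σσ, one_pow]
      linear_combination (-(x-p)^(m+2) * A x) * this
    have hc : Continuous fun x => σ ^ m * A x := continuous_const.mul sA.continuous
    rcases lt_or_gt_of_ne hσA with hs | hs
    · obtain ⟨z, hz, h2⟩ := Metric.eventually_nhds_iff.1 ((hc.tendsto p).eventually (gt_mem_nhds hs))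
      refine ⟨z, hz, Or.inl fun x h3 h4 => ?_⟩
      rw [id1]
      refine mul_neg_of_pos_of_neg (by positivity) (h2 ?_)
      rw [Real.dist_eq]
      rcases hσ with rfl | rfl <;> rw [abs_lt] <;> constructor <;> linarith
    · obtain ⟨z, hz, h2⟩ := Metric.eventually_nhds_iff.1 ((hc.tendsto p).eventually (lt_mem_nhds hs))
      refine ⟨z, hz, Or.inr fun x h3 h4 => ?_⟩
      rw [id1]
      refine mul_pos (by positivity) (h2 ?_)
      rw [Real.dist_eq]
      rcases hσ with rfl | rfl <;> rw [abs_lt] <;> constructor <;> linarith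
  have limE : ∀ {Λ : ℝ → ℝ} {z : ℝ}, 0 < z → Ch Λ p σ z J → ∀ {a b W κ}, Fld F W p κ a b →
      ∀ x₀ ∈ Ioo a b, 0 < σ * (x₀ - p) →
      Tendsto (fun x => W x / ((F x - x) * Real.exp (ℓ x + Λ x))) (𝓝[Ioo a b] p) (𝓝 κ) := by
    intro Λ z hz hΛ a b W κ hW x₀ hx₀ hx₀'
    obtain ⟨c, c0, -, c2⟩ := hΛ
    obtain ⟨C, hC, hb⟩ := c2 0 (by omega)
    rw [c0] at hb
    have side : ∀ x ∈ Ioo a b, 0 < σ * (x - p) := by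
      intro x hx
      obtain ⟨h1, h2⟩ := hx
      obtain ⟨h3, h4⟩ := hx₀
      rcases hσ with rfl | rfl <;> rcases hW.e with rfl | rfl <;> linarith
    have hΛ0 : Tendsto Λ (𝓝[Ioo a b] p) (𝓝 0) := by
      have h2 : Tendsto (fun x => C * (x - p) ^ 2) (𝓝[Ioo a b] p) (𝓝 0) := by
        have : Continuous fun x => C * (x - p) ^ 2 := by fun_prop
        have := this.tendsto p
        simp only [sub_self, ne_eq, OfNat.ofNat_ne_zero, not_false_eq_true, zero_pow, mul_zero] at this
        exact this.mono_left nhdsWithin_le_nhds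
      refine squeeze_zero_norm' ?_ h2
      filter_upwards [self_mem_nhdsWithin, nhdsWithin_le_nhds (Metric.ball_mem_nhds p hz)] with x hx hx'
      rw [Metric.mem_ball, Real.dist_eq] at hx'
      refine hb x (side x hx) (lt_of_le_of_lt ?_ hx')
      rcases hσ with rfl | rfl
      · rw [one_mul]; exact le_abs_self _
      · rw [neg_one_mul]; exact neg_le_abs _
    have hℓ0 : Tendsto ℓ (𝓝[Ioo a b] p) (𝓝 0) := by
      have := sℓ.continuous.tendsto p
      rw [ℓp] at this
      exact this.mono_left nhdsWithin_le_nhds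
    have h3 : Tendsto (fun x => Real.exp (-(ℓ x + Λ x))) (𝓝[Ioo a b] p) (𝓝 1) := by
      have := (hℓ0.add hΛ0).neg
      simp only [add_zero, neg_zero] at this
      have := (Real.continuous_exp.tendsto 0).comp this
      rw [Real.exp_zero] at this
      exact this
    have h4 := hW.lim.mul h3
    rw [mul_one] at h4
    refine h4.congr fun x => ?_
    rw [Real.exp_neg, ← div_eq_mul_inv, div_div]
  obtain ⟨z0, hz0, hctr | hexp⟩ := key
  · obtain ⟨z, hz, zz0, zz1, hch, step⟩ := So_ch h hp sA hA eA hσ hz0 hctr sw er hN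
    refine ⟨So F r, z, hz, hch, fun a b W κ hW x hx h1 h2 => ?_⟩
    set Λ := So F r
    have hQ := inv_lim (Q := fun x => W x / ((F x - x) * Real.exp (ℓ x + Λ x))) h.gd fp hp hσ (z := z) (by linarith)
      (fun x h1 h2 => hctr x h1 (by linarith)) hW.e ?_ (limE hz hch hW x hx h1) hx h1 h2
    · have hne : (F x - x) * Real.exp (ℓ x + Λ x) ≠ 0 :=
        mul_ne_zero (sub_ne_zero.2 (hW.cp.ne x hx)) (Real.exp_pos _).ne'
      rwa [div_eq_iff hne] at hQ
    · intro y hy h3 h4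
      show W (F y) / ((F (F y) - F y) * Real.exp (ℓ (F y) + Λ (F y))) = W y / ((F y - y) * Real.exp (ℓ y + Λ y))
      have e1 := step y h3 h4
      have e2 := eℓ y
      have hE : (F (F y) - F y) * Real.exp (ℓ (F y) + Λ (F y)) = deriv F y * ((F y - y) * Real.exp (ℓ y + Λ y)) := by
        rw [h.eq, mul_assoc, ← Real.exp_add, show (F y - y) * R y + (ℓ (F y) + Λ (F y)) = ℓ y + Λ y by
          linarith]
        ring
      rw [hE, hW.inv y hy, mul_div_mul_left _ _ (h.gd.pos y).ne']
  · -- `G` contracts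
    obtain ⟨B, sB, eB⟩ := hadamard (v := fun x => G x - p) (p := p) (h'.gd.sm.sub contDiff_const) (by simp [gp])
    have Bp : B p ≠ 0 := by
      have h1 : HasDerivAt (fun x => (x - p) * B x) (B p) p :=
        (((hasDerivAt_id p).sub_const p).fun_mul (sB.has p)).congr_deriv (by simp)
      have h2 : HasDerivAt (fun x => G x - p) (deriv G p) p := (Sm.has h'.gd.sm p).sub_const p
      have h3 : (fun x => G x - p) = fun x => (x - p) * B x := funext eB
      rw [h3] at h2
      rw [h1.unique h2]; exact (h'.gd.pos p).ne'
    have sG : Sm G := h'.gd.sm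
    have eA' : ∀ x, G x - x = (x - p) ^ (m+1) * (-(B x ^ (m+1) * A (G x))) := by
      intro x
      have h1 := eA (G x)
      rw [h.gd.right, show G x - p = _ from eB x, mul_pow] at h1
      linear_combination -h1
    have hexp' : ∀ x, 0 < σ * (x - p) → σ * (x - p) < z0 → (G x - x) * (x - p) < 0 := by
      intro x h1 h2
      have h3 := hexp x h1 h2
      have h4 : F x ≠ x := fun e => by rw [e] at h3; simp at h3
      have h5 := h.gd.disp_sign h4
      have h6 : x - p ≠ 0 := fun e => by rw [e] at h3; simp at h3
      by_contra hh
      push Not at hh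
      have h7 : (G x - x) * (F x - x) * (x - p)^2 < 0 := mul_neg_of_neg_of_pos h5 (by positivity)
      nlinarith
    obtain ⟨z, hz, zz0, zz1, hch, step⟩ := So_ch h' hp (A := fun x => -(B x ^ (m+1) * A (G x)))
      ((sB.pow _).mul (sA.comp sG)).neg (by simp [Bp, hA, gp]) eA' hσ hz0 hexp'
      (r := fun x => r (G x)) (w := fun x => B x ^ N * w (G x)) ((sB.pow _).mul (sw.comp sG))
      (fun x => by rw [er, show G x - p = _ from eB x, mul_pow]; ring) hN
    refine ⟨fun x => - So G (fun x => r (G x)) x, z, hz, hch.neg, fun a b W κ hW x hx h1 h2 => ?_⟩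
    have lim := limE hz hch.neg hW x hx h1
    set Λ := fun x => - So G (fun x => r (G x)) x with hΛ
    have hQ := inv_lim (Q := fun x => W x / ((F x - x) * Real.exp (ℓ x + Λ x))) h'.gd gp hp hσ (z := z) (by linarith)
      (fun x h1 h2 => hexp' x h1 (by linarith)) hW.e ?_ lim hx h1 h2
    · have hne : (F x - x) * Real.exp (ℓ x + Λ x) ≠ 0 :=
        mul_ne_zero (sub_ne_zero.2 (hW.cp.ne x hx)) (Real.exp_pos _).ne'
      rwa [div_eq_iff hne] at hQ
    · intro y' hy h3 h4
      show W (G y') / ((F (G y') - G y') * Real.exp (ℓ (G y') + Λ (G y'))) = W y' / ((F y' - y') * Real.exp (ℓ y' + Λ y'))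
      have e1 := step y' h3 h4
      have hcG : Cpt G a b := hW.cp.inv h.gd.toGDiff
      have hGy := mem_of_cpt h'.gd.toGDiff hcG hy
      have hFG := h.gd.right y'
      set y := G y' with hyd
      have e2 := eℓ y
      have hE : (F (F y) - F y) * Real.exp (ℓ (F y) + Λ (F y)) = deriv F y * ((F y - y) * Real.exp (ℓ y + Λ y)) := by
        have e3 : Λ y = r y + Λ (F y) := by
          simp only [hΛ]; rw [hFG]; linarith
        rw [h.eq, mul_assoc, ← Real.exp_add, show (F y - y) * R y + (ℓ (F y) + Λ (F y)) = ℓ y + Λ y by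
          linarith]
        ring
      have h5 := hW.inv y hGy
      rw [hFG] at hE h5 ⊢
      rw [hE, h5, mul_div_mul_left _ _ (h.gd.pos y).ne']

/-- smooth model field at a nonflat fixed point -/
theorem exists_eta (h : Sz F G R) (h' : Sz G F R') (hp : p ∈ Icc (0:ℝ) 1) (sA : Sm A) (hA : A p ≠ 0)
    (eA : ∀ x, F x - x = (x - p) ^ (m + 1) * A x) (J : ℕ) :
    ∃ η : ℝ → ℝ, ∃ z > 0, ContDiffOn ℝ J η (Metric.ball p z) ∧ η p = 0 ∧
      ∀ a b W κ, Fld F W p κ a b → ∀ x ∈ Ioo a b, |x - p| < z → W x = κ * η x := by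
  obtain ⟨ℓ, w, sℓ, sw, ℓp, e⟩ := coh h.gd.toGDiff h.smR sA hA eA ((m+1)*(J+1+1)+3)
  have hN : (m+1)*(J+1+1)+3 ≤ m + 1 + ((m+1)*(J+1+1)+3) := by omega
  obtain ⟨Λ₁, z₁, hz₁, hc₁, hu₁⟩ := side_E h h' hp sA hA eA sw sℓ ℓp (fun x => rfl) hN e (σ := 1) (Or.inl rfl)
  obtain ⟨Λ₂, z₂, hz₂, hc₂, hu₂⟩ := side_E h h' hp sA hA eA sw sℓ ℓp (fun x => rfl) hN e (σ := -1) (Or.inr rfl)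
  have hz : 0 < min z₁ z₂ := lt_min hz₁ hz₂
  have hg := glue hz (hc₁.mono (min_le_left _ _)) (hc₂.mono (min_le_right _ _))
  have fp : F p = p := by have := eA p; simp at this; linarith
  refine ⟨fun x => (F x - x) * Real.exp (ℓ x + gl p Λ₁ Λ₂ x), min z₁ z₂, hz, ?_, by simp [fp], ?_⟩
  · have s1 : ContDiff ℝ J (fun y => F y - y) := h.smu.of_le (by exact_mod_cast le_top)
    have s2 : ContDiff ℝ J ℓ := sℓ.of_le (by exact_mod_cast le_top)
    exact s1.contDiffOn.mul (Real.contDiff_exp.comp_contDiffOn (s2.contDiffOn.add hg))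
  · intro a b W κ hW x hx hxz
    have hxp : x ≠ p := by
      rintro rfl
      rcases hW.e with rfl | rfl
      · exact lt_irrefl _ hx.1
      · exact lt_irrefl _ hx.2
    have := abs_lt.1 hxz
    have m1 := min_le_left z₁ z₂
    have m2 := min_le_right z₁ z₂
    rcases lt_or_gt_of_ne hxp with hlt | hgt
    · show W x = κ * ((F x - x) * Real.exp (ℓ x + gl p Λ₁ Λ₂ x))
      rw [gl_neg hlt]
      exact hu₂ a b W κ hW x hx (by linarith) (by linarith)
    · show W x = κ * ((F x - x) * Real.exp (ℓ x + gl p Λ₁ Λ₂ x))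
      rw [gl_pos hgt]
      exact hu₁ a b W κ hW x hx (by linarith) (by linarith)
end
end

section
open scoped ContDiff

section
variable {F G R : ℝ → ℝ}

theorem Sz.xi_smooth (h : Sz F G R) {x : ℝ} (hx : x ∈ Ioo (-1:ℝ) 2) (hx' : F x ≠ x) : ContDiffAt ℝ ∞ (xi F R) x := by
  set P : ℝ → ℝ → Prop := fun x e => x ∈ Ioo (-1:ℝ) 2 ∧ F x ≠ x ∧ e = 1 with hPd
  have hop : IsOpen {x | x ∈ Ioo (-1:ℝ) 2 ∧ F x ≠ x} :=
    isOpen_Ioo.inter (isOpen_ne_fun h.gd.sm.continuous continuous_id)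
  have hP : Dom F P := by
    refine ⟨fun e => ?_, fun x e he => ⟨he.1, he.2.1⟩, ?_, ?_⟩
    · have : {x | P x e} = {x | x ∈ Ioo (-1:ℝ) 2 ∧ F x ≠ x} ∩ {x | e = 1} := by
        ext x; simp [hPd, and_assoc]
      rw [this]; exact hop.inter isOpen_const
    · rintro y e ⟨hy, hy', he⟩
      refine ⟨⟨?_, ?_⟩, fun e => hy' (h.gd.mono.injective e), he⟩
      · rw [← h.gd.m1]; exact h.gd.mono hy.1
      · rw [← h.gd.two]; exact h.gd.mono hy.2
    · rintro y e ⟨hy, hy', rfl⟩; exact ⟨one_pos, le_rfl⟩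
  have hPI : ∀ x e, P x e → x ∈ Icc (-1:ℝ) 2 := fun x e he => Ioo_subset_Icc_self (hP.sub x e he).1
  obtain ⟨Cx, hCx0, hCx⟩ := h.xi_le
  have hξ : Bc (xi F R) P 0 0 1 (xi F R) := by
    obtain ⟨C, hC0, hC⟩ := bddI h.smu.continuous
    refine ⟨Cx * C, by positivity, fun x e he => ((hCx x (hPI x e he)).1).trans ?_⟩
    rw [he.2.2, one_pow, mul_one]
    exact mul_le_mul_of_nonneg_left (hC x (hPI x e he)) hCx0.le
  have bsm : ∀ (J : ℕ) (a : ℝ → ℝ), Sm a → ∀ i ≤ J, ∃ C, 0 ≤ C ∧ ∀ x e, P x e →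
      e ^ i * |iteratedDeriv i a x| ≤ C * e ^ (0 + 0 * i) := by
    intro J a ha i _
    obtain ⟨C, hC, h1⟩ := bddI (ha.continuous_iteratedDeriv i (by exact_mod_cast le_top))
    refine ⟨C, hC, fun x e he => ?_⟩
    have h4 := h1 x (hPI x e he)
    rw [he.2.2]
    simpa using h4
  have hv : ∀ J, Bc (xi F R) P 0 J 0 (v0 F R) := fun J =>
    Bc.v0 h hP hξ (bsm J _ h.smu.deriv) (bsm J _ h.smr.deriv) J le_rfl
  rw [contDiffAt_infty]
  intro J
  obtain ⟨c, c0, c1, -⟩ := Bc.chain h hP (i := 0) (fun j' _ => hv j') (hv J)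
  have := chain_contDiff hop J (c := fun l => Nat.casesOn l (xi F R) c) ?_
  · exact this.contDiffAt (hop.mem_nhds ⟨hx, hx'⟩)
  · intro l hl y hy
    cases l with
    | zero =>
      show HasDerivAt (xi F R) (c 0 y) y
      rw [c0]; simpa using h.xi_deriv hy.1 hy.2
    | succ l => exact c1 l (by omega) y 1 ⟨hy.1, hy.2, rfl⟩

theorem Fld.smul {W : ℝ → ℝ} {p κ a b : ℝ} (h : Fld F W p κ a b) (c : ℝ) : Fld F (fun x => c * W x) p (c * κ) a b :=
  ⟨h.cp, h.e, fun x hx => by rw [h.inv x hx]; ring, (h.lim.const_mul c).congr fun x => by ring⟩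

theorem Fld.congr {W W' : ℝ → ℝ} {p κ a b : ℝ} (h : Fld F W p κ a b) (gd : GDiff F G) (e : ∀ x ∈ Ioo a b, W' x = W x) :
    Fld F W' p κ a b :=
  ⟨h.cp, h.e, fun x hx => by rw [e x hx, e _ (mem_of_cpt gd h.cp hx), h.inv x hx], h.lim.congr' (by
    filter_upwards [self_mem_nhdsWithin] with x hx
    rw [e x hx])⟩

theorem exists_side (gd : GDE F G) {a b p : ℝ} (ha : -1 ≤ a) (hb : b ≤ 2) (hc : Cpt F a b) (hp : p = a ∨ p = b) :
    ∃ W κ, 0 < κ ∧ Fld F W p κ a b ∧ ∀ x ∈ Ioo a b, ContDiffAt ℝ ∞ W x := by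
  have hfp : F p = p := by rcases hp with rfl | rfl; exacts [hc.fa, hc.fb]
  obtain ⟨R, hR⟩ := Sz.exists gd
  obtain ⟨R', hR'⟩ := Sz.exists gd.symm
  have key : (∀ x ∈ Ioo a b, (F x - x) * (x - p) ≤ 0) ∨ (∀ x ∈ Ioo a b, 0 ≤ (F x - x) * (x - p)) := by
    rcases hp with rfl | rfl <;> rcases hc.sgn gd.sm.continuous with hs | hs
    · right; intro x hx; exact mul_nonneg (hs x hx).le (by linarith [hx.1])
    · left; intro x hx; exact mul_nonpos_of_nonpos_of_nonneg (hs x hx).le (by linarith [hx.1])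
    · left; intro x hx; exact mul_nonpos_of_nonneg_of_nonpos (hs x hx).le (by linarith [hx.2])
    · right; intro x hx; exact mul_nonneg_of_nonpos_of_nonpos (hs x hx).le (by linarith [hx.2])
  have hI : ∀ x ∈ Ioo a b, x ∈ Ioo (-1:ℝ) 2 := fun x hx => ⟨ha.trans_lt hx.1, hx.2.trans_le hb⟩
  rcases key with hk | hk
  · exact ⟨xi F R, 1, one_pos, ⟨hc, hp, (hR.ivr ha hb hc).der, hR.ratio ha hb hfp fun x hx => ⟨hc.ne x hx, hk x hx⟩⟩,
      fun x hx => hR.xi_smooth (hI x hx) (hc.ne x hx)⟩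
  · exact ⟨fun x => - xi G R' x, (deriv F p)⁻¹, inv_pos.2 (gd.pos p), ⟨hc, hp,
      ((hR'.ivr ha hb (hc.inv gd.toGDiff)).symm).neg.der, hR'.ratio' ha hb hfp fun x hx => ⟨hc.ne x hx, hk x hx⟩⟩,
      fun x hx => (hR'.xi_smooth (hI x hx) ((hc.inv gd.toGDiff).ne x hx)).neg⟩
end
end

section
open scoped ContDiff

section
variable {f f' g g' : ℝ → ℝ} {D : Set ℝ}

structure VF (D : Set ℝ) (f f' g g' : ℝ → ℝ) (τ : ℝ) (V : ℝ → ℝ) : Prop where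
  zero : ∀ x ∈ Icc (0:ℝ) 1, f x = x → V x = 0
  ff : ∀ a b, 0 ≤ a → b ≤ 1 → Cpt f a b → FF f f' g g' V a b
  one : ∀ a b, 0 ≤ a → b ≤ 1 → Cpt f a b → ∀ x ∈ Ioo a b, tt V x (f x) = 1 ∧ tt V x (g x) = τ
  sm : ∀ x ∈ Icc (0:ℝ) 1, x ∉ D → ContDiffAt ℝ ∞ V x
  smL : (0:ℝ) ∉ D → ∃ a < 0, ∀ x ∈ Ioo a 0, ContDiffAt ℝ ∞ V x
  smR : (1:ℝ) ∉ D → ∃ b > 1, ∀ x ∈ Ioo 1 b, ContDiffAt ℝ ∞ V x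
  low : ∀ p ∈ Icc (0:ℝ) 1, p ∉ D → f p = p → ∃ κ > 0, ∀ᶠ x in 𝓝[Icc (0:ℝ) 1] p, κ * |f x - x| ≤ |V x|
  eq : ∀ a b W, 0 ≤ a → b ≤ 1 → Cpt f a b → FF f f' g g' W a b → ∀ x ∈ Ioo a b, V x = tt W x (f x) * W x

theorem tt_congr {W W' : ℝ → ℝ} {a b x y : ℝ} (hx : x ∈ Ioo a b) (hy : y ∈ Ioo a b) (e : ∀ t ∈ Ioo a b, W t = W' t) :
    tt W x y = tt W' x y :=
  intervalIntegral.integral_congr fun t ht => by simp only [e t (uIcc_sub_Ioo hx hy ht)]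

theorem tt_smul (c : ℝ) (W : ℝ → ℝ) (x y : ℝ) : tt (fun t => c * W t) x y = c⁻¹ * tt W x y := by
  unfold tt
  rw [← intervalIntegral.integral_const_mul]
  congr 1; ext t; rw [mul_inv]

theorem FF.scale {W W' : ℝ → ℝ} {a b c : ℝ} (h : FF f f' g g' W a b) (hc : 0 < c) (e : ∀ x ∈ Ioo a b, W' x = c * W x) :
    FF f f' g g' W' a b := by
  refine ⟨⟨h.fd.cp, h.fd.fc, ?_, fun x hx => ?_⟩, ⟨h.iff.gd, h.iff.ha, h.iff.hb, fun x hx => ?_⟩,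
    ⟨h.ivg.gd, h.ivg.ha, h.ivg.hb, fun x hx => ?_⟩⟩
  · exact (continuousOn_const.mul h.fd.cont).congr e
  · rw [e x hx, mul_assoc]; exact mul_pos hc (h.fd.pos x hx)
  · rw [e x hx, e _ (h.iff.mem hx), h.iff.der x hx]; ring
  · rw [e x hx, e _ (h.ivg.mem hx), h.ivg.der x hx]; ring

theorem CP.not_D (h : CP D f f' g g') {x : ℝ} (hx : x ∈ Ioo (0:ℝ) 1) : x ∉ D := by
  intro hxD
  have := h.hD hxD
  simp only [mem_insert_iff, mem_singleton_iff] at this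
  rcases this with rfl | rfl
  · exact lt_irrefl _ hx.1
  · exact lt_irrefl _ hx.2

/-- components outside `[0,1]` adjacent to nonflat ends -/
theorem CP.outL (h : CP D f f' g g') (h0 : (0:ℝ) ∉ D) : ∃ a, -1 ≤ a ∧ a < 0 ∧ Cpt f a 0 := by
  obtain ⟨δ, hδ, hi⟩ := h.isol (p := 0) (by simp) h0 h.gf.zero
  set x := - min (δ/2) (1/2) with hx
  have hm : 0 < min (δ/2) (1/2) := by positivity
  have hm1 := min_le_left (δ/2) (1/2)
  have hm2 := min_le_right (δ/2) (1/2 : ℝ)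
  have hin : ∀ y, x ≤ y → y < 0 → f y ≠ y := fun y h1 h2 => hi y (by rw [sub_zero, abs_of_neg h2]; linarith) h2.ne
  obtain ⟨a, b, ha, hb, hxab, hc⟩ := Cpt.exists h.gf.sm.continuous h.gf.m1 h.gf.zero (x := x)
    ⟨by linarith, by linarith⟩ (hin x le_rfl (by linarith))
  have hb0 : b = 0 := by
    by_contra hne
    exact hin b hxab.2.le (lt_of_le_of_ne hb hne) hc.fb
  subst hb0
  exact ⟨a, ha, hc.lt, hc⟩

theorem CP.outR (h : CP D f f' g g') (h1 : (1:ℝ) ∉ D) : ∃ b, b ≤ 2 ∧ 1 < b ∧ Cpt f 1 b := by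
  obtain ⟨δ, hδ, hi⟩ := h.isol (p := 1) (by simp) h1 h.gf.one
  set x := 1 + min (δ/2) (1/2) with hx
  have hm : 0 < min (δ/2) (1/2) := by positivity
  have hm1 := min_le_left (δ/2) (1/2)
  have hm2 := min_le_right (δ/2) (1/2 : ℝ)
  have hin : ∀ y, y ≤ x → 1 < y → f y ≠ y := fun y h1 h2 => hi y (by rw [abs_of_pos (by linarith)]; linarith) h2.ne'
  obtain ⟨a, b, ha, hb, hxab, hc⟩ := Cpt.exists h.gf.sm.continuous h.gf.one h.gf.two (x := x)
    ⟨by linarith, by linarith⟩ (hin x le_rfl (by linarith))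
  have hb0 : a = 1 := by
    by_contra hne
    exact hin a hxab.1.le (lt_of_le_of_ne ha (Ne.symm hne)) hc.fa
  subst hb0
  exact ⟨b, hb, hc.lt, hc⟩

theorem CP.exists_V (h : CP D f f' g g') {τ : ℝ} (hi : Irrational τ)
    (hτ : ∀ x ∈ Icc (0:ℝ) 1, f x ≠ x → RelT h.gf.perm h.gg.perm τ x) : ∃ V, VF D f f' g g' τ V := by
  obtain ⟨R, hR⟩ := Sz.exists h.gf
  obtain ⟨R', hR'⟩ := Sz.exists h.gf.symm
  set V0 : ℝ → ℝ := fun x => tt (xi f R) x (f x) * xi f R x with hV0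
  have sub : ∀ {a b : ℝ}, 0 ≤ a → b ≤ 1 → ∀ {x}, x ∈ Ioo a b → x ∈ Icc (0:ℝ) 1 :=
    fun ha hb x hx => ⟨ha.trans hx.1.le, hx.2.le.trans hb⟩
  -- generic facts on components
  have hc0 : ∀ a b, 0 ≤ a → b ≤ 1 → Cpt f a b → ∃ c > 0, ∀ x ∈ Ioo a b, tt (xi f R) x (f x) = c := by
    intro a b ha hb hc
    have hff := h.ff hR ha hb hc
    have hm : (a + b) / 2 ∈ Ioo a b := ⟨by linarith [hc.lt], by linarith [hc.lt]⟩
    exact ⟨_, hff.c_pos hm, fun x hx => hff.fd.const hff.iff hx hm⟩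
  have hff0 : ∀ a b, 0 ≤ a → b ≤ 1 → Cpt f a b → FF f f' g g' V0 a b := by
    intro a b ha hb hc
    obtain ⟨c, hcp, hcc⟩ := hc0 a b ha hb hc
    exact (h.ff hR ha hb hc).scale hcp fun x hx => by rw [hV0]; simp only [hcc x hx]
  have hone0 : ∀ a b, 0 ≤ a → b ≤ 1 → Cpt f a b → ∀ x ∈ Ioo a b, tt V0 x (f x) = 1 ∧ tt V0 x (g x) = τ := by
    intro a b ha hb hc x hx
    obtain ⟨c, hcp, hcc⟩ := hc0 a b ha hb hc
    have hff := h.ff hR ha hb hc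
    have hV := hff0 a b ha hb hc
    have h1 : tt V0 x (f x) = 1 := by
      rw [tt_congr hx (hff.iff.mem hx) (W' := fun t => c * xi f R t) (fun t ht => by rw [hV0]; simp only [hcc t ht]),
        tt_smul, hcc x hx, inv_mul_cancel₀ hcp.ne']
    refine ⟨h1, ?_⟩
    have h2 := hV.rel h.gf.toGDiff h.gg.toGDiff hx hx
    have h3 := RelT.unique h2 (hτ x (sub ha hb hx) (hc.ne x hx))
    rwa [h1, div_one] at h3
  have heq0 : ∀ a b W, 0 ≤ a → b ≤ 1 → Cpt f a b → FF f f' g g' W a b → ∀ x ∈ Ioo a b, V0 x = tt W x (f x) * W x := by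
    intro a b W ha hb hc hW x hx
    exact (h.ff hR ha hb hc).unique hW h.gf.toGDiff h.gg.toGDiff hi
      (fun x hx => hτ x (sub ha hb hx) (hc.ne x hx)) hx
  -- local fields at nonflat points
  have hfld : ∀ p ∈ Icc (0:ℝ) 1, ∀ m A, Sm A → A p ≠ 0 → (∀ x, f x - x = (x - p) ^ (m + 1) * A x) →
      ∀ a b, 0 ≤ a → b ≤ 1 → Cpt f a b → (p = a ∨ p = b) → 0 < kn m A A p ∧ Fld f V0 p (kn m A A p) a b := by
    intro p hp m A sA hA eA a b ha hb hc hpab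
    obtain ⟨B, sB, eB⟩ := h.factor_g ha hb hc hpab sA eA
    obtain ⟨W, κ, hκ, hW, hl, hk⟩ := h.kn_tt hp ha hb hc hpab sA hA eA sB eB
    have hm : (a + b) / 2 ∈ Ioo a b := ⟨by linarith [hc.lt], by linarith [hc.lt]⟩
    have k0 : 0 < kn m A A p := by
      have := hW.c_pos hm
      rw [(hk _ hm).1] at this
      exact (div_pos_iff_of_pos_right hκ).1 this
    refine ⟨k0, ?_⟩
    have hF : Fld f W p κ a b := ⟨hc, hpab, hW.iff.der, hl⟩
    have := (hF.smul (kn m A A p / κ)).congr (W' := V0) h.gf.toGDiff fun x hx => by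
      rw [heq0 a b W ha hb hc hW x hx, (hk x hx).1]
    rwa [div_mul_cancel₀ _ hκ.ne'] at this
  -- extensions
  have hL : ∃ E : ℝ → ℝ, (0:ℝ) ∉ D → ∀ m A, Sm A → A 0 ≠ 0 → (∀ x, f x - x = (x - 0) ^ (m + 1) * A x) →
      ∃ a < 0, Fld f E 0 (kn m A A 0) a 0 ∧ ∀ x ∈ Ioo a 0, ContDiffAt ℝ ∞ E x := by
    by_cases h0 : (0:ℝ) ∈ D
    · exact ⟨0, fun h => absurd h0 h⟩
    obtain ⟨a, ha, ha0, hc⟩ := h.outL h0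
    obtain ⟨W, κ, hκ, hF, hWs⟩ := exists_side h.gf ha (by norm_num) hc (Or.inr rfl)
    obtain ⟨m₀, A₀, sA₀, hA₀, eA₀⟩ := h.nonflat (p := 0) (by simp) h0 h.gf.zero
    obtain ⟨δ, hδ, hadj⟩ := h.adj (p := 0) (by simp) h0 h.gf.zero
    obtain ⟨a', b', ha', hb', -, hc', hp'⟩ := hadj (min (δ/2) (1/2)) ⟨by positivity, by linarith [min_le_right (δ/2) (1/2 : ℝ)]⟩
      (by rw [sub_zero, abs_of_pos (by positivity)]; linarith [min_le_left (δ/2) (1/2 : ℝ)]) (by positivity)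
    have hb := end_neBot hc'.lt hp'
    refine ⟨fun x => kn m₀ A₀ A₀ 0 / κ * W x, fun _ m A sA hA eA => ⟨a, ha0, ?_, fun x hx => contDiffAt_const.mul (hWs x hx)⟩⟩
    have e1 := (hfld 0 (by simp) m A sA hA eA a' b' ha' hb' hc' hp').2.lim
    have e2 := (hfld 0 (by simp) m₀ A₀ sA₀ hA₀ eA₀ a' b' ha' hb' hc' hp').2.lim
    have := hF.smul (kn m₀ A₀ A₀ 0 / κ)
    rw [div_mul_cancel₀ _ hκ.ne'] at this
    have e3 := tendsto_nhds_unique e2 e1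
    rw [← e3]; exact this
  have hRt : ∃ E : ℝ → ℝ, (1:ℝ) ∉ D → ∀ m A, Sm A → A 1 ≠ 0 → (∀ x, f x - x = (x - 1) ^ (m + 1) * A x) →
      ∃ b > 1, Fld f E 1 (kn m A A 1) 1 b ∧ ∀ x ∈ Ioo 1 b, ContDiffAt ℝ ∞ E x := by
    by_cases h0 : (1:ℝ) ∈ D
    · exact ⟨0, fun h => absurd h0 h⟩
    obtain ⟨b, hb, hb1, hc⟩ := h.outR h0
    obtain ⟨W, κ, hκ, hF, hWs⟩ := exists_side h.gf (by norm_num) hb hc (Or.inl rfl)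
    obtain ⟨m₀, A₀, sA₀, hA₀, eA₀⟩ := h.nonflat (p := 1) (by simp) h0 h.gf.one
    obtain ⟨δ, hδ, hadj⟩ := h.adj (p := 1) (by simp) h0 h.gf.one
    have m0 : 0 < min (δ/2) (1/2) := by positivity
    obtain ⟨a', b', ha', hb', -, hc', hp'⟩ := hadj (1 - min (δ/2) (1/2)) ⟨by linarith [min_le_right (δ/2) (1/2 : ℝ)], by linarith⟩
      (by rw [abs_of_neg (by linarith)]; linarith [min_le_left (δ/2) (1/2 : ℝ)]) (by linarith)
    have hbb := end_neBot hc'.lt hp'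
    refine ⟨fun x => kn m₀ A₀ A₀ 1 / κ * W x, fun _ m A sA hA eA => ⟨b, hb1, ?_, fun x hx => contDiffAt_const.mul (hWs x hx)⟩⟩
    have e1 := (hfld 1 (by simp) m A sA hA eA a' b' ha' hb' hc' hp').2.lim
    have e2 := (hfld 1 (by simp) m₀ A₀ sA₀ hA₀ eA₀ a' b' ha' hb' hc' hp').2.lim
    have := hF.smul (kn m₀ A₀ A₀ 1 / κ)
    rw [div_mul_cancel₀ _ hκ.ne'] at this
    have e3 := tendsto_nhds_unique e2 e1
    rw [← e3]; exact this
  obtain ⟨EL, hEL⟩ := hL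
  obtain ⟨ER, hER⟩ := hRt
  set V : ℝ → ℝ := fun x => if x < 0 then EL x else if 1 < x then ER x else V0 x with hVd
  have hVI : ∀ x ∈ Icc (0:ℝ) 1, V x = V0 x := fun x hx => by
    rw [hVd]; simp only [not_lt.2 hx.1, not_lt.2 hx.2, if_false]
  have hz : ∀ x ∈ Icc (0:ℝ) 1, f x = x → V x = 0 := by
    intro x hx e
    rw [hVI x hx, hV0]; simp [xi, e]
  refine ⟨V, hz, ?_, ?_, ?_, ?_, ?_, ?_, ?_⟩
  · intro a b ha hb hc
    exact (hff0 a b ha hb hc).scale one_pos fun x hx => by rw [hVI x (sub ha hb hx), one_mul]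
  · intro a b ha hb hc x hx
    rw [tt_congr hx (mem_of_cpt h.gf.toGDiff hc hx) (fun t ht => hVI t (sub ha hb ht)),
      tt_congr hx ((hff0 a b ha hb hc).ivg.mem hx) (fun t ht => hVI t (sub ha hb ht))]
    exact hone0 a b ha hb hc x hx
  · intro p hp hpD
    by_cases fp : f p = p
    · obtain ⟨m, A, sA, hA, eA⟩ := h.nonflat hp hpD fp
      rw [contDiffAt_infty]
      intro J
      obtain ⟨η, z, hz0, hη, ηp, hu⟩ := exists_eta hR hR' hp sA hA eA J
      obtain ⟨δ, hδ, hadj⟩ := h.adj hp hpD fp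
      have hV : V =ᶠ[𝓝 p] fun x => kn m A A p * η x := by
        have hin : ∀ x ∈ Icc (0:ℝ) 1, |x - p| < z → |x - p| < δ → V x = kn m A A p * η x := by
          intro x hx h1 h2
          by_cases hxp : x = p
          · rw [hxp, ηp, hz p hp fp, mul_zero]
          · obtain ⟨a, b, ha, hb, hxab, hc, hpab⟩ := hadj x hx h2 hxp
            rw [hVI x hx]
            exact hu a b V0 _ (hfld p hp m A sA hA eA a b ha hb hc hpab).2 x hxab h1
        have b1 := Metric.ball_mem_nhds p hz0
        have b2 := Metric.ball_mem_nhds p hδ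
        rcases eq_or_lt_of_le hp.1 with h0 | h0
        · subst h0
          obtain ⟨a, ha, hF, -⟩ := hEL hpD m A sA hA eA
          filter_upwards [b1, b2, Ioo_mem_nhds ha one_pos] with x hx1 hx2 hx3
          rw [Metric.mem_ball, Real.dist_eq] at hx1 hx2
          rcases lt_or_ge x 0 with hx0 | hx0
          · have : V x = EL x := by rw [hVd]; simp only [hx0, if_true]
            rw [this]
            exact hu a 0 EL _ hF x ⟨hx3.1, hx0⟩ hx1
          · exact hin x ⟨hx0, hx3.2.le⟩ hx1 hx2
        · rcases eq_or_lt_of_le hp.2 with h1 | h1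
          · subst h1
            obtain ⟨b, hb, hF, -⟩ := hER hpD m A sA hA eA
            filter_upwards [b1, b2, Ioo_mem_nhds (zero_lt_one' ℝ) hb] with x hx1 hx2 hx3
            rw [Metric.mem_ball, Real.dist_eq] at hx1 hx2
            rcases lt_or_ge 1 x with hx0 | hx0
            · have : V x = ER x := by rw [hVd]; simp only [not_lt.2 (zero_le_one.trans hx0.le), hx0, if_true, if_false]
              rw [this]
              exact hu 1 b ER _ hF x ⟨hx0, hx3.2⟩ hx1
            · exact hin x ⟨hx3.1.le, hx0⟩ hx1 hx2
          · filter_upwards [b1, b2, Ioo_mem_nhds h0 h1] with x hx1 hx2 hx3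
            rw [Metric.mem_ball, Real.dist_eq] at hx1 hx2
            exact hin x (Ioo_subset_Icc_self hx3) hx1 hx2
      refine ContDiffAt.congr_of_eventuallyEq ?_ hV
      exact contDiffAt_const.mul (hη.contDiffAt (Metric.ball_mem_nhds p hz0))
    · obtain ⟨a, b, ha, hb, hxab, hc⟩ := Cpt.exists h.gf.sm.continuous h.gf.zero h.gf.one hp fp
      obtain ⟨c, hcp, hcc⟩ := hc0 a b ha hb hc
      refine ContDiffAt.congr_of_eventuallyEq (f := fun x => c * xi f R x) ?_ ?_
      · exact contDiffAt_const.mul (hR.xi_smooth ⟨by linarith [hp.1], by linarith [hp.2]⟩ fp)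
      · filter_upwards [isOpen_Ioo.mem_nhds hxab] with x hx
        rw [hVI x (sub ha hb hx), hV0]; simp only [hcc x hx]
  · intro h0
    obtain ⟨m, A, sA, hA, eA⟩ := h.nonflat (p := 0) (by simp) h0 h.gf.zero
    obtain ⟨a, ha, -, hs⟩ := hEL h0 m A sA hA eA
    refine ⟨a, ha, fun x hx => (hs x hx).congr_of_eventuallyEq ?_⟩
    filter_upwards [isOpen_Iio.mem_nhds hx.2] with y hy
    rw [hVd]; simp only [mem_Iio.1 hy, if_true]
  · intro h0
    obtain ⟨m, A, sA, hA, eA⟩ := h.nonflat (p := 1) (by simp) h0 h.gf.one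
    obtain ⟨b, hb, -, hs⟩ := hER h0 m A sA hA eA
    refine ⟨b, hb, fun x hx => (hs x hx).congr_of_eventuallyEq ?_⟩
    filter_upwards [isOpen_Ioi.mem_nhds hx.1] with y hy
    have hy' : 1 < y := hy
    rw [hVd]; simp only [not_lt.2 (zero_le_one.trans hy'.le), hy', if_true, if_false]
  · intro p hp hpD fp
    obtain ⟨m, A, sA, hA, eA⟩ := h.nonflat hp hpD fp
    obtain ⟨δ, hδ, hadj⟩ := h.adj hp hpD fp
    -- the model field controls the size
    obtain ⟨η, z, hz0, hη, ηp, hu⟩ := exists_eta hR hR' hp sA hA eA 0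
    have key : ∀ a b, 0 ≤ a → b ≤ 1 → Cpt f a b → (p = a ∨ p = b) → 
        ∀ᶠ x in 𝓝[Ioo a b] p, kn m A A p / 2 * |f x - x| ≤ |V x| := by
      intro a b ha hb hc hpab
      obtain ⟨k0, hF⟩ := hfld p hp m A sA hA eA a b ha hb hc hpab
      filter_upwards [hF.lim.eventually (lt_mem_nhds (half_lt_self k0)), self_mem_nhdsWithin] with x hx hxI
      have hne := sub_ne_zero.2 (hc.ne x hxI)
      rw [hVI x (sub ha hb hxI)]
      have : V0 x = (V0 x / (f x - x)) * (f x - x) := by field_simp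
      rw [this, abs_mul]
      exact mul_le_mul_of_nonneg_right (hx.le.trans (le_abs_self _)) (abs_nonneg _)
    -- left and right neighbourhoods
    have kp : 0 < kn m A A p := by
      obtain ⟨x, hx1, hx2, hx3⟩ : ∃ x ∈ Icc (0:ℝ) 1, |x - p| < δ ∧ x ≠ p := by
        rcases lt_or_ge p 1 with h1 | h1
        · have : 0 < min (δ/2) (1-p) := lt_min (by positivity) (by linarith)
          refine ⟨p + min (δ/2) (1-p), ⟨by linarith [hp.1], by linarith [min_le_right (δ/2) (1-p)]⟩, ?_, by linarith⟩
          rw [add_sub_cancel_left, abs_of_pos this]; linarith [min_le_left (δ/2) (1-p)]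
        · have : 0 < min (δ/2) 1 := by positivity
          refine ⟨p - min (δ/2) 1, ⟨by linarith [min_le_right (δ/2) 1], by linarith [hp.2]⟩, ?_, by linarith⟩
          rw [abs_of_neg (by linarith)]; linarith [min_le_left (δ/2) 1]
      obtain ⟨a, b, ha, hb, -, hc, hpab⟩ := hadj x hx1 hx2 hx3
      exact (hfld p hp m A sA hA eA a b ha hb hc hpab).1
    refine ⟨kn m A A p / 2, by positivity, ?_⟩
    have hr : ∀ᶠ x in 𝓝[Icc (0:ℝ) 1 ∩ Ioi p] p, kn m A A p / 2 * |f x - x| ≤ |V x| := by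
      rcases lt_or_ge p 1 with h1 | h1
      · have : 0 < min (δ/2) (1-p) := lt_min (by positivity) (by linarith)
        obtain ⟨a, b, ha, hb, hxab, hc, hpab⟩ := hadj (p + min (δ/2) (1-p))
          ⟨by linarith [hp.1], by linarith [min_le_right (δ/2) (1-p)]⟩
          (by rw [add_sub_cancel_left, abs_of_pos this]; linarith [min_le_left (δ/2) (1-p)]) (by linarith)
        have hpa : p = a := by
          rcases hpab with e | e
          · exact e
          · exfalso; linarith [hxab.2]
        have := key a b ha hb hc hpab
        subst hpa
        rw [nhdsWithin_Ioo_eq_nhdsGT hc.lt] at this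
        exact this.filter_mono (nhdsWithin_mono _ inter_subset_right)
      · have : Icc (0:ℝ) 1 ∩ Ioi p = ∅ := by ext x; simp; intro _ _; linarith
        rw [this, nhdsWithin_empty]; exact eventually_bot
    have hl : ∀ᶠ x in 𝓝[Icc (0:ℝ) 1 ∩ Iio p] p, kn m A A p / 2 * |f x - x| ≤ |V x| := by
      rcases lt_or_ge 0 p with h1 | h1
      · have : 0 < min (δ/2) p := lt_min (by positivity) h1
        obtain ⟨a, b, ha, hb, hxab, hc, hpab⟩ := hadj (p - min (δ/2) p)
          ⟨by linarith [min_le_right (δ/2) p], by linarith [hp.2]⟩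
          (by rw [abs_of_neg (by linarith)]; linarith [min_le_left (δ/2) p]) (by linarith)
        have hpa : p = b := by
          rcases hpab with e | e
          · exfalso; linarith [hxab.1]
          · exact e
        have := key a b ha hb hc hpab
        subst hpa
        rw [nhdsWithin_Ioo_eq_nhdsLT hc.lt] at this
        exact this.filter_mono (nhdsWithin_mono _ inter_subset_right)
      · have : Icc (0:ℝ) 1 ∩ Iio p = ∅ := by ext x; simp; intro _ _; linarith
        rw [this, nhdsWithin_empty]; exact eventually_bot
    rw [eventually_nhdsWithin_iff] at hr hl ⊢
    filter_upwards [hr, hl] with x h1 h2 hx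
    rcases lt_trichotomy x p with hlt | rfl | hgt
    · exact h2 ⟨hx, hlt⟩
    · rw [fp]; simp
    · exact h1 ⟨hx, hgt⟩
  · intro a b W ha hb hc hW x hx
    rw [hVI x (sub ha hb hx)]
    exact heq0 a b W ha hb hc hW x hx
end
end

section
open scoped ContDiff

section
noncomputable def MM (u : ℝ → ℝ) (i : ℕ) (Z : ℝ) : ℝ := sSup ((fun x => |iteratedDeriv i u x|) '' Icc 0 Z)

variable {u : ℝ → ℝ}

theorem Sm.cid (hu : Sm u) (i : ℕ) : Continuous (iteratedDeriv i u) :=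
  hu.continuous_iteratedDeriv i (by exact_mod_cast le_top)

theorem Sm.hasid (hu : Sm u) (i : ℕ) (x : ℝ) : HasDerivAt (iteratedDeriv i u) (iteratedDeriv (i+1) u x) x := by
  rw [iteratedDeriv_succ]
  exact ((hu.differentiable_iteratedDeriv i (by exact_mod_cast ENat.coe_lt_top i)) x).hasDerivAt

theorem MM_att (hu : Sm u) (i : ℕ) {Z : ℝ} (hZ : 0 ≤ Z) : ∃ X ∈ Icc 0 Z, MM u i Z = |iteratedDeriv i u X| := by
  obtain ⟨X, hX, e⟩ := isCompact_Icc.exists_sSup_image_eq (nonempty_Icc.2 hZ) (f := fun x => |iteratedDeriv i u x|)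
    (hu.cid i).abs.continuousOn
  exact ⟨X, hX, e⟩

theorem MM_le (hu : Sm u) (i : ℕ) {Z x : ℝ} (hx : x ∈ Icc 0 Z) : |iteratedDeriv i u x| ≤ MM u i Z :=
  le_csSup (isCompact_Icc.image (hu.cid i).abs).bddAbove ⟨x, hx, rfl⟩

theorem MM_nonneg (hu : Sm u) (i : ℕ) {Z : ℝ} (hZ : 0 ≤ Z) : 0 ≤ MM u i Z :=
  (abs_nonneg _).trans (MM_le hu i (x := 0) ⟨le_rfl, hZ⟩)

theorem mvt_bd {v v' : ℝ → ℝ} {Z M : ℝ} (hv : ∀ x, HasDerivAt v (v' x) x) (hM : ∀ x ∈ Icc 0 Z, |v' x| ≤ M)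
    {x y : ℝ} (hx : x ∈ Icc 0 Z) (hy : y ∈ Icc 0 Z) : |v y - v x| ≤ M * |y - x| :=
  (convex_Icc 0 Z).norm_image_sub_le_of_norm_hasDerivWithin_le (fun x _ => (hv x).hasDerivWithinAt) hM hx hy

theorem landau (hu : Sm u) (hf : Flat u 0) (i : ℕ) {Z : ℝ} (hZ : 0 ≤ Z) :
    MM u (i+1) Z ^ 2 ≤ 8 * MM u i Z * MM u (i+2) Z := by
  obtain ⟨x, hx, ex⟩ := MM_att hu (i+1) hZ
  have h0 := MM_nonneg hu i hZ
  have h2 := MM_nonneg hu (i+2) hZ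
  set M0 := MM u i Z
  set M2 := MM u (i+2) Z
  have z0 : (0:ℝ) ∈ Icc 0 Z := ⟨le_rfl, hZ⟩
  have hb : |iteratedDeriv (i+1) u x| ≤ M2 * x := by
    have := mvt_bd (hu.hasid (i+1)) (fun x hx => MM_le hu (i+2) hx) z0 hx
    rwa [hf, sub_zero, sub_zero, abs_of_nonneg hx.1] at this
  rw [ex]
  set a := |iteratedDeriv (i+1) u x| with ha
  rcases eq_or_lt_of_le h2 with e | hpos
  · have : a = 0 := le_antisymm (by rw [← e, zero_mul] at hb; exact hb) (abs_nonneg _)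
    rw [this]; simp; positivity
  have ha0 : 0 ≤ a := abs_nonneg _
  set h := a / (2 * M2) with hh
  have eh : 2 * M2 * h = a := by rw [hh]; field_simp
  have hh0 : 0 ≤ h := by positivity
  have hhx : h ≤ x := by
    rw [hh, div_le_iff₀ (by positivity)]; nlinarith [hx.1]
  have hy : x - h ∈ Icc 0 Z := ⟨by linarith, by linarith [hx.2]⟩
  -- linear comparison
  have key : |(iteratedDeriv i u x - iteratedDeriv (i+1) u x * x) -
      (iteratedDeriv i u (x - h) - iteratedDeriv (i+1) u x * (x - h))| ≤ (M2 * h) * |x - (x - h)| := by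
    refine (convex_Icc (x - h) x).norm_image_sub_le_of_norm_hasDerivWithin_le 
      (f := fun y => iteratedDeriv i u y - iteratedDeriv (i+1) u x * y)
      (f' := fun y => iteratedDeriv (i+1) u y - iteratedDeriv (i+1) u x)
      (fun y _ => (((hu.hasid i y).sub ((hasDerivAt_id y).const_mul (iteratedDeriv (i+1) u x))).congr_deriv (by simp)).hasDerivWithinAt) ?_
      (left_mem_Icc.2 (by linarith)) (right_mem_Icc.2 (by linarith))
    intro y hyI
    refine (mvt_bd (hu.hasid (i+1)) (fun x hx => MM_le hu (i+2) hx) hx ⟨by linarith [hyI.1], by linarith [hyI.2, hx.2]⟩).trans ?_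
    refine mul_le_mul_of_nonneg_left ?_ h2
    rw [abs_le]; constructor <;> linarith [hyI.1, hyI.2]
  rw [sub_sub_cancel, abs_of_nonneg hh0] at key
  have k1 := MM_le hu i hx
  have k2 := MM_le hu i hy
  have : a * h ≤ 2 * M0 + M2 * h * h := by
    have e : iteratedDeriv (i+1) u x * h = iteratedDeriv i u x - iteratedDeriv i u (x-h) -
      ((iteratedDeriv i u x - iteratedDeriv (i+1) u x * x) -
      (iteratedDeriv i u (x - h) - iteratedDeriv (i+1) u x * (x - h))) := by ring
    have : |iteratedDeriv (i+1) u x * h| = a * h := by rw [abs_mul, abs_of_nonneg hh0]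
    rw [← this, e]
    have := abs_sub (iteratedDeriv i u x - iteratedDeriv i u (x-h)) ((iteratedDeriv i u x - iteratedDeriv (i+1) u x * x) -
      (iteratedDeriv i u (x - h) - iteratedDeriv (i+1) u x * (x - h)))
    have h3 := abs_sub (iteratedDeriv i u x) (iteratedDeriv i u (x-h))
    linarith
  have : a * (2 * M2 * h) ≤ 4 * M0 * M2 + (2 * M2 * h) * (2 * M2 * h) / 2 := by nlinarith
  rw [eh] at this
  nlinarith

/-- domination up to a loss of an arbitrarily small power -/
def Qd (δ a : ℝ → ℝ) : Prop := ∀ N : ℕ, ∃ C, 0 ≤ C ∧ ∀ Z ∈ Icc (0:ℝ) 1, a Z ^ (N+1) ≤ C * δ Z ^ N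

theorem Qd.add {δ a b : ℝ → ℝ} (h0 : ∀ Z ∈ Icc (0:ℝ) 1, 0 ≤ a Z ∧ 0 ≤ b Z) (ha : Qd δ a) (hb : Qd δ b) :
    Qd δ (fun Z => a Z + b Z) := by
  intro N
  obtain ⟨C, hC, h1⟩ := ha N
  obtain ⟨C', hC', h2⟩ := hb N
  refine ⟨2 ^ N * (C + C'), by positivity, fun Z hZ => ?_⟩
  have := add_pow_le (h0 Z hZ).1 (h0 Z hZ).2 (N+1)
  rw [Nat.add_sub_cancel] at this
  refine this.trans ?_
  rw [mul_assoc, add_mul]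
  exact mul_le_mul_of_nonneg_left (add_le_add (h1 Z hZ) (h2 Z hZ)) (by positivity)

theorem Qd.trans {δ a b : ℝ → ℝ} {B : ℝ} (h0 : ∀ Z ∈ Icc (0:ℝ) 1, 0 ≤ a Z ∧ 0 ≤ b Z ∧ 0 ≤ δ Z ∧ δ Z ≤ B)
    (ha : Qd δ a) (hb : Qd a b) : Qd δ b := by
  intro N
  obtain ⟨C, hC, h1⟩ := ha (2*N+1)
  obtain ⟨C', hC', h2⟩ := hb (2*N+1)
  have hB : 0 ≤ B := (h0 0 (by simp)).2.2.1.trans (h0 0 (by simp)).2.2.2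
  set K := C' ^ (2*N+2) * C ^ (2*N+1) * B with hK
  have K0 : 0 ≤ K := by positivity
  refine ⟨K + 1, by positivity, fun Z hZ => ?_⟩
  obtain ⟨a0, b0, d0, dB⟩ := h0 Z hZ
  have p1 := h1 Z hZ
  have p2 := h2 Z hZ
  have : (b Z ^ (N+1)) ^ (4*(N+1)) ≤ ((K+1) * δ Z ^ N) ^ (4*(N+1)) := by
    calc (b Z ^ (N+1)) ^ (4*(N+1)) = (b Z ^ (2*N+1+1)) ^ (2*N+2) := by rw [← pow_mul, ← pow_mul]; congr 1; ring
      _ ≤ (C' * a Z ^ (2*N+1)) ^ (2*N+2) := by gcongr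
      _ = C' ^ (2*N+2) * (a Z ^ (2*N+1+1)) ^ (2*N+1) := by
          rw [mul_pow, ← pow_mul, ← pow_mul]; congr 2; ring
      _ ≤ C' ^ (2*N+2) * (C * δ Z ^ (2*N+1)) ^ (2*N+1) := by gcongr
      _ = C' ^ (2*N+2) * C ^ (2*N+1) * (δ Z * δ Z ^ (N * (4*(N+1)))) := by
          rw [mul_pow, ← pow_mul, ← pow_succ', mul_assoc]; congr 3; ring
      _ ≤ C' ^ (2*N+2) * C ^ (2*N+1) * (B * δ Z ^ (N * (4*(N+1)))) := by gcongr
      _ = K * δ Z ^ (N * (4*(N+1))) := by rw [hK]; ring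
      _ ≤ (K+1) ^ (4*(N+1)) * δ Z ^ (N * (4*(N+1))) := by
          gcongr
          exact (by linarith : K ≤ K+1).trans (le_self_pow₀ (by linarith) (by omega))
      _ = _ := by rw [mul_pow, ← pow_mul (δ Z)]
  exact (pow_le_pow_iff_left₀ (by positivity) (by positivity) (by omega)).1 this

theorem MM_bdd (hu : Sm u) (i : ℕ) : ∃ B, 0 ≤ B ∧ ∀ Z ∈ Icc (0:ℝ) 1, MM u i Z ≤ B := by
  obtain ⟨B, hB, h⟩ := bddI (hu.cid i)
  refine ⟨B, hB, fun Z hZ => ?_⟩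
  obtain ⟨X, hX, e⟩ := MM_att hu i hZ.1
  rw [e]; exact h X ⟨by linarith [hX.1], by linarith [hX.2, hZ.2]⟩

theorem MM_succ (hu : Sm u) (hf : Flat u 0) (i : ℕ) : Qd (MM u i) (MM u (i+1)) := by
  intro N
  induction N generalizing i with
  | zero =>
    obtain ⟨B, hB, h⟩ := MM_bdd hu (i+1)
    exact ⟨B, hB, fun Z hZ => by simpa using h Z hZ⟩
  | succ N ih =>
    obtain ⟨C, hC, h⟩ := ih (i+1)
    refine ⟨8 ^ (N+1) * C, by positivity, fun Z hZ => ?_⟩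
    have l := landau hu hf i hZ.1
    have h0 := MM_nonneg hu i hZ.1
    have h1 := MM_nonneg hu (i+1) hZ.1
    have h2 := MM_nonneg hu (i+2) hZ.1
    have hh := h Z hZ
    rcases eq_or_lt_of_le h1 with e | hpos
    · rw [← e, zero_pow (by omega)]; positivity
    have : MM u (i+1) Z ^ N * MM u (i+1) Z ^ (N+1+1) ≤ MM u (i+1) Z ^ N * (8 ^ (N+1) * C * MM u i Z ^ (N+1)) := by
      calc MM u (i+1) Z ^ N * MM u (i+1) Z ^ (N+1+1) = (MM u (i+1) Z ^ 2) ^ (N+1) := by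
            rw [← pow_add, ← pow_mul]; congr 1; ring
        _ ≤ (8 * MM u i Z * MM u (i+2) Z) ^ (N+1) := by gcongr
        _ = (8 * MM u i Z) ^ (N+1) * MM u (i+1+1) Z ^ (N+1) := by rw [mul_pow]
        _ ≤ (8 * MM u i Z) ^ (N+1) * (C * MM u (i+1) Z ^ N) := by gcongr
        _ = _ := by rw [mul_pow]; ring
    exact le_of_mul_le_mul_left this (by positivity)

theorem MM_Qd (hu : Sm u) (hf : Flat u 0) (i : ℕ) : Qd (MM u 0) (MM u i) := by
  obtain ⟨B, hB, h⟩ := MM_bdd hu 0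
  induction i with
  | zero =>
    intro N
    refine ⟨B, hB, fun Z hZ => ?_⟩
    rw [pow_succ']
    exact mul_le_mul_of_nonneg_right (h Z hZ) (pow_nonneg (MM_nonneg hu 0 hZ.1) _)
  | succ i ih =>
    exact Qd.trans (fun Z hZ => ⟨MM_nonneg hu i hZ.1, MM_nonneg hu _ hZ.1, MM_nonneg hu 0 hZ.1, h Z hZ⟩) ih (MM_succ hu hf i)

noncomputable def eM (u : ℝ → ℝ) (I : ℕ) (Z : ℝ) : ℝ := ∑ i ∈ Finset.range (I+1), MM u i Z

theorem eM_Qd (hu : Sm u) (hf : Flat u 0) (I : ℕ) : Qd (MM u 0) (eM u I) := by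
  induction I with
  | zero => unfold eM; simpa using MM_Qd hu hf 0
  | succ I ih =>
    have := Qd.add (b := MM u (I+1)) (fun Z hZ => ⟨?_, MM_nonneg hu _ hZ.1⟩) ih (MM_Qd hu hf (I+1))
    · have e : eM u (I+1) = fun Z => eM u I Z + MM u (I+1) Z := by
        ext Z; unfold eM; rw [Finset.sum_range_succ _ (I+1)]
      rw [e]; exact this
    · exact Finset.sum_nonneg fun i _ => MM_nonneg hu i hZ.1

theorem MM_le_eM (hu : Sm u) {I i : ℕ} (hi : i ≤ I) {Z : ℝ} (hZ : 0 ≤ Z) : MM u i Z ≤ eM u I Z :=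
  Finset.single_le_sum (f := fun i => MM u i Z) (fun i _ => MM_nonneg hu i hZ) (Finset.mem_range.2 (by omega))

theorem MM_mono (hu : Sm u) (i : ℕ) {Z Z' : ℝ} (hZ : 0 ≤ Z) (h : Z ≤ Z') : MM u i Z ≤ MM u i Z' := by
  obtain ⟨X, hX, e⟩ := MM_att hu i hZ
  rw [e]; exact MM_le hu i ⟨hX.1, hX.2.trans h⟩

/-- sup norms tend to zero -/
theorem MM_small (hu : Sm u) (hf : Flat u 0) (i : ℕ) {ε : ℝ} (hε : 0 < ε) : ∃ z > 0, z ≤ 1 ∧ ∀ Z ∈ Ioc 0 z, MM u i Z ≤ ε := by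
  obtain ⟨B, hB, h⟩ := MM_bdd hu (i+1)
  refine ⟨min 1 (ε / (B+1)), by positivity, min_le_left _ _, fun Z hZ => ?_⟩
  have hZ1 : Z ≤ 1 := hZ.2.trans (min_le_left _ _)
  have hZ2 : Z ≤ ε / (B+1) := hZ.2.trans (min_le_right _ _)
  rw [le_div_iff₀ (by positivity)] at hZ2
  obtain ⟨X, hX, e⟩ := MM_att hu i hZ.1.le
  have := mvt_bd (hu.hasid i) (fun x hx => (MM_le hu (i+1) hx).trans (h Z ⟨hZ.1.le, hZ1⟩)) (left_mem_Icc.2 hZ.1.le) hX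
  rw [hf i, sub_zero, sub_zero, abs_of_nonneg hX.1] at this
  rw [e]
  nlinarith [hX.2, hZ.1]

theorem eM_small (hu : Sm u) (hf : Flat u 0) (I : ℕ) {ε : ℝ} (hε : 0 < ε) : ∃ z > 0, z ≤ 1 ∧ ∀ Z ∈ Ioc 0 z, eM u I Z ≤ ε := by
  induction I generalizing ε with
  | zero => unfold eM; simpa using MM_small hu hf 0 hε
  | succ I ih =>
    obtain ⟨z, h0, h1, h2⟩ := ih (half_pos hε)
    obtain ⟨z', h0', h1', h2'⟩ := MM_small hu hf (I+1) (half_pos hε)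
    refine ⟨min z z', lt_min h0 h0', (min_le_left _ _).trans h1, fun Z hZ => ?_⟩
    have a := h2 Z ⟨hZ.1, hZ.2.trans (min_le_left _ _)⟩
    have b := h2' Z ⟨hZ.1, hZ.2.trans (min_le_right _ _)⟩
    have e : eM u (I+1) Z = eM u I Z + MM u (I+1) Z := by unfold eM; rw [Finset.sum_range_succ _ (I+1)]
    rw [e]; linarith
end
end

section
open scoped ContDiff

section
variable {F G R : ℝ → ℝ}

theorem window (h : Sz F G R) (hf : Flat (fun x => F x - x) 0) (hZ : ∀ z > 0, ∃ Z, 0 < Z ∧ Z ≤ z ∧ F Z ≤ Z)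
    (hne : ∀ z > 0, ∃ x, 0 < x ∧ x < z ∧ F x ≠ x) (k : ℕ) {ε : ℝ} (hε : 0 < ε) :
    ∃ X w, 0 < w ∧ 0 < X - w ∧ X < ε ∧ (∀ x ∈ Ioo (X - w) X, F x ≠ x) ∧
      ∀ j ≤ k + 1, ∀ x ∈ Ioo (X - w) X, |iteratedDeriv j (xi F R) x| ≤ ε * w ^ (k + 1 - j) := by
  set u : ℝ → ℝ := fun x => F x - x with hu
  have su : Sm u := h.smu
  obtain ⟨z0, z0p, z01, hz0⟩ := eM_small su hf (k+1) one_pos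
  set P : ℝ → ℝ → Prop := fun x e => (∃ Z, 0 < Z ∧ Z ≤ z0 ∧ F Z ≤ Z ∧ e = eM u (k+1) Z ∧ x ∈ Ioo 0 Z) ∧ F x ≠ x with hPd
  have hPb : ∀ x e, P x e → ∀ i ≤ k + 1, |iteratedDeriv i u x| ≤ e := by
    rintro x e ⟨⟨Z, h0, h1, h2, rfl, h4⟩, h5⟩ i hi
    exact (MM_le su i (Ioo_subset_Icc_self h4)).trans (MM_le_eM su hi h0.le)
  have hP : Dom F P := by
    refine ⟨fun e => ?_, ?_, ?_, ?_⟩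
    · have e1 : {x | P x e} = (⋃ Z ∈ {Z | 0 < Z ∧ Z ≤ z0 ∧ F Z ≤ Z ∧ e = eM u (k+1) Z}, Ioo 0 Z) ∩ {x | F x ≠ x} := by
        ext x
        simp only [hPd, mem_ofPred_eq, mem_inter_iff, mem_iUnion, exists_prop, and_assoc]
      rw [e1]
      exact (isOpen_biUnion fun _ _ => isOpen_Ioo).inter (isOpen_ne_fun h.gd.sm.continuous continuous_id)
    · rintro x e ⟨⟨Z, h0, h1, h2, h3, h4⟩, h5⟩
      exact ⟨⟨by linarith [h4.1], by linarith [h4.2]⟩, h5⟩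
    · rintro x e ⟨⟨Z, h0, h1, h2, h3, h4⟩, h5⟩
      refine ⟨⟨Z, h0, h1, h2, h3, ?_, ?_⟩, fun e => h5 (h.gd.mono.injective e)⟩
      · rw [← h.gd.zero]; exact h.gd.mono h4.1
      · exact (h.gd.mono h4.2).trans_le h2
    · intro x e hx
      have hb := hPb x e hx 0 (by omega)
      obtain ⟨⟨Z, h0, h1, h2, h3, h4⟩, h5⟩ := hx
      refine ⟨lt_of_lt_of_le ?_ hb, h3 ▸ hz0 Z ⟨h0, h1⟩⟩
      rw [iteratedDeriv_zero]; exact abs_pos.2 (sub_ne_zero.2 h5)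
  have hPI : ∀ x e, P x e → x ∈ Icc (-1:ℝ) 2 := fun x e he => Ioo_subset_Icc_self (hP.sub x e he).1
  obtain ⟨Cx, hCx0, hCx⟩ := h.xi_le
  have hξ : Bc (xi F R) P 1 0 1 (xi F R) := by
    refine ⟨Cx, hCx0.le, fun x e he => ((hCx x (hPI x e he)).1).trans ?_⟩
    rw [pow_one]
    have := hPb x e he 0 (by omega)
    rw [iteratedDeriv_zero] at this
    exact mul_le_mul_of_nonneg_left this hCx0.le
  have hb1 : ∀ i ≤ k, ∃ C, 0 ≤ C ∧ ∀ x e, P x e →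
      e ^ i * |iteratedDeriv i (deriv u) x| ≤ C * e ^ (1 + 1 * i) := by
    intro i hi
    refine ⟨1, zero_le_one, fun x e he => ?_⟩
    have := hPb x e he (i+1) (by omega)
    rw [iteratedDeriv_succ'] at this
    have e0 := (hP.e01 x e he).1
    calc e ^ i * |iteratedDeriv i (deriv u) x| ≤ e ^ i * e := by gcongr
      _ = _ := by ring
  have hb2 : ∀ i ≤ k, ∃ C, 0 ≤ C ∧ ∀ x e, P x e →
      e ^ i * |iteratedDeriv i (deriv (fun y => (F y - y) * R y)) x| ≤ C * e ^ (1 + 1 * i) := by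
    intro i hi
    choose B hB0 hB using fun j => bddI (h.smR.cid j)
    refine ⟨∑ l ∈ Finset.range (i+1+1), (i+1).choose l * B (i+1-l), 
      Finset.sum_nonneg fun l _ => mul_nonneg (Nat.cast_nonneg _) (hB0 _), fun x e he => ?_⟩
    have e0 := (hP.e01 x e he).1
    have : |iteratedDeriv (i+1) (fun y => u y * R y) x| ≤ (∑ l ∈ Finset.range (i+1+1), (i+1).choose l * B (i+1-l)) * e := by
      rw [iteratedDeriv_fun_mul (su.contDiffAt.of_le (by exact_mod_cast le_top)) (h.smR.contDiffAt.of_le (by exact_mod_cast le_top))]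
      refine (Finset.abs_sum_le_sum_abs _ _).trans ?_
      rw [Finset.sum_mul]
      refine Finset.sum_le_sum fun l hl => ?_
      rw [abs_mul, abs_mul, Nat.abs_cast]
      have q1 := hPb x e he l (by have := Finset.mem_range.1 hl; omega)
      have q2 := hB (i+1-l) x (hPI x e he)
      calc _ ≤ ((i+1).choose l : ℝ) * e * B (i+1-l) := by gcongr
        _ = _ := by ring
    rw [iteratedDeriv_succ'] at this
    calc e ^ i * |iteratedDeriv i (deriv (fun y => (F y - y) * R y)) x| ≤ e ^ i * (_ * e) := by gcongr
      _ = _ := by ring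
  have hv : ∀ j ≤ k, Bc (xi F R) P 1 j 1 (v0 F R) := Bc.v0 h hP hξ hb1 hb2
  obtain ⟨c, c0, c1, c2⟩ := Bc.chain h hP (i := 0) (fun j' hj => hv j' hj.le) (hv k le_rfl)
  have hcd : ∀ l ≤ k, ∀ x e, P x e → iteratedDeriv (l+1) (xi F R) x = c l x := by
    intro l
    induction l with
    | zero =>
      intro _ x e he
      rw [zero_add, iteratedDeriv_one, (h.xi_deriv (hP.sub x e he).1 (hP.sub x e he).2).deriv, c0]; simp
    | succ l ih =>
      intro hl x e he
      rw [iteratedDeriv_succ]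
      have : iteratedDeriv (l+1) (xi F R) =ᶠ[𝓝 x] c l := by
        filter_upwards [(hP.opn e).mem_nhds he] with y hy
        exact ih (by omega) y e hy
      rw [this.deriv_eq, (c1 l (by omega) x e he).deriv]
  choose! Cl hCl0 hCl using c2
  obtain ⟨Cm, hCm0, hCm⟩ : ∃ Cm, 0 ≤ Cm ∧ ∀ l ≤ k, Cl l ≤ Cm := by
    refine ⟨∑ l ∈ Finset.range (k+1), Cl l, Finset.sum_nonneg fun l hl => hCl0 l (by have := Finset.mem_range.1 hl; omega), fun l hl => ?_⟩
    exact Finset.single_le_sum (f := Cl) (fun l hl => hCl0 l (by have := Finset.mem_range.1 hl; omega)) (Finset.mem_range.2 (by omega))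
  -- constants
  set A := (Cm + Cx) * (2 * Cx + 2) ^ (k+1) with hA
  have A0 : 0 < A := by positivity
  obtain ⟨Cq, hCq0, hCq⟩ := eM_Qd su hf (k+1) (2*k+1)
  obtain ⟨z1, z1p, -, hz1⟩ := MM_small su hf 0 (ε := ε^2 / (A^2 * Cq + 1)) (by positivity)
  obtain ⟨Z, Z0, Zz, FZ⟩ := hZ (min (min z0 z1) (ε/2)) (by positivity)
  have Zz0 : Z ≤ z0 := Zz.trans ((min_le_left _ _).trans (min_le_left _ _))
  have Zz1 : Z ≤ z1 := Zz.trans ((min_le_left _ _).trans (min_le_right _ _))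
  have Ze : Z ≤ ε/2 := Zz.trans (min_le_right _ _)
  obtain ⟨X, hX, eX⟩ := MM_att su 0 Z0.le
  set δ := MM u 0 Z with hδ
  set e := eM u (k+1) Z with he
  set M1 := MM u 1 Z with hM1
  have δ0 : 0 < δ := by
    obtain ⟨x, x0, xZ, hx⟩ := hne Z Z0
    refine lt_of_lt_of_le ?_ (MM_le su 0 (x := x) ⟨x0.le, xZ.le⟩)
    rw [iteratedDeriv_zero]; exact abs_pos.2 (sub_ne_zero.2 hx)
  rw [iteratedDeriv_zero] at eX
  have mv : ∀ {x y}, x ∈ Icc 0 Z → y ∈ Icc 0 Z → |u y - u x| ≤ M1 * |y - x| := fun hx hy => by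
    have := mvt_bd (su.hasid 0) (fun x hx => MM_le su 1 hx) hx hy
    simpa only [iteratedDeriv_zero] using this
  have δX : δ ≤ M1 * X := by
    have := mv (left_mem_Icc.2 Z0.le) hX
    rw [show u 0 = 0 by rw [hu]; simp [h.gd.zero], sub_zero, sub_zero, ← eX, abs_of_nonneg hX.1] at this
    exact this
  have M1n : 0 ≤ M1 := MM_nonneg su 1 Z0.le
  have M1p : 0 < M1 := lt_of_le_of_ne M1n fun e => by rw [← e] at δX; linarith
  have X0 : 0 < X := pos_of_mul_pos_right (δ0.trans_le δX) M1n
  have M1e : M1 ≤ e := MM_le_eM su (by omega) Z0.le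
  have e0 : 0 < e := M1p.trans_le M1e
  set w := δ / (2 * M1) with hw
  have w0 : 0 < w := by positivity
  have wM : w * (2 * M1) = δ := by rw [hw]; field_simp
  have wX : 2 * w ≤ X := by
    have : M1 * (2 * w) ≤ M1 * X := by nlinarith
    exact le_of_mul_le_mul_left this M1p
  have hwe : δ ≤ w * (2 * e) := by rw [← wM]; gcongr
  have hIn : ∀ x ∈ Ioo (X - w) X, x ∈ Ioo 0 Z := fun x hx => ⟨by linarith [hx.1], by linarith [hx.2, hX.2]⟩
  have hu2 : ∀ x ∈ Ioo (X - w) X, δ / 2 ≤ |u x| := by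
    intro x hx
    have h1 := mv (Ioo_subset_Icc_self (hIn x hx)) hX
    have h2 : |X - x| ≤ w := by rw [abs_le]; constructor <;> linarith [hx.1, hx.2]
    have h3 : M1 * |X - x| ≤ M1 * w := by gcongr
    have h4 := abs_sub_abs_le_abs_sub (u X) (u x)
    rw [← eX] at h4
    linarith
  have hune : ∀ x ∈ Ioo (X - w) X, F x ≠ x := fun x hx hxe => by
    have := hu2 x hx
    rw [hu] at this; simp only [hxe, sub_self, abs_zero] at this; linarith
  have hPx : ∀ x ∈ Ioo (X - w) X, P x e := fun x hx => ⟨⟨Z, Z0, Zz0, FZ, rfl, hIn x hx⟩, hune x hx⟩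
  -- main smallness
  have hδs : A ^ 2 * Cq * δ ≤ ε ^ 2 := by
    have := hz1 Z ⟨Z0, Zz1⟩
    rw [le_div_iff₀ (by positivity)] at this
    nlinarith
  have main : A * e ^ (k+1) ≤ ε * δ ^ k := by
    have := hCq Z ⟨Z0.le, Zz0.trans z01⟩
    refine (pow_le_pow_iff_left₀ (by positivity) (by positivity) two_ne_zero).1 ?_
    calc (A * e ^ (k+1)) ^ 2 = A ^ 2 * e ^ (2*k+1+1) := by rw [mul_pow, ← pow_mul]; congr 2; ring
      _ ≤ A ^ 2 * (Cq * δ ^ (2*k+1)) := by gcongr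
      _ = (A ^ 2 * Cq * δ) * δ ^ (2*k) := by ring
      _ ≤ ε ^ 2 * δ ^ (2*k) := by gcongr
      _ = _ := by rw [mul_pow, ← pow_mul]; congr 2; ring
  refine ⟨X, w, w0, by linarith, by linarith [hX.2], hune, ?_⟩
  intro j hj x hx
  have hxP := hPx x hx
  have hxI := hCx x (hPI x e hxP)
  cases j with
  | zero =>
    rw [iteratedDeriv_zero, Nat.sub_zero]
    have hux : |F x - x| ≤ δ := by
      have := MM_le su 0 (Ioo_subset_Icc_self (hIn x hx))
      rwa [iteratedDeriv_zero] at this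
    have h1 : |xi F R x| ≤ Cx * δ := hxI.1.trans (by gcongr)
    refine h1.trans ?_
    have h2 : (Cx * δ) * (2*e) ^ (k+1) ≤ (ε * w ^ (k+1)) * (2*e) ^ (k+1) := by
      calc (Cx * δ) * (2*e) ^ (k+1) = Cx * 2 ^ (k+1) * e ^ (k+1) * δ := by rw [mul_pow]; ring
        _ ≤ A * e ^ (k+1) * δ := by
            gcongr
            rw [hA]
            gcongr
            · linarith
            · linarith
        _ ≤ (ε * δ ^ k) * δ := by gcongr
        _ = ε * δ ^ (k+1) := by ring
        _ ≤ ε * (w * (2*e)) ^ (k+1) := by gcongr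
        _ = _ := by rw [mul_pow]; ring
    exact le_of_mul_le_mul_right h2 (by positivity)
  | succ l =>
    have hl : l ≤ k := by omega
    rw [hcd l hl x e hxP]
    have b1 := hCl l hl x e hxP
    rw [abs_mul, abs_pow, zero_add, one_mul] at b1
    have b2 : δ ≤ 2 * Cx * |xi F R x| := by
      have := (hu2 x hx).trans hxI.2; linarith
    have b3 : δ ^ l * |c l x| ≤ (2 * Cx) ^ l * Cm * e ^ (1 + l) := by
      calc δ ^ l * |c l x| ≤ (2 * Cx * |xi F R x|) ^ l * |c l x| := by gcongr
        _ = (2 * Cx) ^ l * (|xi F R x| ^ l * |c l x|) := by rw [mul_pow]; ring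
        _ ≤ (2 * Cx) ^ l * (Cm * e ^ (1+l)) := by
            refine mul_le_mul_of_nonneg_left (b1.trans ?_) (by positivity)
            exact mul_le_mul_of_nonneg_right (hCm l hl) (by positivity)
        _ = _ := by ring
    obtain ⟨m, rfl⟩ : ∃ m, k = l + m := ⟨k - l, by omega⟩
    rw [show l + m + 1 - (l + 1) = m by omega]
    have h2 : |c l x| * (δ ^ l * (2*e) ^ m) ≤ (ε * w ^ m) * (δ ^ l * (2*e) ^ m) := by
      calc |c l x| * (δ ^ l * (2*e) ^ m) = (δ ^ l * |c l x|) * (2*e) ^ m := by ring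
        _ ≤ ((2 * Cx) ^ l * Cm * e ^ (1 + l)) * (2*e) ^ m := by gcongr
        _ = (Cm * ((2 * Cx) ^ l * 2 ^ m * 1)) * e ^ (l + m + 1) := by rw [mul_pow]; ring
        _ ≤ A * e ^ (l + m + 1) := by
            gcongr
            rw [hA, show (2 * Cx + 2) ^ (l + m + 1) = (2 * Cx + 2) ^ l * (2 * Cx + 2) ^ m * (2 * Cx + 2) by ring]
            gcongr
            · linarith
            · linarith
            · linarith
            · linarith
        _ ≤ ε * δ ^ (l + m) := main
        _ = ε * δ ^ m * δ ^ l := by ring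
        _ ≤ ε * (w * (2*e)) ^ m * δ ^ l := by gcongr
        _ = _ := by rw [mul_pow]; ring
    exact le_of_mul_le_mul_right h2 (by positivity)
end
end

section
open scoped ContDiff

section
variable {F G R : ℝ → ℝ}

/-- reflection -/
def rf (F : ℝ → ℝ) (x : ℝ) : ℝ := 1 - F (1 - x)

theorem sm_rf (h : Sm F) : Sm (rf F) :=
  contDiff_const.sub (h.comp (contDiff_const.sub contDiff_id))

theorem rf_deriv (h : Sm F) (x : ℝ) : deriv (rf F) x = deriv F (1 - x) := by
  have h1 : HasDerivAt (fun y : ℝ => 1 - y) (-1) x := by simpa using (hasDerivAt_id x).const_sub 1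
  have h2 : HasDerivAt F (deriv F (1 - x)) (1 - x) := h.has _
  have := (h2.comp x h1).const_sub 1
  rw [show rf F = fun y => 1 - (F ∘ fun y => 1 - y) y from rfl, this.deriv]; ring

theorem gde_rf (h : GDE F G) : GDE (rf F) (rf G) := by
  refine ⟨⟨sm_rf h.sm, sm_rf h.smi, fun x => ?_, fun x => ?_, fun x => ?_, ?_, ?_⟩, ?_, ?_⟩
  · unfold rf; rw [sub_sub_cancel, h.left]; ring
  · unfold rf; rw [sub_sub_cancel, h.right]; ring
  · rw [rf_deriv h.sm]; exact h.pos _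
  · unfold rf; rw [sub_zero, h.one]; ring
  · unfold rf; rw [sub_self, h.zero]; ring
  · unfold rf; rw [show (1:ℝ) - -1 = 2 by norm_num, h.two]; norm_num
  · unfold rf; rw [show (1:ℝ) - 2 = -1 by norm_num, h.m1]; norm_num

theorem sz_rf (h : Sz F G R) : Sz (rf F) (rf G) (fun x => - R (1 - x)) := by
  refine ⟨gde_rf h.gd, (h.smR.comp (contDiff_const.sub contDiff_id)).neg, fun x => ?_⟩
  have := h.eq (1 - x)
  rw [rf_deriv h.gd.sm]
  unfold rf
  rw [sub_sub_cancel]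
  rw [show 1 - F (F (1 - x)) - (1 - F (1 - x)) = - (F (F (1-x)) - F (1-x)) by ring, this,
    show (1 - F (1 - x) - x) * -R (1 - x) = (F (1-x) - (1-x)) * R (1-x) by ring]
  ring

theorem rf_iter (F : ℝ → ℝ) (n : ℕ) (x : ℝ) : (rf F)^[n] x = 1 - F^[n] (1 - x) := by
  induction n with
  | zero => simp
  | succ n ih => 
    rw [Function.iterate_succ_apply', ih, Function.iterate_succ_apply']
    unfold rf; rw [sub_sub_cancel]

theorem xi_rf (F R : ℝ → ℝ) (x : ℝ) : xi (rf F) (fun x => - R (1 - x)) x = - xi F R (1 - x) := by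
  have : Lf (rf F) (fun x => - R (1 - x)) x = Lf F R (1 - x) := by
    unfold Lf So
    congr 1; ext n
    rw [rf_iter]
    simp only [rf, sub_sub_cancel]
    ring
  unfold xi
  rw [this]; unfold rf; ring

theorem window1 (h : Sz F G R) (hf : Flat (fun x => F x - x) 1) (hZ : ∀ z > 0, ∃ Z, Z < 1 ∧ 1 - z ≤ Z ∧ Z ≤ F Z)
    (hne : ∀ z > 0, ∃ x, x < 1 ∧ 1 - z < x ∧ F x ≠ x) (k : ℕ) {ε : ℝ} (hε : 0 < ε) :
    ∃ X w, 0 < w ∧ X + w < 1 ∧ 1 - ε < X ∧ (∀ x ∈ Ioo X (X + w), F x ≠ x) ∧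
      ∀ j ≤ k + 1, ∀ x ∈ Ioo X (X + w), |iteratedDeriv j (xi F R) x| ≤ ε * w ^ (k + 1 - j) := by
  have e1 : Flat (fun x => rf F x - x) 0 := by
    intro n
    have : (fun x => rf F x - x) = fun x => - ((fun y => F y - y) (1 - x)) := by
      ext x; simp only [rf]; ring
    rw [this, iteratedDeriv_fun_neg, iteratedDeriv_comp_const_sub (f := fun y => F y - y)]
    simp only [sub_zero]
    rw [hf n]; simp
  have e2 : ∀ z > 0, ∃ Z, 0 < Z ∧ Z ≤ z ∧ rf F Z ≤ Z := by
    intro z hz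
    obtain ⟨Z, a, b, c⟩ := hZ z hz
    refine ⟨1 - Z, by linarith, by linarith, ?_⟩
    unfold rf; rw [sub_sub_cancel]; linarith
  have e3 : ∀ z > 0, ∃ x, 0 < x ∧ x < z ∧ rf F x ≠ x := by
    intro z hz
    obtain ⟨x, a, b, c⟩ := hne z hz
    refine ⟨1 - x, by linarith, by linarith, fun e => c ?_⟩
    unfold rf at e; rw [sub_sub_cancel] at e; linarith
  obtain ⟨X, w, h1, h2, h3, h4, h5⟩ := window (sz_rf h) e1 e2 e3 k hε
  refine ⟨1 - X, w, h1, by linarith, by linarith, fun x hx e => ?_, fun j hj x hx => ?_⟩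
  · refine h4 (1 - x) ⟨by linarith [hx.2], by linarith [hx.1]⟩ ?_
    unfold rf; rw [sub_sub_cancel, e]
  · have := h5 j hj (1 - x) ⟨by linarith [hx.2], by linarith [hx.1]⟩
    refine le_trans (le_of_eq ?_) this
    rw [show xi (rf F) (fun x => - R (1 - x)) = fun x => - xi F R (1 - x) from funext fun x => xi_rf F R x,
      iteratedDeriv_fun_neg, iteratedDeriv_comp_const_sub]
    simp [abs_mul]
end

section
variable {f f' g g' V F G R : ℝ → ℝ} {D : Set ℝ} {τ : ℝ}

structure Src (f V F G R : ℝ → ℝ) : Prop where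
  sz : Sz F G R
  fx : ∀ x, F x = x ↔ f x = x
  rel : ∃ σ : ℝ, |σ| = 1 ∧ ∀ a b, 0 ≤ a → b ≤ 1 → Cpt f a b → ∀ x ∈ Ioo a b, ∀ y ∈ Ioo a b,
    V x = σ * tt (xi F R) y (F y) * xi F R x

theorem VF.src (hV : VF D f f' g g' τ V) (h : CP D f f' g g') (hR : Sz f f' R) : Src f V f f' R := by
  refine ⟨hR, fun x => Iff.rfl, 1, abs_one, fun a b ha hb hc x hx y hy => ?_⟩
  have hff := h.ff hR ha hb hc
  rw [hV.eq a b _ ha hb hc hff x hx, hff.fd.const hff.iff hx hy, one_mul]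

theorem VF.src' (hV : VF D f f' g g' τ V) (h : CP D f f' g g') (hR : Sz f' f R) : Src f V f' f R := by
  refine ⟨hR, fun x => ⟨fun e => ?_, fun e => ?_⟩, -1, by simp, fun a b ha hb hc x hx y hy => ?_⟩
  · have := h.gf.right x; rwa [e] at this
  · have := h.gf.left x; rwa [e] at this
  have hff := h.ff' hR ha hb hc
  have hy' : f' y ∈ Ioo a b := hff.iff.symm.mem hy
  rw [hV.eq a b _ ha hb hc hff x hx, hff.fd.const hff.iff hx hy', h.gf.right]
  have : tt (fun x => - xi f' R x) (f' y) y = tt (xi f' R) y (f' y) := by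
    rw [tt_symm (xi f' R) (f' y) y]
    have := tt_smul (-1) (xi f' R) (f' y) y
    simp only [neg_mul, one_mul, inv_neg, inv_one] at this
    exact this
  rw [this]; ring

theorem Src.bound (h : Src f V F G R) {p : ℝ} (hp : p ∈ Icc (0:ℝ) 1) (hf : Flat (fun x => F x - x) p) :
    ∃ C z, 0 < z ∧ 0 < C ∧ ∀ l r, 0 < l → r < 1 → (∀ x ∈ Ioo l r, |x - p| ≤ z ∧ F x ≠ x) →
      ∃ c : ℝ, |c| ≤ C ∧ ∀ x ∈ Ioo l r, V x = c * xi F R x := by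
  set u : ℝ → ℝ := fun x => F x - x with hu
  have su : Sm u := h.sz.smu
  obtain ⟨Cx, hCx0, hCx⟩ := h.sz.xi_le
  have d0 : deriv u p = 0 := by have := hf 1; rwa [iteratedDeriv_one] at this
  have hev : ∀ᶠ x in 𝓝 p, |deriv u x| < 1/2 := by
    have : ContinuousAt (fun x => |deriv u x|) p := (su.deriv.continuous.abs).continuousAt
    refine this.eventually (gt_mem_nhds ?_)
    show |deriv u p| < 1/2
    rw [d0]; norm_num
  obtain ⟨r0, hr0, hb⟩ := Metric.eventually_nhds_iff.1 hev
  set z := r0 / 3 with hz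
  have mv : ∀ x y, |x - p| ≤ 2 * z → |y - p| ≤ 2 * z → |u y - u x| ≤ 1/2 * |y - x| := by
    intro x y hx hy
    refine (convex_Icc (p - 2*z) (p + 2*z)).norm_image_sub_le_of_norm_hasDerivWithin_le 
      (fun x _ => (su.has x).hasDerivWithinAt) (fun x hx => (hb ?_).le) ?_ ?_
    · rw [Real.dist_eq]
      have : |x - p| ≤ 2 * z := by rw [abs_le]; constructor <;> linarith [hx.1, hx.2]
      linarith
    · rw [abs_le] at hx; constructor <;> linarith [hx.1, hx.2]
    · rw [abs_le] at hy; constructor <;> linarith [hy.1, hy.2]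
  have u0 : u p = 0 := by have := hf 0; rwa [iteratedDeriv_zero] at this
  obtain ⟨σ, hσ, hrel⟩ := h.rel
  refine ⟨2 * Cx, z, by positivity, by positivity, fun l r hl hr hlr => ?_⟩
  rcases le_or_gt r l with hle | hlt
  · exact ⟨0, by simp; positivity, fun x hx => absurd (hx.1.trans hx.2) (not_lt.2 hle)⟩
  set y := (l + r) / 2 with hy
  have hyI : y ∈ Ioo l r := ⟨by linarith, by linarith⟩
  obtain ⟨yz, yne⟩ := hlr y hyI
  have hc' := Cpt.exists h.sz.gd.sm.continuous h.sz.gd.zero h.sz.gd.one (x := y) ⟨by linarith, by linarith⟩ yne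
  obtain ⟨a, b, ha, hb', hyab, hc⟩ := hc'
  have hcf : Cpt f a b := ⟨hc.lt, (h.fx a).1 hc.fa, (h.fx b).1 hc.fb, fun x hx e => hc.ne x hx ((h.fx x).2 e)⟩
  have al : a ≤ l := by
    by_contra hh
    exact (hlr a ⟨not_le.1 hh, hyab.1.trans hyI.2⟩).2 hc.fa
  have rb : r ≤ b := by
    by_contra hh
    exact (hlr b ⟨hyI.1.trans hyab.2, not_le.1 hh⟩).2 hc.fb
  refine ⟨σ * tt (xi F R) y (F y), ?_, fun x hx => hrel a b ha hb' hcf x ⟨al.trans_lt hx.1, hx.2.trans_le rb⟩ y hyab⟩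
  rw [abs_mul, hσ, one_mul]
  have uy : |u y| ≤ 1/2 * |y - p| := by
    have := mv p y (by simp; positivity) (by linarith)
    rwa [u0, sub_zero] at this
  have une : 0 < |u y| := abs_pos.2 (sub_ne_zero.2 yne)
  have key : ∀ t ∈ uIoc y (F y), ‖(xi F R t)⁻¹‖ ≤ 2 * Cx / |u y| := by
    intro t ht
    have h1 : |t - y| ≤ |u y| := abs_sub_left_of_mem_uIcc (uIoc_subset_uIcc ht)
    have h2 : |t - p| ≤ 2 * z := by
      have : t - p = (t - y) + (y - p) := by ring
      rw [this]; refine (abs_add_le _ _).trans ?_; linarith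
    have h3 := mv y t (by linarith) h2
    have h4 : |u y| / 2 ≤ |u t| := by
      have := abs_sub_abs_le_abs_sub (u y) (u t)
      rw [abs_sub_comm (u y) (u t)] at this
      linarith
    have htI : t ∈ Icc (-1:ℝ) 2 := by
      have : t ∈ Ioo a b := uIcc_sub_Ioo hyab (mem_of_cpt h.sz.gd.toGDiff hc hyab) (uIoc_subset_uIcc ht)
      exact ⟨by linarith [this.1], by linarith [this.2]⟩
    have h5 := (hCx t htI).2
    have h6 : 0 < |xi F R t| := by
      have : 0 < Cx * |xi F R t| := lt_of_lt_of_le (by positivity) (h4.trans h5)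
      exact pos_of_mul_pos_right this hCx0.le
    rw [norm_inv, Real.norm_eq_abs, inv_le_comm₀ h6 (by positivity), inv_div, div_le_iff₀ (by positivity)]
    have h7 : |u t| ≤ Cx * |xi F R t| := h5
    nlinarith
  have := intervalIntegral.norm_integral_le_of_norm_le_const key
  rw [Real.norm_eq_abs] at this
  refine this.trans (le_of_eq ?_)
  show 2 * Cx / |u y| * |u y| = _
  field_simp

theorem CP.nontriv (h : CP D f f' g g') {a b : ℝ} (ha : 0 ≤ a) (hb : b ≤ 1) (hab : a < b) : ∃ x ∈ Ioo a b, f x ≠ x := by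
  by_contra! hh
  have hm : (a + b) / 2 ∈ Ioo a b := ⟨by linarith, by linarith⟩
  have hm01 : (a + b) / 2 ∈ Ioo (0:ℝ) 1 := ⟨by linarith, by linarith⟩
  refine h.not_D hm01 ((h.flf _ (Ioo_subset_Icc_self hm01)).1 fun n => ?_)
  have : (fun x => f x - x) =ᶠ[𝓝 ((a+b)/2)] fun _ => 0 := by
    filter_upwards [isOpen_Ioo.mem_nhds hm] with x hx
    rw [hh x hx, sub_self]
  rw [this.iteratedDeriv_eq]; simp [iteratedDeriv_const]

theorem CP.flat' (h : CP D f f' g g') {p : ℝ} (hp : p ∈ Icc (0:ℝ) 1) (hpD : p ∈ D) : Flat (fun x => f' x - x) p := by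
  obtain ⟨C, hC⟩ := h.gf.symm.toGDiff.cmp_inv
  exact flat_of_bound (h.gf.smi.sub contDiff_id) (h.gf.sm.sub contDiff_id) hp hC ((h.flf p hp).2 hpD)

theorem id_scale {c : ℝ} {W : ℝ → ℝ} {S : Set ℝ} (hS : IsOpen S) (e : ∀ x ∈ S, V x = c * W x) (j : ℕ) {x : ℝ} (hx : x ∈ S) :
    iteratedDeriv j V x = c * iteratedDeriv j W x := by
  have : V =ᶠ[𝓝 x] fun y => c * W y := by
    filter_upwards [hS.mem_nhds hx] with y hy using e y hy
  rw [this.iteratedDeriv_eq, iteratedDeriv_const_mul_field]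

theorem VF.win0 (hV : VF D f f' g g' τ V) (h : CP D f f' g g') (h0 : (0:ℝ) ∈ D) (k : ℕ) {ε : ℝ} (hε : 0 < ε) :
    ∃ l w, 0 < w ∧ 0 < l ∧ l + w < ε ∧ l + w < 1 ∧
      ∀ j ≤ k + 1, ∀ x ∈ Ioo l (l + w), |iteratedDeriv j V x| ≤ ε * w ^ (k + 1 - j) := by
  have main : ∀ F G R, Src f V F G R → Flat (fun x => F x - x) 0 → (∀ z > 0, ∃ Z, 0 < Z ∧ Z ≤ z ∧ F Z ≤ Z) → 
      ∃ l w, 0 < w ∧ 0 < l ∧ l + w < ε ∧ l + w < 1 ∧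
      ∀ j ≤ k + 1, ∀ x ∈ Ioo l (l + w), |iteratedDeriv j V x| ≤ ε * w ^ (k + 1 - j) := by
    intro F G R hS hf hZ
    obtain ⟨C, z, z0, C0, hb⟩ := hS.bound (p := 0) (by simp) hf
    obtain ⟨X, w, h1, h2, h3, h4, h5⟩ := window hS.sz hf hZ (fun z hz => by
      obtain ⟨x, hx, hn⟩ := h.nontriv le_rfl (b := min z 1) (min_le_right _ _) (by positivity)
      exact ⟨x, hx.1, hx.2.trans_le (min_le_left _ _), fun e => hn ((hS.fx x).1 e)⟩) k
      (ε := min (min ε (ε / C)) (min z 1)) (by positivity)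
    have q1 := h3.trans_le ((min_le_left _ _).trans (min_le_left ε (ε / C)))
    have q2 : min (min ε (ε / C)) (min z 1) ≤ ε / C := (min_le_left _ _).trans (min_le_right ε (ε / C))
    have q3 := h3.trans_le ((min_le_right _ _).trans (min_le_left z 1))
    have q4 := h3.trans_le ((min_le_right _ _).trans (min_le_right z 1))
    obtain ⟨c, hc, hcV⟩ := hb (X - w) X h2 q4 (fun x hx => ⟨by
      rw [sub_zero, abs_of_pos (h2.trans hx.1)]; linarith [hx.2], h4 x hx⟩)
    refine ⟨X - w, w, h1, h2, by linarith, by linarith, fun j hj x hx => ?_⟩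
    rw [sub_add_cancel] at hx
    rw [id_scale isOpen_Ioo hcV j hx, abs_mul]
    calc |c| * |iteratedDeriv j (xi F R) x| ≤ C * (ε / C * w ^ (k+1-j)) := by
          refine mul_le_mul hc ((h5 j hj x hx).trans ?_) (abs_nonneg _) C0.le
          exact mul_le_mul_of_nonneg_right q2 (by positivity)
      _ = _ := by field_simp
  by_cases hz : ∀ z > 0, ∃ Z, 0 < Z ∧ Z ≤ z ∧ f Z ≤ Z
  · obtain ⟨R, hR⟩ := Sz.exists h.gf
    exact main f f' R (hV.src h hR) ((h.flf 0 (by simp)).2 h0) hz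
  · push Not at hz
    obtain ⟨z, z0, hz⟩ := hz
    obtain ⟨R, hR⟩ := Sz.exists h.gf.symm
    refine main f' f R (hV.src' h hR) (h.flat' (by simp) h0) fun z' hz' => ?_
    have hm : 0 < min z z' := lt_min z0 hz'
    refine ⟨min z z', hm, min_le_right _ _, ?_⟩
    have := h.gf.symm.mono (hz (min z z') hm (min_le_left _ _))
    rw [h.gf.left] at this
    exact this.le

theorem VF.win1 (hV : VF D f f' g g' τ V) (h : CP D f f' g g') (h0 : (1:ℝ) ∈ D) (k : ℕ) {ε : ℝ} (hε : 0 < ε) :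
    ∃ l w, 0 < w ∧ 0 < l ∧ 1 - ε < l ∧ l + w < 1 ∧
      ∀ j ≤ k + 1, ∀ x ∈ Ioo l (l + w), |iteratedDeriv j V x| ≤ ε * w ^ (k + 1 - j) := by
  have main : ∀ F G R, Src f V F G R → Flat (fun x => F x - x) 1 → (∀ z > 0, ∃ Z, Z < 1 ∧ 1 - z ≤ Z ∧ Z ≤ F Z) → 
      ∃ l w, 0 < w ∧ 0 < l ∧ 1 - ε < l ∧ l + w < 1 ∧
      ∀ j ≤ k + 1, ∀ x ∈ Ioo l (l + w), |iteratedDeriv j V x| ≤ ε * w ^ (k + 1 - j) := by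
    intro F G R hS hf hZ
    obtain ⟨C, z, z0, C0, hb⟩ := hS.bound (p := 1) (by simp) hf
    obtain ⟨X, w, h1, h2, h3, h4, h5⟩ := window1 hS.sz hf hZ (fun z hz => by
      obtain ⟨x, hx, hn⟩ := h.nontriv (a := 1 - min z 1) (by linarith [min_le_right z 1]) le_rfl (by linarith [lt_min hz one_pos])
      exact ⟨x, hx.2, by linarith [hx.1, min_le_left z 1], fun e => hn ((hS.fx x).1 e)⟩) k
      (ε := min (min ε (ε / C)) (min z 1)) (by positivity)
    have q1 := ((min_le_left (min ε (ε / C)) (min z 1)).trans (min_le_left ε (ε / C)))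
    have q2 : min (min ε (ε / C)) (min z 1) ≤ ε / C := (min_le_left _ _).trans (min_le_right ε (ε / C))
    have q3 := ((min_le_right (min ε (ε / C)) (min z 1)).trans (min_le_left z 1))
    have q4 := ((min_le_right (min ε (ε / C)) (min z 1)).trans (min_le_right z 1))
    obtain ⟨c, hc, hcV⟩ := hb X (X + w) (by linarith) h2 (fun x hx => ⟨by
      rw [abs_of_neg (by linarith [hx.2])]; linarith [hx.1], h4 x hx⟩)
    refine ⟨X, w, h1, by linarith, by linarith, by linarith, fun j hj x hx => ?_⟩
    rw [id_scale isOpen_Ioo hcV j hx, abs_mul]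
    calc |c| * |iteratedDeriv j (xi F R) x| ≤ C * (ε / C * w ^ (k+1-j)) := by
          refine mul_le_mul hc ((h5 j hj x hx).trans ?_) (abs_nonneg _) C0.le
          exact mul_le_mul_of_nonneg_right q2 (by positivity)
      _ = _ := by field_simp
  by_cases hz : ∀ z > 0, ∃ Z, Z < 1 ∧ 1 - z ≤ Z ∧ Z ≤ f Z
  · obtain ⟨R, hR⟩ := Sz.exists h.gf
    exact main f f' R (hV.src h hR) ((h.flf 1 (by simp)).2 h0) hz
  · push Not at hz
    obtain ⟨z, z0, hz⟩ := hz
    obtain ⟨R, hR⟩ := Sz.exists h.gf.symm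
    refine main f' f R (hV.src' h hR) (h.flat' (by simp) h0) fun z' hz' => ?_
    have hm : 0 < min z z' := lt_min z0 hz'
    refine ⟨1 - min z z', by linarith, by linarith [min_le_right z z'], ?_⟩
    have := h.gf.symm.mono (hz (1 - min z z') (by linarith) (by linarith [min_le_left z z']))
    rw [h.gf.left] at this
    exact this.le
end
end

section
open scoped ContDiff

theorem op_cont {F : OnePoint ℕ → ℝ → ℝ} (hc : ∀ p, Continuous (F p))
    (h : ∀ (n : ℕ) x, |F (n : OnePoint ℕ) x - F OnePoint.infty x| ≤ 1 / ((n:ℝ) + 1)) :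
    Continuous (fun z : OnePoint ℕ × ℝ => F z.1 z.2) := by
  rw [continuous_iff_continuousAt]
  rintro ⟨p, x⟩
  induction p using OnePoint.rec with
  | coe n =>
    have hop : IsOpen ({(n : OnePoint ℕ)} : Set (OnePoint ℕ)) := by
      have := OnePoint.isOpenEmbedding_coe (X := ℕ) |>.isOpenMap {n} (isOpen_discrete _)
      simpa using this
    have : ContinuousAt (fun z : OnePoint ℕ × ℝ => F (n : OnePoint ℕ) z.2) ((n : OnePoint ℕ), x) :=
      ((hc n).comp continuous_snd).continuousAt
    refine this.congr ?_
    filter_upwards [(hop.preimage continuous_fst).mem_nhds (show ((n : OnePoint ℕ), x) ∈ _ by simp)] with z hz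
    have : z.1 = (n : OnePoint ℕ) := by simpa using hz
    rw [this]
  | infty =>
    rw [Metric.continuousAt_iff']
    intro ε hε
    have h1 : ∀ᶠ p : OnePoint ℕ in 𝓝 OnePoint.infty, ∀ x, |F p x - F OnePoint.infty x| < ε / 2 := by
      rw [OnePoint.nhds_infty_eq]
      refine eventually_sup.2 ⟨?_, ?_⟩
      · rw [eventually_map, coclosedCompact_eq_cocompact, cocompact_eq_cofinite, Nat.cofinite_eq_atTop]
        obtain ⟨N, hN⟩ := exists_nat_one_div_lt (half_pos hε)
        filter_upwards [eventually_ge_atTop N] with n hn x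
        refine (h n x).trans_lt (lt_of_le_of_lt ?_ hN)
        have : (N:ℝ) ≤ n := by exact_mod_cast hn
        gcongr
      · simp only [eventually_pure]; intro x; simpa using by positivity
    have h2 : ∀ᶠ z : ℝ in 𝓝 x, dist (F OnePoint.infty z) (F OnePoint.infty x) < ε / 2 :=
      Metric.continuousAt_iff'.1 (hc _).continuousAt _ (by positivity)
    rw [nhds_prod_eq]
    filter_upwards [h1.prod_mk h2] with z hz
    have a := hz.1 z.2
    have b := hz.2
    rw [Real.dist_eq] at b ⊢
    have : F z.1 z.2 - F OnePoint.infty x = (F z.1 z.2 - F OnePoint.infty z.2) + (F OnePoint.infty z.2 - F OnePoint.infty x) := by ring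
    rw [this]
    refine (abs_add_le _ _).trans_lt (by linarith)

theorem op_ck (k : ℕ) : ∀ {F : OnePoint ℕ → ℝ → ℝ}, (∀ p, Sm (F p)) →
    (∀ i ≤ k, ∀ (n : ℕ) x, |iteratedDeriv i (F (n : OnePoint ℕ)) x - iteratedDeriv i (F OnePoint.infty) x| ≤ 1 / ((n:ℝ) + 1)) →
    CK k F := by
  induction k with
  | zero =>
    intro F hF h
    exact op_cont (fun p => (hF p).continuous) fun n x => by simpa using h 0 le_rfl n x
  | succ k ih =>
    intro F hF h
    refine ⟨op_cont (fun p => (hF p).continuous) fun n x => by simpa using h 0 (by omega) n x,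
      fun p => deriv (F p), fun p x => (hF p).has x, ih (fun p => (hF p).deriv) fun i hi n x => ?_⟩
    have := h (i+1) (by omega) n x
    rwa [iteratedDeriv_succ', iteratedDeriv_succ'] at this

theorem flow_close {ξ : ℝ → ℝ} {φ : ℝ → ℝ → ℝ} (hξ : Sm ξ) (hs : Sup12 ξ) (hφ : Fl ξ φ) (k : ℕ) (T : ℝ) {ε : ℝ} (hε : 0 < ε) :
    ∃ ε' > 0, ∀ η ψ, Sm η → Sup12 η → Fl η ψ →
      (∀ i ≤ k + 1, ∀ x, |iteratedDeriv i η x - iteratedDeriv i ξ x| ≤ ε') →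
      ∀ i ≤ k, ∀ t ∈ Icc (-T) T, ∀ x ∈ Icc (0:ℝ) 1, |iteratedDeriv i (ψ t) x - iteratedDeriv i (φ t) x| < ε := by
  by_contra hcon
  push Not at hcon
  have hc' := fun n : ℕ => hcon (1 / ((n:ℝ) + 1)) (by positivity)
  choose η ψ h1 h2 h3 h4 i hi t ht x hx hbad using hc'
  let Ξ : OnePoint ℕ → ℝ → ℝ := fun p => OnePoint.elim p ξ η
  let Φ : OnePoint ℕ → ℝ → ℝ → ℝ := fun p => OnePoint.elim p φ ψ
  have hck : CK (k+1) Ξ := by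
    refine op_ck (k+1) (fun p => ?_) (fun i hi n x => h4 n i hi x)
    induction p using OnePoint.rec with
    | coe n => exact h1 n
    | infty => exact hξ
  have hC := flow_CK hck (φ := Φ) (fun p => by
    induction p using OnePoint.rec with
    | coe n => exact h2 n
    | infty => exact hs) (fun p => by
    induction p using OnePoint.rec with
    | coe n => exact h3 n
    | infty => exact hφ)
  have hev : ∀ᶠ p : OnePoint ℕ in 𝓝 OnePoint.infty, ∀ z ∈ Icc (-T) T ×ˢ Icc (0:ℝ) 1, ∀ i ∈ Finset.range (k+1),
      |iteratedDeriv i (Φ p z.1) z.2 - iteratedDeriv i (Φ OnePoint.infty z.1) z.2| < ε := by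
    refine (isCompact_Icc.prod isCompact_Icc).eventually_forall_of_forall_eventually fun z hz => ?_
    rw [Finset.eventually_all]
    intro i hi
    have hi' : i ≤ k + 1 := by have := Finset.mem_range.1 hi; omega
    have c1 := hC.cont_iteratedDeriv hi'
    have c2 : Continuous (fun w : OnePoint ℕ × (ℝ × ℝ) =>
        iteratedDeriv i (Φ w.1 w.2.1) w.2.2 - iteratedDeriv i (Φ OnePoint.infty w.2.1) w.2.2) :=
      (c1.comp (show Continuous (fun w : OnePoint ℕ × (ℝ × ℝ) => (((w.1, w.2.1), w.2.2) : (OnePoint ℕ × ℝ) × ℝ)) by fun_prop)).sub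
      (c1.comp (show Continuous (fun w : OnePoint ℕ × (ℝ × ℝ) => (((OnePoint.infty, w.2.1), w.2.2) : (OnePoint ℕ × ℝ) × ℝ)) by fun_prop))
    have := (c2.abs).continuousAt (x := ((OnePoint.infty : OnePoint ℕ), z))
    refine this.eventually_lt continuousAt_const ?_
    simpa using hε
  rw [OnePoint.nhds_infty_eq] at hev
  have hev := (eventually_sup.1 hev).1
  rw [eventually_map, coclosedCompact_eq_cocompact, cocompact_eq_cofinite, Nat.cofinite_eq_atTop] at hev
  obtain ⟨n, hn⟩ := hev.exists
  have := hn (t n, x n) ⟨ht n, hx n⟩ (i n) (Finset.mem_range.2 (by have := hi n; omega))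
  exact absurd (hbad n) (not_le.2 this)
end

section
open scoped ContDiff

noncomputable def stp (x : ℝ) : ℝ := Real.smoothTransition x

theorem stp_sm : Sm stp := Real.smoothTransition.contDiff
theorem stp_zero {x : ℝ} (h : x ≤ 0) : stp x = 0 := Real.smoothTransition.zero_of_nonpos h
theorem stp_one {x : ℝ} (h : 1 ≤ x) : stp x = 1 := Real.smoothTransition.one_of_one_le h
theorem stp_nonneg (x : ℝ) : 0 ≤ stp x := Real.smoothTransition.nonneg x
theorem stp_le (x : ℝ) : stp x ≤ 1 := Real.smoothTransition.le_one x

noncomputable def chi0 (y : ℝ) : ℝ := stp (8 * y - 1) * (1 - stp (8 * y - 6))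

theorem chi0_sm : Sm chi0 := by
  have h1 : Sm (fun y : ℝ => stp (8 * y - 1)) := stp_sm.comp (by fun_prop)
  have h2 : Sm (fun y : ℝ => stp (8 * y - 6)) := stp_sm.comp (by fun_prop)
  exact h1.mul (contDiff_const.sub h2)

theorem chi0_bd (k : ℕ) : ∃ M, 1 ≤ M ∧ ∀ j ≤ k, ∀ y ∈ Icc (0:ℝ) 1, |iteratedDeriv j chi0 y| ≤ M := by
  have h : ∀ j, ∃ M, ∀ y ∈ Icc (0:ℝ) 1, ‖iteratedDeriv j chi0 y‖ ≤ M := fun j =>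
    isCompact_Icc.exists_bound_of_continuousOn (chi0_sm.cid j).continuousOn
  choose M hM using h
  refine ⟨1 + ∑ j ∈ Finset.range (k+1), |M j|, ?_, fun j hj y hy => ?_⟩
  · have : 0 ≤ ∑ j ∈ Finset.range (k+1), |M j| := Finset.sum_nonneg fun _ _ => abs_nonneg _
    linarith
  · have h1 := hM j y hy
    have h2 : |M j| ≤ ∑ j ∈ Finset.range (k+1), |M j| :=
      Finset.single_le_sum (f := fun j => |M j|) (fun _ _ => abs_nonneg _) (Finset.mem_range.2 (by omega))
    rw [Real.norm_eq_abs] at h1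
    linarith [le_abs_self (M j)]

theorem chi0_le (y : ℝ) : |chi0 y| ≤ 1 := by
  unfold chi0
  rw [abs_mul]
  have h1 : |stp (8 * y - 1)| ≤ 1 := abs_le.2 ⟨by linarith [stp_nonneg (8*y-1)], stp_le _⟩
  have h2 : |1 - stp (8 * y - 6)| ≤ 1 := abs_le.2 ⟨by linarith [stp_le (8*y-6)], by linarith [stp_nonneg (8*y-6)]⟩
  exact mul_le_one₀ h1 (abs_nonneg _) h2

theorem chi0_zero {y : ℝ} (h : y ≤ 1/8 ∨ 7/8 ≤ y) : chi0 y = 0 := by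
  unfold chi0
  rcases h with h | h
  · rw [stp_zero (by linarith), zero_mul]
  · rw [stp_one (x := 8 * y - 6) (by linarith), sub_self, mul_zero]

noncomputable def chi (l w x : ℝ) : ℝ := chi0 (w⁻¹ * (x - l))

theorem chi_iter (l w : ℝ) (j : ℕ) (x : ℝ) : iteratedDeriv j (chi l w) x = (w⁻¹) ^ j * iteratedDeriv j chi0 (w⁻¹ * (x - l)) := by
  have : chi l w = fun x => (fun y => chi0 (w⁻¹ * y)) (x - l) := rfl
  rw [this, iteratedDeriv_comp_sub_const (f := fun y => chi0 (w⁻¹ * y)), iteratedDeriv_comp_const_mul (chi0_sm.of_le (by exact_mod_cast le_top))]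

theorem chi_sm (l w : ℝ) : Sm (chi l w) := chi0_sm.comp (by fun_prop)

theorem win_eq {l w x c : ℝ} (hw : 0 < w) : w⁻¹ * (x - l) ≤ c ↔ x ≤ l + c * w := by
  rw [inv_mul_le_iff₀ hw]; constructor <;> intro h <;> linarith

theorem win_eq' {l w x c : ℝ} (hw : 0 < w) : c ≤ w⁻¹ * (x - l) ↔ l + c * w ≤ x := by
  rw [le_inv_mul_iff₀ hw]; constructor <;> intro h <;> linarith

section
variable {V : ℝ → ℝ} {l w : ℝ}

theorem chi_out (hw : 0 < w) {x : ℝ} (hx : x ∉ Ioo l (l+w)) : (fun y => chi l w y * V y) =ᶠ[𝓝 x] fun _ => 0 := by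
  have : x < l + 1/8 * w ∨ l + 7/8 * w < x := by
    by_contra hc
    push Not at hc
    exact hx ⟨by linarith, by linarith⟩
  rcases this with h | h
  · filter_upwards [Iio_mem_nhds h] with y hy
    rw [chi, chi0_zero (Or.inl ((win_eq hw).2 (le_of_lt hy))), zero_mul]
  · filter_upwards [Ioi_mem_nhds h] with y hy
    rw [chi, chi0_zero (Or.inr ((win_eq' hw).2 (le_of_lt hy))), zero_mul]

theorem chi_cut_sm (hw : 0 < w) (hV : ∀ x ∈ Ioo l (l+w), ContDiffAt ℝ ∞ V x) : Sm (fun y => chi l w y * V y) := by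
  refine contDiff_iff_contDiffAt.2 fun x => ?_
  by_cases hx : x ∈ Ioo l (l+w)
  · exact (chi_sm l w).contDiffAt.mul (hV x hx)
  · exact contDiffAt_const.congr_of_eventuallyEq (chi_out hw hx)

theorem chi_cut_bd (hw : 0 < w) (hw1 : w ≤ 1) (hV : ∀ x ∈ Ioo l (l+w), ContDiffAt ℝ ∞ V x) {k : ℕ} {M ε : ℝ} (hM1 : 1 ≤ M)
    (hM : ∀ j ≤ k + 1, ∀ y ∈ Icc (0:ℝ) 1, |iteratedDeriv j chi0 y| ≤ M) (hε : 0 < ε)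
    (hb : ∀ j ≤ k+1, ∀ x ∈ Ioo l (l + w), |iteratedDeriv j V x| ≤ ε * w ^ (k + 1 - j)) :
    ∀ i ≤ k + 1, ∀ x, |iteratedDeriv i (fun y => chi l w y * V y) x| ≤ 2 ^ (k+1) * M * ε := by
  intro i hi x
  by_cases hx : x ∈ Ioo l (l+w)
  · rw [iteratedDeriv_fun_mul ((chi_sm l w).contDiffAt.of_le (by exact_mod_cast le_top)) ((hV x hx).of_le (by exact_mod_cast le_top))]
    have hterm : ∀ j ∈ Finset.range (i+1), |(i.choose j : ℝ) * iteratedDeriv j (chi l w) x * iteratedDeriv (i-j) V x| ≤ (i.choose j : ℝ) * (M * ε) := by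
      intro j hj
      have hji : j ≤ i := by have := Finset.mem_range.1 hj; omega
      rw [abs_mul, abs_mul, Nat.abs_cast, mul_assoc]
      refine mul_le_mul_of_nonneg_left ?_ (by positivity)
      rw [chi_iter, abs_mul, abs_of_pos (by positivity : 0 < (w⁻¹)^j)]
      have h1 := hM j (by omega) (w⁻¹ * (x - l)) ⟨(win_eq' hw).2 (by linarith [hx.1]), (win_eq hw).2 (by linarith [hx.2])⟩
      have h2 := hb (i-j) (by omega) x hx
      calc (w⁻¹)^j * |iteratedDeriv j chi0 (w⁻¹ * (x - l))| * |iteratedDeriv (i-j) V x|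
          ≤ (w⁻¹)^j * M * (ε * w ^ (k+1-(i-j))) := by gcongr
        _ = M * ε * ((w⁻¹)^j * w ^ (k+1-(i-j))) := by ring
        _ ≤ M * ε * 1 := by
            refine mul_le_mul_of_nonneg_left ?_ (by positivity)
            rw [show k+1-(i-j) = j + (k+1-i) by omega, pow_add, ← mul_assoc, ← mul_pow, inv_mul_cancel₀ hw.ne', one_pow, one_mul]
            exact pow_le_one₀ hw.le hw1
        _ = _ := by ring
    calc _ ≤ ∑ j ∈ Finset.range (i+1), |(i.choose j : ℝ) * iteratedDeriv j (chi l w) x * iteratedDeriv (i-j) V x| := Finset.abs_sum_le_sum_abs _ _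
      _ ≤ ∑ j ∈ Finset.range (i+1), (i.choose j : ℝ) * (M * ε) := Finset.sum_le_sum hterm
      _ = 2 ^ i * (M * ε) := by rw [← Finset.sum_mul]; congr 1; exact_mod_cast Nat.sum_range_choose i
      _ ≤ 2 ^ (k+1) * (M * ε) := by
          refine mul_le_mul_of_nonneg_right ?_ (by positivity)
          exact pow_le_pow_right₀ (by norm_num) hi
      _ = _ := by ring
  · rw [(chi_out hw hx).iteratedDeriv_eq]
    have : iteratedDeriv i (fun _ : ℝ => (0:ℝ)) x = 0 := by simp
    rw [this, abs_zero]; positivity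

/-- the left cutoff for a flat end -/
theorem cutD (k : ℕ) (T : ℝ) (hT : 0 ≤ T) {ε : ℝ} (hε : 0 < ε) : ∃ ε0 > 0, ∀ V : ℝ → ℝ, ∀ l w : ℝ, 0 < l → 0 < w → l + w < 1 →
    (∀ x ∈ Ioo l (l+w), ContDiffAt ℝ ∞ V x) →
    (∀ j ≤ k+1, ∀ x ∈ Ioo l (l + w), |iteratedDeriv j V x| ≤ ε0 * w ^ (k + 1 - j)) →
    ∀ ξ φ, Sm ξ → Sup12 ξ → Fl ξ φ → ξ 0 = 0 → ξ 1 = 0 → 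
      (∀ x ≤ l + 3/4 * w, ξ x = stp (8 * (w⁻¹ * (x - l)) - 1) * V x) →
      (∀ i ≤ k, ∀ t ∈ Icc (-T) T, ∀ x ∈ Ico 0 (l + w/2), |iteratedDeriv i (φ t) x - iteratedDeriv i (fun y => y) x| < ε) ∧
      ∀ t ∈ Icc (-T) T, ∀ x ≥ l + w / 2, l + 1/4 * w ≤ φ t x := by
  have hz : Fl (fun _ => 0) (fun _ x => x) := ⟨fun x => rfl, fun t x => hasDerivAt_const _ _⟩
  obtain ⟨ε', ε'0, hcl⟩ := flow_close (ξ := fun _ => 0) contDiff_const (fun _ _ => rfl) hz k T hε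
  obtain ⟨M, hM1, hM⟩ := chi0_bd (k+1)
  refine ⟨min (ε' / (2 ^ (k+1) * M)) (1 / (8 * (T + 1))), by positivity, fun V l w hl hw hlw hV hb ξ φ hξ hs hφ h0 h1 he => ?_⟩
  set ε0 := min (ε' / (2 ^ (k+1) * M)) (1 / (8 * (T + 1))) with hε0
  have ε00 : 0 < ε0 := by positivity
  have hbd := chi_cut_bd hw (by linarith) hV hM1 hM ε00 hb
  have hsm := chi_cut_sm hw hV
  set η : ℝ → ℝ := fun y => chi l w y * V y with hη
  have hηs : Sup12 η := fun x hx => by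
    have hx' : x ∉ Ioo l (l+w) := fun h => hx ⟨by linarith [h.1], by linarith [h.2]⟩
    exact (chi_out (V := V) hw hx').eq_of_nhds
  obtain ⟨ψ, hψ⟩ := Fl.exists hηs hsm.one
  have hspeed : ∀ x, |η x| ≤ w / (8 * (T + 1)) := by
    intro x
    by_cases hx : x ∈ Ioo l (l+w)
    · rw [hη]; simp only [abs_mul]
      have a1 := chi0_le (w⁻¹ * (x - l))
      have a2 := hb 0 (by omega) x hx
      rw [iteratedDeriv_zero, Nat.sub_zero] at a2
      have a3 : w ^ (k+1) ≤ w := by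
        rw [pow_succ]
        exact mul_le_of_le_one_left hw.le (pow_le_one₀ hw.le (by linarith))
      calc |chi l w x| * |V x| ≤ 1 * (ε0 * w ^ (k+1)) := mul_le_mul a1 a2 (abs_nonneg _) zero_le_one
        _ ≤ 1 * (1 / (8 * (T + 1)) * w) := by
            refine mul_le_mul_of_nonneg_left (mul_le_mul (min_le_right _ _) a3 (by positivity) (by positivity)) zero_le_one
        _ = _ := by ring
    · have := (chi_out (V := V) hw hx).eq_of_nhds
      rw [hη]; simp only at this ⊢; rw [this, abs_zero]; positivity
  have hmove : ∀ x, ∀ t ∈ Icc (-(T+1)) (T+1), |ψ t x - x| ≤ w / 8 := by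
    intro x t ht
    have := (convex_univ (𝕜 := ℝ) (E := ℝ)).norm_image_sub_le_of_norm_hasDerivWithin_le (f := fun s => ψ s x) (x := 0) (y := t)
      (fun s _ => (hψ.2 s x).hasDerivWithinAt) (fun s _ => hspeed (ψ s x)) trivial trivial
    rw [hψ.1, Real.norm_eq_abs, sub_zero, Real.norm_eq_abs] at this
    refine this.trans ?_
    calc _ ≤ w / (8 * (T+1)) * (T + 1) := mul_le_mul_of_nonneg_left (abs_le.2 ht) (by positivity)
      _ = _ := by field_simp
  have heq : ∀ x ≤ l + 3/4 * w, ξ x = η x := by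
    intro x hx
    rw [he x hx, hη]
    simp only [chi, chi0]
    rw [stp_zero (x := 8 * (w⁻¹ * (x - l)) - 6), sub_zero, mul_one]
    have := (win_eq (c := 3/4) hw).2 hx
    linarith
  obtain ⟨K, L, hK, -⟩ := hs.lip hξ.one
  have hsame : ∀ x ≤ l + w / 2, ∀ t ∈ Icc (-T) T, φ t x = ψ t x := by
    intro x hx t ht
    have := ODE_solution_unique_of_mem_Ioo (v := fun _ => ξ) (s := fun _ => univ) (K := K) (t₀ := 0) (a := -(T+1)) (b := T+1)
      (f := fun t => φ t x) (g := fun t => ψ t x) (fun _ _ => hK.lipschitzOnWith) ⟨by linarith, by linarith⟩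
      (fun t _ => ⟨hφ.2 t _, trivial⟩) (fun t ht => ⟨by
        have h2 := hψ.2 t x
        have h3 := (abs_le.1 (hmove x t ⟨ht.1.le, ht.2.le⟩)).2
        rw [← heq _ (by linarith)] at h2
        exact h2, trivial⟩) (by simp [hφ.1, hψ.1])
    exact this ⟨by linarith [ht.1], by linarith [ht.2]⟩
  refine ⟨fun i hi t ht x hx => ?_, fun t ht x hx => ?_⟩
  · have e : φ t =ᶠ[𝓝 x] ψ t := by
      filter_upwards [Iio_mem_nhds hx.2] with y hy
      exact hsame y (le_of_lt hy) t ht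
    rw [e.iteratedDeriv_eq]
    refine hcl η ψ hsm hηs hψ (fun i hi x => ?_) i hi t ht x ⟨hx.1, by linarith [hx.2]⟩
    have : iteratedDeriv i (fun _ : ℝ => (0:ℝ)) x = 0 := by simp
    rw [this, sub_zero]
    refine (hbd i hi x).trans ?_
    calc 2 ^ (k+1) * M * ε0 ≤ 2 ^ (k+1) * M * (ε' / (2 ^ (k+1) * M)) := mul_le_mul_of_nonneg_left (min_le_left _ _) (by positivity)
      _ = ε' := by field_simp
  · have a := hsame (l + w/2) le_rfl t ht
    have b := (abs_le.1 (hmove (l + w/2) t ⟨by linarith [ht.1], by linarith [ht.2]⟩)).1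
    have c := (hφ.gdiff hs hξ h0 h1 t).mono.monotone hx
    rw [a] at c
    linarith
end
end

section
open scoped ContDiff

structure Lcut (P : Prop) (V σ : ℝ → ℝ) (k : ℕ) (T ε X L Z : ℝ) : Prop where
  sms : Sm σ
  sm : ∀ x < 1, ContDiffAt ℝ ∞ (fun y => σ y * V y) x
  s0 : ∀ x ≤ -1, σ x = 0
  s1 : ∀ x, L ≤ x → σ x = 1
  X0 : 0 ≤ X
  LX : L < X
  XZ : X < Z
  Z1 : Z ≤ 1/2
  P1 : P → ∀ᶠ x in 𝓝 0, σ x = 0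
  P2 : ¬ P → L < 0
  P3 : ¬ P → X = 0
  main : ∀ ξ φ, Sm ξ → Sup12 ξ → Fl ξ φ → ξ 0 = 0 → ξ 1 = 0 → (∀ x ≤ Z, ξ x = σ x * V x) →
      (∀ i ≤ k, ∀ t ∈ Icc (-T) T, ∀ x ∈ Ico 0 X, |iteratedDeriv i (φ t) x - iteratedDeriv i (fun y => y) x| < ε) ∧
      ∀ t ∈ Icc (-T) T, ∀ x ≥ X, L ≤ φ t x

theorem Lcut.exists {P : Prop} {V : ℝ → ℝ} (hsm : ∀ x ∈ Ioo (0:ℝ) 1, ContDiffAt ℝ ∞ V x) (V0 : V 0 = 0)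
    (nP : ¬ P → ContDiffAt ℝ ∞ V 0 ∧ ∃ a < 0, ∀ x ∈ Ioo a 0, ContDiffAt ℝ ∞ V x) (k : ℕ)
    (win : P → ∀ ε > 0, ∃ l w, 0 < w ∧ 0 < l ∧ l + w < ε ∧ l + w < 1 ∧
      ∀ j ≤ k + 1, ∀ x ∈ Ioo l (l + w), |iteratedDeriv j V x| ≤ ε * w ^ (k + 1 - j))
    {T ε δ : ℝ} (hT : 0 ≤ T) (hε : 0 < ε) (hδ : 0 < δ) : ∃ σ X L Z, X < δ ∧ Lcut P V σ k T ε X L Z := by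
  by_cases hP : P
  · obtain ⟨ε0, ε00, hcut⟩ := cutD k T hT hε
    obtain ⟨l, w, hw, hl, h1, h2, hb⟩ := win hP (min ε0 (min δ (1/2))) (by positivity)
    have hd : l + w < δ := h1.trans_le ((min_le_right _ _).trans (min_le_left _ _))
    have hh : l + w < 1/2 := h1.trans_le ((min_le_right _ _).trans (min_le_right _ _))
    have hV : ∀ x ∈ Ioo l (l+w), ContDiffAt ℝ ∞ V x := fun x hx => hsm x ⟨by linarith [hx.1], by linarith [hx.2]⟩
    have hc := hcut V l w hl hw h2 hV (fun j hj x hx => (hb j hj x hx).trans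
      (mul_le_mul_of_nonneg_right (min_le_left _ _) (by positivity)))
    have hsms : Sm (fun x : ℝ => stp (8 * (w⁻¹ * (x - l)) - 1)) := stp_sm.comp (by fun_prop)
    have hz : ∀ x ≤ l + 1/8 * w, stp (8 * (w⁻¹ * (x - l)) - 1) = 0 := fun x hx => stp_zero (by
      have := (win_eq (c := 1/8) hw).2 hx
      linarith)
    refine ⟨fun x => stp (8 * (w⁻¹ * (x - l)) - 1), l + w/2, l + 1/4 * w, l + 3/4 * w, by linarith, hsms, fun x hx => ?_,
      fun x hx => hz x (by linarith), fun x hx => stp_one (by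
        have := (win_eq' (c := 1/4) hw).2 hx
        linarith), by linarith, by linarith, by linarith, by linarith, fun _ => ?_, fun h => absurd hP h, fun h => absurd hP h, hc⟩
    · rcases lt_or_ge x (l + 1/8 * w) with h | h
      · refine contDiffAt_const (c := (0:ℝ)) |>.congr_of_eventuallyEq ?_
        filter_upwards [Iio_mem_nhds h] with y hy
        rw [hz y (le_of_lt hy), zero_mul]
      · exact hsms.contDiffAt.mul (hsm x ⟨by linarith, hx⟩)
    · filter_upwards [Iio_mem_nhds (show (0:ℝ) < l + 1/8 * w by linarith)] with y hy
      exact hz y (le_of_lt hy)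
  · obtain ⟨c0, a, a0, ha⟩ := nP hP
    set d := min (-a) 1 / 2 with hd
    have d0 : 0 < d := by have : 0 < min (-a) 1 := lt_min (by linarith) one_pos
                          linarith
    have d1 : d ≤ 1/2 := by have := min_le_right (-a) 1; linarith
    have d2 : d ≤ -a / 2 := by have := min_le_left (-a) 1; linarith
    have hsms : Sm (fun x : ℝ => stp (2 * (x + d) * d⁻¹)) := stp_sm.comp (by fun_prop)
    have hz : ∀ x ≤ -d, stp (2 * (x + d) * d⁻¹) = 0 := fun x hx => stp_zero
      (mul_nonpos_of_nonpos_of_nonneg (by linarith) (by positivity))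
    refine ⟨fun x => stp (2 * (x + d) * d⁻¹), 0, -(d/2), 1/4, hδ, hsms, fun x hx => ?_,
      fun x hx => hz x (by linarith), fun x hx => stp_one (by
        rw [← div_eq_mul_inv, le_div_iff₀ d0]; linarith), le_rfl, by linarith, by norm_num, by norm_num, fun h => absurd h hP,
        fun _ => by linarith, fun _ => rfl, fun ξ φ h1 h2 h3 h4 h5 h6 => ⟨fun i hi t ht x hx => absurd hx (by simp), fun t ht x hx => ?_⟩⟩
    · rcases lt_or_ge x (-d) with h | h
      · refine contDiffAt_const (c := (0:ℝ)) |>.congr_of_eventuallyEq ?_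
        filter_upwards [Iio_mem_nhds h] with y hy
        rw [hz y (le_of_lt hy), zero_mul]
      · refine hsms.contDiffAt.mul ?_
        rcases lt_trichotomy x 0 with h' | h' | h'
        · exact ha x ⟨by linarith, h'⟩
        · rw [h']; exact c0
        · exact hsm x ⟨h', hx⟩
    · have := (h3.gdiff h2 h1 h4 h5 t).mono.monotone hx
      rw [h3.fix h2 h1.one h4] at this
      linarith

section
variable {f f' g g' V : ℝ → ℝ} {D : Set ℝ} {τ : ℝ}

theorem VF.lcut (hV : VF D f f' g g' τ V) (h : CP D f f' g g') (k : ℕ) {T ε δ : ℝ} (hT : 0 ≤ T) (hε : 0 < ε) (hδ : 0 < δ) :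
    ∃ σ X L Z, X < δ ∧ Lcut ((0:ℝ) ∈ D) V σ k T ε X L Z :=
  Lcut.exists (fun x hx => hV.sm x ⟨hx.1.le, hx.2.le⟩ (h.not_D hx)) (hV.zero 0 (by simp) h.gf.zero)
    (fun hP => ⟨hV.sm 0 (by simp) hP, hV.smL hP⟩) k (fun hP ε hε => hV.win0 h hP k hε) hT hε hδ

theorem VF.rcut (hV : VF D f f' g g' τ V) (h : CP D f f' g g') (k : ℕ) {T ε δ : ℝ} (hT : 0 ≤ T) (hε : 0 < ε) (hδ : 0 < δ) :
    ∃ σ X L Z, X < δ ∧ Lcut ((1:ℝ) ∈ D) (fun x => - V (1 - x)) σ k T ε X L Z := by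
  have hr : ∀ x, ContDiffAt ℝ ∞ V (1 - x) → ContDiffAt ℝ ∞ (fun x => - V (1 - x)) x := fun x hx =>
    (ContDiffAt.comp x hx (by fun_prop)).neg
  refine Lcut.exists (fun x hx => hr x (hV.sm (1 - x) ⟨by linarith [hx.2], by linarith [hx.1]⟩
    (h.not_D ⟨by linarith [hx.2], by linarith [hx.1]⟩))) ?_
    (fun hP => ⟨hr 0 (by rw [sub_zero]; exact hV.sm 1 (by simp) hP), ?_⟩) k (fun hP ε hε => ?_) hT hε hδ
  · simp [hV.zero 1 (by simp) h.gf.one]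
  · obtain ⟨b, hb, h1⟩ := hV.smR hP
    exact ⟨1 - b, by linarith, fun x hx => hr x (h1 (1 - x) ⟨by linarith [hx.2], by linarith [hx.1]⟩)⟩
  · obtain ⟨l, w, h1, h2, h3, h4, h5⟩ := hV.win1 h hP k (ε := min ε 1) (by positivity)
    have := min_le_left ε 1
    refine ⟨1 - l - w, w, h1, by linarith, by linarith, by linarith, fun j hj x hx => ?_⟩
    rw [iteratedDeriv_fun_neg, iteratedDeriv_comp_const_sub]
    simp only [smul_eq_mul, abs_neg, abs_mul, abs_pow, abs_one, one_pow, one_mul]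
    refine (h5 j hj (1 - x) ⟨by linarith [hx.2], by linarith [hx.1]⟩).trans ?_
    exact mul_le_mul_of_nonneg_right (min_le_left _ _) (by positivity)
end
end

section
open scoped ContDiff

theorem id_eq_Icc {f g : ℝ → ℝ} (hf : Sm f) (hg : Sm g) {α β : ℝ} (hab : α < β)
    (h : ∀ x ∈ Icc α β, f x = g x) (k : ℕ) {x : ℝ} (hx : x ∈ Icc α β) :
    iteratedDeriv k f x = iteratedDeriv k g x := by
  have h1 : EqOn (iteratedDeriv k f) (iteratedDeriv k g) (Ioo α β) := by
    intro y hy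
    refine Filter.EventuallyEq.iteratedDeriv_eq k ?_
    filter_upwards [isOpen_Ioo.mem_nhds hy] with z hz
    exact h z ⟨hz.1.le, hz.2.le⟩
  have h2 := h1.closure (hf.cid k) (hg.cid k)
  rw [closure_Ioo hab.ne] at h2
  exact h2 hx

theorem id_sub {f g : ℝ → ℝ} (hf : Sm f) (hg : Sm g) (i : ℕ) (x : ℝ) :
    iteratedDeriv i (fun y => f y - g y) x = iteratedDeriv i f x - iteratedDeriv i g x :=
  iteratedDeriv_fun_sub (hf.contDiffAt.of_le (by exact_mod_cast le_top)) (hg.contDiffAt.of_le (by exact_mod_cast le_top))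

theorem sm_id : Sm (fun y : ℝ => y) := contDiff_id

theorem near_flat {f : ℝ → ℝ} {p : ℝ} (hf : Sm f) (h : Flat (fun x => f x - x) p) (k : ℕ) {ε : ℝ} (hε : 0 < ε) :
    ∃ δ > 0, ∀ i ≤ k, ∀ x, |x - p| < δ → |iteratedDeriv i f x - iteratedDeriv i (fun y => y) x| < ε := by
  have hev : ∀ᶠ x in 𝓝 p, ∀ i ∈ Finset.range (k+1), |iteratedDeriv i f x - iteratedDeriv i (fun y => y) x| < ε := by
    rw [Finset.eventually_all]
    intro i _
    have c : Continuous (fun x => |iteratedDeriv i f x - iteratedDeriv i (fun y => y) x|) :=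
      ((hf.cid i).sub (sm_id.cid i)).abs
    refine c.continuousAt.eventually_lt continuousAt_const ?_
    rw [← id_sub hf sm_id, h i, abs_zero]; exact hε
  obtain ⟨δ, δ0, hd⟩ := Metric.eventually_nhds_iff.1 hev
  exact ⟨δ, δ0, fun i hi x hx => hd (by rwa [Real.dist_eq]) i (Finset.mem_range.2 (by omega))⟩

section
variable {f f' g g' V : ℝ → ℝ} {D : Set ℝ} {τ : ℝ}

theorem VF.mid (hV : VF D f f' g g' τ V) (h : CP D f f' g g') {ξ : ℝ → ℝ} {φ : ℝ → ℝ → ℝ} (hξ : Sm ξ) (hs : Sup12 ξ) (hφ : Fl ξ φ)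
    (h0 : ξ 0 = 0) (h1 : ξ 1 = 0) (hz : ∀ x ∈ Icc (0:ℝ) 1, f x = x → ξ x = 0) {T : ℝ} (hT1 : 1 ≤ T) (hTτ : |τ| ≤ T)
    {x : ℝ} (hx : x ∈ Icc (0:ℝ) 1) (he : ∀ t ∈ Icc (-T) T, ξ (φ t x) = V (φ t x)) : φ 1 x = f x ∧ φ τ x = g x := by
  by_cases hfx : f x = x
  · rw [hφ.fix hs hξ.one (hz x hx hfx), hφ.fix hs hξ.one (hz x hx hfx), hfx, h.fix hx hfx]; exact ⟨rfl, rfl⟩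
  · obtain ⟨a, b, ha, hb, hxab, hc⟩ := Cpt.exists h.gf.sm.continuous h.gf.zero h.gf.one hx hfx
    have hff := hV.ff a b ha hb hc
    have hab := hc.lt
    have za := hz a ⟨ha, by linarith⟩ hc.fa
    have zb := hz b ⟨by linarith, hb⟩ hc.fb
    have hin : ∀ t, φ t x ∈ Ioo a b := by
      intro t
      have m := (hφ.gdiff hs hξ h0 h1 t).mono
      have m1 := m hxab.1
      have m2 := m hxab.2
      rw [hφ.fix hs hξ.one za] at m1
      rw [hφ.fix hs hξ.one zb] at m2
      exact ⟨m1, m2⟩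
    have hd : ∀ t ∈ Icc (-T) T, HasDerivAt (fun t => tt V x (φ t x) - t) 0 t := by
      intro t ht
      have d1 := hff.fd.hasDeriv hxab (hin t)
      have d2 := HasDerivAt.comp t d1 (hφ.2 t x)
      rw [he t ht, inv_mul_cancel₀ (hff.fd.ne (hin t))] at d2
      exact (d2.sub (hasDerivAt_id t)).congr_deriv (by simp)
    have htt : ∀ t ∈ Icc (-T) T, tt V x (φ t x) = t := by
      intro t ht
      have := (convex_Icc (-T) T).norm_image_sub_le_of_norm_hasDerivWithin_le (C := 0) (fun t ht => (hd t ht).hasDerivWithinAt)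
        (fun t ht => by simp) (show (0:ℝ) ∈ Icc (-T) T from ⟨by linarith, by linarith⟩) ht
      rw [zero_mul] at this
      have := norm_le_zero_iff.1 this
      rw [hφ.1] at this
      simp only [tt, intervalIntegral.integral_same, sub_zero] at this
      unfold tt; linarith
    have hone := hV.one a b ha hb hc x hxab
    have fin : ∀ y ∈ Ioo a b, ∀ t ∈ Icc (-T) T, tt V x y = t → φ t x = y := by
      intro y hy t ht e
      refine hff.fd.tt_inj (hin t) hy ?_
      have := hff.fd.tt_add hxab (hin t) hy
      rw [htt t ht, e] at this
      linarith
    refine ⟨fin _ (mem_of_cpt h.gf.toGDiff hc hxab) _ ⟨by linarith, hT1⟩ hone.1, fin _ (hff.ivg.mem hxab) _ (abs_le.1 hTτ) hone.2⟩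

theorem VF.approx (hV : VF D f f' g g' τ V) (h : CP D f f' g g') (hg : ∀ p ∈ Icc (0:ℝ) 1, p ∈ D → Flat (fun x => g x - x) p)
    (k : ℕ) {ε : ℝ} (hε : 0 < ε) : ∃ ξ φ, Sm ξ ∧ Sup12 ξ ∧ Fl ξ φ ∧ ξ 0 = 0 ∧ ξ 1 = 0 ∧
      (∀ i ≤ k, ∀ x ∈ Icc (0:ℝ) 1, |iteratedDeriv i (φ 1) x - iteratedDeriv i f x| < ε ∧ |iteratedDeriv i (φ τ) x - iteratedDeriv i g x| < ε) ∧
      ((0:ℝ) ∈ D → ∀ᶠ x in 𝓝 0, ξ x = 0) ∧ ((1:ℝ) ∈ D → ∀ᶠ x in 𝓝 1, ξ x = 0) ∧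
      ((0:ℝ) ∉ D → ∀ᶠ x in 𝓝 0, ξ x = V x) ∧ ((1:ℝ) ∉ D → ∀ᶠ x in 𝓝 1, ξ x = V x) := by
  have hε2 := half_pos hε
  have hdel : ∀ p ∈ Icc (0:ℝ) 1, ∃ δ > 0, p ∈ D → ∀ i ≤ k, ∀ x, |x - p| < δ → |iteratedDeriv i f x - iteratedDeriv i (fun y => y) x| < ε / 2
      ∧ |iteratedDeriv i g x - iteratedDeriv i (fun y => y) x| < ε / 2 := by
    intro p hp
    by_cases hD : p ∈ D
    · obtain ⟨δ1, a1, b1⟩ := near_flat h.gf.sm ((h.flf p hp).2 hD) k hε2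
      obtain ⟨δ2, a2, b2⟩ := near_flat h.gg.sm (hg p hp hD) k hε2
      exact ⟨min δ1 δ2, lt_min a1 a2, fun _ i hi x hx => ⟨b1 i hi x (hx.trans_le (min_le_left _ _)), b2 i hi x (hx.trans_le (min_le_right _ _))⟩⟩
    · exact ⟨1, one_pos, fun h => absurd h hD⟩
  obtain ⟨δ0, δ00, hδ0⟩ := hdel 0 (by simp)
  obtain ⟨δ1, δ10, hδ1⟩ := hdel 1 (by simp)
  set T := max 1 |τ| with hTd
  have hT1 : 1 ≤ T := le_max_left _ _
  have hTτ : |τ| ≤ T := le_max_right _ _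
  obtain ⟨σ, X, L, Z, hX, hL⟩ := hV.lcut h k (T := T) (by linarith) hε2 δ00
  obtain ⟨ρ, X', L', Z', hX', hR⟩ := hV.rcut h k (T := T) (by linarith) hε2 δ10
  set ξ : ℝ → ℝ := fun x => σ x * ρ (1 - x) * V x with hξd
  have smρ : Sm (fun x => ρ (1 - x)) := hR.sms.comp (by fun_prop)
  have hξ : Sm ξ := by
    refine contDiff_iff_contDiffAt.2 fun x => ?_
    rcases lt_or_ge x 1 with hx | hx
    · refine (smρ.contDiffAt.mul (hL.sm x hx)).congr_of_eventuallyEq (Eventually.of_forall fun y => ?_)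
      rw [hξd]; ring
    · have e1 := hR.sm (1 - x) (by linarith)
      have e2 : ContDiffAt ℝ ∞ (fun y => ρ (1 - y) * -V (1 - (1 - y))) x := ContDiffAt.comp x e1 (by fun_prop)
      refine (hL.sms.contDiffAt.mul e2.neg).congr_of_eventuallyEq (Eventually.of_forall fun y => ?_)
      rw [hξd]; simp only [sub_sub_cancel]; ring
  have hs : Sup12 ξ := by
    intro x hx
    rw [hξd]
    rcases lt_or_ge x (-1) with h' | h'
    · simp only; rw [hL.s0 x h'.le]; simp
    · have : 2 < x := by
        by_contra hc
        exact hx ⟨h', not_lt.1 hc⟩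
      simp only; rw [hR.s0 (1 - x) (by linarith)]; simp
  obtain ⟨φ, hφ⟩ := Fl.exists hs hξ.one
  have hz : ∀ x ∈ Icc (0:ℝ) 1, f x = x → ξ x = 0 := fun x hx e => by rw [hξd]; simp only; rw [hV.zero x hx e, mul_zero]
  have h0 := hz 0 (by simp) h.gf.zero
  have h1 := hz 1 (by simp) h.gf.one
  have := hL.LX; have := hL.XZ; have := hL.Z1; have := hL.X0
  have := hR.LX; have := hR.XZ; have := hR.Z1; have := hR.X0
  have eL : ∀ x ≤ Z, ξ x = σ x * V x := fun x hx => by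
    rw [hξd]; simp only; rw [hR.s1 (1 - x) (by linarith), mul_one]
  have eR : ∀ x ≥ 1 - Z', ξ x = ρ (1 - x) * V x := fun x hx => by
    rw [hξd]; simp only; rw [hL.s1 x (by linarith), one_mul]
  obtain ⟨cL, sL⟩ := hL.main ξ φ hξ hs hφ h0 h1 eL
  -- reflected flow
  have hξr : Sm (fun x => - ξ (1 - x)) := (hξ.comp (show ContDiff ℝ ∞ (fun x : ℝ => 1 - x) by fun_prop)).neg
  have hφr : Fl (fun x => - ξ (1 - x)) (fun t x => 1 - φ t (1 - x)) := by
    refine ⟨fun x => by simp [hφ.1], fun t x => ?_⟩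
    have := (hφ.2 t (1 - x)).const_sub 1
    simpa using this
  have hsr : Sup12 (fun x => - ξ (1 - x)) := fun x hx => by
    show - ξ (1 - x) = 0
    rw [hs (1 - x) fun hc => hx ⟨by linarith [hc.2], by linarith [hc.1]⟩, neg_zero]
  obtain ⟨cR, sR⟩ := hR.main _ _ hξr hsr hφr (by simpa using h1) (by simpa using h0) (fun x hx => by
    rw [eR (1 - x) (by linarith), sub_sub_cancel]; ring)
  have cR' : ∀ i ≤ k, ∀ t ∈ Icc (-T) T, ∀ x ∈ Ioc (1 - X') 1, |iteratedDeriv i (φ t) x - iteratedDeriv i (fun y => y) x| < ε / 2 := by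
    intro i hi t ht x hx
    have a := cR i hi t ht (1 - x) ⟨by linarith [hx.2], by linarith [hx.1]⟩
    rw [← id_sub (hφr.sm hsr hξr t) sm_id] at a
    rw [← id_sub (hφ.sm hs hξ t) sm_id]
    have e : (fun y => 1 - φ t (1 - y) - y) = fun y => - ((fun z => φ t z - z) (1 - y)) := by ext y; simp only; ring
    rw [e, iteratedDeriv_fun_neg, iteratedDeriv_comp_const_sub (f := fun z => φ t z - z)] at a
    simpa only [smul_eq_mul, abs_neg, abs_mul, abs_pow, abs_one, one_pow, one_mul, sub_sub_cancel] using a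
  have hmid : ∀ x ∈ Icc X (1 - X'), φ 1 x = f x ∧ φ τ x = g x := by
    intro x hx
    refine hV.mid h hξ hs hφ h0 h1 hz hT1 hTτ ⟨by linarith [hx.1], by linarith [hx.2]⟩ fun t ht => ?_
    have a1 := sL t ht x hx.1
    have a2 := sR t ht (1 - x) (by linarith [hx.2])
    rw [sub_sub_cancel] at a2
    rw [hξd]; simp only; rw [hL.s1 _ a1, hR.s1 _ a2]; ring
  have t1 : (1:ℝ) ∈ Icc (-T) T := ⟨by linarith, hT1⟩
  have t2 : τ ∈ Icc (-T) T := abs_le.1 hTτ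
  have tri : ∀ {a b c : ℝ}, |a - c| < ε / 2 → |b - c| < ε / 2 → |a - b| < ε := by
    intro a b c h1 h2
    rw [abs_sub_lt_iff] at *
    constructor <;> linarith [h1.1, h1.2, h2.1, h2.2]
  refine ⟨ξ, φ, hξ, hs, hφ, h0, h1, fun i hi x hx => ?_, fun hD => ?_, fun hD => ?_, fun hD => ?_, fun hD => ?_⟩
  · rcases lt_or_ge x X with hx1 | hx1
    · have hD : (0:ℝ) ∈ D := by
        by_contra hc
        have := hL.P3 hc
        linarith [hx.1]
      have q := hδ0 hD i hi x (by rw [sub_zero, abs_of_nonneg hx.1]; linarith)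
      exact ⟨tri (cL i hi 1 t1 x ⟨hx.1, hx1⟩) q.1, tri (cL i hi τ t2 x ⟨hx.1, hx1⟩) q.2⟩
    rcases lt_or_ge (1 - X') x with hx2 | hx2
    · have hD : (1:ℝ) ∈ D := by
        by_contra hc
        have := hR.P3 hc
        linarith [hx.2]
      have q := hδ1 hD i hi x (by rw [abs_sub_lt_iff]; constructor <;> linarith [hx.2])
      exact ⟨tri (cR' i hi 1 t1 x ⟨hx2, hx.2⟩) q.1, tri (cR' i hi τ t2 x ⟨hx2, hx.2⟩) q.2⟩
    · rw [id_eq_Icc (hφ.sm hs hξ 1) h.gf.sm (α := X) (β := 1 - X') (by linarith) (fun x hx => (hmid x hx).1) i ⟨hx1, hx2⟩,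
        id_eq_Icc (hφ.sm hs hξ τ) h.gg.sm (α := X) (β := 1 - X') (by linarith) (fun x hx => (hmid x hx).2) i ⟨hx1, hx2⟩]
      simpa using hε
  · filter_upwards [hL.P1 hD] with x hx
    rw [hξd]; simp only; rw [hx]; simp
  · have := hR.P1 hD
    have c : Tendsto (fun x : ℝ => 1 - x) (𝓝 1) (𝓝 0) := by
      have : Continuous (fun x : ℝ => 1 - x) := by fun_prop
      have := this.tendsto 1
      rwa [sub_self] at this
    filter_upwards [c.eventually this] with x hx
    rw [hξd]; simp only; rw [hx]; simp
  · have a := hL.P2 hD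
    filter_upwards [Ioi_mem_nhds a, Iio_mem_nhds (show (0:ℝ) < 1/2 by norm_num)] with x hx hx'
    rw [hξd]; simp only; rw [hL.s1 x (le_of_lt hx), hR.s1 (1 - x) (by simp only [mem_Iio] at hx'; linarith)]; ring
  · have a := hR.P2 hD
    filter_upwards [Iio_mem_nhds (show (1:ℝ) < 1 - L' by linarith), Ioi_mem_nhds (show (1/2:ℝ) < 1 by norm_num)] with x hx hx'
    rw [hξd]; simp only [mem_Iio, mem_Ioi] at hx hx' ⊢; rw [hL.s1 x (by linarith), hR.s1 (1 - x) (by linarith)]; ring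
end
end

section
open scoped ContDiff

noncomputable def tht (x : ℝ) : ℝ := expNegInvGlue x * expNegInvGlue (1 - x)

theorem tht_sm : Sm tht := by
  have h1 : Sm expNegInvGlue := expNegInvGlue.contDiff
  have h2 : Sm (fun x : ℝ => expNegInvGlue (1 - x)) := h1.comp (by fun_prop)
  exact h1.mul h2

theorem tht_pos {x : ℝ} (hx : x ∈ Ioo (0:ℝ) 1) : 0 < tht x :=
  mul_pos (expNegInvGlue.pos_of_pos hx.1) (expNegInvGlue.pos_of_pos (by linarith [hx.2]))

theorem tht_zero {x : ℝ} (hx : x ≤ 0 ∨ 1 ≤ x) : tht x = 0 := by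
  unfold tht
  rcases hx with h | h
  · rw [expNegInvGlue.zero_of_nonpos h, zero_mul]
  · rw [expNegInvGlue.zero_of_nonpos (x := 1 - x) (by linarith), mul_zero]

theorem id_zero (i : ℕ) (x : ℝ) : iteratedDeriv i (fun _ : ℝ => (0:ℝ)) x = 0 := by simp

theorem tht_flat {p : ℝ} (hp : p ≤ 0 ∨ 1 ≤ p) : Flat tht p := by
  intro n
  rcases hp with h | h
  · rw [id_eq_Icc tht_sm (contDiff_const (c := (0:ℝ))) (α := p - 1) (β := p) (by linarith)
      (fun x hx => tht_zero (Or.inl (hx.2.trans h))) n (by simp), id_zero]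
  · rw [id_eq_Icc tht_sm (contDiff_const (c := (0:ℝ))) (α := p) (β := p + 1) (by linarith)
      (fun x hx => tht_zero (Or.inr (h.trans hx.1))) n (by simp), id_zero]

theorem tht_bd (k : ℕ) : ∃ M > 0, ∀ i ≤ k, ∀ x, |iteratedDeriv i tht x| ≤ M := by
  have h : ∀ j, ∃ M, ∀ y ∈ Icc (0:ℝ) 1, ‖iteratedDeriv j tht y‖ ≤ M := fun j =>
    isCompact_Icc.exists_bound_of_continuousOn (tht_sm.cid j).continuousOn
  choose M hM using h
  have hp : 0 ≤ ∑ j ∈ Finset.range (k+1), |M j| := Finset.sum_nonneg fun _ _ => abs_nonneg _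
  refine ⟨1 + ∑ j ∈ Finset.range (k+1), |M j|, by linarith, fun j hj y => ?_⟩
  by_cases hy : y ∈ Icc (0:ℝ) 1
  · have h1 := hM j y hy
    have h2 : |M j| ≤ ∑ j ∈ Finset.range (k+1), |M j| :=
      Finset.single_le_sum (f := fun j => |M j|) (fun _ _ => abs_nonneg _) (Finset.mem_range.2 (by omega))
    rw [Real.norm_eq_abs] at h1
    linarith [le_abs_self (M j)]
  · have : y ≤ 0 ∨ 1 ≤ y := by
      by_contra hc
      push Not at hc
      exact hy ⟨hc.1.le, hc.2.le⟩
    rw [tht_flat this j, abs_zero]; linarith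

theorem sard {ξ : ℝ → ℝ} (hξ : Sm ξ) {s0 : ℝ} (hs : 0 < s0) :
    ∃ s, 0 < s ∧ s < s0 ∧ ∀ p ∈ Ioo (0:ℝ) 1, ¬ Flat (fun x => ξ x + s * tht x) p := by
  let q : ℝ → ℝ := fun x => - ξ x / tht x
  let C : Set ℝ := {x | x ∈ Ioo (0:ℝ) 1 ∧ HasDerivAt q 0 x}
  have hC : MeasureTheory.volume (q '' C) = 0 := by
    refine MeasureTheory.addHaar_image_eq_zero_of_det_fderivWithin_eq_zero MeasureTheory.volume (f' := fun _ => 0) (fun x hx => ?_) (fun x _ => ?_)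
    · have := hx.2.hasFDerivAt
      have e : (ContinuousLinearMap.toSpanSingleton ℝ (0:ℝ)) = 0 := by ext; simp
      rw [e] at this
      exact this.hasFDerivWithinAt
    · simp [ContinuousLinearMap.det]
  have : ∃ s ∈ Ioo 0 s0, s ∉ q '' C := by
    by_contra hc
    push Not at hc
    have h1 := MeasureTheory.measure_mono (μ := MeasureTheory.volume) (show Ioo 0 s0 ⊆ q '' C from hc)
    rw [hC, Real.volume_Ioo, nonpos_iff_eq_zero, ENNReal.ofReal_eq_zero] at h1
    linarith
  obtain ⟨s, hs', hsC⟩ := this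
  refine ⟨s, hs'.1, hs'.2, fun p hp hfl => hsC ?_⟩
  have e0 := hfl 0
  have e1 := hfl 1
  rw [iteratedDeriv_zero] at e0
  have hd := (hξ.has p).fun_add ((tht_sm.has p).const_mul s)
  rw [iteratedDeriv_one, hd.deriv] at e1
  have tp := tht_pos hp
  refine ⟨p, ⟨hp, ?_⟩, ?_⟩
  · have := (hξ.has p).neg.div (tht_sm.has p) tp.ne'
    refine this.congr_deriv ?_
    rw [div_eq_zero_iff]; left
    simp only [Pi.neg_apply]
    have a : ξ p = - (s * tht p) := by linarith
    have b : deriv ξ p = - (s * deriv tht p) := by linarith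
    rw [a, b]; ring
  · show - ξ p / tht p = s
    rw [div_eq_iff tp.ne']; linarith

section
variable {f f' g g' V : ℝ → ℝ} {D : Set ℝ} {τ : ℝ}

theorem VF.notflat (hV : VF D f f' g g' τ V) (h : CP D f f' g g') {p : ℝ} (hp : p ∈ Icc (0:ℝ) 1) (hpD : p ∉ D) (fp : f p = p)
    {ξ : ℝ → ℝ} (hξ : Sm ξ) (he : ∀ᶠ x in 𝓝 p, ξ x = V x) : ¬ Flat ξ p := by
  intro hfl
  obtain ⟨κ, κ0, hκ⟩ := hV.low p hp hpD fp
  obtain ⟨m, A, hA, hA0, hfA⟩ := h.nonflat hp hpD fp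
  obtain ⟨w, hw, hξw⟩ := hfl.factor hξ (m + 2)
  have := nhds_I_neBot hp
  have t1 : Tendsto (fun x => κ * |A x|) (𝓝[Icc (0:ℝ) 1 \ {p}] p) (𝓝 (κ * |A p|)) :=
    ((continuous_const.mul hA.continuous.abs).tendsto p).mono_left nhdsWithin_le_nhds
  have t2 : Tendsto (fun x => |x - p| * |w x|) (𝓝[Icc (0:ℝ) 1 \ {p}] p) (𝓝 (|p - p| * |w p|)) :=
    ((((continuous_id.sub continuous_const).abs).mul hw.continuous.abs).tendsto p).mono_left nhdsWithin_le_nhds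
  have hle : ∀ᶠ x in 𝓝[Icc (0:ℝ) 1 \ {p}] p, κ * |A x| ≤ |x - p| * |w x| := by
    filter_upwards [nhdsWithin_mono p diff_subset hκ, nhdsWithin_le_nhds he, self_mem_nhdsWithin] with x h1 h2 h3
    have hxp : 0 < |x - p| := abs_pos.2 (sub_ne_zero.2 h3.2)
    rw [← h2, hfA, hξw, abs_mul, abs_mul, abs_pow, abs_pow] at h1
    have : |x - p| ^ (m+1) * (κ * |A x|) ≤ |x - p| ^ (m+1) * (|x - p| * |w x|) := by
      calc _ = κ * (|x - p| ^ (m+1) * |A x|) := by ring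
        _ ≤ _ := h1
        _ = _ := by ring
    exact le_of_mul_le_mul_left this (by positivity)
  have := le_of_tendsto_of_tendsto t1 t2 hle
  rw [sub_self, abs_zero, zero_mul] at this
  have : 0 < κ * |A p| := by positivity
  linarith

theorem VF.clean (hV : VF D f f' g g' τ V) (h : CP D f f' g g') (hg : ∀ p ∈ Icc (0:ℝ) 1, p ∈ D → Flat (fun x => g x - x) p)
    (k : ℕ) {ε : ℝ} (hε : 0 < ε) : ∃ ξ φ, Sm ξ ∧ Sup12 ξ ∧ Fl ξ φ ∧ ξ 0 = 0 ∧ ξ 1 = 0 ∧ (∀ p ∈ Icc (0:ℝ) 1, Flat ξ p ↔ p ∈ D) ∧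
      (∀ i ≤ k, ∀ x ∈ Icc (0:ℝ) 1, |iteratedDeriv i (φ 1) x - iteratedDeriv i f x| < ε ∧ |iteratedDeriv i (φ τ) x - iteratedDeriv i g x| < ε) := by
  obtain ⟨ξ, φ, hξ, hs, hφ, h0, h1, hcl, hD0, hD1, hn0, hn1⟩ := hV.approx h hg k (half_pos hε)
  set T := max 1 |τ| with hTd
  have hT1 : 1 ≤ T := le_max_left _ _
  have t1 : (1:ℝ) ∈ Icc (-T) T := ⟨by linarith, hT1⟩
  have t2 : τ ∈ Icc (-T) T := abs_le.1 (le_max_right _ _)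
  obtain ⟨ε', ε'0, hfc⟩ := flow_close hξ hs hφ k T (half_pos hε)
  obtain ⟨M, M0, hM⟩ := tht_bd (k+1)
  obtain ⟨s, s0, s1, hsard⟩ := sard hξ (s0 := ε' / M) (by positivity)
  have hη : Sm (fun x => ξ x + s * tht x) := hξ.add (contDiff_const.mul tht_sm)
  have hηs : Sup12 (fun x => ξ x + s * tht x) := fun x hx => by
    show ξ x + s * tht x = 0
    rw [hs x hx, tht_zero, mul_zero, add_zero]
    by_contra hc
    push Not at hc
    exact hx ⟨by linarith [hc.1], by linarith [hc.2]⟩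
  obtain ⟨ψ, hψ⟩ := Fl.exists hηs hη.one
  have hit : ∀ i x, iteratedDeriv i (fun x => ξ x + s * tht x) x = iteratedDeriv i ξ x + s * iteratedDeriv i tht x := by
    intro i x
    rw [iteratedDeriv_fun_add (hξ.contDiffAt.of_le (by exact_mod_cast le_top))
      ((contDiff_const.mul tht_sm).contDiffAt.of_le (by exact_mod_cast le_top)), iteratedDeriv_const_mul_field]
  have hc2 := hfc _ ψ hη hηs hψ (fun i hi x => by
    rw [hit, add_sub_cancel_left, abs_mul, abs_of_pos s0]
    calc s * |iteratedDeriv i tht x| ≤ ε' / M * M := mul_le_mul s1.le (hM i hi x) (abs_nonneg _) (by positivity)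
      _ = ε' := by field_simp)
  have hflat : ∀ p, (p ≤ 0 ∨ 1 ≤ p) → (Flat (fun x => ξ x + s * tht x) p ↔ Flat ξ p) := by
    intro p hp
    refine forall_congr' fun n => ?_
    rw [hit, tht_flat hp n, mul_zero, add_zero]
  have hz : ∀ p, (∀ᶠ x in 𝓝 p, ξ x = 0) → Flat ξ p := by
    intro p hp n
    have : ξ =ᶠ[𝓝 p] fun _ => 0 := hp
    rw [this.iteratedDeriv_eq, id_zero]
  refine ⟨_, ψ, hη, hηs, hψ, ?_, ?_, fun p hp => ?_, fun i hi x hx => ?_⟩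
  · simp [h0, tht_zero]
  · simp [h1, tht_zero]
  · rcases eq_or_lt_of_le hp.1 with e | l0
    · subst e
      rw [hflat 0 (Or.inl le_rfl)]
      by_cases hD : (0:ℝ) ∈ D
      · exact ⟨fun _ => hD, fun _ => hz 0 (hD0 hD)⟩
      · exact ⟨fun hf => absurd hf (hV.notflat h hp hD h.gf.zero hξ (hn0 hD)), fun h => absurd h hD⟩
    rcases eq_or_lt_of_le hp.2 with e | l1
    · subst e
      rw [hflat 1 (Or.inr le_rfl)]
      by_cases hD : (1:ℝ) ∈ D
      · exact ⟨fun _ => hD, fun _ => hz 1 (hD1 hD)⟩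
      · exact ⟨fun hf => absurd hf (hV.notflat h hp hD h.gf.one hξ (hn1 hD)), fun h => absurd h hD⟩
    · exact ⟨fun hf => absurd hf (hsard p ⟨l0, l1⟩), fun hD => absurd hD (h.not_D ⟨l0, l1⟩)⟩
  · have a := hcl i hi x hx
    have tri : ∀ {a b c : ℝ}, |a - b| < ε / 2 → |b - c| < ε / 2 → |a - c| < ε := by
      intro a b c h1 h2
      have := abs_sub_le a b c
      linarith
    exact ⟨tri (hc2 i hi 1 t1 x hx) a.1, tri (hc2 i hi τ t2 x hx) a.2⟩
end
end

section
open scoped ContDiff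

theorem tendsto_pairs {D : Set ℝ} {q : ℕ → PairStar D} {p : PairStar D}
    (h : ∀ n : ℕ, ∀ i ≤ n, ∀ x ∈ Icc (0:ℝ) 1,
      |iteratedDeriv i (q n).1.1 x - iteratedDeriv i p.1.1 x| < 1 / ((n:ℝ) + 1) ∧
      |iteratedDeriv i (q n).1.2 x - iteratedDeriv i p.1.2 x| < 1 / ((n:ℝ) + 1)) :
    Tendsto q atTop (𝓝 p) := by
  rw [nhds_induced, tendsto_comap_iff, tendsto_pi_nhds]
  intro b
  rw [tendsto_pi_nhds]
  intro k
  rw [Metric.tendsto_atTop]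
  intro ε hε
  obtain ⟨N, hN⟩ := exists_nat_one_div_lt hε
  refine ⟨max N k, fun n hn => ?_⟩
  have h1 : (N:ℝ) ≤ n := by exact_mod_cast (le_max_left _ _).trans hn
  have h2 : 1 / ((n:ℝ) + 1) < ε := lt_of_le_of_lt (one_div_le_one_div_of_le (by positivity) (by linarith)) hN
  rw [ContinuousMap.dist_lt_iff hε]
  intro x
  have h3 := h n k ((le_max_right _ _).trans hn) x x.2
  rw [Real.dist_eq]
  cases b
  · exact h3.2.trans h2
  · exact h3.1.trans h2

theorem exists_GDE_of {D : Set ℝ} {f : ℝ → ℝ} (hf : DiffStar D f) :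
    ∃ F G, GDE F G ∧ (∀ x ∈ Icc (0:ℝ) 1, f x = F x) ∧ DiffStar D F := by
  obtain ⟨F0, G0, h0, e0, -⟩ := exists_ext hf.1
  obtain ⟨F, G, h, e⟩ := h0.exists_GDE
  have e' : ∀ x ∈ Icc (0:ℝ) 1, f x = F x := fun x hx => by rw [e0 x hx, e x hx]
  exact ⟨F, G, h, e', hf.congr h.sm e'⟩

theorem mem_closure_clean {D : Set ℝ} (hD : D ⊆ ({0, 1} : Set ℝ)) (p : PairStar D) : p ∈ closure (CleanPairs D) := by
  obtain ⟨⟨f0, g0⟩, hf, hg, hc⟩ := p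
  have hf : DiffStar D f0 := hf
  have hg : DiffStar D g0 := hg
  have hc : ∀ x ∈ Icc (0:ℝ) 1, f0 (g0 x) = g0 (f0 x) := hc
  obtain ⟨F, F', hF, eF, dF⟩ := exists_GDE_of hf
  obtain ⟨G, G', hG, eG, dG⟩ := exists_GDE_of hg
  by_cases hid : ∀ x ∈ Icc (0:ℝ) 1, f0 x = x
  · apply subset_closure
    right
    refine ⟨G, G', dG, ⟨fun x _ => hG.left x, fun x _ => hG.right x⟩, 0, 1, fun x hx => ?_, fun x hx => ?_⟩
    · simpa [zpowIter] using hid x hx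
    · simpa [zpowIter] using eG x hx
  have flF : ∀ p ∈ Icc (0:ℝ) 1, Flat (fun x => F x - x) p ↔ p ∈ D := by
    intro p hp
    rcases dF.2 with h | h
    · exact absurd (fun x hx => by rw [eF x hx, h x hx]) hid
    · rw [← ITI_iff hF.sm]; exact h p hp
  have flG : ∀ p ∈ Icc (0:ℝ) 1, p ∈ D → Flat (fun x => G x - x) p := by
    intro p hp hpD
    rcases dG.2 with h | h
    · intro n
      rw [iteratedDeriv_eq_of_eqOn (f := fun x => G x - x) (g := fun _ => (0:ℝ)) (hG.sm.sub contDiff_id) contDiff_const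
        (fun x hx => by rw [h x hx, sub_self]) n hp, id_zero]
    · rw [← ITI_iff hG.sm]; exact (h p hp).2 hpD
  have cp : CP D F F' G G' := ⟨hD, hF, hG, fun x hx => by
    rw [← eG x hx, ← eF x hx, ← eF _ (hg.1.2.2.2.2 hx), ← eG _ (hf.1.2.2.2.2 hx)]; exact hc x hx, flF⟩
  obtain ⟨τ, hτ⟩ := cp.tau
  by_cases hi : Irrational τ
  swap
  · apply subset_closure
    right
    obtain ⟨k, kinv, dk, hk, q, q', e1, e2⟩ := cp.rational dF hτ hi
    exact ⟨k, kinv, dk, hk, q, q', fun x hx => (eF x hx).trans (e1 x hx), fun x hx => (eG x hx).trans (e2 x hx)⟩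
  obtain ⟨V, hV⟩ := cp.exists_V hi hτ
  have key := fun n : ℕ => hV.clean cp flG n (ε := 1 / ((n:ℝ) + 1)) (by positivity)
  choose ξ φ sm hs hfl h0 h1 hfD hcl using key
  let q : ℕ → PairStar D := fun n => ⟨(φ n 1, φ n τ), (hfl n).diffStar (hs n) (sm n) (h0 n) (h1 n) (hfD n) 1,
    (hfl n).diffStar (hs n) (sm n) (h0 n) (h1 n) (hfD n) τ, fun x _ => (hfl n).comm (hs n) (sm n) 1 τ x⟩
  refine mem_closure_of_tendsto (f := q) (b := atTop) (tendsto_pairs fun n i hi x hx => ?_) (Eventually.of_forall fun n => ?_)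
  · have a := hcl n i hi x hx
    have b1 := iteratedDeriv_eq_of_eqOn hf.1.1 hF.sm eF i hx
    have b2 := iteratedDeriv_eq_of_eqOn hg.1.1 hG.sm eG i hx
    rw [← b1, ← b2] at a
    exact a
  · left
    exact ⟨ξ n, φ n, sm n, (hfl n).isFlowOn (hs n) (sm n) (h0 n) (h1 n), 1, τ, fun _ _ => rfl, fun _ _ => rfl⟩
end

end Helpers

/-- For every `∂ ⊆ {0,1}`, the set `R^c_∂` of clean pairs is path-connected and dense in
the space `R*_∂` of pairs of commuting elements of `Diff*_∂[0,1]`, for the `C^∞` topology. -/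
theorem cleanPairs_pathConnected_and_dense (D : Set ℝ) (hD : D ⊆ ({0, 1} : Set ℝ)) :
    IsPathConnected (CleanPairs D) ∧ Dense (CleanPairs D) := by
  exact ⟨cleanPairs_pathConnected D, fun p => mem_closure_clean hD p⟩
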